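/- Fix 0 < ε < 1/2 and an integer m ≥ 1, and let P_ε be the set of primes p such that there exist integers a, b with p = a² + b² and |a| ≤ ε√p. Then there exists a constant B = B(ε, m) > 0 such that for infinitely many natural numbers n, the interval [n, n+B] contains at least m primes belonging to P_ε. -/

import Mathlib

/-- The set of primes `p = a² + b²` with `|a| ≤ ε√p`. -/
def Peps (ε : ℝ) : Set ℕ :=
  {p : ℕ | p.Prime ∧ ∃ a b : ℤ, (p : ℤ) = a ^ 2 + b ^ 2 ∧ |(a : ℝ)| ≤ ε * Real.sqrt p}

open ArithmeticFunction
open scoped ArithmeticFunction.zeta ArithmeticFunction.Moebius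

namespace SectorPrimes

noncomputable section

/-- Pointwise twist of an arithmetic function by a completely multiplicative function. -/
def tw (g : ℕ →*₀ ℂ) (a : ArithmeticFunction ℂ) : ArithmeticFunction ℂ :=
  ⟨fun n ↦ g n * a n, by simp⟩

lemma tw_apply (g : ℕ →*₀ ℂ) (a : ArithmeticFunction ℂ) (n : ℕ) : tw g a n = g n * a n := rfl

lemma tw_mul (g : ℕ →*₀ ℂ) (a b : ArithmeticFunction ℂ) : tw g (a * b) = tw g a * tw g b := by
  ext n
  simp only [tw_apply, mul_apply, Finset.mul_sum]
  refine Finset.sum_congr rfl fun p hp ↦ ?_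
  rw [← (Nat.mem_divisorsAntidiagonal.1 hp).1, map_mul]
  ring

lemma tw_add (g : ℕ →*₀ ℂ) (a b : ArithmeticFunction ℂ) : tw g (a + b) = tw g a + tw g b := by
  ext n
  simp only [tw_apply, ArithmeticFunction.add_apply]
  ring

lemma tw_one (g : ℕ →*₀ ℂ) : tw g 1 = 1 := by
  ext n
  by_cases h : n = 1
  · simp [tw_apply, h]
  · simp [tw_apply, h]

lemma tw_tw (g h : ℕ →*₀ ℂ) (a : ArithmeticFunction ℂ) : tw (h * g) a = tw h (tw g a) := by
  ext n
  simp only [tw_apply]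
  exact mul_assoc (h n) (g n) (a n)

/-- The von Mangoldt function with complex values. -/
def vm : ArithmeticFunction ℂ := ⟨fun n ↦ (Λ n : ℂ), by simp⟩

/-- Multiplication by the logarithm, a derivation of the Dirichlet convolution ring. -/
def lg (a : ArithmeticFunction ℂ) : ArithmeticFunction ℂ :=
  ⟨fun n ↦ (Real.log n : ℂ) * a n, by simp⟩

lemma lg_apply (a : ArithmeticFunction ℂ) (n : ℕ) : lg a n = (Real.log n : ℂ) * a n := rfl

lemma vm_apply (n : ℕ) : vm n = (Λ n : ℂ) := rfl

lemma lg_iterate_apply (j : ℕ) (a : ArithmeticFunction ℂ) (n : ℕ) :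
    (lg^[j] a) n = (Real.log n : ℂ) ^ j * a n := by
  induction j with
  | zero => simp
  | succ j ih => rw [Function.iterate_succ_apply', lg_apply, ih]; ring

lemma lg_iterate_mul (j : ℕ) (a b : ArithmeticFunction ℂ) :
    lg^[j] (a * b) = ∑ i ∈ Finset.range (j + 1), (j.choose i : ℂ) • (lg^[i] a * lg^[j - i] b) := by
  ext n
  have hs : (∑ i ∈ Finset.range (j + 1), (j.choose i : ℂ) • (lg^[i] a * lg^[j - i] b)) n
      = ∑ i ∈ Finset.range (j + 1), (j.choose i : ℂ) * (lg^[i] a * lg^[j - i] b) n := by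
    induction Finset.range (j + 1) using Finset.induction_on with
    | empty => simp
    | insert x s hx ih => simp [Finset.sum_insert hx, ih]
  rw [hs]
  simp only [lg_iterate_apply, mul_apply, Finset.mul_sum]
  rw [Finset.sum_comm]
  refine Finset.sum_congr rfl fun p hp ↦ ?_
  obtain ⟨h1, h2⟩ := Nat.mem_divisorsAntidiagonal.1 hp
  have h3 : p.1 ≠ 0 := by rintro h; simp [h] at h1; exact h2 h1.symm
  have h4 : p.2 ≠ 0 := by rintro h; simp [h] at h1; exact h2 h1.symm
  have h5 : (Real.log n : ℂ) = (Real.log p.1 : ℂ) + (Real.log p.2 : ℂ) := by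
    rw [← h1, Nat.cast_mul, Real.log_mul (by exact_mod_cast h3) (by exact_mod_cast h4)]
    push_cast; ring
  rw [h5, add_pow, Finset.sum_mul]
  refine Finset.sum_congr rfl fun i _ ↦ ?_
  ring

lemma lg_mul (a b : ArithmeticFunction ℂ) : lg (a * b) = lg a * b + a * lg b := by
  have := lg_iterate_mul 1 a b
  simp [Finset.sum_range_succ] at this
  rw [this, add_comm]

lemma zeta_mul_vm : (ζ : ArithmeticFunction ℂ) * vm = lg ζ := by
  ext n
  rw [coe_zeta_mul_apply, lg_apply]
  by_cases h : n = 0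
  · simp [h]
  · rw [natCoe_apply, zeta_apply_ne h, ← vonMangoldt_sum]
    push_cast
    simp [vm_apply]

lemma tw_lg (g : ℕ →*₀ ℂ) (a : ArithmeticFunction ℂ) : tw g (lg a) = lg (tw g a) := by
  ext n
  simp only [tw_apply, lg_apply]
  ring

/-- The Dirichlet convolution of two completely multiplicative functions. -/
def pf (g₁ g₂ : ℕ →*₀ ℂ) : ArithmeticFunction ℂ := tw g₁ ζ * tw g₂ ζ

/-- The convolution inverse of `pf`. -/
def pb (g₁ g₂ : ℕ →*₀ ℂ) : ArithmeticFunction ℂ := tw g₁ μ * tw g₂ μ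

/-- The von Mangoldt function attached to `pf`. -/
def pl (g₁ g₂ : ℕ →*₀ ℂ) : ArithmeticFunction ℂ := tw g₁ vm + tw g₂ vm

lemma pf_mul_pb (g₁ g₂ : ℕ →*₀ ℂ) : pf g₁ g₂ * pb g₁ g₂ = 1 := by
  have h (g : ℕ →*₀ ℂ) : tw g (ζ : ArithmeticFunction ℂ) * tw g (μ : ArithmeticFunction ℂ) = 1 := by
    rw [← tw_mul, coe_zeta_mul_coe_moebius, tw_one]
  rw [pf, pb, mul_mul_mul_comm, h, h, one_mul]

lemma lg_pf (g₁ g₂ : ℕ →*₀ ℂ) : lg (pf g₁ g₂) = pf g₁ g₂ * pl g₁ g₂ := by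
  have h (g : ℕ →*₀ ℂ) : lg (tw g (ζ : ArithmeticFunction ℂ)) = tw g ζ * tw g vm := by
    rw [← tw_lg, ← zeta_mul_vm, tw_mul]
  rw [pf, lg_mul, h, h, pl]
  ring

lemma pf_twist (χ g₁ g₂ : ℕ →*₀ ℂ) : pf (χ * g₁) (χ * g₂) = tw χ (pf g₁ g₂) := by
  rw [pf, pf, tw_tw, tw_tw, tw_mul]

lemma pl_twist (χ g₁ g₂ : ℕ →*₀ ℂ) : pl (χ * g₁) (χ * g₂) = tw χ (pl g₁ g₂) := by
  rw [pl, pl, tw_tw, tw_tw, tw_add]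

lemma pb_twist (χ g₁ g₂ : ℕ →*₀ ℂ) : pb (χ * g₁) (χ * g₂) = tw χ (pb g₁ g₂) := by
  rw [pb, pb, tw_tw, tw_tw, tw_mul]

lemma norm_conv_le {a b : ArithmeticFunction ℂ} {c d : ArithmeticFunction ℝ}
    (h : ∀ n, ‖a n‖ ≤ c n) (h' : ∀ n, ‖b n‖ ≤ d n) (n : ℕ) : ‖(a * b) n‖ ≤ (c * d) n := by
  rw [mul_apply, mul_apply]
  refine (norm_sum_le _ _).trans (Finset.sum_le_sum fun p _ ↦ ?_)
  rw [norm_mul]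
  exact mul_le_mul (h _) (h' _) (norm_nonneg _) ((norm_nonneg _).trans (h _))

variable {g₁ g₂ : ℕ →*₀ ℂ}

lemma norm_tw_zeta_le {g : ℕ →*₀ ℂ} (hg : ∀ n, ‖g n‖ ≤ 1) (n : ℕ) :
    ‖tw g (ζ : ArithmeticFunction ℂ) n‖ ≤ (ζ : ArithmeticFunction ℝ) n := by
  rw [tw_apply, norm_mul]
  by_cases h : n = 0
  · simp [h]
  · simpa [natCoe_apply, zeta_apply_ne h] using hg n

lemma norm_tw_moebius_le {g : ℕ →*₀ ℂ} (hg : ∀ n, ‖g n‖ ≤ 1) (n : ℕ) :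
    ‖tw g (μ : ArithmeticFunction ℂ) n‖ ≤ (ζ : ArithmeticFunction ℝ) n := by
  rw [tw_apply, norm_mul]
  by_cases h : n = 0
  · simp [h]
  · have h1 : ‖((μ n : ℤ) : ℂ)‖ ≤ 1 := by
      rw [Complex.norm_intCast]
      exact_mod_cast abs_moebius_le_one
    simpa [natCoe_apply, intCoe_apply, zeta_apply_ne h] using
      mul_le_one₀ (hg n) (norm_nonneg _) h1

lemma zeta_mul_zeta_apply (n : ℕ) :
    ((ζ : ArithmeticFunction ℝ) * (ζ : ArithmeticFunction ℝ)) n = n.divisors.card := by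
  rw [coe_zeta_mul_apply, Finset.card_eq_sum_ones, Nat.cast_sum]
  refine Finset.sum_congr rfl fun i hi ↦ ?_
  rw [natCoe_apply, zeta_apply_ne (Nat.pos_of_mem_divisors hi).ne']

lemma norm_pf_le (h₁ : ∀ n, ‖g₁ n‖ ≤ 1) (h₂ : ∀ n, ‖g₂ n‖ ≤ 1) (n : ℕ) :
    ‖pf g₁ g₂ n‖ ≤ n.divisors.card := by
  rw [← zeta_mul_zeta_apply]
  exact norm_conv_le (norm_tw_zeta_le h₁) (norm_tw_zeta_le h₂) n

lemma norm_pb_le (h₁ : ∀ n, ‖g₁ n‖ ≤ 1) (h₂ : ∀ n, ‖g₂ n‖ ≤ 1) (n : ℕ) :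
    ‖pb g₁ g₂ n‖ ≤ n.divisors.card := by
  rw [← zeta_mul_zeta_apply]
  exact norm_conv_le (norm_tw_moebius_le h₁) (norm_tw_moebius_le h₂) n

lemma norm_pl_le (h₁ : ∀ n, ‖g₁ n‖ ≤ 1) (h₂ : ∀ n, ‖g₂ n‖ ≤ 1) (n : ℕ) :
    ‖pl g₁ g₂ n‖ ≤ 2 * Λ n := by
  rw [pl, ArithmeticFunction.add_apply, tw_apply, tw_apply, vm_apply, two_mul]
  refine (norm_add_le _ _).trans ?_
  rw [norm_mul, norm_mul, Complex.norm_of_nonneg vonMangoldt_nonneg]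
  exact add_le_add (mul_le_of_le_one_left vonMangoldt_nonneg (h₁ n))
    (mul_le_of_le_one_left vonMangoldt_nonneg (h₂ n))

lemma sum_divisorsAntidiagonal_eq (Z : ℕ) {E : Type*} [AddCommMonoid E] (F : ℕ × ℕ → E) :
    ∑ n ∈ Finset.Icc 1 Z, ∑ p ∈ n.divisorsAntidiagonal, F p =
      ∑ p ∈ Finset.Icc 1 Z ×ˢ Finset.Icc 1 Z, if p.1 * p.2 ≤ Z then F p else 0 := by
  have h1 : ∀ n ∈ Finset.Icc 1 Z, ∑ p ∈ n.divisorsAntidiagonal, F p =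
      ∑ p ∈ Finset.Icc 1 Z ×ˢ Finset.Icc 1 Z, if p.1 * p.2 = n then F p else 0 := by
    intro n hn
    rw [← Finset.sum_filter]
    refine Finset.sum_congr ?_ fun _ _ ↦ rfl
    obtain ⟨hn1, hn2⟩ := Finset.mem_Icc.1 hn
    ext ⟨a, b⟩
    simp only [Nat.mem_divisorsAntidiagonal, Finset.mem_filter, Finset.mem_product, Finset.mem_Icc]
    constructor
    · rintro ⟨h, -⟩
      have ha : a ≠ 0 := by rintro rfl; simp at h; omega
      have hb : b ≠ 0 := by rintro rfl; simp at h; omega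
      have := Nat.le_mul_of_pos_right a (Nat.pos_of_ne_zero hb)
      have := Nat.le_mul_of_pos_left b (Nat.pos_of_ne_zero ha)
      omega
    · rintro ⟨-, h⟩
      exact ⟨h, by omega⟩
  rw [Finset.sum_congr rfl h1, Finset.sum_comm]
  refine Finset.sum_congr rfl fun p hp ↦ ?_
  simp only [Finset.mem_product, Finset.mem_Icc] at hp
  rw [Finset.sum_ite_eq]
  have : 1 ≤ p.1 * p.2 := Nat.mul_pos hp.1.1 hp.2.1
  simp [Finset.mem_Icc, this]

lemma sum_divisorsAntidiagonal_le (Z : ℕ) (F : ℕ × ℕ → ℝ) (hF : ∀ p, 0 ≤ F p) :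
    ∑ n ∈ Finset.Icc 1 Z, ∑ p ∈ n.divisorsAntidiagonal, F p ≤
      ∑ p ∈ Finset.Icc 1 Z ×ˢ Finset.Icc 1 Z, F p := by
  rw [sum_divisorsAntidiagonal_eq]
  refine Finset.sum_le_sum fun p _ ↦ ?_
  split_ifs
  exacts [le_rfl, hF p]

/-- `∑_{n ≤ Z} d(n)^j / n ≤ (1 + log Z)^(2^j)`. -/
lemma sum_divisors_pow_div_le (j Z : ℕ) :
    ∑ n ∈ Finset.Icc 1 Z, (n.divisors.card : ℝ) ^ j / n ≤ (1 + Real.log Z) ^ 2 ^ j := by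
  induction j with
  | zero =>
    simp only [pow_zero, pow_one, one_div]
    have := harmonic_le_one_add_log Z
    rw [harmonic_eq_sum_Icc] at this
    push_cast at this
    exact this
  | succ j ih =>
    have key : ∑ n ∈ Finset.Icc 1 Z, (n.divisors.card : ℝ) ^ (j + 1) / n
        ≤ (∑ n ∈ Finset.Icc 1 Z, (n.divisors.card : ℝ) ^ j / n) ^ 2 := by
      have h1 : ∀ n ∈ Finset.Icc 1 Z, (n.divisors.card : ℝ) ^ (j + 1) / n ≤
          ∑ p ∈ n.divisorsAntidiagonal,
            ((p.1.divisors.card : ℝ) ^ j / p.1) * ((p.2.divisors.card : ℝ) ^ j / p.2) := by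
        intro n hn
        have hn0 : n ≠ 0 := by have := (Finset.mem_Icc.1 hn).1; omega
        have h2 : ∀ p ∈ n.divisorsAntidiagonal, (n.divisors.card : ℝ) ^ j / n ≤
            ((p.1.divisors.card : ℝ) ^ j / p.1) * ((p.2.divisors.card : ℝ) ^ j / p.2) := by
          intro p hp
          have hp1 := (Nat.mem_divisorsAntidiagonal.1 hp).1
          have h3 : n.divisors.card ≤ p.1.divisors.card * p.2.divisors.card := by
            rw [← hp1, Nat.divisors_mul]
            exact Finset.card_mul_le
          rw [div_mul_div_comm, ← mul_pow, ← Nat.cast_mul, ← Nat.cast_mul, hp1]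
          gcongr
        calc (n.divisors.card : ℝ) ^ (j + 1) / n
            = ∑ p ∈ n.divisorsAntidiagonal, (n.divisors.card : ℝ) ^ j / n := by
              rw [Finset.sum_const, nsmul_eq_mul, ← Nat.map_div_right_divisors, Finset.card_map]
              ring
          _ ≤ _ := Finset.sum_le_sum h2
      refine (Finset.sum_le_sum h1).trans ?_
      rw [sq, Finset.sum_mul_sum, ← Finset.sum_product']
      exact sum_divisorsAntidiagonal_le Z (fun p ↦ ((p.1.divisors.card : ℝ) ^ j / p.1) *
        ((p.2.divisors.card : ℝ) ^ j / p.2)) fun p ↦ by positivity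
    calc _ ≤ _ := key
      _ ≤ ((1 + Real.log Z) ^ 2 ^ j) ^ 2 := by gcongr
      _ = _ := by rw [← pow_mul, pow_succ 2 j]

/-! ### Bounds for Dirichlet series from bounds for partial sums -/

lemma one_add_log_pow_le (j : ℕ) {u : ℝ} (hu : 1 ≤ u) :
    (1 + Real.log u) ^ j ≤ (8 ^ j * j.factorial * Real.exp 1) * u ^ (1 / 8 : ℝ) := by
  have hL : 0 ≤ Real.log u := Real.log_nonneg hu
  have h := Real.pow_div_factorial_le_exp (x := (1 + Real.log u) / 8) (by positivity) j
  rw [div_le_iff₀ (by positivity), div_pow, div_le_iff₀ (by positivity)] at h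
  refine h.trans ?_
  have h2 : Real.exp ((1 + Real.log u) / 8) ≤ Real.exp 1 * u ^ (1 / 8 : ℝ) := by
    rw [Real.rpow_def_of_pos (by linarith), ← Real.exp_add]
    refine Real.exp_le_exp.2 (by linarith)
  calc _ ≤ (Real.exp 1 * u ^ (1 / 8 : ℝ)) * j.factorial * 8 ^ j := by gcongr
    _ = _ := by ring

/-- The smooth weight `u ↦ (log u)^j u^{-s}`. -/
def lw (j : ℕ) (s : ℂ) (u : ℝ) : ℂ := (Real.log u : ℂ) ^ j * (u : ℂ) ^ (-s)

lemma norm_lw_le (j : ℕ) {s : ℂ} (hs : 1 < s.re) {u : ℝ} (hu : 1 ≤ u) :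
    ‖lw j s u‖ ≤ (1 + Real.log u) ^ j * u⁻¹ := by
  have hu0 : 0 < u := by linarith
  have hL : 0 ≤ Real.log u := Real.log_nonneg hu
  rw [lw, norm_mul, norm_pow, Complex.norm_cpow_eq_rpow_re_of_pos hu0, Complex.norm_of_nonneg hL]
  gcongr
  · linarith
  · rw [← Real.rpow_neg_one]
    exact Real.rpow_le_rpow_of_exponent_le hu (by simpa using hs.le)

lemma hasDerivAt_lw (j : ℕ) (s : ℂ) {u : ℝ} (hu : 1 ≤ u) :
    HasDerivAt (lw j s) ((j : ℂ) * (Real.log u : ℂ) ^ (j - 1) * (u : ℂ)⁻¹ * (u : ℂ) ^ (-s) +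
      (Real.log u : ℂ) ^ j * (-s * (u : ℂ) ^ (-s - 1))) u := by
  have hu0 : 0 < u := by linarith
  have h1 : HasDerivAt (fun u : ℝ ↦ ((Real.log u : ℝ) : ℂ)) ((u⁻¹ : ℝ) : ℂ) u :=
    (Real.hasDerivAt_log hu0.ne').ofReal_comp
  have h2 : HasDerivAt (fun u : ℝ ↦ (u : ℂ) ^ (-s)) (-s * (u : ℂ) ^ (-s - 1)) u := by
    have h3 := ((hasDerivAt_id (u : ℂ)).cpow_const (c := -s)
      (by left; simpa using hu0)).comp_ofReal
    simpa using h3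
  have := (h1.pow j).mul h2
  rw [Complex.ofReal_inv] at this
  exact this

lemma norm_deriv_lw_le (j : ℕ) {s : ℂ} (hs : 1 < s.re) {u : ℝ} (hu : 1 ≤ u) :
    ‖deriv (lw j s) u‖ ≤ (j + ‖s‖) * ((1 + Real.log u) ^ j * (u ^ 2)⁻¹) := by
  have hu0 : 0 < u := by linarith
  have hL : 0 ≤ Real.log u := Real.log_nonneg hu
  rw [(hasDerivAt_lw j s hu).deriv]
  have e1 : u ^ (-s.re) ≤ u⁻¹ := by
    rw [← Real.rpow_neg_one]
    exact Real.rpow_le_rpow_of_exponent_le hu (by simpa using hs.le)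
  have e2 : u ^ (-s.re - 1) ≤ (u ^ 2)⁻¹ := by
    rw [← Real.rpow_natCast, ← Real.rpow_neg hu0.le]
    exact Real.rpow_le_rpow_of_exponent_le hu (by push_cast; linarith)
  have e3 : Real.log u ^ (j - 1) ≤ (1 + Real.log u) ^ j := by
    calc Real.log u ^ (j - 1) ≤ (1 + Real.log u) ^ (j - 1) := by gcongr; linarith
      _ ≤ (1 + Real.log u) ^ j := pow_le_pow_right₀ (by linarith) (Nat.sub_le _ _)
  have e4 : Real.log u ^ j ≤ (1 + Real.log u) ^ j := by gcongr; linarith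
  refine (norm_add_le _ _).trans ?_
  rw [add_mul]
  refine add_le_add ?_ ?_
  · rw [norm_mul, norm_mul, norm_mul, norm_pow, norm_inv, Complex.norm_of_nonneg hL,
      Complex.norm_of_nonneg hu0.le, Complex.norm_cpow_eq_rpow_re_of_pos hu0, Complex.norm_natCast,
      Complex.neg_re]
    calc _ ≤ (j : ℝ) * (1 + Real.log u) ^ j * u⁻¹ * u⁻¹ := by gcongr
      _ = _ := by rw [sq, mul_inv]; ring
  · rw [norm_mul, norm_mul, norm_neg, norm_pow, Complex.norm_of_nonneg hL,
      Complex.norm_cpow_eq_rpow_re_of_pos hu0, Complex.sub_re, Complex.neg_re, Complex.one_re]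
    calc _ ≤ (1 + Real.log u) ^ j * (‖s‖ * (u ^ 2)⁻¹) := by gcongr
      _ = _ := by ring

lemma continuousOn_deriv_lw (j : ℕ) (s : ℂ) (a b : ℝ) (ha : 1 ≤ a) :
    ContinuousOn (deriv (lw j s)) (Set.Icc a b) := by
  have h : Set.EqOn (deriv (lw j s)) (fun u : ℝ ↦ (j : ℂ) * (Real.log u : ℂ) ^ (j - 1) *
      (u : ℂ)⁻¹ * (u : ℂ) ^ (-s) + (Real.log u : ℂ) ^ j * (-s * (u : ℂ) ^ (-s - 1)))
      (Set.Icc a b) := fun u hu ↦ (hasDerivAt_lw j s (ha.trans hu.1)).deriv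
  refine ContinuousOn.congr ?_ h
  have hc : ∀ z : ℂ, ContinuousOn (fun u : ℝ ↦ (u : ℂ) ^ z) (Set.Icc a b) := by
    intro z u hu
    have : (u : ℂ) ∈ Complex.slitPlane := by left; simpa using (by linarith [hu.1] : 0 < u)
    exact (ContinuousAt.cpow Complex.continuous_ofReal.continuousAt continuousAt_const this).continuousWithinAt
  have hl : ContinuousOn (fun u : ℝ ↦ ((Real.log u : ℝ) : ℂ)) (Set.Icc a b) :=
    Complex.continuous_ofReal.comp_continuousOn (Real.continuousOn_log.mono fun u hu ↦ by
      have : 0 < u := by linarith [hu.1]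
      simpa using this.ne')
  have hi : ContinuousOn (fun u : ℝ ↦ (u : ℂ)⁻¹) (Set.Icc a b) :=
    Complex.continuous_ofReal.continuousOn.inv₀ fun u hu ↦ by
      have : 0 < u := by linarith [hu.1]
      exact_mod_cast this.ne'
  have := hc (-s)
  have := hc (-s - 1)
  fun_prop

/-- Tail estimate via partial summation. -/
lemma norm_sum_Ioc_lw_le (j : ℕ) : ∃ C : ℝ, 0 < C ∧ ∀ (f : ℕ → ℂ) (K : ℝ) (s : ℂ) (a b : ℝ),
    0 ≤ K → (∀ N : ℕ, ‖∑ n ∈ Finset.Icc 0 N, f n‖ ≤ K * (N : ℝ) ^ (3 / 4 : ℝ)) →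
    1 < s.re → 1 ≤ a → a ≤ b →
    ‖∑ n ∈ Finset.Ioc ⌊a⌋₊ ⌊b⌋₊, lw j s n * f n‖ ≤
      C * K * (1 + ‖s‖) * a ^ (-(1 / 8) : ℝ) := by
  set D : ℝ := 8 ^ j * j.factorial * Real.exp 1 with hD
  have hD0 : 0 < D := by positivity
  refine ⟨D * (2 + 8 * (j + 1)), by positivity, fun f K s a b hK hA hs ha hab ↦ ?_⟩
  have hA' : ∀ t : ℝ, 1 ≤ t → ‖∑ n ∈ Finset.Icc 0 ⌊t⌋₊, f n‖ ≤ K * t ^ (3 / 4 : ℝ) := by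
    intro t ht
    refine (hA _).trans ?_
    gcongr
    exact Nat.floor_le (by linarith)
  have hb : 1 ≤ b := ha.trans hab
  have hint : MeasureTheory.IntegrableOn (deriv (lw j s)) (Set.Icc a b) :=
    (continuousOn_deriv_lw j s a b ha).integrableOn_Icc
  rw [sum_mul_eq_sub_sub_integral_mul f (by linarith) hab
    (fun t ht ↦ (hasDerivAt_lw j s (ha.trans ht.1)).differentiableAt) hint]
  have hpt : ∀ t : ℝ, a ≤ t → ‖lw j s t * ∑ n ∈ Finset.Icc 0 ⌊t⌋₊, f n‖ ≤
      D * K * a ^ (-(1 / 8) : ℝ) := by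
    intro t hat
    have ht : 1 ≤ t := ha.trans hat
    have ht0 : 0 < t := by linarith
    have hl : 0 ≤ Real.log t := Real.log_nonneg ht
    rw [norm_mul]
    calc _ ≤ ((1 + Real.log t) ^ j * t⁻¹) * (K * t ^ (3 / 4 : ℝ)) := by
          gcongr
          exacts [norm_lw_le j hs ht, hA' t ht]
      _ ≤ (D * t ^ (1 / 8 : ℝ) * t⁻¹) * (K * t ^ (3 / 4 : ℝ)) := by
          gcongr
          exact one_add_log_pow_le j ht
      _ = D * K * (t ^ (1 / 8 : ℝ) * t ^ (-1 : ℝ) * t ^ (3 / 4 : ℝ)) := by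
          rw [Real.rpow_neg_one]; ring
      _ = D * K * t ^ (-(1 / 8) : ℝ) := by
          rw [← Real.rpow_add ht0, ← Real.rpow_add ht0]; norm_num
      _ ≤ _ := by
          gcongr D * K * ?_
          exact Real.rpow_le_rpow_of_nonpos (by linarith) hat (by norm_num)
  have hI : ‖∫ t in Set.Ioc a b, deriv (lw j s) t * ∑ k ∈ Finset.Icc 0 ⌊t⌋₊, f k‖ ≤
      ∫ t in Set.Ioc a b, (D * K * (j + ‖s‖)) * t ^ (-(9 / 8) : ℝ) := by
    refine MeasureTheory.norm_integral_le_of_norm_le ?_ ?_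
    · refine (MeasureTheory.IntegrableOn.mono_set ?_ Set.Ioc_subset_Icc_self)
      refine ContinuousOn.integrableOn_Icc (ContinuousOn.mul continuousOn_const ?_)
      exact ContinuousOn.rpow_const continuousOn_id fun x hx ↦ by
        left; have : 0 < x := by linarith [hx.1]
        exact this.ne'
    · refine (MeasureTheory.ae_restrict_iff' measurableSet_Ioc).2 (Filter.Eventually.of_forall ?_)
      intro t htt
      have ht : 1 ≤ t := by linarith [htt.1]
      have ht0 : 0 < t := by linarith
      have hl : 0 ≤ Real.log t := Real.log_nonneg ht
      rw [norm_mul]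
      calc _ ≤ ((j + ‖s‖) * ((1 + Real.log t) ^ j * (t ^ 2)⁻¹)) * (K * t ^ (3 / 4 : ℝ)) := by
            gcongr
            exacts [norm_deriv_lw_le j hs ht, hA' t ht]
        _ ≤ ((j + ‖s‖) * (D * t ^ (1 / 8 : ℝ) * (t ^ 2)⁻¹)) * (K * t ^ (3 / 4 : ℝ)) := by
            gcongr
            exact one_add_log_pow_le j ht
        _ = (D * K * (j + ‖s‖)) * (t ^ (1 / 8 : ℝ) * t ^ (-2 : ℝ) * t ^ (3 / 4 : ℝ)) := by
            rw [Real.rpow_neg ht0.le, Real.rpow_two]; ring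
        _ = _ := by
            rw [← Real.rpow_add ht0, ← Real.rpow_add ht0]; norm_num
  have hI2 : ∫ t in Set.Ioc a b, (D * K * (j + ‖s‖)) * t ^ (-(9 / 8) : ℝ) ≤
      (D * K * (j + ‖s‖)) * (8 * a ^ (-(1 / 8) : ℝ)) := by
    rw [← intervalIntegral.integral_of_le hab, intervalIntegral.integral_const_mul,
      integral_rpow (by
        right; refine ⟨by norm_num, ?_⟩
        rw [Set.uIcc_of_le hab]; intro h; linarith [h.1])]
    gcongr
    have : 0 ≤ b ^ (-(1 / 8) : ℝ) := by positivity
    norm_num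
    norm_num at this
    linarith
  refine (norm_sub_le _ _).trans ((add_le_add (norm_sub_le _ _) (hI.trans hI2)).trans ?_)
  have h1 := hpt b hab
  have h2 := hpt a le_rfl
  have hp : 0 ≤ D * K * a ^ (-(1 / 8) : ℝ) := by positivity
  have hs0 : 0 ≤ ‖s‖ := norm_nonneg s
  have hj : (0 : ℝ) ≤ j := Nat.cast_nonneg j
  have h3 : D * K * (↑j + ‖s‖) * (8 * a ^ (-(1 / 8) : ℝ)) =
    (D * K * a ^ (-(1 / 8) : ℝ)) * (8 * (j + ‖s‖)) := by ring
  have h4 : D * (2 + 8 * (↑j + 1)) * K * (1 + ‖s‖) * a ^ (-(1 / 8) : ℝ) =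
    (D * K * a ^ (-(1 / 8) : ℝ)) * ((2 + 8 * (↑j + 1)) * (1 + ‖s‖)) := by ring
  rw [h3, h4]
  nlinarith [mul_nonneg hp hs0, mul_nonneg hp hj, mul_nonneg (mul_nonneg hp hj) hs0]

lemma abscissa_le_one {f : ArithmeticFunction ℂ} (hf : ∀ n, ‖f n‖ ≤ n.divisors.card) :
    LSeries.abscissaOfAbsConv (f ·) ≤ 1 := by
  refine LSeries.abscissaOfAbsConv_le_of_forall_lt_LSeriesSummable' (x := 1) fun y hy ↦ ?_
  have h1 : LSeriesSummable (((ζ : ArithmeticFunction ℂ) * ζ : ArithmeticFunction ℂ) ·) (y : ℂ) := by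
    have h2 : LSeriesSummable ((ζ : ArithmeticFunction ℂ) ·) (y : ℂ) := by
      have := (LSeriesSummable_zeta_iff (s := (y : ℂ))).2 (by simpa using (by exact_mod_cast hy : (1 : ℝ) < y))
      simpa [natCoe_apply] using this
    exact LSeriesSummable_mul h2 h2
  refine Summable.of_norm_bounded h1.norm fun n ↦ ?_
  refine LSeries.norm_term_le _ ?_
  refine (hf n).trans (le_of_eq ?_)
  rw [coe_zeta_mul_apply, Finset.sum_congr rfl (g := fun _ ↦ (1 : ℂ)) fun i hi ↦ by
    rw [natCoe_apply, zeta_apply_ne (Nat.pos_of_mem_divisors hi).ne', Nat.cast_one]]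
  simp

lemma lg_iterate_eq (j : ℕ) (f : ArithmeticFunction ℂ) :
    ((lg^[j] f : ArithmeticFunction ℂ) : ℕ → ℂ) = LSeries.logMul^[j] (f ·) := by
  induction j with
  | zero => rfl
  | succ j ih =>
    rw [Function.iterate_succ_apply', Function.iterate_succ_apply', ← ih]
    ext n
    simp [lg_apply, LSeries.logMul]

lemma LSeriesSummable_lg {f : ArithmeticFunction ℂ} (hf : ∀ n, ‖f n‖ ≤ n.divisors.card) (j : ℕ)
    {s : ℂ} (hs : 1 < s.re) : LSeriesSummable ((lg^[j] f : ArithmeticFunction ℂ) ·) s := by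
  refine LSeriesSummable_of_abscissaOfAbsConv_lt_re ?_
  have : (fun n ↦ (lg^[j] f : ArithmeticFunction ℂ) n) = LSeries.logMul^[j] (f ·) :=
    lg_iterate_eq j f
  rw [this, LSeries.absicssaOfAbsConv_logPowMul]
  exact (abscissa_le_one hf).trans_lt (by exact_mod_cast hs)

lemma term_lg (f : ArithmeticFunction ℂ) (j : ℕ) (s : ℂ) (n : ℕ) :
    LSeries.term ((lg^[j] f : ArithmeticFunction ℂ) ·) s n = lw j s n * f n := by
  rcases eq_or_ne n 0 with rfl | hn
  · simp
  · rw [LSeries.term_of_ne_zero hn, lg_iterate_apply, lw, Complex.cpow_neg]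
    push_cast
    field_simp

/-- The quantity controlling all logarithmic losses. -/
def cL (K : ℝ) (s : ℂ) : ℝ := Real.log (K * (‖s‖ + 2))

lemma half_le_cL {K : ℝ} (hK : 1 ≤ K) (s : ℂ) : 1 / 2 ≤ cL K s := by
  have h : (2 : ℝ) ≤ K * (‖s‖ + 2) := by nlinarith [norm_nonneg s]
  have := Real.log_le_log (by norm_num) h
  have := Real.log_two_gt_d9
  rw [cL]
  linarith

lemma norm_sum_head_le (j : ℕ) {f : ArithmeticFunction ℂ} (hf : ∀ n, ‖f n‖ ≤ n.divisors.card)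
    {s : ℂ} (hs : 1 < s.re) (Y : ℕ) :
    ‖∑ n ∈ Finset.Icc 1 Y, lw j s n * f n‖ ≤ (1 + Real.log Y) ^ (j + 2) := by
  have hL : 0 ≤ Real.log Y := Real.log_natCast_nonneg Y
  calc _ ≤ ∑ n ∈ Finset.Icc 1 Y, (1 + Real.log Y) ^ j * ((n.divisors.card : ℝ) ^ 1 / n) := by
        refine (norm_sum_le _ _).trans (Finset.sum_le_sum fun n hn ↦ ?_)
        obtain ⟨h1, h2⟩ := Finset.mem_Icc.1 hn
        have h1' : (1 : ℝ) ≤ n := by exact_mod_cast h1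
        have hl : 0 ≤ Real.log n := Real.log_natCast_nonneg n
        rw [norm_mul]
        calc _ ≤ ((1 + Real.log n) ^ j * (n : ℝ)⁻¹) * n.divisors.card := by
              gcongr
              exacts [norm_lw_le j hs h1', hf n]
          _ ≤ ((1 + Real.log Y) ^ j * (n : ℝ)⁻¹) * n.divisors.card := by gcongr
          _ = _ := by rw [pow_one]; ring
    _ ≤ (1 + Real.log Y) ^ j * (1 + Real.log Y) ^ 2 := by
        rw [← Finset.mul_sum]
        gcongr
        simpa using sum_divisors_pow_div_le 1 Y
    _ = _ := by rw [← pow_add]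

lemma sum_range_eq_head_add_tail {F : ℕ → ℂ} (h0 : F 0 = 0) {Y N : ℕ} (h : Y ≤ N) :
    ∑ n ∈ Finset.range (N + 1), F n =
      ∑ n ∈ Finset.Icc 1 Y, F n + ∑ n ∈ Finset.Ioc Y N, F n := by
  have e1 : Finset.Icc 1 Y = Finset.Ico 1 (Y + 1) := by ext; simp
  have e2 : Finset.Ioc Y N = Finset.Ico (Y + 1) (N + 1) := by ext; simp
  rw [Finset.range_eq_Ico, Finset.sum_eq_sum_Ico_succ_bot (Nat.succ_pos N), h0, zero_add, e1, e2,
    Finset.sum_Ico_consecutive _ (by omega) (by omega)]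

theorem norm_LSeries_lg_le (j : ℕ) : ∃ C : ℝ, 0 < C ∧
    ∀ (f : ArithmeticFunction ℂ) (K : ℝ) (s : ℂ), 1 ≤ K → (∀ n, ‖f n‖ ≤ n.divisors.card) →
    (∀ N : ℕ, ‖∑ n ∈ Finset.Icc 0 N, f n‖ ≤ K * (N : ℝ) ^ (3 / 4 : ℝ)) → 1 < s.re →
    ‖LSeries ((lg^[j] f : ArithmeticFunction ℂ) ·) s‖ ≤ C * cL K s ^ (j + 2) := by
  obtain ⟨C₁, hC₁, hT⟩ := norm_sum_Ioc_lw_le j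
  refine ⟨10 ^ (j + 2) + 2 ^ (j + 2) * C₁, by positivity, fun f K s hK hf hA hs ↦ ?_⟩
  have hs0 := norm_nonneg s
  set X : ℝ := K * (‖s‖ + 2) with hX
  have hX2 : 2 ≤ X := by nlinarith
  set Y : ℕ := ⌊X ^ 8⌋₊ with hYdef
  have hX8 : (1 : ℝ) ≤ X ^ 8 := one_le_pow₀ (by linarith)
  have hY : 1 ≤ Y := Nat.one_le_floor_iff _ |>.2 hX8
  have hcL : cL K s = Real.log X := rfl
  have hlogY : Real.log Y ≤ 8 * cL K s := by
    have h1 : (Y : ℝ) ≤ X ^ 8 := Nat.floor_le (by positivity)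
    have := Real.log_le_log (by exact_mod_cast hY) h1
    rwa [Real.log_pow] at this
  have hh := half_le_cL hK s
  have hbound : ∀ N : ℕ, Y ≤ N → ‖∑ n ∈ Finset.range (N + 1),
      LSeries.term ((lg^[j] f : ArithmeticFunction ℂ) ·) s n‖ ≤
      (10 ^ (j + 2) + 2 ^ (j + 2) * C₁) * cL K s ^ (j + 2) := by
    intro N hN
    simp only [term_lg]
    rw [sum_range_eq_head_add_tail (by simp) hN]
    refine (norm_add_le _ _).trans ?_
    rw [add_mul]
    refine add_le_add ?_ ?_
    · refine (norm_sum_head_le j hf hs Y).trans ?_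
      rw [← mul_pow]
      have : 0 ≤ Real.log Y := Real.log_natCast_nonneg Y
      gcongr
      linarith
    · have hmax : X ^ 8 ≤ max (X ^ 8) N := le_max_left _ _
      have ht := hT f K s (X ^ 8) (max (X ^ 8) N) (by linarith) hA hs hX8 hmax
      have hfl : ⌊max (X ^ 8) (N : ℝ)⌋₊ = N := by
        rcases le_total (X ^ 8) (N : ℝ) with h | h
        · rw [max_eq_right h, Nat.floor_natCast]
        · rw [max_eq_left h]
          refine le_antisymm hN ?_
          exact Nat.le_floor h
      rw [hfl] at ht
      refine ht.trans ?_
      have e : (X ^ 8) ^ (-(1 / 8) : ℝ) = X⁻¹ := by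
        rw [← Real.rpow_natCast, ← Real.rpow_mul (by linarith), ← Real.rpow_neg_one]
        norm_num
      rw [e]
      have h1 : K * (1 + ‖s‖) * X⁻¹ ≤ 1 := by
        rw [← div_eq_mul_inv, div_le_one (by linarith)]
        nlinarith
      have h2 : (1 : ℝ) ≤ 2 ^ (j + 2) * cL K s ^ (j + 2) := by
        rw [← mul_pow]
        exact one_le_pow₀ (by linarith)
      calc _ = C₁ * (K * (1 + ‖s‖) * X⁻¹) := by ring
        _ ≤ C₁ * (2 ^ (j + 2) * cL K s ^ (j + 2)) := by gcongr C₁ * ?_; linarith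
        _ = _ := by ring
  have hsum := (LSeriesSummable_lg hf j hs).LSeriesHasSum.tendsto_sum_nat
  refine le_of_tendsto ((hsum.comp (Filter.tendsto_add_atTop_nat 1)).norm) ?_
  filter_upwards [Filter.eventually_ge_atTop Y] with N hN using hbound N hN

lemma one_le_cL {K : ℝ} (hK : 1 ≤ K) {s : ℂ} (hs : 1 < s.re) : 1 ≤ cL K s := by
  have h1 : 1 < ‖s‖ := hs.trans_le (Complex.re_le_norm s)
  have h : Real.exp 1 ≤ K * (‖s‖ + 2) := by nlinarith [Real.exp_one_lt_d9]
  have := Real.log_le_log (Real.exp_pos 1) h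
  rwa [Real.log_exp] at this

lemma LSeriesSummable_lg_pl {g₁ g₂ : ℕ →*₀ ℂ} (h₁ : ∀ n, ‖g₁ n‖ ≤ 1) (h₂ : ∀ n, ‖g₂ n‖ ≤ 1)
    (j : ℕ) {s : ℂ} (hs : 1 < s.re) :
    LSeriesSummable ((lg^[j] (pl g₁ g₂) : ArithmeticFunction ℂ) ·) s := by
  refine LSeriesSummable_of_abscissaOfAbsConv_lt_re ?_
  have : (fun n ↦ (lg^[j] (pl g₁ g₂) : ArithmeticFunction ℂ) n) = LSeries.logMul^[j] (pl g₁ g₂ ·) :=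
    lg_iterate_eq j _
  rw [this, LSeries.absicssaOfAbsConv_logPowMul]
  have h : LSeries.abscissaOfAbsConv (pl g₁ g₂ ·) ≤ 1 := by
    refine LSeries.abscissaOfAbsConv_le_of_forall_lt_LSeriesSummable' (x := 1) fun y hy ↦ ?_
    have h1 : LSeriesSummable (fun n ↦ (Λ n : ℂ)) (y : ℂ) :=
      LSeriesSummable_vonMangoldt (by simpa using (by exact_mod_cast hy : (1 : ℝ) < y))
    refine Summable.of_norm_bounded (h1.smul 2).norm fun n ↦ ?_
    refine LSeries.norm_term_le _ ?_
    refine (norm_pl_le h₁ h₂ n).trans (le_of_eq ?_)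
    simp [abs_of_nonneg (vonMangoldt_nonneg (n := n))]
  exact h.trans_lt (by exact_mod_cast hs)

lemma LSeries_sum_smul {f : ℕ → ArithmeticFunction ℂ} {c : ℕ → ℂ} {s : ℂ} (S : Finset ℕ)
    (hf : ∀ i ∈ S, LSeriesSummable (f i ·) s) :
    LSeries ((∑ i ∈ S, c i • f i : ArithmeticFunction ℂ) ·) s =
      ∑ i ∈ S, c i * LSeries (f i ·) s := by
  have h1 : (fun n ↦ (∑ i ∈ S, c i • f i : ArithmeticFunction ℂ) n) =
      ∑ i ∈ S, c i • (fun n ↦ f i n) := by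
    ext n
    clear hf
    induction S using Finset.induction_on with
    | empty => simp
    | insert x S hx ih =>
      rw [Finset.sum_insert hx, Finset.sum_insert hx, ArithmeticFunction.add_apply, ih]
      simp
  rw [h1, LSeries_sum fun i hi ↦ (hf i hi).smul _]
  simp [LSeries_smul]

lemma LSeries_lg_succ_pf {g₁ g₂ : ℕ →*₀ ℂ} (h₁ : ∀ n, ‖g₁ n‖ ≤ 1) (h₂ : ∀ n, ‖g₂ n‖ ≤ 1)
    (j : ℕ) {s : ℂ} (hs : 1 < s.re) :
    LSeries ((lg^[j + 1] (pf g₁ g₂) : ArithmeticFunction ℂ) ·) s =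
      ∑ i ∈ Finset.range (j + 1), (j.choose i : ℂ) *
        (LSeries ((lg^[i] (pf g₁ g₂) : ArithmeticFunction ℂ) ·) s *
          LSeries ((lg^[j - i] (pl g₁ g₂) : ArithmeticFunction ℂ) ·) s) := by
  have hf := norm_pf_le h₁ h₂
  rw [Function.iterate_succ_apply, lg_pf, lg_iterate_mul, LSeries_sum_smul]
  · refine Finset.sum_congr rfl fun i _ ↦ ?_
    rw [LSeries_mul' (LSeriesSummable_lg hf i hs) (LSeriesSummable_lg_pl h₁ h₂ _ hs)]
  · exact fun i _ ↦ LSeriesSummable_mul (LSeriesSummable_lg hf i hs)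
      (LSeriesSummable_lg_pl h₁ h₂ _ hs)

/-- Logarithmic bounds for the derivatives of the logarithmic derivative, given a lower bound for
the Dirichlet series. -/
theorem norm_LSeries_lg_pl_le (B : ℕ) {c : ℝ} (hc : 0 < c) (J : ℕ) : ∃ C : ℝ, 0 < C ∧ ∃ N : ℕ,
    ∀ (g₁ g₂ : ℕ →*₀ ℂ) (K : ℝ) (s : ℂ), (∀ n, ‖g₁ n‖ ≤ 1) → (∀ n, ‖g₂ n‖ ≤ 1) → 1 ≤ K →
    (∀ N : ℕ, ‖∑ n ∈ Finset.Icc 0 N, pf g₁ g₂ n‖ ≤ K * (N : ℝ) ^ (3 / 4 : ℝ)) → 1 < s.re →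
    c ≤ ‖LSeries (pf g₁ g₂ ·) s‖ * cL K s ^ B →
    ‖LSeries ((lg^[J] (pl g₁ g₂) : ArithmeticFunction ℂ) ·) s‖ ≤ C * cL K s ^ N := by
  induction J using Nat.strong_induction_on with
  | _ J ih =>
  choose! C hC N hN using ih
  choose D hD hD' using norm_LSeries_lg_le
  set S : ℝ := D (J + 1) + ∑ i ∈ Finset.range J, (J.choose (i + 1) : ℝ) * (D (i + 1) * C (J - (i + 1)))
    with hS
  set M : ℕ := (J + 3) + ∑ i ∈ Finset.range J, (i + 3 + N (J - (i + 1))) with hM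
  have hS0 : 0 < S := by
    refine add_pos_of_pos_of_nonneg (hD _) (Finset.sum_nonneg fun i hi ↦ ?_)
    have := hC (J - (i + 1)) (by have := Finset.mem_range.1 hi; omega)
    have := hD (i + 1)
    positivity
  refine ⟨S / c, by positivity, M + B, fun g₁ g₂ K s h₁ h₂ hK hA hs hlow ↦ ?_⟩
  have hl := one_le_cL hK hs
  have hf := norm_pf_le h₁ h₂
  have key := LSeries_lg_succ_pf h₁ h₂ J hs
  rw [Finset.sum_range_succ'] at key
  simp only [Nat.choose_zero_right, Nat.cast_one, one_mul, Nat.sub_zero, Function.iterate_zero,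
    id_eq] at key
  set P := LSeries ((lg^[J] (pl g₁ g₂) : ArithmeticFunction ℂ) ·) s with hP
  have hPL : LSeries (pf g₁ g₂ ·) s * P = LSeries ((lg^[J + 1] (pf g₁ g₂) : ArithmeticFunction ℂ) ·) s
      - ∑ k ∈ Finset.range J, (J.choose (k + 1) : ℂ) *
        (LSeries ((lg^[k + 1] (pf g₁ g₂) : ArithmeticFunction ℂ) ·) s *
          LSeries ((lg^[J - (k + 1)] (pl g₁ g₂) : ArithmeticFunction ℂ) ·) s) := by
    rw [key]; ring
  have hb : ‖LSeries (pf g₁ g₂ ·) s * P‖ ≤ S * cL K s ^ M := by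
    rw [hPL, hS, add_mul, Finset.sum_mul]
    refine (norm_sub_le _ _).trans (add_le_add ?_ ((norm_sum_le _ _).trans
      (Finset.sum_le_sum fun i hi ↦ ?_)))
    · refine (hD' (J + 1) _ K s hK hf hA hs).trans ?_
      have := hD (J + 1)
      gcongr
      omega
    · have hi' : J - (i + 1) < J := by have := Finset.mem_range.1 hi; omega
      rw [norm_mul, norm_mul, Complex.norm_natCast, mul_assoc]
      have e1 := hD' (i + 1) _ K s hK hf hA hs
      have e2 := hN (J - (i + 1)) hi' g₁ g₂ K s h₁ h₂ hK hA hs hlow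
      have e3 : (i + 1 + 2) + N (J - (i + 1)) ≤ M := by
        have := Finset.single_le_sum (f := fun i ↦ i + 3 + N (J - (i + 1)))
          (fun i _ ↦ Nat.zero_le _) hi
        omega
      have e4 := hD (i + 1)
      have e5 := hC (J - (i + 1)) hi'
      have e6 : 0 ≤ cL K s := by linarith
      calc _ ≤ (J.choose (i + 1) : ℝ) * ((D (i + 1) * cL K s ^ (i + 1 + 2)) *
            (C (J - (i + 1)) * cL K s ^ N (J - (i + 1)))) := by gcongr
        _ = (J.choose (i + 1) : ℝ) * (D (i + 1) * C (J - (i + 1)) *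
            cL K s ^ (i + 1 + 2 + N (J - (i + 1)))) := by rw [pow_add]; ring
        _ ≤ _ := by gcongr
  rw [norm_mul] at hb
  have e6 : 0 < cL K s := by linarith
  rw [div_mul_eq_mul_div, le_div_iff₀ hc]
  calc ‖P‖ * c ≤ ‖P‖ * (‖LSeries (pf g₁ g₂ ·) s‖ * cL K s ^ B) := by gcongr
    _ = (‖LSeries (pf g₁ g₂ ·) s‖ * ‖P‖) * cL K s ^ B := by ring
    _ ≤ (S * cL K s ^ M) * cL K s ^ B := by gcongr
    _ = _ := by rw [pow_add]; ring

lemma hasProd_LSeries {g : ℕ →*₀ ℂ} (hg : ∀ n, ‖g n‖ ≤ 1) {s : ℂ} (hs : 1 < s.re) :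
    HasProd (fun p : Nat.Primes ↦ (1 - g p * (p : ℂ) ^ (-s))⁻¹) (LSeries (g ·) s) := by
  have hs0 := Complex.ne_zero_of_one_lt_re hs
  have hsum : Summable (‖(g * riemannZetaSummandHom hs0) ·‖) := by
    refine Summable.of_nonneg_of_le (fun _ ↦ norm_nonneg _) (fun n ↦ ?_)
      (summable_riemannZetaSummand hs)
    change ‖g n * riemannZetaSummandHom hs0 n‖ ≤ _
    rw [norm_mul]
    exact mul_le_of_le_one_left (norm_nonneg _) (hg n)
  have h := EulerProduct.eulerProduct_completely_multiplicative_hasProd hsum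
  suffices h2 : LSeries (g ·) s = ∑' n, (g * riemannZetaSummandHom hs0) n by
    rw [h2]; exact h
  change ∑' n, LSeries.term (g ·) s n = _
  congr 1
  ext n
  change LSeries.term (g ·) s n = g n * (n : ℂ) ^ (-s)
  rcases eq_or_ne n 0 with rfl | hn
  · simp
  · rw [LSeries.term_of_ne_zero hn, Complex.cpow_neg, div_eq_mul_inv]

/-- A product of Euler products is at least one in absolute value if the inverse local factors are
at most one. -/
lemma one_le_prod_norm_LSeries {ι : Type} [Fintype ι] (g : ι → ℕ →*₀ ℂ) (s : ι → ℂ) (k : ι → ℕ)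
    (hg : ∀ i n, ‖g i n‖ ≤ 1) (hs : ∀ i, 1 < (s i).re)
    (h : ∀ p : ℕ, p.Prime → ∏ i, ‖1 - g i p * (p : ℂ) ^ (-s i)‖ ^ k i ≤ 1) :
    1 ≤ ∏ i, ‖LSeries (g i ·) (s i)‖ ^ k i := by
  have h1 (i : ι) : HasProd (fun p : Nat.Primes ↦ ‖(1 - g i p * (p : ℂ) ^ (-s i))⁻¹‖ ^ k i)
      (‖LSeries (g i ·) (s i)‖ ^ k i) :=
    (hasProd_LSeries (hg i) (hs i)).norm.map (powMonoidHom (k i)) (continuous_pow _)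
  have h2 := hasProd_prod (s := Finset.univ) fun i _ ↦ h1 i
  refine ge_of_tendsto' h2 fun S ↦ ?_
  refine Finset.one_le_prod fun p _ ↦ ?_
  simp only [norm_inv, inv_pow, Finset.prod_inv_distrib]
  refine (one_le_inv₀ ?_).2 (h p p.2)
  refine Finset.prod_pos fun i _ ↦ pow_pos (norm_pos_iff.2 (sub_ne_zero.2 fun h0 ↦ ?_)) _
  have h2 : ‖g i p * (p : ℂ) ^ (-s i)‖ < 1 := by
    rw [norm_mul]
    refine (mul_le_of_le_one_left (norm_nonneg _) (hg i _)).trans_lt ?_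
    rw [Complex.norm_natCast_cpow_of_pos p.2.pos]
    exact Real.rpow_lt_one_of_one_lt_of_neg (by exact_mod_cast p.2.one_lt)
      (by have := hs i; simp; linarith)
  rw [← h0] at h2
  simp at h2

/-- The local `3`-`4`-`1` inequality. -/
lemma local_three_four_one {a : ℝ} (ha₀ : 0 ≤ a) (ha₁ : a < 1) {z : ℂ} (hz : ‖z‖ = 1) :
    (1 - a) ^ 3 * ‖1 - a * z‖ ^ 4 * ‖1 - a * z ^ 2‖ ≤ 1 := by
  have hac₀ : ‖(a : ℂ)‖ < 1 := by
    simp only [Complex.norm_of_nonneg ha₀, ha₁]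
  have hac₁ : ‖a * z‖ < 1 := by rwa [norm_mul, hz, mul_one]
  have hac₂ : ‖a * z ^ 2‖ < 1 := by rwa [norm_mul, norm_pow, hz, one_pow, mul_one]
  have key : 0 ≤ 3 * (-Complex.log (1 - a)).re + 4 * (-Complex.log (1 - a * z)).re +
      (-Complex.log (1 - a * z ^ 2)).re := by
    rw [← ((Complex.hasSum_re <| Complex.hasSum_taylorSeries_neg_log hac₀).mul_left 3).add
      ((Complex.hasSum_re <| Complex.hasSum_taylorSeries_neg_log hac₁).mul_left 4) |>.add
      (Complex.hasSum_re <| Complex.hasSum_taylorSeries_neg_log hac₂) |>.tsum_eq]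
    refine tsum_nonneg fun n ↦ ?_
    simp only [← Complex.ofReal_pow, Complex.div_natCast_re, Complex.ofReal_re, mul_pow,
      Complex.mul_re, Complex.ofReal_im, zero_mul, sub_zero]
    rcases n.eq_zero_or_pos with rfl | hn
    · simp
    · simp only [← mul_div_assoc, ← add_div]
      refine div_nonneg ?_ n.cast_nonneg
      rw [← pow_mul, pow_mul', sq, Complex.mul_re, ← sq, ← sq, ← Complex.sq_norm_sub_sq_re,
        norm_pow, hz]
      convert! (show 0 ≤ 2 * a ^ n * ((z ^ n).re + 1) ^ 2 by positivity) using 1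
      ring
  have hpos (w : ℂ) (hw : ‖w‖ < 1) : 0 < ‖1 - w‖ := by
    refine norm_pos_iff.2 (sub_ne_zero.2 fun h ↦ ?_)
    rw [← h] at hw
    simp at hw
  have e : (1 - a) = ‖1 - (a : ℂ)‖ := by
    rw [← Complex.ofReal_one, ← Complex.ofReal_sub, Complex.norm_of_nonneg (by linarith)]
  have p0 := hpos _ hac₀
  have p1 := hpos _ hac₁
  have p2 := hpos _ hac₂
  rw [e, ← Real.log_nonpos_iff (by positivity), Real.log_mul (by positivity) p2.ne',
    Real.log_mul (by positivity) (by positivity), Real.log_pow, Real.log_pow]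
  simp only [Complex.neg_re, Complex.log_re] at key
  push_cast
  linarith

/-- From a `3`-`4`-`1` inequality and a Lipschitz bound to a lower bound. -/
lemma lower_of_three_four_one {f : ℝ → ℂ} {l c C : ℝ} {a : ℕ} (hl : 1 ≤ l) (hc : 0 < c)
    (hC : 0 < C)
    (hlow : ∀ σ : ℝ, 1 < σ → σ ≤ 2 → c ^ 4 * (σ - 1) ^ 3 ≤ ‖f σ‖ ^ 4 * (l ^ a) ^ 4)
    (hlip : ∀ σ σ' : ℝ, 1 < σ → σ ≤ 2 → 1 < σ' → σ' ≤ 2 → ‖f σ - f σ'‖ ≤ C * l ^ 3 * |σ - σ'|)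
    {σ : ℝ} (h1 : 1 < σ) (h2 : σ ≤ 2) :
    c / 2 * (min 1 (c / (2 * C))) ^ 3 ≤ ‖f σ‖ * l ^ (4 * a + 9) := by
  set d := min 1 (c / (2 * C)) with hd
  have hd0 : 0 < d := by positivity
  have hd1 : d ≤ 1 := min_le_left _ _
  have hd2 : d * (2 * C) ≤ c := by
    have := min_le_right 1 (c / (2 * C))
    rwa [← hd, le_div_iff₀ (by positivity)] at this
  have hl0 : 0 < l := by linarith
  set δ := d / l ^ (a + 3) with hδ
  have hδ0 : 0 < δ := by positivity
  have hδl : δ * l ^ (a + 3) = d := by rw [hδ]; field_simp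
  have hδ1 : δ ≤ 1 := by
    rw [hδ, div_le_one (by positivity)]
    exact hd1.trans (one_le_pow₀ hl)
  have main (τ : ℝ) (t1 : 1 < τ) (t2 : τ ≤ 2) (t3 : δ ^ 4 ≤ τ - 1) : c * δ ^ 3 ≤ ‖f τ‖ * l ^ a := by
    refine le_of_pow_le_pow_left₀ (n := 4) (by norm_num) (by positivity) ?_
    calc (c * δ ^ 3) ^ 4 = c ^ 4 * (δ ^ 4) ^ 3 := by ring
      _ ≤ c ^ 4 * (τ - 1) ^ 3 := by gcongr
      _ ≤ ‖f τ‖ ^ 4 * (l ^ a) ^ 4 := hlow τ t1 t2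
      _ = _ := by ring
  have fin : c / 2 * δ ^ 3 ≤ ‖f σ‖ * l ^ a := by
    rcases le_or_gt (δ ^ 4) (σ - 1) with h | h
    · refine le_trans ?_ (main σ h1 h2 h)
      gcongr
      linarith
    · have hδ4 : δ ^ 4 ≤ 1 := pow_le_one₀ hδ0.le hδ1
      have hδ4' : 0 < δ ^ 4 := by positivity
      have e1 := main (1 + δ ^ 4) (by linarith) (by linarith) (by linarith)
      have e2 := hlip (1 + δ ^ 4) σ (by linarith) (by linarith) h1 h2
      have e3 : ‖f (1 + δ ^ 4)‖ ≤ ‖f σ‖ + C * l ^ 3 * δ ^ 4 := by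
        have := norm_sub_norm_le (f (1 + δ ^ 4)) (f σ)
        have h4 : |1 + δ ^ 4 - σ| ≤ δ ^ 4 := by rw [abs_le]; constructor <;> linarith
        have : C * l ^ 3 * |1 + δ ^ 4 - σ| ≤ C * l ^ 3 * δ ^ 4 := by gcongr
        linarith
      have e4 : C * l ^ 3 * δ ^ 4 * l ^ a ≤ c / 2 * δ ^ 3 := by
        calc C * l ^ 3 * δ ^ 4 * l ^ a = (δ * l ^ (a + 3)) * C * δ ^ 3 := by rw [pow_add]; ring
          _ ≤ c / 2 * δ ^ 3 := by rw [hδl]; gcongr; linarith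
      have e5 : ‖f (1 + δ ^ 4)‖ * l ^ a ≤ (‖f σ‖ + C * l ^ 3 * δ ^ 4) * l ^ a := by gcongr
      linarith
  calc c / 2 * d ^ 3 = (c / 2 * δ ^ 3) * l ^ (3 * a + 9) := by
        rw [← hδl]; ring
    _ ≤ (‖f σ‖ * l ^ a) * l ^ (3 * a + 9) := by gcongr
    _ = _ := by rw [mul_assoc, ← pow_add]; congr 2; ring

/-- The arithmetic function concentrated at `1`, as a multiplicative map. -/
def dl : ℕ →*₀ ℂ where
  toFun n := if n = 1 then 1 else 0
  map_zero' := by simp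
  map_one' := by simp
  map_mul' m n := by
    by_cases hm : m = 1 <;> by_cases hn : n = 1 <;> simp [hm, hn]

/-- A Dirichlet character as a multiplicative map on the natural numbers. -/
def hm {r : ℕ} (χ : DirichletCharacter ℂ r) : ℕ →*₀ ℂ where
  toFun n := if n = 0 then 0 else χ n
  map_zero' := by simp
  map_one' := by simp
  map_mul' m n := by
    by_cases hm : m = 0 <;> by_cases hn : n = 0 <;> simp [hm, hn]

lemma dl_apply (n : ℕ) : dl n = if n = 1 then 1 else 0 := rfl

lemma hm_apply {r : ℕ} (χ : DirichletCharacter ℂ r) {n : ℕ} (hn : n ≠ 0) : hm χ n = χ n :=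
  if_neg hn

lemma mul_apply' (g h : ℕ →*₀ ℂ) (n : ℕ) : (g * h) n = g n * h n := rfl

lemma norm_dl_le (n : ℕ) : ‖dl n‖ ≤ 1 := by
  rw [dl_apply]; split_ifs <;> simp

lemma norm_hm_le {r : ℕ} (χ : DirichletCharacter ℂ r) (n : ℕ) : ‖hm χ n‖ ≤ 1 := by
  rcases eq_or_ne n 0 with rfl | hn
  · simp
  · rw [hm_apply χ hn]; exact χ.norm_le_one _

lemma norm_mul_le' {g h : ℕ →*₀ ℂ} (hg : ∀ n, ‖g n‖ ≤ 1) (hh : ∀ n, ‖h n‖ ≤ 1) (n : ℕ) :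
    ‖(g * h) n‖ ≤ 1 := by
  rw [mul_apply', norm_mul]
  exact mul_le_one₀ (hg n) (norm_nonneg _) (hh n)

lemma tw_zeta_apply (g : ℕ →*₀ ℂ) (n : ℕ) : tw g (ζ : ArithmeticFunction ℂ) n = g n := by
  rcases eq_or_ne n 0 with rfl | hn
  · simp
  · simp [tw_apply, hn]

lemma LSeriesSummable_hom {g : ℕ →*₀ ℂ} (hg : ∀ n, ‖g n‖ ≤ 1) {s : ℂ} (hs : 1 < s.re) :
    LSeriesSummable (g ·) s :=
  LSeriesSummable_of_bounded_of_one_lt_re (fun n _ ↦ hg n) hs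

lemma LSeries_pf {g₁ g₂ : ℕ →*₀ ℂ} (h₁ : ∀ n, ‖g₁ n‖ ≤ 1) (h₂ : ∀ n, ‖g₂ n‖ ≤ 1) {s : ℂ}
    (hs : 1 < s.re) :
    LSeries (pf g₁ g₂ ·) s = LSeries (g₁ ·) s * LSeries (g₂ ·) s := by
  have h (g : ℕ →*₀ ℂ) : (fun n ↦ tw g (ζ : ArithmeticFunction ℂ) n) = (g ·) := by
    ext n; exact tw_zeta_apply g n
  rw [pf, LSeries_mul', h, h]
  · rw [h]; exact LSeriesSummable_hom h₁ hs
  · rw [h]; exact LSeriesSummable_hom h₂ hs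

lemma LSeries_dl (s : ℂ) : LSeries (dl ·) s = 1 := by
  rw [show (fun n ↦ dl n) = LSeries.delta from rfl, LSeries_delta]
  rfl

lemma hasDerivAt_ofReal_cpow_neg {u : ℝ} (hu : 0 < u) (w : ℂ) :
    HasDerivAt (fun u : ℝ ↦ (u : ℂ) ^ w) (w * (u : ℂ) ^ (w - 1)) u := by
  have h : HasDerivAt (fun z : ℂ ↦ z ^ w) (w * (u : ℂ) ^ (w - 1) * 1) (u : ℂ) :=
    (hasDerivAt_id (u : ℂ)).cpow_const (Or.inl (by simpa using hu))
  rw [mul_one] at h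
  exact h.comp_ofReal

lemma norm_cpow_neg_sub_le {s : ℂ} (hs : 1 < s.re) {n : ℕ} (hn : 0 < n) {u : ℝ}
    (hu : u ∈ Set.Icc (n : ℝ) (n + 1)) :
    ‖(u : ℂ) ^ (-s) - (n : ℂ) ^ (-s)‖ ≤ ‖s‖ / (n : ℝ) ^ 2 := by
  have hn' : (1 : ℝ) ≤ n := by exact_mod_cast hn
  have h := norm_image_sub_le_of_norm_deriv_le_segment' (a := (n : ℝ)) (b := n + 1)
    (f := fun u : ℝ ↦ (u : ℂ) ^ (-s)) (f' := fun u : ℝ ↦ -s * (u : ℂ) ^ (-s - 1))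
    (C := ‖s‖ / (n : ℝ) ^ 2)
    (fun x hx ↦ (hasDerivAt_ofReal_cpow_neg (by linarith [hx.1]) _).hasDerivWithinAt)
    (fun x hx ↦ ?_) u hu
  · refine h.trans ?_
    have : u - n ≤ 1 := by linarith [hu.2]
    have h0 : 0 ≤ ‖s‖ / (n : ℝ) ^ 2 := by positivity
    nlinarith
  · have hx0 : 1 ≤ x := hn'.trans hx.1
    rw [norm_mul, norm_neg, Complex.norm_cpow_eq_rpow_re_of_pos (by linarith), div_eq_mul_inv]
    gcongr
    calc x ^ (-s - 1).re ≤ x ^ (-2 : ℝ) := by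
          apply Real.rpow_le_rpow_of_exponent_le hx0; simp; linarith
      _ ≤ (n : ℝ) ^ (-2 : ℝ) := by
          apply Real.rpow_le_rpow_of_nonpos (by linarith) hx.1 (by norm_num)
      _ = _ := by rw [Real.rpow_neg (by linarith)]; norm_num

lemma norm_sum_Ico_cpow_le {s : ℂ} (hs : 1 < s.re) {N M : ℕ} (hN : 0 < N) (hNM : N ≤ M) :
    ‖∑ n ∈ Finset.Ico N M, (n : ℂ) ^ (-s)‖ ≤ 2 / ‖s - 1‖ + 2 * ‖s‖ / N := by
  set φ : ℝ → ℂ := fun u ↦ (u : ℂ) ^ (1 - s) / (1 - s) with hφ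
  have h1s : 1 - s ≠ 0 := fun h ↦ by
    have := congrArg Complex.re h
    simp at this
    linarith
  have hφn (n : ℕ) (hn : 0 < n) : ‖φ n‖ ≤ 1 / ‖s - 1‖ := by
    rw [hφ]
    dsimp only
    rw [norm_div, norm_sub_rev 1 s]
    gcongr
    have : (1 : ℝ) ≤ n := by exact_mod_cast hn
    rw [Complex.norm_cpow_eq_rpow_re_of_pos (by linarith)]
    exact Real.rpow_le_one_of_one_le_of_nonpos this (by simp; linarith)
  have hD (n : ℕ) (hn : 0 < n) : ‖(φ (n + 1 : ℕ) - φ n) - (n : ℂ) ^ (-s)‖ ≤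
      2 * ‖s‖ * ((n : ℝ)⁻¹ - ((n + 1 : ℕ) : ℝ)⁻¹) := by
    have hn' : (1 : ℝ) ≤ n := by exact_mod_cast hn
    have h := norm_image_sub_le_of_norm_deriv_le_segment' (a := (n : ℝ)) (b := n + 1)
      (f := fun u : ℝ ↦ φ u - u * (n : ℂ) ^ (-s))
      (f' := fun u : ℝ ↦ (u : ℂ) ^ (-s) - (n : ℂ) ^ (-s))
      (C := ‖s‖ / (n : ℝ) ^ 2)
      (fun x hx ↦ HasDerivAt.hasDerivWithinAt ?_)
      (fun x hx ↦ norm_cpow_neg_sub_le hs hn ⟨hx.1, hx.2.le⟩) (n + 1) ⟨by linarith, le_rfl⟩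
    · have e : (fun u : ℝ ↦ φ u - u * (n : ℂ) ^ (-s)) (n + 1) -
          (fun u : ℝ ↦ φ u - u * (n : ℂ) ^ (-s)) n =
          (φ (n + 1 : ℕ) - φ n) - (n : ℂ) ^ (-s) := by
        push_cast; ring
      rw [e] at h
      refine h.trans ?_
      have e2 : ((n : ℝ)⁻¹ - ((n + 1 : ℕ) : ℝ)⁻¹) = 1 / (n * (n + 1)) := by
        push_cast; field_simp; ring
      rw [e2, add_sub_cancel_left, mul_one, mul_one_div, div_le_div_iff₀ (by positivity)
        (by positivity)]
      have := norm_nonneg s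
      nlinarith [mul_nonneg this (sub_nonneg.2 hn')]
    · have hx0 : 0 < x := by linarith [hx.1]
      have h1 := (hasDerivAt_ofReal_cpow_neg hx0 (1 - s)).div_const (1 - s)
      have h2 : HasDerivAt (fun u : ℝ ↦ (u : ℂ) * (n : ℂ) ^ (-s)) (1 * (n : ℂ) ^ (-s)) x :=
        ((hasDerivAt_id (x : ℂ)).comp_ofReal).mul_const _
      have h3 := h1.sub h2
      rw [mul_div_cancel_left₀ _ h1s, one_mul, show 1 - s - 1 = -s by ring] at h3
      exact h3
  have tele : ∑ n ∈ Finset.Ico N M, (n : ℂ) ^ (-s) = (φ M - φ N) -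
      ∑ n ∈ Finset.Ico N M, ((φ (n + 1 : ℕ) - φ n) - (n : ℂ) ^ (-s)) := by
    rw [Finset.sum_sub_distrib, Finset.sum_Ico_sub (fun n : ℕ ↦ φ n) hNM]
    ring
  have tele2 : ∑ n ∈ Finset.Ico N M, 2 * ‖s‖ * ((n : ℝ)⁻¹ - ((n + 1 : ℕ) : ℝ)⁻¹) ≤
      2 * ‖s‖ / N := by
    rw [← Finset.mul_sum]
    have := Finset.sum_Ico_sub (fun n : ℕ ↦ -(n : ℝ)⁻¹) hNM
    have e : ∑ n ∈ Finset.Ico N M, ((n : ℝ)⁻¹ - ((n + 1 : ℕ) : ℝ)⁻¹) = (N : ℝ)⁻¹ - (M : ℝ)⁻¹ := by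
      rw [← neg_sub_neg, ← this]
      exact Finset.sum_congr rfl fun _ _ ↦ by ring
    rw [e, div_eq_mul_inv]
    gcongr
    simp
  rw [tele]
  refine (norm_sub_le _ _).trans (add_le_add ((norm_sub_le _ _).trans ?_)
    ((norm_sum_le _ _).trans (le_trans (Finset.sum_le_sum fun n hn ↦ hD n ?_) tele2)))
  · have := hφn M (hN.trans_le hNM)
    have := hφn N hN
    rw [← one_add_one_eq_two, add_div]
    linarith
  · exact hN.trans_le (Finset.mem_Ico.1 hn).1

/-- The Riemann zeta function as the Dirichlet series of this multiplicative map. -/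
def zt : ℕ →*₀ ℂ := hm (1 : DirichletCharacter ℂ 1)

lemma zt_apply {n : ℕ} (hn : n ≠ 0) : zt n = 1 := by
  rw [zt, hm_apply _ hn, MulChar.one_apply (isUnit_of_subsingleton _)]

lemma norm_zt_le (n : ℕ) : ‖zt n‖ ≤ 1 := norm_hm_le _ n

lemma norm_LSeries_zt_le {s : ℂ} (hs : 1 < s.re) (hs2 : s.re ≤ 2) :
    ‖LSeries (zt ·) s‖ ≤ 2 / ‖s - 1‖ + 4 * Real.log (|s.im| + 4) := by
  have hsum := (LSeriesSummable_hom norm_zt_le hs).LSeriesHasSum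
  have hlim := (hsum.tendsto_sum_nat).norm
  refine le_of_tendsto hlim ?_
  set N := ⌈|s.im| + 2⌉₊ with hN
  have hN1 : |s.im| + 2 ≤ N := Nat.le_ceil _
  have hN2 : (N : ℝ) < |s.im| + 2 + 1 := Nat.ceil_lt_add_one (by positivity)
  have hN0 : (2 : ℝ) ≤ N := le_trans (by linarith [abs_nonneg s.im]) hN1
  have hNpos : 0 < N := by exact_mod_cast (by linarith : (0 : ℝ) < N)
  filter_upwards [Filter.eventually_ge_atTop N] with M hM
  rw [← Finset.sum_range_add_sum_Ico _ hM]
  have hl : 1 ≤ Real.log (|s.im| + 4) := by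
    rw [Real.le_log_iff_exp_le (by positivity)]
    linarith [Real.exp_one_lt_d9, abs_nonneg s.im]
  have h1 : ‖∑ n ∈ Finset.range N, LSeries.term (zt ·) s n‖ ≤ 1 + Real.log (|s.im| + 4) := by
    have hh := harmonic_le_one_add_log N
    refine le_trans ((norm_sum_le _ _).trans ?_) (hh.trans ?_)
    · rw [harmonic]
      push_cast
      rw [← Nat.succ_pred_eq_of_pos hNpos, Finset.sum_range_succ', Finset.sum_range_succ]
      have : ∀ i ∈ Finset.range (N.pred), ‖LSeries.term (zt ·) s (i + 1)‖ ≤ ((i : ℝ) + 1)⁻¹ := by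
        intro i _
        rw [LSeries.term_of_ne_zero (by omega), zt_apply (by omega), norm_div, norm_one, one_div,
          Complex.norm_natCast_cpow_of_pos (by omega)]
        push_cast
        gcongr
        calc (i : ℝ) + 1 = ((i : ℝ) + 1) ^ (1 : ℝ) := by simp
          _ ≤ _ := Real.rpow_le_rpow_of_exponent_le (by linarith [Nat.cast_nonneg (α := ℝ) i])
            hs.le
      have := Finset.sum_le_sum this
      simp only [LSeries.term_zero, norm_zero, add_zero]
      refine this.trans (le_add_of_nonneg_right (by positivity))
    · gcongr
      linarith
  have h2 : ‖∑ n ∈ Finset.Ico N M, LSeries.term (zt ·) s n‖ ≤ 2 / ‖s - 1‖ + 2 := by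
    have e : ∑ n ∈ Finset.Ico N M, LSeries.term (zt ·) s n =
        ∑ n ∈ Finset.Ico N M, (n : ℂ) ^ (-s) := by
      refine Finset.sum_congr rfl fun n hn ↦ ?_
      have : n ≠ 0 := by have := (Finset.mem_Ico.1 hn).1; omega
      rw [LSeries.term_of_ne_zero this, zt_apply this, Complex.cpow_neg, one_div]
    rw [e]
    refine (norm_sum_Ico_cpow_le hs hNpos hM).trans ?_
    gcongr
    rw [div_le_iff₀ (by linarith)]
    have h3 : ‖s‖ ≤ |s.re| + |s.im| := Complex.norm_le_abs_re_add_abs_im s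
    rw [abs_of_pos (by linarith)] at h3
    linarith
  refine (norm_add_le _ _).trans ?_
  linarith

/-- The analytic conductor at height `t`, on a logarithmic scale. -/
def ll (K t : ℝ) : ℝ := Real.log (K * (|t| + 4))

lemma one_le_ll {K : ℝ} (hK : 1 ≤ K) (t : ℝ) : 1 ≤ ll K t := by
  rw [ll, Real.le_log_iff_exp_le (by positivity)]
  nlinarith [Real.exp_one_lt_d9, abs_nonneg t]

lemma cL_le_ll {K : ℝ} (hK : 1 ≤ K) {s : ℂ} (hs : 1 < s.re) (hs2 : s.re ≤ 2) :
    cL K s ≤ ll K s.im := by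
  rw [cL, ll]
  have h3 : ‖s‖ ≤ |s.re| + |s.im| := Complex.norm_le_abs_re_add_abs_im s
  rw [abs_of_pos (by linarith)] at h3
  refine Real.log_le_log (by positivity) ?_
  exact mul_le_mul_of_nonneg_left (by linarith) (by linarith)

lemma ll_le_two_mul_cL {K : ℝ} (hK : 1 ≤ K) {s : ℂ} (hs : 1 < s.re) :
    ll K s.im ≤ 2 * cL K s := by
  rw [cL, ll, ← Nat.cast_two, ← Real.log_pow]
  have h3 : |s.im| ≤ ‖s‖ := Complex.abs_im_le_norm s
  have h1 : 1 ≤ ‖s‖ := hs.le.trans (Complex.re_le_norm s)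
  refine Real.log_le_log (by positivity) ?_
  have : K * (|s.im| + 4) ≤ K * (‖s‖ + 4) := by gcongr
  have h4 : K ≤ K ^ 2 := by nlinarith
  have h5 : ‖s‖ + 4 ≤ (‖s‖ + 2) ^ 2 := by nlinarith
  rw [Nat.cast_two, mul_pow]
  refine this.trans (mul_le_mul h4 h5 (by positivity) (by positivity))

lemma ll_two_mul_le {K : ℝ} (hK : 1 ≤ K) (t : ℝ) : ll K (2 * t) ≤ 2 * ll K t := by
  have h := ll_le_two_mul_cL hK (s := 2 + (2 * t) * Complex.I) (by simp)
  rw [ll, ll, ← Nat.cast_two, ← Real.log_pow]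
  refine Real.log_le_log (by positivity) ?_
  rw [Nat.cast_two, abs_mul, abs_two]
  have : K ≤ K ^ 2 := by nlinarith
  have := abs_nonneg t
  nlinarith [mul_nonneg this this]

lemma ll_mono {K K' : ℝ} (hK : 1 ≤ K) (h : K ≤ K') (t : ℝ) : ll K t ≤ ll K' t := by
  rw [ll, ll]
  exact Real.log_le_log (by positivity) (by gcongr)

/-- The hypotheses on a coefficient sequence under which its Dirichlet series is controlled. -/
structure Controlled (f : ArithmeticFunction ℂ) (K : ℝ) : Prop where
  one_le : 1 ≤ K
  norm_le : ∀ n, ‖f n‖ ≤ n.divisors.card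
  sum_le : ∀ N : ℕ, ‖∑ n ∈ Finset.Icc 0 N, f n‖ ≤ K * (N : ℝ) ^ (3 / 4 : ℝ)

lemma Controlled.mono {f : ArithmeticFunction ℂ} {K K' : ℝ} (h : Controlled f K) (hK : K ≤ K') :
    Controlled f K' :=
  ⟨h.one_le.trans hK, h.norm_le, fun N ↦ (h.sum_le N).trans (by gcongr)⟩

lemma norm_LSeries_le_ll : ∃ C : ℝ, 1 ≤ C ∧ ∀ (f : ArithmeticFunction ℂ) (K : ℝ),
    Controlled f K → ∀ s : ℂ, 1 < s.re → s.re ≤ 2 → ‖LSeries (f ·) s‖ ≤ C * ll K s.im ^ 2 := by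
  obtain ⟨C, hC, h⟩ := norm_LSeries_lg_le 0
  refine ⟨max 1 C, le_max_left _ _, fun f K hf s hs hs2 ↦ ?_⟩
  refine (h f K s hf.one_le hf.norm_le hf.sum_le hs).trans ?_
  have := one_le_cL hf.one_le hs
  gcongr
  · exact le_max_right _ _
  · exact cL_le_ll hf.one_le hs hs2

lemma ll_mono_right {K : ℝ} (hK : 1 ≤ K) {t T : ℝ} (h : |t| ≤ |T|) : ll K t ≤ ll K T := by
  rw [ll, ll]
  exact Real.log_le_log (by positivity) (by gcongr)

lemma lipschitz_LSeries : ∃ C : ℝ, 1 ≤ C ∧ ∀ (f : ArithmeticFunction ℂ) (K : ℝ),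
    Controlled f K → ∀ (T : ℝ) (s s' : ℂ), 1 < s.re → s.re ≤ 2 → |s.im| ≤ |T| → 1 < s'.re →
    s'.re ≤ 2 → |s'.im| ≤ |T| →
    ‖LSeries (f ·) s - LSeries (f ·) s'‖ ≤ C * ll K T ^ 3 * ‖s - s'‖ := by
  obtain ⟨C, hC, h⟩ := norm_LSeries_lg_le 1
  refine ⟨max 1 C, le_max_left _ _, fun f K hf T s s' h1 h2 h3 h1' h2' h3' ↦ ?_⟩
  set S : Set ℂ := Complex.reLm ⁻¹' (Set.Ioc (1 : ℝ) 2) ∩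
    Complex.imLm ⁻¹' (Set.Icc (-|T|) |T|) with hS
  have hconv : Convex ℝ S := ((convex_Ioc 1 2).linear_preimage _).inter
    ((convex_Icc _ _).linear_preimage _)
  have hder : ∀ x ∈ S, HasDerivWithinAt (LSeries (f ·))
      (-LSeries ((lg^[1] f : ArithmeticFunction ℂ) ·) x) S x := by
    intro x hx
    have h3 : HasDerivAt (LSeries (f ·)) _ x := LSeries_hasDerivAt
      ((abscissa_le_one hf.norm_le).trans_lt (by exact_mod_cast hx.1.1))
    rw [lg_iterate_eq]
    exact h3.hasDerivWithinAt
  have hb : ∀ x ∈ S, ‖-LSeries ((lg^[1] f : ArithmeticFunction ℂ) ·) x‖ ≤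
      max 1 C * ll K T ^ 3 := by
    intro x hx
    have hs : 1 < x.re := hx.1.1
    rw [norm_neg]
    refine (h f K _ hf.one_le hf.norm_le hf.sum_le hs).trans ?_
    have := one_le_cL hf.one_le hs
    have h3 := (cL_le_ll hf.one_le hs hx.1.2).trans (ll_mono_right hf.one_le (abs_le.2 hx.2))
    gcongr
    exact le_max_right _ _
  exact hconv.norm_image_sub_le_of_norm_hasDerivWithin_le hder hb ⟨⟨h1', h2'⟩, abs_le.1 h3'⟩
    ⟨⟨h1, h2⟩, abs_le.1 h3⟩

lemma exists_cpow_split {p : ℕ} (hp : p.Prime) {σ : ℝ} (hσ : 1 < σ) (t : ℝ) :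
    ∃ (a : ℝ) (w : ℂ), 0 ≤ a ∧ a < 1 ∧ ‖w‖ = 1 ∧ (p : ℂ) ^ (-(σ : ℂ)) = a ∧
      (p : ℂ) ^ (-(σ + t * Complex.I : ℂ)) = a * w ∧
      (p : ℂ) ^ (-(σ + (2 * t : ℝ) * Complex.I : ℂ)) = a * w ^ 2 := by
  have hp0 : (p : ℂ) ≠ 0 := by exact_mod_cast hp.ne_zero
  refine ⟨(p : ℝ) ^ (-σ), (p : ℂ) ^ (-(t * Complex.I)), by positivity, ?_, ?_, ?_, ?_, ?_⟩
  · exact Real.rpow_lt_one_of_one_lt_of_neg (by exact_mod_cast hp.one_lt) (by linarith)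
  · rw [Complex.norm_natCast_cpow_of_pos hp.pos]; simp
  · rw [Complex.ofReal_cpow (by positivity)]; simp
  · rw [Complex.ofReal_cpow (by positivity), neg_add, Complex.cpow_add _ _ hp0]; simp
  · rw [Complex.ofReal_cpow (by positivity), neg_add, Complex.cpow_add _ _ hp0, ← Complex.cpow_nat_mul]
    congr 2
    · simp
    · push_cast; ring

lemma norm_hm_prime {r : ℕ} (χ : DirichletCharacter ℂ r) {p : ℕ} (hp : p.Prime) :
    hm χ p = 0 ∨ ‖hm χ p‖ = 1 := by
  rw [hm_apply χ hp.ne_zero]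
  by_cases h : IsUnit (p : ZMod r)
  · right
    obtain ⟨u, hu⟩ := h
    rw [← hu]
    exact χ.unit_norm_eq_one u
  · exact Or.inl (χ.map_nonunit h)

lemma hm_mul {r : ℕ} (χ ψ : DirichletCharacter ℂ r) : hm (χ * ψ) = hm χ * hm ψ := by
  ext n
  rcases eq_or_ne n 0 with rfl | hn
  · simp
  · rw [mul_apply', hm_apply _ hn, hm_apply _ hn, hm_apply _ hn, MulChar.mul_apply]

lemma norm_sum_range_char_le {r : ℕ} [NeZero r] {χ : DirichletCharacter ℂ r} (hχ : χ ≠ 1) (N : ℕ) :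
    ‖∑ n ∈ Finset.range N, χ n‖ ≤ r := by
  have h0 : ∑ n ∈ Finset.range r, χ n = 0 := by
    rw [← MulChar.sum_eq_zero_of_ne_one hχ]
    obtain ⟨k, rfl⟩ := Nat.exists_eq_succ_of_ne_zero (NeZero.ne r)
    rw [Finset.sum_range]
    refine Fintype.sum_congr (α := Fin (k + 1)) _ _ fun a ↦ ?_
    congr 1
    exact Fin.cast_val_eq_self a
  induction N using Nat.strong_induction_on with
  | _ N ih =>
    rcases le_or_gt N r with h | h
    · refine (norm_sum_le _ _).trans ((Finset.sum_le_sum fun (n : ℕ) _ ↦ χ.norm_le_one (n : ZMod r)).trans ?_)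
      simpa using h
    · obtain ⟨M, rfl⟩ := Nat.exists_eq_add_of_lt h
      rw [add_assoc, Finset.sum_range_add, h0, zero_add]
      have := ih (M + 1) (by have := NeZero.pos r; omega)
      convert this using 4
      simp

lemma pf_dl_apply (g : ℕ →*₀ ℂ) (n : ℕ) : pf g dl n = g n := by
  have h : tw dl (ζ : ArithmeticFunction ℂ) = 1 := by
    ext n
    rw [tw_zeta_apply, dl_apply, one_apply]
  rw [pf, h, mul_one, tw_zeta_apply]

lemma controlled_char {r : ℕ} (hr : r ≠ 0) {χ : DirichletCharacter ℂ r} (hχ : χ ≠ 1) :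
    Controlled (pf (hm χ) dl) r := by
  have : NeZero r := ⟨hr⟩
  have hr1 : r ≠ 1 := by
    rintro rfl
    exact hχ (DirichletCharacter.level_one χ)
  have h1 : (1 : ℝ) ≤ r := by exact_mod_cast Nat.one_le_iff_ne_zero.2 hr
  refine ⟨h1, norm_pf_le (norm_hm_le χ) norm_dl_le, fun N ↦ ?_⟩
  have e : ∑ n ∈ Finset.Icc 0 N, pf (hm χ) dl n = ∑ n ∈ Finset.range (N + 1), χ n := by
    refine Finset.sum_congr (by ext; simp) fun n _ ↦ ?_
    rw [pf_dl_apply]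
    rcases eq_or_ne n 0 with rfl | hn
    · have : Nontrivial (ZMod r) := ZMod.nontrivial_iff.2 hr1
      rw [_root_.map_zero, Nat.cast_zero, MulChar.map_zero]
    · exact hm_apply χ hn
  rcases Nat.eq_zero_or_pos N with rfl | hN
  · simp [pf_dl_apply]
  rw [e]
  refine (norm_sum_range_char_le hχ _).trans (le_mul_of_one_le_right (by positivity) ?_)
  exact Real.one_le_rpow (by exact_mod_cast hN) (by norm_num)

lemma LSeries_pf_dl (g : ℕ →*₀ ℂ) (s : ℂ) : LSeries (pf g dl ·) s = LSeries (g ·) s := by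
  congr 1
  ext n
  exact pf_dl_apply g n

lemma norm_LSeries_zt_real_le {σ : ℝ} (h1 : 1 < σ) (h2 : σ ≤ 2) :
    ‖LSeries (zt ·) σ‖ ≤ 8 / (σ - 1) := by
  have h := norm_LSeries_zt_le (s := σ) (by simpa using h1) (by simpa using h2)
  rw [← Complex.ofReal_one, ← Complex.ofReal_sub, Complex.norm_of_nonneg (by linarith)] at h
  have hl : Real.log 4 ≤ 1.5 := by
    rw [show (4 : ℝ) = 2 ^ 2 by norm_num, Real.log_pow]
    have := Real.log_two_lt_d9
    push_cast
    linarith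
  refine h.trans ?_
  have h3 : 6 ≤ 6 / (σ - 1) := by rw [le_div_iff₀ (by linarith)]; linarith
  have h4 : 2 / (σ - 1) + 6 / (σ - 1) = 8 / (σ - 1) := by rw [← add_div]; norm_num
  simp only [Complex.ofReal_im, abs_zero, zero_add]
  linarith

lemma local_three_four_one' {a : ℝ} (ha₀ : 0 ≤ a) (ha₁ : a < 1) {z : ℂ} (hz : z = 0 ∨ ‖z‖ = 1) :
    ‖1 - (a : ℂ)‖ ^ 3 * ‖1 - a * z‖ ^ 4 * ‖1 - a * z ^ 2‖ ≤ 1 := by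
  have e : ‖1 - (a : ℂ)‖ = 1 - a := by
    rw [← Complex.ofReal_one, ← Complex.ofReal_sub, Complex.norm_of_nonneg (by linarith)]
  rw [e]
  rcases hz with rfl | hz
  · simp
    exact pow_le_one₀ (by linarith) (by linarith)
  · exact local_three_four_one ha₀ ha₁ hz

/-- The nonprincipal character modulo four. -/
def x4 : DirichletCharacter ℂ 4 := ZMod.χ₄.ringHomComp (Int.castRingHom ℂ)

lemma x4_ne_one : x4 ≠ 1 := by
  intro h
  have h1 : x4 (3 : ZMod 4) = -1 := by
    simp [x4, show ZMod.χ₄ 3 = -1 from by decide]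
  rw [h, MulChar.one_apply (by decide)] at h1
  norm_num at h1

/-- Two pairs of multiplicative functions, the second being the "square" of the first, over the
Gaussian integers. -/
structure HeckePair (g₁ g₂ h₁ h₂ : ℕ →*₀ ℂ) : Prop where
  ng₁ : ∀ n, ‖g₁ n‖ ≤ 1
  ng₂ : ∀ n, ‖g₂ n‖ ≤ 1
  nh₁ : ∀ n, ‖h₁ n‖ ≤ 1
  nh₂ : ∀ n, ‖h₂ n‖ ≤ 1
  loc : ∀ p : ℕ, p.Prime →
    (hm x4 p = 1 ∧ ‖g₁ p‖ = 1 ∧ ‖g₂ p‖ = 1 ∧ h₁ p = g₁ p ^ 2 ∧ h₂ p = g₂ p ^ 2) ∨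
    (hm x4 p = -1 ∧ g₁ p = 1 ∧ g₂ p = -1 ∧ h₁ p = 1 ∧ h₂ p = -1) ∨
    (hm x4 p = 0 ∧ ‖g₁ p‖ = 1 ∧ g₂ p = 0 ∧ h₁ p = g₁ p ^ 2 ∧ h₂ p = 0)

lemma hecke_three_four_one {g₁ g₂ h₁ h₂ : ℕ →*₀ ℂ} (H : HeckePair g₁ g₂ h₁ h₂) {r : ℕ}
    (χ : DirichletCharacter ℂ r) {σ : ℝ} (hσ : 1 < σ) (t : ℝ) :
    1 ≤ ‖LSeries (zt ·) σ‖ ^ 3 * ‖LSeries (hm x4 ·) σ‖ ^ 3 *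
      ‖LSeries (pf (hm χ * g₁) (hm χ * g₂) ·) (σ + t * Complex.I)‖ ^ 4 *
      ‖LSeries (pf (hm (χ * χ) * h₁) (hm (χ * χ) * h₂) ·) (σ + (2 * t : ℝ) * Complex.I)‖ := by
  set s : ℂ := σ + t * Complex.I with hs
  set s2 : ℂ := σ + (2 * t : ℝ) * Complex.I with hs2
  have r0 : 1 < (σ : ℂ).re := by simpa
  have r1 : 1 < s.re := by rw [hs]; simpa
  have r2 : 1 < s2.re := by rw [hs2]; simpa
  have nχ := norm_hm_le χ
  have nχ2 := norm_hm_le (χ * χ)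
  have key := one_le_prod_norm_LSeries
    ![zt, hm x4, hm χ * g₁, hm χ * g₂, hm (χ * χ) * h₁, hm (χ * χ) * h₂]
    ![(σ : ℂ), σ, s, s, s2, s2] ![3, 3, 4, 4, 1, 1] ?_ ?_ ?_
  · rw [LSeries_pf (norm_mul_le' nχ H.ng₁) (norm_mul_le' nχ H.ng₂) r1,
      LSeries_pf (norm_mul_le' nχ2 H.nh₁) (norm_mul_le' nχ2 H.nh₂) r2, norm_mul, norm_mul]
    refine key.trans (le_of_eq ?_)
    simp [Fin.prod_univ_six]
    ring
  · intro i
    fin_cases i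
    exacts [norm_zt_le, norm_hm_le x4, norm_mul_le' nχ H.ng₁, norm_mul_le' nχ H.ng₂,
      norm_mul_le' nχ2 H.nh₁, norm_mul_le' nχ2 H.nh₂]
  · intro i
    fin_cases i
    exacts [r0, r0, r1, r1, r2, r2]
  · intro p hp
    obtain ⟨a, w, ha0, ha1, hw, e0, e1, e2⟩ := exists_cpow_split hp hσ t
    simp only [Fin.prod_univ_six, Matrix.cons_val, pow_one]
    rw [e0, hs, e1, hs2, e2, hm_mul]
    simp only [mul_apply', zt_apply hp.ne_zero]
    have hx := norm_hm_prime χ hp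
    set x := hm χ p
    rcases H.loc p hp with ⟨c0, c1, c2, c3, c4⟩ | ⟨c0, c1, c2, c3, c4⟩ | ⟨c0, c1, c2, c3, c4⟩
    · rw [c0, c3, c4]
      have f1 := local_three_four_one' ha0 ha1 (z := x * g₁ p * w)
        (hx.imp (by rintro h; simp [h]) (by intro h; simp [h, c1, hw]))
      have f2 := local_three_four_one' ha0 ha1 (z := x * g₂ p * w)
        (hx.imp (by rintro h; simp [h]) (by intro h; simp [h, c2, hw]))
      refine le_trans (le_of_eq ?_) (mul_le_one₀ f1 (by positivity) f2)
      rw [show x * g₁ p * (a * w) = a * (x * g₁ p * w) by ring,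
        show x * g₂ p * (a * w) = a * (x * g₂ p * w) by ring,
        show x * x * g₁ p ^ 2 * (a * w ^ 2) = a * (x * g₁ p * w) ^ 2 by ring,
        show x * x * g₂ p ^ 2 * (a * w ^ 2) = a * (x * g₂ p * w) ^ 2 by ring, one_mul]
      ring
    · rw [c0, c1, c2, c3, c4]
      have f1 := local_three_four_one' (a := a ^ 2) (by positivity)
        (pow_lt_one₀ ha0 ha1 (by norm_num)) (z := (x * w) ^ 2)
        (hx.imp (by rintro h; simp [h]) (by intro h; simp [h, hw]))
      refine le_trans (le_of_eq ?_) f1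
      rw [show 1 - ((a ^ 2 : ℝ) : ℂ) = (1 - 1 * a) * (1 - -1 * a) by push_cast; ring,
        show 1 - ((a ^ 2 : ℝ) : ℂ) * (x * w) ^ 2 =
          (1 - x * 1 * (a * w)) * (1 - x * -1 * (a * w)) by push_cast; ring,
        show 1 - ((a ^ 2 : ℝ) : ℂ) * ((x * w) ^ 2) ^ 2 =
          (1 - x * x * 1 * (a * w ^ 2)) * (1 - x * x * -1 * (a * w ^ 2)) by push_cast; ring,
        norm_mul, norm_mul, norm_mul]
      ring
    · rw [c0, c2, c3, c4]
      have f1 := local_three_four_one' ha0 ha1 (z := x * g₁ p * w)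
        (hx.imp (by rintro h; simp [h]) (by intro h; simp [h, c1, hw]))
      refine le_trans (le_of_eq ?_) f1
      rw [show x * g₁ p * (a * w) = a * (x * g₁ p * w) by ring,
        show x * x * g₁ p ^ 2 * (a * w ^ 2) = a * (x * g₁ p * w) ^ 2 by ring, one_mul]
      simp

lemma dirichlet_three_four_one {r : ℕ} (χ : DirichletCharacter ℂ r) {h : ℕ →*₀ ℂ}
    (nh : ∀ n, ‖h n‖ ≤ 1) (hh : ∀ p : ℕ, p.Prime → hm χ p = 0 ∨ h p = hm χ p ^ 2)
    {σ : ℝ} (hσ : 1 < σ) (t : ℝ) :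
    1 ≤ ‖LSeries (zt ·) σ‖ ^ 3 * ‖LSeries (hm χ ·) (σ + t * Complex.I)‖ ^ 4 *
      ‖LSeries (h ·) (σ + (2 * t : ℝ) * Complex.I)‖ := by
  set s : ℂ := σ + t * Complex.I with hs
  set s2 : ℂ := σ + (2 * t : ℝ) * Complex.I with hs2
  have r0 : 1 < (σ : ℂ).re := by simpa
  have r1 : 1 < s.re := by rw [hs]; simpa
  have r2 : 1 < s2.re := by rw [hs2]; simpa
  have key := one_le_prod_norm_LSeries ![zt, hm χ, h] ![(σ : ℂ), s, s2] ![3, 4, 1] ?_ ?_ ?_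
  · refine key.trans (le_of_eq ?_)
    simp [Fin.prod_univ_three]
  · intro i
    fin_cases i
    exacts [norm_zt_le, norm_hm_le χ, nh]
  · intro i
    fin_cases i
    exacts [r0, r1, r2]
  · intro p hp
    obtain ⟨a, w, ha0, ha1, hw, e0, e1, e2⟩ := exists_cpow_split hp hσ t
    simp only [Fin.prod_univ_three, Matrix.cons_val, pow_one]
    rw [e0, hs, e1, hs2, e2]
    simp only [zt_apply hp.ne_zero]
    have hx := norm_hm_prime χ hp
    rcases hh p hp with h0 | h0
    · rw [h0, zero_mul, sub_zero, norm_one, one_pow, mul_one, one_mul]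
      have e : ‖1 - (a : ℂ)‖ = 1 - a := by
        rw [← Complex.ofReal_one, ← Complex.ofReal_sub, Complex.norm_of_nonneg (by linarith)]
      have e3 : ‖1 - h p * (a * w ^ 2)‖ ≤ 1 + a := by
        refine (norm_sub_le _ _).trans ?_
        rw [norm_one, norm_mul, norm_mul, norm_pow, hw, one_pow, mul_one,
          Complex.norm_of_nonneg ha0]
        have := mul_le_of_le_one_left ha0 (nh p)
        linarith
      rw [e]
      have h1a : 0 ≤ 1 - a := by linarith
      calc (1 - a) ^ 3 * ‖1 - h p * (a * w ^ 2)‖ ≤ (1 - a) ^ 3 * (1 + a) := by gcongr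
        _ = (1 - a) ^ 2 * (1 - a ^ 2) := by ring
        _ ≤ 1 := mul_le_one₀ (pow_le_one₀ h1a (by linarith)) (by nlinarith) (by nlinarith)
    · have f1 := local_three_four_one' ha0 ha1 (z := hm χ p * w)
        (hx.imp (by rintro h; simp [h]) (by intro h; simp [h, hw]))
      refine le_trans (le_of_eq ?_) f1
      rw [h0, show hm χ p * (a * w) = a * (hm χ p * w) by ring,
        show hm χ p ^ 2 * (a * w ^ 2) = a * (hm χ p * w) ^ 2 by ring, one_mul]

lemma lower_engine (n : ℕ) {A : ℝ} (hA : 1 ≤ A) : ∃ c : ℝ, 0 < c ∧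
    ∀ (f : ArithmeticFunction ℂ) (K t : ℝ), Controlled f K →
      (∀ σ : ℝ, 1 < σ → σ ≤ 2 → 1 ≤ ‖LSeries (zt ·) σ‖ ^ 3 *
        ‖LSeries (f ·) (σ + t * Complex.I)‖ ^ 4 * (A * ll K t ^ (4 * n))) →
      ∀ σ : ℝ, 1 < σ → σ ≤ 2 →
        c ≤ ‖LSeries (f ·) (σ + t * Complex.I)‖ * ll K t ^ (4 * n + 9) := by
  obtain ⟨C, hC, hlip⟩ := lipschitz_LSeries
  set c := 1 / (512 * A) with hc
  have hc0 : 0 < c := by positivity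
  have hc1 : c ≤ 1 := by rw [hc, div_le_one (by positivity)]; linarith
  refine ⟨c / 2 * (min 1 (c / (2 * C))) ^ 3, by positivity, fun f K t hf h σ h1 h2 ↦ ?_⟩
  refine lower_of_three_four_one (f := fun σ : ℝ ↦ LSeries (f ·) (σ + t * Complex.I))
    (one_le_ll hf.one_le t) hc0 (by linarith) (fun σ h1 h2 ↦ ?_)
    (fun σ σ' h1 h2 h1' h2' ↦ ?_) h1 h2
  · have h3 := h σ h1 h2
    have h4 := norm_LSeries_zt_real_le h1 h2
    have h5 : 0 < σ - 1 := by linarith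
    set X := ‖LSeries (f ·) (σ + t * Complex.I)‖ ^ 4
    have hX : 0 ≤ X := by positivity
    have hl := one_le_ll hf.one_le t
    have h6 : 1 ≤ (8 / (σ - 1)) ^ 3 * X * (A * ll K t ^ (4 * n)) := h3.trans (by gcongr)
    have h7 : (σ - 1) ^ 3 ≤ 512 * A * (X * ll K t ^ (4 * n)) := by
      calc (σ - 1) ^ 3 = (σ - 1) ^ 3 * 1 := by ring
        _ ≤ (σ - 1) ^ 3 * ((8 / (σ - 1)) ^ 3 * X * (A * ll K t ^ (4 * n))) := by gcongr
        _ = _ := by field_simp; ring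
    calc c ^ 4 * (σ - 1) ^ 3 ≤ c * (512 * A * (X * ll K t ^ (4 * n))) := by
          gcongr
          exact pow_le_of_le_one hc0.le hc1 (by norm_num)
      _ = X * (ll K t ^ n) ^ 4 := by rw [hc, ← pow_mul, mul_comm n 4]; field_simp
  · have := hlip f K hf t (σ + t * Complex.I) (σ' + t * Complex.I) (by simpa) (by simpa) (by simp)
      (by simpa) (by simpa) (by simp)
    refine this.trans (le_of_eq ?_)
    congr 1
    rw [add_sub_add_right_eq_sub, ← Complex.ofReal_sub, Complex.norm_real, Real.norm_eq_abs]

theorem hecke_lower : ∃ c : ℝ, 0 < c ∧ ∀ {g₁ g₂ h₁ h₂ : ℕ →*₀ ℂ}, HeckePair g₁ g₂ h₁ h₂ →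
    ∀ {r : ℕ} (χ : DirichletCharacter ℂ r) (K : ℝ), Controlled (pf (hm χ * g₁) (hm χ * g₂)) K →
    Controlled (pf (hm (χ * χ) * h₁) (hm (χ * χ) * h₂)) K → ∀ (σ t : ℝ), 1 < σ → σ ≤ 2 →
    c ≤ ‖LSeries (pf (hm χ * g₁) (hm χ * g₂) ·) (σ + t * Complex.I)‖ * ll K t ^ 13 := by
  obtain ⟨C, hC, hup⟩ := norm_LSeries_le_ll
  set Y := C * ll 4 0 ^ 2 with hY
  have hl0 := one_le_ll (K := 4) (by norm_num) 0
  have hY1 : 1 ≤ Y := one_le_mul_of_one_le_of_one_le hC (one_le_pow₀ hl0)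
  obtain ⟨c, hc, h⟩ := lower_engine 1 (A := Y ^ 3 * (4 * C))
    (one_le_mul_of_one_le_of_one_le (one_le_pow₀ hY1) (by linarith))
  refine ⟨c, hc, fun {g₁ g₂ h₁ h₂} H {r} χ K hG hH σ t h1 h2 ↦
    h _ K t hG (fun σ h1 h2 ↦ ?_) σ h1 h2⟩
  have e1 : ‖LSeries (hm x4 ·) σ‖ ≤ Y := by
    have := hup _ _ (controlled_char (by norm_num) x4_ne_one) σ (by simpa) (by simpa)
    rw [LSeries_pf_dl] at this
    simpa using this
  have hl := one_le_ll hG.one_le t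
  have e2 : ‖LSeries (pf (hm (χ * χ) * h₁) (hm (χ * χ) * h₂) ·) (σ + (2 * t : ℝ) * Complex.I)‖ ≤
      4 * C * ll K t ^ 4 := by
    refine (hup _ _ hH _ (by simpa) (by simpa)).trans ?_
    have e3 := ll_two_mul_le hG.one_le t
    have e4 := one_le_ll hG.one_le (2 * t)
    calc _ ≤ C * (2 * ll K t) ^ 2 := by
          gcongr
          · linarith [one_le_ll hG.one_le (σ + (2 * t : ℝ) * Complex.I : ℂ).im]
          · simpa using e3
      _ = 4 * C * ll K t ^ 2 := by ring
      _ ≤ _ := by gcongr <;> norm_num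
  refine (hecke_three_four_one H χ h1 t).trans ?_
  calc _ ≤ ‖LSeries (zt ·) σ‖ ^ 3 * Y ^ 3 *
      ‖LSeries (pf (hm χ * g₁) (hm χ * g₂) ·) (σ + t * Complex.I)‖ ^ 4 * (4 * C * ll K t ^ 4) := by
        gcongr
    _ = _ := by ring

theorem complex_lower : ∃ c : ℝ, 0 < c ∧ ∀ {r : ℕ}, r ≠ 0 → ∀ (χ : DirichletCharacter ℂ r),
    χ * χ ≠ 1 → ∀ (K : ℝ), (r : ℝ) ≤ K → ∀ (σ t : ℝ), 1 < σ → σ ≤ 2 →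
    c ≤ ‖LSeries (hm χ ·) (σ + t * Complex.I)‖ * ll K t ^ 13 := by
  obtain ⟨C, hC, hup⟩ := norm_LSeries_le_ll
  obtain ⟨c, hc, h⟩ := lower_engine 1 (A := 4 * C) (by linarith)
  refine ⟨c, hc, fun {r} hr χ hχ K hK σ t h1 h2 ↦ ?_⟩
  have hχ1 : χ ≠ 1 := by rintro rfl; simp at hχ
  have hG := (controlled_char hr hχ1).mono hK
  have hH := (controlled_char hr hχ).mono hK
  rw [← LSeries_pf_dl]
  refine h _ K t hG (fun σ h1 h2 ↦ ?_) σ h1 h2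
  rw [LSeries_pf_dl]
  have e2 : ‖LSeries (hm (χ * χ) ·) (σ + (2 * t : ℝ) * Complex.I)‖ ≤ 4 * C * ll K t ^ 4 := by
    rw [← LSeries_pf_dl]
    refine (hup _ _ hH _ (by simpa) (by simpa)).trans ?_
    have hl := one_le_ll hG.one_le t
    have e3 := ll_two_mul_le hG.one_le t
    have e4 := one_le_ll hG.one_le (2 * t)
    calc _ ≤ C * (2 * ll K t) ^ 2 := by
          gcongr
          · linarith [one_le_ll hG.one_le (σ + (2 * t : ℝ) * Complex.I : ℂ).im]
          · simpa using e3
      _ = 4 * C * ll K t ^ 2 := by ring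
      _ ≤ _ := by gcongr <;> norm_num
  refine (dirichlet_three_four_one χ (norm_hm_le (χ * χ)) (fun p hp ↦ Or.inr ?_) h1 t).trans ?_
  · rw [hm_mul, mul_apply', sq]
  · gcongr

lemma hm_sq_of_real {r : ℕ} {χ : DirichletCharacter ℂ r} (hχ : χ * χ = 1) {p : ℕ} (hp : p ≠ 0) :
    hm χ p = 0 ∨ hm χ p ^ 2 = 1 := by
  rw [hm_apply χ hp]
  by_cases h : IsUnit (p : ZMod r)
  · right
    rw [sq, ← MulChar.mul_apply, hχ, MulChar.one_apply h]
  · exact Or.inl (χ.map_nonunit h)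

/-- Lower bound for real characters away from the real axis. -/
theorem real_lower {τ : ℝ} (hτ : 0 < τ) : ∃ c : ℝ, 0 < c ∧ ∀ {r : ℕ}, r ≠ 0 →
    ∀ (χ : DirichletCharacter ℂ r), χ ≠ 1 → χ * χ = 1 → ∀ (K : ℝ), (r : ℝ) ≤ K →
    ∀ (σ t : ℝ), 1 < σ → σ ≤ 2 → τ ≤ |t| * ll K t ^ 12 →
    c ≤ ‖LSeries (hm χ ·) (σ + t * Complex.I)‖ * ll K t ^ 21 := by
  obtain ⟨c, hc, h⟩ := lower_engine 3 (A := 1 / τ + 8)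
    (by have : 0 < 1 / τ := by positivity
        linarith)
  refine ⟨c, hc, fun {r} hr χ hχ hχ2 K hK σ t h1 h2 ht ↦ ?_⟩
  have hG := (controlled_char hr hχ).mono hK
  rw [← LSeries_pf_dl]
  refine h _ K t hG (fun σ h1 h2 ↦ ?_) σ h1 h2
  rw [LSeries_pf_dl]
  have hl := one_le_ll hG.one_le t
  have ht0 : 0 < |t| := by
    rcases (abs_nonneg t).eq_or_lt with h0 | h0
    · rw [← h0, zero_mul] at ht; linarith
    · exact h0
  have e2 : ‖LSeries (zt ·) (σ + (2 * t : ℝ) * Complex.I)‖ ≤ (1 / τ + 8) * ll K t ^ 12 := by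
    refine (norm_LSeries_zt_le (by simpa) (by simpa)).trans ?_
    rw [add_mul]
    refine add_le_add ?_ ?_
    · have : 2 * |t| ≤ ‖(σ + (2 * t : ℝ) * Complex.I - 1 : ℂ)‖ := by
        have := Complex.abs_im_le_norm (σ + (2 * t : ℝ) * Complex.I - 1)
        simpa [abs_mul] using this
      calc _ ≤ 2 / (2 * |t|) := by gcongr
        _ = 1 / |t| := by field_simp
        _ ≤ _ := by
          rw [div_mul_eq_mul_div, one_mul, div_le_div_iff₀ ht0 hτ, one_mul]
          linarith
    · have e3 := ll_two_mul_le hG.one_le t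
      have e4 : Real.log (|2 * t| + 4) ≤ ll K (2 * t) := by
        rw [ll]
        refine Real.log_le_log (by positivity) (le_mul_of_one_le_left (by positivity) hG.one_le)
      have e5 : ll K t ≤ ll K t ^ 12 := le_self_pow₀ hl (by norm_num)
      simp only [Complex.add_im, Complex.ofReal_im, Complex.mul_im, Complex.ofReal_re,
        Complex.I_im, Complex.I_re, mul_one, mul_zero, zero_add, add_zero]
      linarith
  refine (dirichlet_three_four_one χ norm_zt_le (fun p hp ↦ ?_) h1 t).trans ?_
  · rw [zt_apply hp.ne_zero]
    exact (hm_sq_of_real hχ2 hp.ne_zero).imp id Eq.symm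
  · gcongr

/-- A completely multiplicative function with values in `{0, 1, -1}` at the primes. -/
def RealHom (g : ℕ →*₀ ℂ) : Prop := ∀ p : ℕ, p.Prime → g p = 0 ∨ g p = 1 ∨ g p = -1

lemma realHom_hm {r : ℕ} {χ : DirichletCharacter ℂ r} (hχ : χ * χ = 1) : RealHom (hm χ) := by
  intro p hp
  rcases hm_sq_of_real hχ hp.ne_zero with h | h
  · exact Or.inl h
  · exact Or.inr (mul_self_eq_one_iff.1 (by rw [← sq, h]))

lemma one_le_zt_mul {g : ℕ →*₀ ℂ} (hg : ∀ n, ‖g n‖ ≤ 1) (hr : RealHom g) {σ : ℝ} (hσ : 1 < σ) :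
    1 ≤ ‖LSeries (zt ·) σ‖ * ‖LSeries (g ·) σ‖ := by
  have h := one_le_prod_norm_LSeries ![zt, g] ![(σ : ℂ), σ] ![1, 1]
    (by intro i; fin_cases i; exacts [norm_zt_le, hg]) (by intro i; fin_cases i <;> simpa) ?_
  · simpa [Fin.prod_univ_two] using h
  · intro p hp
    obtain ⟨a, w, ha0, ha1, -, ha, -⟩ := exists_cpow_split hp hσ 0
    simp only [Fin.prod_univ_two, Matrix.cons_val_zero, Matrix.cons_val_one, ha, pow_one,
      zt_apply hp.ne_zero, one_mul]
    rcases hr p hp with h | h | h <;> rw [h]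
    · rw [zero_mul, sub_zero, norm_one, mul_one, ← Complex.ofReal_one, ← Complex.ofReal_sub,
        Complex.norm_of_nonneg (by linarith)]
      linarith
    · rw [one_mul, ← Complex.ofReal_one, ← Complex.ofReal_sub,
        Complex.norm_of_nonneg (by linarith)]
      nlinarith
    · rw [neg_one_mul, sub_neg_eq_add, ← Complex.ofReal_one, ← Complex.ofReal_sub,
        ← Complex.ofReal_add, Complex.norm_of_nonneg (by linarith),
        Complex.norm_of_nonneg (by linarith)]
      nlinarith

lemma one_le_zt_mul_mul_mul {g₁ g₂ g₃ : ℕ →*₀ ℂ} (h₁ : ∀ n, ‖g₁ n‖ ≤ 1) (h₂ : ∀ n, ‖g₂ n‖ ≤ 1)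
    (h₃ : ∀ n, ‖g₃ n‖ ≤ 1) (hr₁ : RealHom g₁) (hr₂ : RealHom g₂)
    (hm3 : ∀ p : ℕ, p.Prime → g₃ p = g₁ p * g₂ p) {σ : ℝ} (hσ : 1 < σ) :
    1 ≤ ‖LSeries (zt ·) σ‖ * ‖LSeries (g₁ ·) σ‖ * ‖LSeries (g₂ ·) σ‖ * ‖LSeries (g₃ ·) σ‖ := by
  have h := one_le_prod_norm_LSeries ![zt, g₁, g₂, g₃] ![(σ : ℂ), σ, σ, σ] ![1, 1, 1, 1]
    (by intro i; fin_cases i; exacts [norm_zt_le, h₁, h₂, h₃])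
    (by intro i; fin_cases i <;> simpa) ?_
  · simpa [Fin.prod_univ_four] using h
  · intro p hp
    obtain ⟨a, w, ha0, ha1, -, ha, -⟩ := exists_cpow_split hp hσ 0
    have n0 : ‖(1 - a : ℂ)‖ = 1 - a := by
      rw [← Complex.ofReal_one, ← Complex.ofReal_sub, Complex.norm_of_nonneg (by linarith)]
    have n1 : ‖(1 + a : ℂ)‖ = 1 + a := by
      rw [← Complex.ofReal_one, ← Complex.ofReal_add, Complex.norm_of_nonneg (by linarith)]
    have b1 : 0 ≤ 1 - a := by linarith
    have b2 : 1 - a ≤ 1 := by linarith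
    have b3 : (1 - a) * (1 + a) ≤ 1 := by nlinarith
    have b4 : (1 - a) * (1 - a) ≤ 1 := by nlinarith
    have b5 : (1 - a) * (1 - a) * (1 + a) * (1 + a) ≤ 1 := by
      calc _ = ((1 - a) * (1 + a)) ^ 2 := by ring
        _ ≤ 1 := pow_le_one₀ (by nlinarith) b3
    have b6 : (1 - a) * (1 - a) * (1 - a) * (1 - a) ≤ 1 := by
      calc _ = (1 - a) ^ 4 := by ring
        _ ≤ 1 := pow_le_one₀ b1 b2
    simp only [Fin.prod_univ_four, Matrix.cons_val, ha, pow_one,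
      zt_apply hp.ne_zero, one_mul, hm3 p hp]
    rcases hr₁ p hp with h | h | h <;> rcases hr₂ p hp with h' | h' | h' <;> rw [h, h'] <;>
      simp only [zero_mul, mul_zero, one_mul, neg_one_mul, neg_neg, sub_zero, sub_neg_eq_add,
        norm_one, mul_one, n0, n1] <;> linarith

/-- Landau: two real characters with nonprincipal product cannot both have small values. -/
theorem landau : ∃ β : ℝ, 0 < β ∧ ∀ {r₁ r₂ r₃ : ℕ}, r₁ ≠ 0 → r₂ ≠ 0 → r₃ ≠ 0 →
    ∀ (χ₁ : DirichletCharacter ℂ r₁) (χ₂ : DirichletCharacter ℂ r₂) (χ₃ : DirichletCharacter ℂ r₃),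
    χ₁ ≠ 1 → χ₂ ≠ 1 → χ₃ ≠ 1 → χ₁ * χ₁ = 1 → χ₂ * χ₂ = 1 →
    (∀ p : ℕ, p.Prime → hm χ₃ p = hm χ₁ p * hm χ₂ p) →
    ∀ K : ℝ, (r₁ : ℝ) ≤ K → (r₂ : ℝ) ≤ K → (r₃ : ℝ) ≤ K →
    ∀ σ₁ σ₂ : ℝ, 1 < σ₁ → σ₁ ≤ 2 → 1 < σ₂ → σ₂ ≤ 2 →
    ‖LSeries (hm χ₁ ·) σ₁‖ * ll K 0 ^ 9 < β → ‖LSeries (hm χ₂ ·) σ₂‖ * ll K 0 ^ 9 < β → False := by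
  obtain ⟨C, hC, hlip⟩ := lipschitz_LSeries
  obtain ⟨C', hC', hup⟩ := norm_LSeries_le_ll
  set β := 1 / (82 * C ^ 2 * C') with hβ
  have hC2 : 1 ≤ C ^ 2 * C' := one_le_mul_of_one_le_of_one_le (one_le_pow₀ hC) hC'
  have hβ0 : 0 < β := by positivity
  have hβC : 81 * C ^ 2 * C' * β < 1 := by
    rw [hβ, mul_one_div, div_lt_one (by positivity)]; nlinarith
  have hβ8 : 8 * β ≤ 1 := by nlinarith
  refine ⟨β, hβ0, fun {r₁ r₂ r₃} hr₁ hr₂ hr₃ χ₁ χ₂ χ₃ n₁ n₂ n₃ q₁ q₂ hm3 K k₁ k₂ k₃ σ₁ σ₂ a₁ b₁ a₂ b₂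
    s₁ s₂ ↦ ?_⟩
  have c₁ := (controlled_char hr₁ n₁).mono k₁
  have c₂ := (controlled_char hr₂ n₂).mono k₂
  have c₃ := (controlled_char hr₃ n₃).mono k₃
  set V := ll K 0 with hV
  have hV1 : 1 ≤ V := one_le_ll c₁.one_le 0
  set η := 8 * β / V ^ 9 with hη
  have hη0 : 0 < η := by positivity
  have hη1 : η ≤ 1 := by
    rw [hη, div_le_one (by positivity)]
    exact hβ8.trans (one_le_pow₀ hV1)
  have key {r : ℕ} (χ : DirichletCharacter ℂ r) (hc : Controlled (pf (hm χ) dl) K)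
      (hr : RealHom (hm χ)) {σ : ℝ} (h1 : 1 < σ) (h2 : σ ≤ 2)
      (hs : ‖LSeries (hm χ ·) σ‖ * V ^ 9 < β) :
      ‖LSeries (hm χ ·) ((1 + η : ℝ) : ℂ)‖ * V ^ 6 ≤ 9 * C * β := by
    have e1 := one_le_zt_mul (norm_hm_le χ) hr h1
    have e2 := norm_LSeries_zt_real_le h1 h2
    have e3 : σ - 1 ≤ η := by
      rw [hη, le_div_iff₀ (by positivity)]
      have h0 : 0 < σ - 1 := by linarith
      calc (σ - 1) * V ^ 9 = (σ - 1) * 1 * V ^ 9 := by ring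
        _ ≤ (σ - 1) * (8 / (σ - 1) * ‖LSeries (hm χ ·) σ‖) * V ^ 9 := by
          gcongr; exact e1.trans (by gcongr)
        _ = 8 * (‖LSeries (hm χ ·) σ‖ * V ^ 9) := by field_simp
        _ ≤ 8 * β := by gcongr
    have e4 := hlip _ K hc 0 ((1 + η : ℝ) : ℂ) σ (by simpa using hη0)
      (by simp only [Complex.ofReal_re]; linarith) (by simp) (by simpa) (by simpa) (by simp)
    rw [LSeries_pf_dl, LSeries_pf_dl, ← Complex.ofReal_sub, Complex.norm_real, Real.norm_eq_abs,
      ← hV] at e4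
    have e5 : |1 + η - σ| ≤ η := abs_le.2 ⟨by linarith, by linarith⟩
    have e6 : ‖LSeries (hm χ ·) ((1 + η : ℝ) : ℂ)‖ ≤ ‖LSeries (hm χ ·) σ‖ + C * V ^ 3 * η := by
      have := norm_sub_norm_le (LSeries (hm χ ·) ((1 + η : ℝ) : ℂ)) (LSeries (hm χ ·) σ)
      have : C * V ^ 3 * |1 + η - σ| ≤ C * V ^ 3 * η := by gcongr
      linarith
    calc _ ≤ (‖LSeries (hm χ ·) σ‖ + C * V ^ 3 * η) * V ^ 6 := by gcongr
      _ = ‖LSeries (hm χ ·) σ‖ * V ^ 6 + C * (8 * β) := by rw [hη]; field_simp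
      _ ≤ ‖LSeries (hm χ ·) σ‖ * V ^ 9 + C * (8 * β) := by gcongr <;> norm_num
      _ ≤ 9 * C * β := by nlinarith
  have hσ : 1 < 1 + η := by linarith
  have f₁ := key χ₁ c₁ (realHom_hm q₁) a₁ b₁ s₁
  have f₂ := key χ₂ c₂ (realHom_hm q₂) a₂ b₂ s₂
  have f₃ := hup _ K c₃ ((1 + η : ℝ) : ℂ) (by simpa using hη0)
    (by simp only [Complex.ofReal_re]; linarith)
  rw [LSeries_pf_dl, Complex.ofReal_im, ← hV] at f₃
  have f₀ := norm_LSeries_zt_real_le hσ (by linarith)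
  rw [add_sub_cancel_left] at f₀
  have f := one_le_zt_mul_mul_mul (norm_hm_le χ₁) (norm_hm_le χ₂) (norm_hm_le χ₃)
    (realHom_hm q₁) (realHom_hm q₂) hm3 hσ
  set A₁ := ‖LSeries (hm χ₁ ·) ((1 + η : ℝ) : ℂ)‖
  set A₂ := ‖LSeries (hm χ₂ ·) ((1 + η : ℝ) : ℂ)‖
  set A₃ := ‖LSeries (hm χ₃ ·) ((1 + η : ℝ) : ℂ)‖
  have g : V ≤ 81 * C ^ 2 * C' * β := by
    calc V = V * 1 := by ring
      _ ≤ V * (8 / η * A₁ * A₂ * (C' * V ^ 2)) := by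
        gcongr; exact f.trans (by gcongr)
      _ = (A₁ * V ^ 6) * (A₂ * V ^ 6) * C' / β := by rw [hη]; field_simp
      _ ≤ (9 * C * β) * (9 * C * β) * C' / β := by gcongr
      _ = _ := by field_simp; norm_num
  linarith

lemma hm_eq_of_changeLevel_eq {r₁ r₂ n : ℕ} (hn : n ≠ 0) (h₁ : r₁ ∣ n) (h₂ : r₂ ∣ n)
    (χ₁ : DirichletCharacter ℂ r₁) (χ₂ : DirichletCharacter ℂ r₂) (p₁ : χ₁.IsPrimitive)
    (p₂ : χ₂.IsPrimitive) (h : DirichletCharacter.changeLevel h₁ χ₁ =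
      DirichletCharacter.changeLevel h₂ χ₂) : hm χ₁ = hm χ₂ := by
  have : NeZero n := ⟨hn⟩
  have e : r₁ = r₂ := by
    rw [DirichletCharacter.isPrimitive_def] at p₁ p₂
    rw [← p₁, ← p₂, ← DirichletCharacter.conductor_changeLevel _ h₁,
      ← DirichletCharacter.conductor_changeLevel _ h₂, h]
  subst e
  rw [DirichletCharacter.changeLevel_injective h₁ h]

/-- No primitive real character of conductor at most `Q` has a very small value near `1`. -/
def Good (β : ℝ) (Q : ℕ) : Prop := ∀ r : ℕ, r ≠ 0 → r ≤ Q → ∀ χ : DirichletCharacter ℂ r,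
  χ.IsPrimitive → χ ≠ 1 → χ * χ = 1 → ∀ σ : ℝ, 1 < σ → σ ≤ 2 →
    β ≤ ‖LSeries (hm χ ·) σ‖ * ll ((Q : ℝ) ^ 3) 0 ^ 9

lemma hm_changeLevel_mul {r₁ r₂ : ℕ} (h₁ : r₁ ≠ 0) (h₂ : r₂ ≠ 0) (χ₁ : DirichletCharacter ℂ r₁)
    (χ₂ : DirichletCharacter ℂ r₂) {p : ℕ} (hp : p ≠ 0) :
    hm (DirichletCharacter.changeLevel (Nat.dvd_mul_right r₁ r₂) χ₁ *
      DirichletCharacter.changeLevel (Nat.dvd_mul_left r₂ r₁) χ₂) p = hm χ₁ p * hm χ₂ p := by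
  have : NeZero (r₁ * r₂) := ⟨mul_ne_zero h₁ h₂⟩
  rw [hm_mul, mul_apply', hm_apply _ hp, hm_apply _ hp, hm_apply _ hp, hm_apply _ hp]
  by_cases h : IsUnit (p : ZMod (r₁ * r₂))
  · obtain ⟨u, hu⟩ := h
    rw [← hu, DirichletCharacter.changeLevel_eq_cast_of_dvd,
      DirichletCharacter.changeLevel_eq_cast_of_dvd, hu, ZMod.cast_natCast (Nat.dvd_mul_right _ _),
      ZMod.cast_natCast (Nat.dvd_mul_left _ _)]
  · rw [MulChar.map_nonunit _ h, zero_mul]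
    rw [ZMod.isUnit_iff_coprime, Nat.coprime_mul_iff_right, not_and_or] at h
    rcases h with h | h
    · rw [χ₁.map_nonunit (by rwa [ZMod.isUnit_iff_coprime]), zero_mul]
    · rw [χ₂.map_nonunit (by rwa [ZMod.isUnit_iff_coprime]), mul_zero]

theorem exists_good : ∃ β : ℝ, 0 < β ∧ ∀ Q₀ : ℕ, ∃ Q : ℕ, Q₀ ≤ Q ∧ Good β Q := by
  obtain ⟨β, hβ, hl⟩ := landau
  refine ⟨β, hβ, fun Q₁ ↦ ?_⟩
  by_contra! hbad
  obtain ⟨Q₀, hQ₀, hQ2⟩ : ∃ Q₀, Q₁ ≤ Q₀ ∧ 2 ≤ Q₀ := ⟨max Q₁ 2, le_max_left _ _, le_max_right _ _⟩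
  set q : ℕ → ℕ := fun j ↦ Q₀ ^ 2 ^ j with hq
  have hqj (j : ℕ) : j ≤ q j := by
    calc j ≤ 2 ^ j := Nat.lt_two_pow_self.le
      _ ≤ 2 ^ 2 ^ j := Nat.lt_two_pow_self.le
      _ ≤ _ := Nat.pow_le_pow_left hQ2 _
  have hq1 (j : ℕ) : 1 ≤ q j := Nat.one_le_pow _ _ (by lia)
  have hqs (j : ℕ) : q (j + 1) = q j ^ 2 := by simp only [hq, pow_succ, pow_mul]
  have hb (j : ℕ) : ¬ Good β (q j) :=
    hbad _ (hQ₀.trans (Nat.le_self_pow (by positivity) _))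
  simp only [Good] at hb
  push Not at hb
  choose r hr0 hr χ hp h1 h2 σ hσ1 hσ2 hs using hb
  have hK1 (j : ℕ) : (1 : ℝ) ≤ (q j : ℝ) ^ 3 := one_le_pow₀ (by exact_mod_cast hq1 j)
  have hll1 (j : ℕ) := one_le_ll (hK1 j) 0
  have step (j : ℕ) : hm (χ (j + 1)) = hm (χ j) := by
    have hr0' := mul_ne_zero (hr0 j) (hr0 (j + 1))
    refine (hm_eq_of_changeLevel_eq hr0' (Nat.dvd_mul_right _ _) (Nat.dvd_mul_left _ _) _ _ (hp j)
      (hp (j + 1)) ?_).symm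
    by_contra hne
    have i1 : r j * r (j + 1) ≤ q j ^ 3 := by
      calc _ ≤ q j * q (j + 1) := Nat.mul_le_mul (hr _) (hr _)
        _ = q j ^ 3 := by rw [hqs]; ring
    refine hl (hr0 j) (hr0 (j + 1)) hr0' (χ j) (χ (j + 1)) _ (h1 j) (h1 (j + 1)) ?_ (h2 j)
      (h2 (j + 1)) (fun p hp ↦ hm_changeLevel_mul (hr0 j) (hr0 (j + 1)) _ _ hp.ne_zero)
      ((q j : ℝ) ^ 3) ?_ ?_ ?_ (σ j) (σ (j + 1)) (hσ1 j) (hσ2 j) (hσ1 _) (hσ2 _) (hs j) ?_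
    · intro h
      refine hne ?_
      have e := congrArg (DirichletCharacter.changeLevel (Nat.dvd_mul_left (r (j + 1)) (r j)))
        (h2 (j + 1))
      rw [map_mul, map_one] at e
      exact mul_right_cancel (h.trans e.symm)
    · exact_mod_cast (Nat.le_mul_of_pos_right _ (Nat.pos_of_ne_zero (hr0 (j + 1)))).trans i1
    · exact_mod_cast (Nat.le_mul_of_pos_left _ (Nat.pos_of_ne_zero (hr0 j))).trans i1
    · exact_mod_cast i1
    · refine lt_of_le_of_lt ?_ (hs (j + 1))
      have := hll1 j
      gcongr
      refine ll_mono (hK1 j) ?_ 0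
      have : q j ≤ q (j + 1) := by rw [hqs]; exact Nat.le_self_pow (by norm_num) _
      gcongr
  have hconst (j : ℕ) : hm (χ j) = hm (χ 0) := by
    induction j with
    | zero => rfl
    | succ j ih => rw [step, ih]
  have lim0 : Filter.Tendsto (fun j ↦ β / ll ((q j : ℝ) ^ 3) 0) Filter.atTop (nhds 0) := by
    refine Filter.Tendsto.const_div_atTop ?_ β
    refine Real.tendsto_log_atTop.comp ?_
    refine Filter.tendsto_atTop_mono (fun j ↦ ?_) tendsto_natCast_atTop_atTop
    have a1 : (j : ℝ) ≤ q j := by exact_mod_cast hqj j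
    have a2 : (q j : ℝ) ≤ (q j : ℝ) ^ 3 :=
      le_self_pow₀ (by exact_mod_cast hq1 j) (by norm_num)
    have a3 := hK1 j
    rw [abs_zero, zero_add]
    linarith
  have hL (j : ℕ) : ‖LSeries (hm (χ 0) ·) (σ j)‖ ≤ β / ll ((q j : ℝ) ^ 3) 0 := by
    have := hll1 j
    rw [← hconst j, le_div_iff₀ (by positivity)]
    refine le_trans ?_ (hs j).le
    gcongr
    exact le_self_pow₀ this (by norm_num)
  have lim1 : Filter.Tendsto (fun j ↦ LSeries (hm (χ 0) ·) (σ j)) Filter.atTop (nhds 0) :=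
    squeeze_zero_norm hL lim0
  have lim2 : Filter.Tendsto σ Filter.atTop (nhds 1) := by
    refine tendsto_of_tendsto_of_tendsto_of_le_of_le tendsto_const_nhds
      (h := fun j ↦ 1 + 8 * (β / ll ((q j : ℝ) ^ 3) 0))
      (by simpa using (lim0.const_mul 8).const_add 1) (fun j ↦ (hσ1 j).le) fun j ↦ ?_
    have e1 := one_le_zt_mul (norm_hm_le (χ 0)) (realHom_hm (h2 0)) (hσ1 j)
    have e2 := norm_LSeries_zt_real_le (hσ1 j) (hσ2 j)
    have h0 : 0 < σ j - 1 := by linarith [hσ1 j]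
    have e3 : (σ j - 1) * 1 ≤ (σ j - 1) * (8 / (σ j - 1) * (β / ll ((q j : ℝ) ^ 3) 0)) := by
      gcongr
      exact e1.trans (by gcongr; exact hL j)
    have e4 : (σ j - 1) * (8 / (σ j - 1) * (β / ll ((q j : ℝ) ^ 3) 0)) =
      8 * (β / ll ((q j : ℝ) ^ 3) 0) := by field_simp
    show σ j ≤ 1 + 8 * (β / ll ((q j : ℝ) ^ 3) 0)
    linarith
  have : NeZero (r 0) := ⟨hr0 0⟩
  have lim3 : Filter.Tendsto (fun j ↦ DirichletCharacter.LFunction (χ 0) (σ j)) Filter.atTop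
      (nhds (DirichletCharacter.LFunction (χ 0) 1)) := by
    have hc : Continuous (DirichletCharacter.LFunction (χ 0)) :=
      (DirichletCharacter.differentiable_LFunction (h1 0)).continuous
    refine (hc.tendsto 1).comp ?_
    rw [← Complex.ofReal_one]
    exact (Complex.continuous_ofReal.tendsto 1).comp lim2
  refine DirichletCharacter.LFunction_apply_one_ne_zero (h1 0) (tendsto_nhds_unique lim3 ?_)
  refine lim1.congr fun j ↦ ?_
  rw [DirichletCharacter.LFunction_eq_LSeries _ (by simpa using hσ1 j)]
  refine LSeries_congr (fun {n} hn ↦ ?_) _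
  exact hm_apply _ hn

/-- A uniform lower bound for all nonprincipal primitive characters of conductor at most a good
`Q`. -/
theorem good_lower {β : ℝ} (hβ : 0 < β) : ∃ c : ℝ, 0 < c ∧ ∀ Q : ℕ, Good β Q →
    ∀ r : ℕ, r ≠ 0 → r ≤ Q → ∀ χ : DirichletCharacter ℂ r, χ.IsPrimitive → χ ≠ 1 →
    ∀ σ t : ℝ, 1 < σ → σ ≤ 2 →
      c ≤ ‖LSeries (hm χ ·) (σ + t * Complex.I)‖ * ll ((Q : ℝ) ^ 3) t ^ 21 := by
  obtain ⟨C, hC, hlip⟩ := lipschitz_LSeries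
  set τ := β / (2 * C) with hτ
  have hτ0 : 0 < τ := by positivity
  obtain ⟨c₁, hc₁, h₁⟩ := complex_lower
  obtain ⟨c₂, hc₂, h₂⟩ := real_lower hτ0
  refine ⟨min (min c₁ c₂) (β / 2), by positivity, fun Q hQ r hr hrQ χ hp h1 σ t hσ1 hσ2 ↦ ?_⟩
  set K := (Q : ℝ) ^ 3 with hK
  have hQ1 : (1 : ℝ) ≤ Q := by exact_mod_cast (Nat.one_le_iff_ne_zero.2 hr).trans hrQ
  have hK1 : 1 ≤ K := one_le_pow₀ hQ1
  have hrK : (r : ℝ) ≤ K := by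
    calc (r : ℝ) ≤ Q := by exact_mod_cast hrQ
      _ ≤ K := le_self_pow₀ hQ1 (by norm_num)
  have hl := one_le_ll hK1 t
  by_cases h2 : χ * χ = 1
  · rcases le_total τ (|t| * ll K t ^ 12) with ht | ht
    · exact ((min_le_left _ _).trans (min_le_right _ _)).trans
        (h₂ hr χ h1 h2 K hrK σ t hσ1 hσ2 ht)
    · refine (min_le_right _ _).trans ?_
      have e1 := hQ r hr hrQ χ hp h1 h2 σ hσ1 hσ2
      rw [← hK] at e1
      have e2 := hlip _ K ((controlled_char hr h1).mono hrK) t (σ + t * Complex.I) σ (by simpa)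
        (by simpa) (by simp) (by simpa) (by simpa) (by simp)
      rw [LSeries_pf_dl, LSeries_pf_dl, add_sub_cancel_left, norm_mul, Complex.norm_I, mul_one,
        Complex.norm_real, Real.norm_eq_abs] at e2
      have e3 := norm_sub_norm_le (LSeries (hm χ ·) σ) (LSeries (hm χ ·) (σ + t * Complex.I))
      rw [norm_sub_rev] at e3
      set X := ‖LSeries (hm χ ·) σ‖
      set Y := ‖LSeries (hm χ ·) (σ + t * Complex.I)‖
      have e4 : β ≤ X * ll K t ^ 9 := by
        refine e1.trans ?_
        have := one_le_ll hK1 0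
        gcongr
        exact ll_mono_right hK1 (by simp)
      have e5 : (X - Y) * ll K t ^ 9 ≤ β / 2 := by
        calc (X - Y) * ll K t ^ 9 ≤ C * ll K t ^ 3 * |t| * ll K t ^ 9 := by
              gcongr; linarith
          _ = C * (|t| * ll K t ^ 12) := by ring
          _ ≤ C * τ := by gcongr
          _ = β / 2 := by rw [hτ]; field_simp
      calc β / 2 ≤ Y * ll K t ^ 9 := by linarith
        _ ≤ Y * ll K t ^ 21 := by gcongr <;> norm_num
  · refine ((min_le_left _ _).trans (min_le_left _ _)).trans
      ((h₁ hr χ h2 K hrK σ t hσ1 hσ2).trans ?_)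
    gcongr <;> norm_num

open scoped FourierTransform SchwartzMap in
lemma exists_fourier {h : ℝ → ℂ} (h1 : ContDiff ℝ (⊤ : ℕ∞) h) (h2 : HasCompactSupport h) :
    ∃ (F : ℝ → ℂ) (C : ℝ), 0 < C ∧ Continuous F ∧ (∀ w, ‖F w‖ ≤ C * ((1 + w ^ 2) ^ 2)⁻¹) ∧
      ∀ u, h u = ∫ w : ℝ, F w * Complex.exp (2 * Real.pi * w * u * Complex.I) := by
  let f : 𝓢(ℝ, ℂ) := h2.toSchwartzMap h1
  obtain ⟨C0, h0⟩ := (𝓕 f : 𝓢(ℝ, ℂ)).decay 0 0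
  obtain ⟨C4, h4⟩ := (𝓕 f : 𝓢(ℝ, ℂ)).decay 4 0
  refine ⟨⇑(𝓕 f : 𝓢(ℝ, ℂ)), 2 * (C0 + C4), by linarith [h0.1, h4.1], (𝓕 f).continuous, fun w ↦ ?_, fun u ↦ ?_⟩
  · have a0 := h0.2 w
    have a4 := h4.2 w
    simp only [pow_zero, one_mul, norm_iteratedFDeriv_zero, Real.norm_eq_abs] at a0 a4
    rw [← div_eq_mul_inv, le_div_iff₀ (by positivity)]
    have e : |w| ^ 4 = w ^ 4 := by rw [← abs_pow, abs_of_nonneg (by positivity)]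
    rw [e] at a4
    have : (1 + w ^ 2) ^ 2 ≤ 2 * (1 + w ^ 4) := by nlinarith [sq_nonneg (w ^ 2 - 1)]
    calc _ ≤ ‖(𝓕 f) w‖ * (2 * (1 + w ^ 4)) := by gcongr
      _ ≤ _ := by nlinarith
  · have e : h u = (𝓕⁻ (𝓕 f)) u := by
      rw [FourierTransform.fourierInv_fourier_eq]; rfl
    rw [e, SchwartzMap.fourierInv_coe, Real.fourierInv_eq']
    refine MeasureTheory.integral_congr_ae (.of_forall fun w ↦ ?_)
    simp only [smul_eq_mul, RCLike.inner_apply, conj_trivial]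
    rw [mul_comm]
    congr 2
    push_cast
    ring

/-- The smooth weight `(n/x)^{-σ} h(log(n/x))`. -/
def wt (h : ℝ → ℂ) (x σ : ℝ) (n : ℕ) : ℂ := (((n / x : ℝ) ^ (-σ) : ℝ) : ℂ) * h (Real.log (n / x))

/-- The smoothed sum of `a` at scale `x`. -/
def ssum (h : ℝ → ℂ) (x σ : ℝ) (a : ArithmeticFunction ℂ) : ℂ :=
  ∑ n ∈ Finset.Icc 1 ⌊Real.exp 1 * x⌋₊, a n * wt h x σ n

lemma wt_eq_zero {h : ℝ → ℂ} (hs : ∀ u, 1 < |u| → h u = 0) {x : ℝ} (hx : 0 < x) (σ : ℝ) {n : ℕ}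
    (hn : n ≠ 0) (hn' : Real.exp 1 * x < n ∨ Real.exp 1 * n < x) : wt h x σ n = 0 := by
  have hn0 : (0 : ℝ) < n := by positivity
  rw [wt, hs, mul_zero]
  rw [lt_abs, Real.log_div hn0.ne' hx.ne']
  rcases hn' with h1 | h1
  · left
    have := Real.log_lt_log (by positivity) h1
    rw [Real.log_mul (Real.exp_ne_zero _) hx.ne', Real.log_exp] at this
    linarith
  · right
    have := Real.log_lt_log (by positivity) h1
    rw [Real.log_mul (Real.exp_ne_zero _) hn0.ne', Real.log_exp] at this
    linarith

lemma ssum_eq_tsum {h : ℝ → ℂ} (hs : ∀ u, 1 < |u| → h u = 0) {x : ℝ} (hx : 0 < x) (σ : ℝ)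
    (a : ArithmeticFunction ℂ) : ssum h x σ a = ∑' n, a n * wt h x σ n := by
  rw [ssum, tsum_eq_sum]
  intro n hn
  rcases eq_or_ne n 0 with rfl | h0
  · simp
  · rw [wt_eq_zero hs hx σ h0, mul_zero]
    left
    refine Nat.lt_of_floor_lt ?_
    by_contra! hle
    exact hn (Finset.mem_Icc.2 ⟨Nat.one_le_iff_ne_zero.2 h0, hle⟩)

lemma ssum_add (h : ℝ → ℂ) (x σ : ℝ) (a b : ArithmeticFunction ℂ) :
    ssum h x σ (a + b) = ssum h x σ a + ssum h x σ b := by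
  simp [ssum, add_mul, Finset.sum_add_distrib]

lemma ssum_congr {h : ℝ → ℂ} (hs : ∀ u, 1 < |u| → h u = 0) {x : ℝ} (hx : 0 < x) {σ : ℝ}
    {a b : ArithmeticFunction ℂ}
    (hab : ∀ n : ℕ, n ≠ 0 → n ≤ Real.exp 1 * x → x ≤ Real.exp 1 * n → a n = b n) :
    ssum h x σ a = ssum h x σ b := by
  refine Finset.sum_congr rfl fun n hn ↦ ?_
  have hn' := Finset.mem_Icc.1 hn
  have h0 : n ≠ 0 := by lia
  by_cases h1 : Real.exp 1 * x < n ∨ Real.exp 1 * n < x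
  · rw [wt_eq_zero hs hx σ h0 h1, mul_zero, mul_zero]
  · push Not at h1
    rw [hab n h0 h1.1 h1.2]

lemma LSeriesSummable_of_re_eq {a : ℕ → ℂ} {s s' : ℂ} (h : s.re = s'.re)
    (hs : LSeriesSummable a s) : LSeriesSummable a s' :=
  hs.of_re_le_re h.le

/-- Sums with a smooth weight are controlled by the Dirichlet series. -/
theorem norm_ssum_le {h : ℝ → ℂ} (h1 : ContDiff ℝ (⊤ : ℕ∞) h) (hs : ∀ u, 1 < |u| → h u = 0) :
    ∃ C : ℝ, 0 < C ∧ ∀ (x σ : ℝ), 0 < x → ∀ (a : ArithmeticFunction ℂ) (G : ℝ),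
      LSeriesSummable (a ·) σ →
      (∀ t : ℝ, ‖LSeries (a ·) (σ + t * Complex.I)‖ ≤ G * (1 + t ^ 2)) →
      ‖ssum h x σ a‖ ≤ C * x ^ σ * G := by
  have h2 : HasCompactSupport h := by
    refine HasCompactSupport.intro (isCompact_Icc (a := (-1 : ℝ)) (b := 1)) fun u hu ↦ hs u ?_
    by_contra! hle
    exact hu (abs_le.1 hle)
  obtain ⟨F, C, hC, hFc, hF, hinv⟩ := exists_fourier h1 h2
  set D : ℝ := C * (2 * Real.pi) ^ 2 with hD
  have hint : MeasureTheory.Integrable (fun w : ℝ ↦ (1 + w ^ 2)⁻¹) := integrable_inv_one_add_sq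
  have hFint : MeasureTheory.Integrable F := by
    refine (hint.const_mul C).mono' hFc.aestronglyMeasurable (.of_forall fun w ↦ (hF w).trans ?_)
    gcongr
    exact le_self_pow₀ (by nlinarith [sq_nonneg w]) (by norm_num)
  refine ⟨D * ∫ w : ℝ, (1 + w ^ 2)⁻¹, ?_, fun x σ hx a G ha hG ↦ ?_⟩
  · rw [integral_univ_inv_one_add_sq]
    have := Real.pi_pos
    positivity
  set s : ℝ → ℂ := fun w ↦ σ + (-(2 * Real.pi * w) : ℝ) * Complex.I with hs'
  have hsre (w : ℝ) : (s w).re = σ := by simp [hs']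
  have hsc : Continuous s := by fun_prop
  set P : ℝ → ℂ := fun w ↦ F w * (x : ℂ) ^ (s w) with hP
  have hxc : Continuous fun w ↦ (x : ℂ) ^ (s w) :=
    hsc.const_cpow (Or.inl (by exact_mod_cast hx.ne'))
  have hxn (w : ℝ) : ‖(x : ℂ) ^ (s w)‖ = x ^ σ := by
    rw [Complex.norm_cpow_eq_rpow_re_of_pos hx, hsre]
  have hPint : MeasureTheory.Integrable P := by
    refine (hFint.norm.mul_const (x ^ σ)).mono' (hFc.mul hxc).aestronglyMeasurable
      (.of_forall fun w ↦ ?_)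
    rw [hP, norm_mul, hxn]
  have htc (n : ℕ) : Continuous fun w ↦ LSeries.term (a ·) (s w) n := by
    rcases eq_or_ne n 0 with rfl | hn
    · simp only [LSeries.term_zero]; fun_prop
    · simp only [LSeries.term_of_ne_zero hn]
      refine continuous_const.div ?_ fun w ↦ ?_
      · exact hsc.const_cpow (Or.inl (by exact_mod_cast hn))
      · simp [Complex.cpow_eq_zero_iff, hn]
  have htn (w : ℝ) (n : ℕ) : ‖LSeries.term (a ·) (s w) n‖ = ‖LSeries.term (a ·) σ n‖ := by
    rw [LSeries.norm_term_eq, LSeries.norm_term_eq, hsre, Complex.ofReal_re]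
  have hterm (n : ℕ) : a n * wt h x σ n = ∫ w, P w * LSeries.term (a ·) (s w) n := by
    rcases eq_or_ne n 0 with rfl | hn
    · simp
    have hn0 : (0 : ℝ) < n := by positivity
    rw [wt, hinv, ← MeasureTheory.integral_const_mul, ← MeasureTheory.integral_const_mul]
    refine MeasureTheory.integral_congr_ae (.of_forall fun w ↦ ?_)
    simp only [hP, LSeries.term_of_ne_zero hn]
    have e1 : (((n / x : ℝ) ^ (-σ) : ℝ) : ℂ) *
        Complex.exp (2 * Real.pi * w * (Real.log (n / x) : ℝ) * Complex.I) =
        (x : ℂ) ^ (s w) / (n : ℂ) ^ (s w) := by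
      rw [Complex.cpow_def_of_ne_zero (by exact_mod_cast hx.ne'),
        Complex.cpow_def_of_ne_zero (by exact_mod_cast hn), ← Complex.exp_sub,
        Real.rpow_def_of_pos (by positivity), Complex.ofReal_exp, ← Complex.exp_add,
        Real.log_div hn0.ne' hx.ne', Complex.ofReal_mul, Complex.ofReal_sub, Complex.ofReal_log hx.le,
        Complex.ofReal_log hn0.le]
      congr 1
      simp only [hs']
      push_cast
      ring
    linear_combination (a n * F w) * e1
  have hsum : Summable fun n ↦ ∫ w, ‖P w * LSeries.term (a ·) (s w) n‖ := by
    simp only [norm_mul, htn, MeasureTheory.integral_mul_const]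
    exact (ha.norm).mul_left _
  have hhs := MeasureTheory.hasSum_integral_of_summable_integral_norm (fun n ↦ ?_) hsum
  swap
  · refine (hPint.norm.mul_const ‖LSeries.term (a ·) σ n‖).mono'
      (hPint.aestronglyMeasurable.mul (htc n).aestronglyMeasurable) (.of_forall fun w ↦ ?_)
    rw [norm_mul, htn]
  rw [ssum_eq_tsum hs hx, tsum_congr hterm, hhs.tsum_eq]
  have hb : ∀ w, ‖∑' n, P w * LSeries.term (a ·) (s w) n‖ ≤ (D * x ^ σ * G) * (1 + w ^ 2)⁻¹ := by
    intro w
    rw [tsum_mul_left, norm_mul]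
    have hG0 : 0 ≤ G := by simpa using (norm_nonneg _).trans (hG 0)
    have e1 : ‖P w‖ ≤ C * ((1 + w ^ 2) ^ 2)⁻¹ * x ^ σ := by
      rw [hP, norm_mul, hxn]; gcongr; exact hF w
    have e2 : ‖∑' n, LSeries.term (a ·) (s w) n‖ ≤ G * ((2 * Real.pi) ^ 2 * (1 + w ^ 2)) := by
      refine (hG _).trans ?_
      gcongr
      have := Real.pi_gt_three
      nlinarith [sq_nonneg w, sq_nonneg Real.pi]
    calc _ ≤ C * ((1 + w ^ 2) ^ 2)⁻¹ * x ^ σ * (G * ((2 * Real.pi) ^ 2 * (1 + w ^ 2))) := by gcongr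
      _ = _ := by rw [hD]; field_simp
  refine (MeasureTheory.norm_integral_le_of_norm_le (hint.const_mul _) (.of_forall hb)).trans ?_
  rw [MeasureTheory.integral_const_mul]
  exact le_of_eq (by ring)

/-- Version of `norm_ssum_le` for families. -/
theorem sum_norm_ssum_le {h : ℝ → ℂ} (h1 : ContDiff ℝ (⊤ : ℕ∞) h) (hs : ∀ u, 1 < |u| → h u = 0) :
    ∃ C : ℝ, 0 < C ∧ ∀ (x σ : ℝ), 0 < x → ∀ {ι : Type} (X : Finset ι)
      (a : ι → ArithmeticFunction ℂ) (G : ℝ), (∀ i ∈ X, LSeriesSummable (a i ·) σ) →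
      (∀ t : ℝ, ∑ i ∈ X, ‖LSeries (a i ·) (σ + t * Complex.I)‖ ≤ G * (1 + t ^ 2)) →
      ∑ i ∈ X, ‖ssum h x σ (a i)‖ ≤ C * x ^ σ * G := by
  obtain ⟨C, hC, hmain⟩ := norm_ssum_le h1 hs
  refine ⟨C, hC, fun x σ hx ι X a G ha hG ↦ ?_⟩
  have hu (z : ℂ) : ∃ u : ℂ, ‖u‖ ≤ 1 ∧ u * z = ‖z‖ := by
    rcases eq_or_ne z 0 with rfl | hz
    · exact ⟨0, by simp, by simp⟩
    · refine ⟨‖z‖ / z, ?_, by field_simp⟩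
      rw [norm_div, Complex.norm_real, norm_norm, div_self (norm_ne_zero_iff.2 hz)]
  choose u hu1 hu2 using fun i ↦ hu (ssum h x σ (a i))
  set b : ArithmeticFunction ℂ := ⟨fun n ↦ ∑ i ∈ X, u i * a i n, by simp⟩ with hb
  have hbL (s : ℂ) (hsr : s.re = σ) :
      LSeriesSummable (b ·) s ∧ LSeries (b ·) s = ∑ i ∈ X, u i * LSeries (a i ·) s := by
    have hh (i : ι) (hi : i ∈ X) : LSeriesSummable (fun n ↦ u i * a i n) s :=
      (LSeriesSummable_of_re_eq (by simp [hsr]) (ha i hi)).smul (u i)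
    have e : (b ·) = ∑ i ∈ X, fun n ↦ u i * a i n := by
      ext n
      simp [hb]
    rw [e]
    refine ⟨LSeriesSummable.sum hh, ?_⟩
    rw [LSeries_sum hh]
    refine Finset.sum_congr rfl fun i _ ↦ ?_
    exact LSeries_smul _ _ _
  have e : ∑ i ∈ X, ‖ssum h x σ (a i)‖ = ‖ssum h x σ b‖ := by
    have e1 : ssum h x σ b = ((∑ i ∈ X, ‖ssum h x σ (a i)‖ : ℝ) : ℂ) := by
      rw [Complex.ofReal_sum, ← Finset.sum_congr rfl fun i _ ↦ hu2 i]
      simp only [ssum, hb, coe_mk, Finset.mul_sum, Finset.sum_mul]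
      rw [Finset.sum_comm]
      refine Finset.sum_congr rfl fun i _ ↦ Finset.sum_congr rfl fun n _ ↦ by ring
    rw [e1, Complex.norm_of_nonneg (by positivity)]
  rw [e]
  refine hmain x σ hx b G (hbL σ (by simp)).1 fun t ↦ ?_
  rw [(hbL (σ + t * Complex.I) (by simp)).2]
  refine (norm_sum_le _ _).trans (le_trans (Finset.sum_le_sum fun i _ ↦ ?_) (hG t))
  rw [norm_mul]
  exact mul_le_of_le_one_left (norm_nonneg _) (hu1 i)

/-- Small conductors: a lower bound for the Dirichlet series gives a bound for sums over primes
weighted by a power of the logarithm. -/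
theorem norm_ssum_lg_pl_le {h : ℝ → ℂ} (h1 : ContDiff ℝ (⊤ : ℕ∞) h)
    (hs : ∀ u, 1 < |u| → h u = 0) (B J : ℕ) {b : ℝ} (hb : 0 < b) :
    ∃ C : ℝ, 0 < C ∧ ∃ N : ℕ, ∀ (g₁ g₂ : ℕ →*₀ ℂ) (K : ℝ), (∀ n, ‖g₁ n‖ ≤ 1) →
      (∀ n, ‖g₂ n‖ ≤ 1) → Controlled (pf g₁ g₂) K → ∀ σ : ℝ, 1 < σ → σ ≤ 2 →
      (∀ t : ℝ, b ≤ ‖LSeries (pf g₁ g₂ ·) (σ + t * Complex.I)‖ * ll K t ^ B) →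
      ∀ x : ℝ, 0 < x →
        ‖ssum h x σ (lg^[J] (pl g₁ g₂))‖ ≤ C * x ^ σ * (1 + Real.log K) ^ N := by
  obtain ⟨C₁, hC₁, hm⟩ := norm_ssum_le h1 hs
  obtain ⟨C₂, hC₂, N, hp⟩ := norm_LSeries_lg_pl_le B (c := b / 2 ^ B) (by positivity) J
  set D : ℝ := 8 ^ N * N.factorial * Real.exp 1 with hD
  have hD0 : 0 < D := by positivity
  refine ⟨C₁ * (C₂ * (D * 5)), by positivity, N, fun g₁ g₂ K n₁ n₂ hc σ σ1 σ2 hlow x hx ↦ ?_⟩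
  have hK0 : 0 < K := by linarith [hc.one_le]
  have hlK : 0 ≤ Real.log K := Real.log_nonneg hc.one_le
  have key : ‖ssum h x σ (lg^[J] (pl g₁ g₂))‖ ≤
      C₁ * x ^ σ * (C₂ * (D * 5) * (1 + Real.log K) ^ N) := by
    refine hm x σ hx _ _ (LSeriesSummable_lg_pl n₁ n₂ J (by simpa)) fun t ↦ ?_
    set s : ℂ := σ + t * Complex.I with hs'
    have hsre : s.re = σ := by simp [hs']
    have hsim : s.im = t := by simp [hs']
    have hl1 : 1 < s.re := by rw [hsre]; exact σ1
    have hcL := one_le_cL hc.one_le hl1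
    have e1 : b / 2 ^ B ≤ ‖LSeries (pf g₁ g₂ ·) s‖ * cL K s ^ B := by
      rw [div_le_iff₀ (by positivity)]
      refine (hlow t).trans ?_
      have := ll_le_two_mul_cL hc.one_le hl1
      rw [hsim] at this
      have h0 := one_le_ll hc.one_le t
      calc _ ≤ ‖LSeries (pf g₁ g₂ ·) s‖ * (2 * cL K s) ^ B := by gcongr
        _ = _ := by ring
    refine (hp g₁ g₂ K s n₁ n₂ hc.one_le hc.sum_le hl1 e1).trans ?_
    have e2 : ‖s‖ ≤ 2 + |t| := by
      refine (Complex.norm_le_abs_re_add_abs_im s).trans ?_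
      rw [hsre, hsim, abs_of_pos (by linarith)]
      linarith
    have ht := abs_nonneg t
    have e3 : cL K s ≤ (1 + Real.log K) * (1 + Real.log (4 + |t|)) := by
      have h4 : 0 ≤ Real.log (4 + |t|) := Real.log_nonneg (by linarith)
      have h5 : cL K s ≤ Real.log K + Real.log (4 + |t|) := by
        rw [cL, ← Real.log_mul hK0.ne' (by positivity)]
        exact Real.log_le_log (by positivity)
          (mul_le_mul_of_nonneg_left (by linarith) hK0.le)
      nlinarith
    have e4 := one_add_log_pow_le N (u := 4 + |t|) (by linarith)
    have e5 : (4 + |t|) ^ (1 / 8 : ℝ) ≤ 5 * (1 + t ^ 2) := by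
      calc (4 + |t|) ^ (1 / 8 : ℝ) ≤ (4 + |t|) ^ (1 : ℝ) :=
            Real.rpow_le_rpow_of_exponent_le (by linarith) (by norm_num)
        _ = 4 + |t| := Real.rpow_one _
        _ ≤ _ := by rw [← sq_abs t]; nlinarith [sq_nonneg (|t| - 1)]
    calc C₂ * cL K s ^ N ≤ C₂ * ((1 + Real.log K) * (1 + Real.log (4 + |t|))) ^ N := by gcongr
      _ = C₂ * (1 + Real.log K) ^ N * (1 + Real.log (4 + |t|)) ^ N := by
        rw [mul_pow]; ring
      _ ≤ C₂ * (1 + Real.log K) ^ N * (D * (5 * (1 + t ^ 2))) := by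
        gcongr
        exact e4.trans (by rw [← hD]; gcongr)
      _ = _ := by ring
  exact key.trans (le_of_eq (by ring))

/-- The duality principle for the large sieve. -/
lemma duality {ι : Type} (X : Finset ι) (S : Finset ℕ) (φ : ι → ℕ → ℂ) (w : ℕ → ℝ) (Δ : ℝ)
    (hw : ∀ n ∈ S, 0 < w n) (hΔ0 : 0 ≤ Δ)
    (hΔ : ∀ i ∈ X, ∑ i' ∈ X, ‖∑ n ∈ S, w n * (φ i n * star (φ i' n))‖ ≤ Δ) (c : ℕ → ℂ) :
    ∑ i ∈ X, ‖∑ n ∈ S, c n * φ i n‖ ^ 2 ≤ Δ * ∑ n ∈ S, ‖c n‖ ^ 2 / w n := by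
  classical
  set s : ι → ℂ := fun i ↦ ∑ n ∈ S, c n * φ i n with hs
  set T : ℝ := ∑ i ∈ X, ‖s i‖ ^ 2 with hT
  set E : ℝ := ∑ n ∈ S, ‖c n‖ ^ 2 / w n with hE
  have hT0 : 0 ≤ T := Finset.sum_nonneg fun i _ ↦ by positivity
  have hE0 : 0 ≤ E := Finset.sum_nonneg fun n hn ↦ div_nonneg (by positivity) (hw n hn).le
  set b : ℕ → ℂ := fun n ↦ ∑ i ∈ X, star (s i) * φ i n with hb
  set V : ℝ := ∑ n ∈ S, w n * ‖b n‖ ^ 2 with hV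
  have e1 : (T : ℂ) = ∑ n ∈ S, c n * b n := by
    calc (T : ℂ) = ∑ i ∈ X, star (s i) * s i := by
          rw [hT]; push_cast
          refine Finset.sum_congr rfl fun i _ ↦ ?_
          rw [← Complex.conj_mul']; rfl
      _ = ∑ i ∈ X, ∑ n ∈ S, c n * (star (s i) * φ i n) := by
          refine Finset.sum_congr rfl fun i _ ↦ ?_
          conv_lhs => rw [show s i = ∑ n ∈ S, c n * φ i n from rfl, Finset.mul_sum]
          exact Finset.sum_congr rfl fun n _ ↦ by ring
      _ = _ := by
          rw [Finset.sum_comm]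
          simp only [hb, Finset.mul_sum]
  have e2 : T ^ 2 ≤ E * V := by
    have h1 : T ≤ ∑ n ∈ S, ‖c n‖ * ‖b n‖ := by
      have : ‖(T : ℂ)‖ = T := by rw [Complex.norm_real, Real.norm_of_nonneg hT0]
      rw [← this, e1]
      refine (norm_sum_le _ _).trans (Finset.sum_le_sum fun n _ ↦ (norm_mul _ _).le)
    refine (pow_le_pow_left₀ hT0 h1 2).trans ?_
    refine Finset.sum_sq_le_sum_mul_sum_of_sq_le_mul _
      (fun n hn ↦ div_nonneg (by positivity) (hw n hn).le)
      (fun n hn ↦ mul_nonneg (hw n hn).le (by positivity)) fun n hn ↦ ?_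
    rw [mul_pow]
    have := (hw n hn).ne'
    field_simp
    exact le_rfl
  have e3 : (V : ℂ) = ∑ i ∈ X, ∑ i' ∈ X, star (s i) * s i' *
      ∑ n ∈ S, w n * (φ i n * star (φ i' n)) := by
    rw [hV]; push_cast
    have : ∀ n ∈ S, (w n : ℂ) * (‖b n‖ : ℂ) ^ 2 = ∑ i ∈ X, ∑ i' ∈ X, star (s i) * s i' *
        (w n * (φ i n * star (φ i' n))) := by
      intro n _
      rw [← Complex.mul_conj', hb]
      simp only [map_sum, map_mul]
      rw [Finset.sum_mul_sum, Finset.mul_sum]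
      refine Finset.sum_congr rfl fun i _ ↦ ?_
      rw [Finset.mul_sum]
      refine Finset.sum_congr rfl fun i' _ ↦ ?_
      simp only [Complex.star_def, Complex.conj_conj]
      ring
    rw [Finset.sum_congr rfl this, Finset.sum_comm]
    refine Finset.sum_congr rfl fun i _ ↦ ?_
    rw [Finset.sum_comm]
    refine Finset.sum_congr rfl fun i' _ ↦ ?_
    exact (Finset.mul_sum _ _ _).symm
  have e4 : V ≤ Δ * T := by
    set G : ι → ι → ℝ := fun i i' ↦ ‖∑ n ∈ S, (w n : ℂ) * (φ i n * star (φ i' n))‖ with hG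
    have hsym : ∀ i i', G i i' = G i' i := by
      intro i i'
      have h0 : ∑ n ∈ S, (w n : ℂ) * (φ i' n * star (φ i n)) =
          star (∑ n ∈ S, (w n : ℂ) * (φ i n * star (φ i' n))) := by
        rw [star_sum]
        refine Finset.sum_congr rfl fun n _ ↦ ?_
        simp only [star_mul', Complex.star_def, Complex.conj_ofReal, Complex.conj_conj]
        ring
      simp only [hG]
      rw [h0, norm_star]
    have hV0 : 0 ≤ V := Finset.sum_nonneg fun n hn ↦ mul_nonneg (hw n hn).le (by positivity)
    have h1 : V ≤ ∑ i ∈ X, ∑ i' ∈ X, (‖s i‖ ^ 2 / 2 * G i i' + ‖s i'‖ ^ 2 / 2 * G i i') := by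
      have : ‖(V : ℂ)‖ = V := by rw [Complex.norm_real, Real.norm_of_nonneg hV0]
      rw [← this, e3]
      refine (norm_sum_le _ _).trans (Finset.sum_le_sum fun i _ ↦ ?_)
      refine (norm_sum_le _ _).trans (Finset.sum_le_sum fun i' _ ↦ ?_)
      rw [norm_mul, norm_mul, norm_star, ← add_mul]
      refine mul_le_mul_of_nonneg_right ?_ (norm_nonneg _)
      nlinarith [sq_nonneg (‖s i‖ - ‖s i'‖)]
    have h2 : ∑ i ∈ X, ∑ i' ∈ X, ‖s i‖ ^ 2 / 2 * G i i' ≤ Δ * T / 2 := by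
      rw [hT, mul_div_assoc, Finset.sum_div, Finset.mul_sum]
      refine Finset.sum_le_sum fun i hi ↦ ?_
      rw [← Finset.mul_sum, mul_comm]
      exact mul_le_mul_of_nonneg_right (hΔ i hi) (by positivity)
    have h3 : ∑ i ∈ X, ∑ i' ∈ X, ‖s i'‖ ^ 2 / 2 * G i i' ≤ Δ * T / 2 := by
      rw [Finset.sum_comm]
      refine le_trans (le_of_eq ?_) h2
      exact Finset.sum_congr rfl fun i _ ↦ Finset.sum_congr rfl fun i' _ ↦ by rw [hsym i' i]
    simp only [Finset.sum_add_distrib] at h1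
    linarith
  rcases hT0.eq_or_lt with h0 | h0
  · rw [← h0]; positivity
  · have h5 : T ^ 2 ≤ Δ * E * T := by nlinarith
    nlinarith

/-- Primitive characters of modulus at most `Q`. -/
structure PrimChars (X : Finset (Σ r : ℕ, DirichletCharacter ℂ r)) (Q : ℝ) : Prop where
  ne : ∀ i ∈ X, i.1 ≠ 0
  le : ∀ i ∈ X, (i.1 : ℝ) ≤ Q
  prim : ∀ i ∈ X, i.2.IsPrimitive

lemma PrimChars.card_le {X : Finset (Σ r : ℕ, DirichletCharacter ℂ r)} {Q : ℝ}
    (h : PrimChars X Q) (hQ : 0 ≤ Q) : (X.card : ℝ) ≤ Q ^ 2 := by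
  classical
  have h1 : X.card = ∑ r ∈ Finset.Icc 1 ⌊Q⌋₊, (X.filter fun i ↦ i.1 = r).card := by
    refine Finset.card_eq_sum_card_fiberwise fun i hi ↦ ?_
    simp only [Finset.coe_Icc, Set.mem_Icc]
    exact ⟨Nat.one_le_iff_ne_zero.2 (h.ne i hi), Nat.le_floor (h.le i hi)⟩
  have h2 : ∀ r ∈ Finset.Icc 1 ⌊Q⌋₊, (X.filter fun i ↦ i.1 = r).card ≤ ⌊Q⌋₊ := by
    intro r hr
    rw [Finset.mem_Icc] at hr
    have : NeZero r := ⟨by omega⟩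
    have h3 : (X.filter fun i ↦ i.1 = r) ⊆ (Finset.univ : Finset (DirichletCharacter ℂ r)).image
        fun χ ↦ (⟨r, χ⟩ : Σ r : ℕ, DirichletCharacter ℂ r) := by
      rintro ⟨r', χ⟩ hi
      obtain rfl : r' = r := (Finset.mem_filter.1 hi).2
      exact Finset.mem_image.2 ⟨χ, Finset.mem_univ _, rfl⟩
    refine (Finset.card_le_card h3).trans (Finset.card_image_le.trans ?_)
    rw [Finset.card_univ, ← Nat.card_eq_fintype_card,
      DirichletCharacter.card_eq_totient_of_hasEnoughRootsOfUnity]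
    exact (Nat.totient_le r).trans hr.2
  have h4 : X.card ≤ ⌊Q⌋₊ * ⌊Q⌋₊ := by
    rw [h1]
    refine (Finset.sum_le_card_nsmul _ _ _ h2).trans (by simp)
  calc (X.card : ℝ) ≤ (⌊Q⌋₊ : ℝ) * ⌊Q⌋₊ := by exact_mod_cast h4
    _ ≤ Q * Q := by gcongr <;> exact Nat.floor_le hQ
    _ = _ := by ring

lemma hm_inv_apply {r : ℕ} (χ : DirichletCharacter ℂ r) (n : ℕ) :
    hm χ⁻¹ n = star (hm χ n) := by
  rcases eq_or_ne n 0 with rfl | hn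
  · simp
  · rw [hm_apply _ hn, hm_apply _ hn, MulChar.star_apply']

lemma changeLevel_mul_inv_ne_one {i j : Σ r : ℕ, DirichletCharacter ℂ r} (hi : i.1 ≠ 0)
    (hj : j.1 ≠ 0) (pi : i.2.IsPrimitive) (pj : j.2.IsPrimitive) (hij : i ≠ j) :
    DirichletCharacter.changeLevel (Nat.dvd_mul_right i.1 j.1) i.2 *
      DirichletCharacter.changeLevel (Nat.dvd_mul_left j.1 i.1) j.2⁻¹ ≠ 1 := by
  obtain ⟨r, χ⟩ := i
  obtain ⟨r', χ'⟩ := j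
  intro h
  have : NeZero (r * r') := ⟨mul_ne_zero hi hj⟩
  rw [map_inv, mul_inv_eq_one] at h
  have e : r = r' := by
    rw [DirichletCharacter.isPrimitive_def] at pi pj
    simp only at pi pj
    rw [← pi, ← pj, ← DirichletCharacter.conductor_changeLevel _ (Nat.dvd_mul_right r r'),
      ← DirichletCharacter.conductor_changeLevel _ (Nat.dvd_mul_left r' r), h]
  subst e
  have hχ : χ = χ' := DirichletCharacter.changeLevel_injective _ h
  exact hij (by rw [hχ])

/-- The large sieve inequality for primitive characters, in a weak logarithmic form. -/
theorem large_sieve : ∃ C : ℝ, 0 < C ∧ ∀ (X : Finset (Σ r : ℕ, DirichletCharacter ℂ r)) (Q : ℝ),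
    PrimChars X Q → 0 ≤ Q → ∀ σ U Z : ℝ, 1 < σ → σ ≤ 2 → 1 ≤ U → U ≤ Z → ∀ c : ℕ → ℂ,
    ∑ i ∈ X, ‖∑ n ∈ Finset.Ioc ⌊U⌋₊ ⌊Z⌋₊, c n * hm i.2 n‖ ^ 2 ≤
      (1 + Real.log Z + C * Q ^ 4 * U ^ (-(1 / 8) : ℝ)) *
        ∑ n ∈ Finset.Ioc ⌊U⌋₊ ⌊Z⌋₊, ‖c n‖ ^ 2 * (n : ℝ) ^ σ := by
  classical
  obtain ⟨C, hC, hl⟩ := norm_sum_Ioc_lw_le 0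
  refine ⟨C * 3, by positivity, fun X Q hX hQ σ U Z σ1 σ2 hU hUZ c ↦ ?_⟩
  have hpos : ∀ n ∈ Finset.Ioc ⌊U⌋₊ ⌊Z⌋₊, (0 : ℝ) < n := by
    intro n hn
    rw [Finset.mem_Ioc] at hn
    exact_mod_cast (by omega : 0 < n)
  refine (duality X _ (fun i n ↦ hm i.2 n) (fun n ↦ (n : ℝ) ^ (-σ))
    (1 + Real.log Z + C * 3 * Q ^ 4 * U ^ (-(1 / 8) : ℝ))
    (fun n hn ↦ Real.rpow_pos_of_pos (hpos n hn) _) (by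
      have := Real.log_nonneg (hU.trans hUZ)
      positivity) (fun i hi ↦ ?_) c).trans (le_of_eq ?_)
  · have hdiag : ‖∑ n ∈ Finset.Ioc ⌊U⌋₊ ⌊Z⌋₊, (((n : ℝ) ^ (-σ) : ℝ) : ℂ) *
        (hm i.2 n * star (hm i.2 n))‖ ≤ 1 + Real.log Z := by
      refine (norm_sum_le _ _).trans ?_
      have : ∀ n ∈ Finset.Ioc ⌊U⌋₊ ⌊Z⌋₊, ‖(((n : ℝ) ^ (-σ) : ℝ) : ℂ) *
        (hm i.2 n * star (hm i.2 n))‖ ≤ (n : ℝ)⁻¹ := by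
        intro n hn
        have hn0 := hpos n hn
        have hn1 : (1 : ℝ) ≤ n := by exact_mod_cast (by exact_mod_cast hn0 : 0 < n)
        rw [norm_mul, norm_mul, norm_star, Complex.norm_real,
          Real.norm_of_nonneg (by positivity), ← Real.rpow_neg_one]
        have := norm_hm_le i.2 n
        calc _ ≤ (n : ℝ) ^ (-σ) * 1 := by
              gcongr; exact mul_le_one₀ this (norm_nonneg _) this
          _ ≤ _ := by
              rw [mul_one]
              exact Real.rpow_le_rpow_of_exponent_le hn1 (by linarith)
      refine (Finset.sum_le_sum this).trans ?_
      have hs : Finset.Ioc ⌊U⌋₊ ⌊Z⌋₊ ⊆ Finset.Icc 1 ⌊Z⌋₊ := fun n hn ↦ by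
        rw [Finset.mem_Ioc] at hn
        rw [Finset.mem_Icc]
        omega
      refine (Finset.sum_le_sum_of_subset_of_nonneg hs fun n _ _ ↦ by positivity).trans ?_
      have := harmonic_le_one_add_log ⌊Z⌋₊
      rw [harmonic_eq_sum_Icc] at this
      push_cast at this
      refine this.trans ?_
      have h1 : (1 : ℝ) ≤ ⌊Z⌋₊ := by
        exact_mod_cast Nat.le_floor (by exact_mod_cast hU.trans hUZ)
      gcongr
      exact Nat.floor_le (by linarith)
    have hoff : ∀ j ∈ X.erase i, ‖∑ n ∈ Finset.Ioc ⌊U⌋₊ ⌊Z⌋₊, (((n : ℝ) ^ (-σ) : ℝ) : ℂ) *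
        (hm i.2 n * star (hm j.2 n))‖ ≤ C * 3 * Q ^ 2 * U ^ (-(1 / 8) : ℝ) := by
      intro j hj'
      have hj := Finset.mem_of_mem_erase hj'
      have hne := changeLevel_mul_inv_ne_one (hX.ne i hi) (hX.ne j hj) (hX.prim i hi)
        (hX.prim j hj) (Finset.ne_of_mem_erase hj').symm
      have hc := controlled_char (mul_ne_zero (hX.ne i hi) (hX.ne j hj)) hne
      have := hl _ _ (σ : ℂ) U Z (by positivity) hc.sum_le (by simpa) hU hUZ
      have e : ∀ n ∈ Finset.Ioc ⌊U⌋₊ ⌊Z⌋₊, (((n : ℝ) ^ (-σ) : ℝ) : ℂ) *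
          (hm i.2 n * star (hm j.2 n)) = lw 0 σ n * pf (hm
            (DirichletCharacter.changeLevel (Nat.dvd_mul_right i.1 j.1) i.2 *
            DirichletCharacter.changeLevel (Nat.dvd_mul_left j.1 i.1) j.2⁻¹)) dl n := by
        intro n hn
        have hn0 := hpos n hn
        rw [pf_dl_apply, hm_changeLevel_mul (hX.ne i hi) (hX.ne j hj) _ _
          (by exact_mod_cast hn0.ne'), hm_inv_apply, lw, pow_zero, one_mul,
          Complex.ofReal_cpow hn0.le]
        push_cast
        rfl
      rw [Finset.sum_congr rfl e]
      refine this.trans ?_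
      rw [Complex.norm_real, Real.norm_of_nonneg (by linarith)]
      push_cast
      have h1 := hX.le i hi
      have h2 := hX.le j hj
      calc C * ((i.1 : ℝ) * j.1) * (1 + σ) * U ^ (-(1 / 8) : ℝ) ≤
            C * (Q * Q) * (1 + 2) * U ^ (-(1 / 8) : ℝ) := by gcongr
        _ = _ := by ring
    rw [← Finset.add_sum_erase _ _ hi]
    refine add_le_add hdiag ((Finset.sum_le_card_nsmul _ _ _ hoff).trans ?_)
    rw [nsmul_eq_mul]
    have hc : ((X.erase i).card : ℝ) ≤ Q ^ 2 :=
      le_trans (by exact_mod_cast Finset.card_le_card (Finset.erase_subset _ _)) (hX.card_le hQ)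
    calc ((X.erase i).card : ℝ) * (C * 3 * Q ^ 2 * U ^ (-(1 / 8) : ℝ)) ≤
          Q ^ 2 * (C * 3 * Q ^ 2 * U ^ (-(1 / 8) : ℝ)) := by gcongr
      _ = _ := by ring
  · congr 1
    refine Finset.sum_congr rfl fun n hn ↦ ?_
    rw [Real.rpow_neg (hpos n hn).le, div_inv_eq_mul]

/-- Restriction of an arithmetic function to a finite set. -/
def restr (S : Finset ℕ) (a : ArithmeticFunction ℂ) : ArithmeticFunction ℂ :=
  ⟨fun n ↦ if n ∈ S then a n else 0, by simp⟩

lemma restr_apply (S : Finset ℕ) (a : ArithmeticFunction ℂ) (n : ℕ) :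
    restr S a n = if n ∈ S then a n else 0 := rfl

lemma tw_restr (g : ℕ →*₀ ℂ) (S : Finset ℕ) (a : ArithmeticFunction ℂ) :
    tw g (restr S a) = restr S (tw g a) := by
  ext n
  simp only [tw_apply, restr_apply]
  split_ifs <;> simp

lemma term_restr (S : Finset ℕ) (a : ArithmeticFunction ℂ) (s : ℂ) (n : ℕ) :
    LSeries.term (restr S a ·) s n = if n ∈ S then a n * (n : ℂ) ^ (-s) else 0 := by
  rcases eq_or_ne n 0 with rfl | hn
  · simp
  · rw [LSeries.term_of_ne_zero hn, restr_apply]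
    split_ifs with h
    · rw [Complex.cpow_neg, div_eq_mul_inv]
    · simp

lemma LSeriesSummable_restr (S : Finset ℕ) (a : ArithmeticFunction ℂ) (s : ℂ) :
    LSeriesSummable (restr S a ·) s := by
  refine summable_of_ne_finset_zero (s := S) fun n hn ↦ ?_
  rw [term_restr, if_neg hn]

lemma LSeries_restr (S : Finset ℕ) (a : ArithmeticFunction ℂ) (s : ℂ) :
    LSeries (restr S a ·) s = ∑ n ∈ S, a n * (n : ℂ) ^ (-s) := by
  rw [LSeries, tsum_eq_sum (s := S)]
  · exact Finset.sum_congr rfl fun n hn ↦ by rw [term_restr, if_pos hn]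
  · intro n hn; rw [term_restr, if_neg hn]

lemma conv_congr {a b a' b' : ArithmeticFunction ℂ} {n : ℕ}
    (h : ∀ d k : ℕ, d * k = n → n ≠ 0 → a d * b k = a' d * b' k) : (a * b) n = (a' * b') n := by
  rw [mul_apply, mul_apply]
  refine Finset.sum_congr rfl fun p hp ↦ ?_
  rw [Nat.mem_divisorsAntidiagonal] at hp
  exact h _ _ hp.1 hp.2

/-- Type I sums. -/
theorem type_one {h : ℝ → ℂ} (h1 : ContDiff ℝ (⊤ : ℕ∞) h) (hs : ∀ u, 1 < |u| → h u = 0) (j : ℕ) :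
    ∃ C : ℝ, 0 < C ∧ ∀ (f a : ArithmeticFunction ℂ) (K D x σ : ℝ), Controlled f K → 1 ≤ D →
      (∀ n : ℕ, D < n → a n = 0) → 9 * D ≤ x → 1 < σ → σ ≤ 2 →
      ‖ssum h x σ (lg^[j] f * a)‖ ≤ C * x ^ σ *
        (K * (∑ n ∈ Finset.Icc 1 ⌊D⌋₊, ‖a n‖ / n) * (x / (9 * D)) ^ (-(1 / 8) : ℝ)) := by
  obtain ⟨C₁, hC₁, hm⟩ := norm_ssum_le h1 hs
  obtain ⟨C₂, hC₂, hl⟩ := norm_sum_Ioc_lw_le j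
  refine ⟨C₁ * (C₂ * 4), by positivity, fun f a K D x σ hf hD ha hx σ1 σ2 ↦ ?_⟩
  have hx0 : 0 < x := by linarith
  set N := x / (9 * D) with hN
  have hN1 : 1 ≤ N := by rw [hN, le_div_iff₀ (by positivity)]; linarith
  have he := Real.exp_one_lt_d9
  have he' := Real.exp_one_gt_d9
  set S := Finset.Ioc ⌊N⌋₊ ⌊Real.exp 1 * x⌋₊ with hS
  set A := ∑ n ∈ Finset.Icc 1 ⌊D⌋₊, ‖a n‖ / n with hA
  have hA0 : 0 ≤ A := Finset.sum_nonneg fun n _ ↦ by positivity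
  have hK := hf.one_le
  have e1 : ssum h x σ (lg^[j] f * a) =
      ssum h x σ (restr S (lg^[j] f) * restr (Finset.Icc 1 ⌊D⌋₊) a) := by
    refine ssum_congr hs hx0 fun n hn hn1 hn2 ↦ conv_congr fun d k hdk _ ↦ ?_
    have hd : d ≠ 0 := by rintro rfl; simp at hdk; exact hn hdk.symm
    have hk : k ≠ 0 := by rintro rfl; simp at hdk; exact hn hdk.symm
    by_cases hkD : D < k
    · rw [ha k hkD, mul_zero, restr_apply _ _ k, if_neg, mul_zero]
      rw [Finset.mem_Icc, not_and, not_le]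
      exact fun _ ↦ Nat.floor_lt (by linarith) |>.2 hkD
    · push Not at hkD
      rw [restr_apply _ _ k, if_pos (Finset.mem_Icc.2 ⟨by omega, Nat.le_floor hkD⟩), restr_apply,
        if_pos]
      have hdn : d ≤ n := by rw [← hdk]; exact Nat.le_mul_of_pos_right _ (by omega)
      rw [hS, Finset.mem_Ioc, Nat.floor_lt (by linarith)]
      refine ⟨?_, Nat.le_floor (le_trans (by exact_mod_cast hdn) hn1)⟩
      rw [hN, div_lt_iff₀ (by positivity)]
      have h2 : (n : ℝ) ≤ d * D := by
        rw [← hdk]; push_cast; gcongr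
      have hd0 : (0 : ℝ) < d := by positivity
      nlinarith
  rw [e1]
  refine (hm x σ hx0 _ (C₂ * 4 * (K * A * N ^ (-(1 / 8) : ℝ))) ?_ fun t ↦ ?_).trans
    (le_of_eq (by ring))
  · exact LSeriesSummable_mul (LSeriesSummable_restr _ _ _) (LSeriesSummable_restr _ _ _)
  · set s : ℂ := σ + t * Complex.I with hs'
    have hsre : s.re = σ := by simp [hs']
    have hsim : s.im = t := by simp [hs']
    rw [LSeries_mul' (LSeriesSummable_restr _ _ _) (LSeriesSummable_restr _ _ _), norm_mul]
    have b1 : ‖LSeries (restr S (lg^[j] f) ·) s‖ ≤ C₂ * K * (1 + ‖s‖) * N ^ (-(1 / 8) : ℝ) := by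
      have := hl f K s N (Real.exp 1 * x) (by linarith) hf.sum_le (by rw [hsre]; exact σ1) hN1
        (by
          rw [hN, div_le_iff₀ (by positivity)]
          nlinarith [mul_pos hx0 (by linarith : (0 : ℝ) < D)])
      rw [LSeries_restr]
      convert this using 3 with n hn
      rw [lg_iterate_apply, lw]
      push_cast
      ring
    have b2 : ‖LSeries (restr (Finset.Icc 1 ⌊D⌋₊) a ·) s‖ ≤ A := by
      rw [LSeries_restr]
      refine (norm_sum_le _ _).trans (Finset.sum_le_sum fun n hn ↦ ?_)
      have hn1 : 1 ≤ n := (Finset.mem_Icc.1 hn).1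
      rw [norm_mul, Complex.norm_natCast_cpow_of_pos hn1, div_eq_mul_inv, ← Real.rpow_neg_one]
      refine mul_le_mul_of_nonneg_left (Real.rpow_le_rpow_of_exponent_le (by exact_mod_cast hn1) ?_)
        (norm_nonneg _)
      rw [Complex.neg_re, hsre]; linarith
    have b3 : 1 + ‖s‖ ≤ 4 * (1 + t ^ 2) := by
      have := Complex.norm_le_abs_re_add_abs_im s
      rw [hsre, hsim, abs_of_pos (by linarith)] at this
      rw [← sq_abs t]
      nlinarith [sq_nonneg (|t| - 1), abs_nonneg t]
    have hN0 : 0 ≤ N ^ (-(1 / 8) : ℝ) := by positivity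
    calc _ ≤ C₂ * K * (4 * (1 + t ^ 2)) * N ^ (-(1 / 8) : ℝ) * A := by
          refine mul_le_mul (b1.trans ?_) b2 (norm_nonneg _) (by positivity)
          gcongr
      _ = _ := by ring

/-- Type II sums. -/
theorem type_two {h : ℝ → ℂ} (h1 : ContDiff ℝ (⊤ : ℕ∞) h) (hs : ∀ u, 1 < |u| → h u = 0) :
    ∃ C : ℝ, 0 < C ∧ ∀ (X : Finset (Σ r : ℕ, DirichletCharacter ℂ r)) (Q : ℝ),
    PrimChars X Q → 0 ≤ Q → ∀ (x σ U Z : ℝ), 0 < x → 1 < σ → σ ≤ 2 → 1 ≤ U → U ≤ Z →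
      ∀ a c : ArithmeticFunction ℂ,
    ∑ i ∈ X, ‖ssum h x σ (restr (Finset.Ioc ⌊U⌋₊ ⌊Z⌋₊) (tw (hm i.2) a) *
        restr (Finset.Ioc ⌊U⌋₊ ⌊Z⌋₊) (tw (hm i.2) c))‖ ≤
      C * x ^ σ * ((1 + Real.log Z + Q ^ 4 * U ^ (-(1 / 8) : ℝ)) *
        (∑ n ∈ Finset.Ioc ⌊U⌋₊ ⌊Z⌋₊, ‖a n‖ ^ 2 / n + ∑ n ∈ Finset.Ioc ⌊U⌋₊ ⌊Z⌋₊, ‖c n‖ ^ 2 / n)) := by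
  obtain ⟨C₁, hC₁, hm'⟩ := sum_norm_ssum_le h1 hs
  obtain ⟨C₂, hC₂, hl⟩ := large_sieve
  refine ⟨C₁ * (1 + C₂), by positivity, fun X Q hX hQ x σ U Z hx σ1 σ2 hU hUZ a c ↦ ?_⟩
  set S := Finset.Ioc ⌊U⌋₊ ⌊Z⌋₊ with hS
  set Δ := 1 + Real.log Z + Q ^ 4 * U ^ (-(1 / 8) : ℝ) with hΔ
  have hlog := Real.log_nonneg (hU.trans hUZ)
  have hU0 : 0 ≤ U ^ (-(1 / 8) : ℝ) := by positivity
  have hΔ0 : 0 ≤ Δ := by positivity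
  have key : ∀ (a : ArithmeticFunction ℂ) (t : ℝ),
      ∑ i ∈ X, ‖LSeries (restr S (tw (hm i.2) a) ·) (σ + t * Complex.I)‖ ^ 2 ≤
        (1 + C₂) * Δ * ∑ n ∈ S, ‖a n‖ ^ 2 / n := by
    intro a t
    have hL := hl X Q hX hQ σ U Z σ1 σ2 hU hUZ
      (fun n ↦ a n * (n : ℂ) ^ (-(σ + t * Complex.I)))
    have e : ∀ i ∈ X, ‖LSeries (restr S (tw (hm i.2) a) ·) (σ + t * Complex.I)‖ ^ 2 =
        ‖∑ n ∈ S, a n * (n : ℂ) ^ (-(σ + t * Complex.I)) * hm i.2 n‖ ^ 2 := by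
      intro i _
      rw [LSeries_restr]
      congr 2
      exact Finset.sum_congr rfl fun n _ ↦ by rw [tw_apply]; ring
    rw [Finset.sum_congr rfl e]
    refine hL.trans (mul_le_mul ?_ (Finset.sum_le_sum fun n hn ↦ ?_)
      (Finset.sum_nonneg fun n _ ↦ by positivity) (by positivity))
    · have : 0 ≤ Q ^ 4 * U ^ (-(1 / 8) : ℝ) := by positivity
      rw [hΔ]
      nlinarith
    · have hn1 : 1 ≤ n := by
        rw [Finset.mem_Ioc] at hn; omega
      have hn0 : (0 : ℝ) < n := by exact_mod_cast hn1
      rw [norm_mul, Complex.norm_natCast_cpow_of_pos hn1]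
      simp only [Complex.neg_re, Complex.add_re, Complex.ofReal_re, Complex.mul_re, Complex.I_re,
        mul_zero, Complex.ofReal_im, Complex.I_im, mul_one, sub_zero, add_zero]
      have hu : (n : ℝ) ^ (-σ) * (n : ℝ) ^ σ = 1 := by
        rw [← Real.rpow_add hn0, neg_add_cancel, Real.rpow_zero]
      rw [mul_pow, mul_assoc, sq ((n : ℝ) ^ (-σ)), mul_assoc ((n : ℝ) ^ (-σ)), hu, mul_one,
        div_eq_mul_inv, ← Real.rpow_neg_one]
      refine mul_le_mul_of_nonneg_left (Real.rpow_le_rpow_of_exponent_le (by exact_mod_cast hn1) ?_)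
        (by positivity)
      linarith
  refine (hm' x σ hx X _ ((1 + C₂) * (Δ * (∑ n ∈ S, ‖a n‖ ^ 2 / n + ∑ n ∈ S, ‖c n‖ ^ 2 / n)))
    (fun i _ ↦ LSeriesSummable_mul (LSeriesSummable_restr _ _ _) (LSeriesSummable_restr _ _ _))
    fun t ↦ ?_).trans (le_of_eq (by ring))
  have ka := key a t
  have kc := key c t
  have hle : ∑ i ∈ X, ‖LSeries (↑(restr S (tw (hm i.2) a) * restr S (tw (hm i.2) c)))
      (σ + t * Complex.I)‖ ≤
      ∑ i ∈ X, (‖LSeries (restr S (tw (hm i.2) a) ·) (σ + t * Complex.I)‖ ^ 2 +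
        ‖LSeries (restr S (tw (hm i.2) c) ·) (σ + t * Complex.I)‖ ^ 2) := by
    refine Finset.sum_le_sum fun i _ ↦ ?_
    rw [LSeries_mul' (LSeriesSummable_restr _ _ _) (LSeriesSummable_restr _ _ _), norm_mul]
    nlinarith [sq_nonneg (‖LSeries (restr S (tw (hm i.2) a) ·) (σ + t * Complex.I)‖ -
        ‖LSeries (restr S (tw (hm i.2) c) ·) (σ + t * Complex.I)‖),
      sq_nonneg ‖LSeries (restr S (tw (hm i.2) a) ·) (σ + t * Complex.I)‖,
      sq_nonneg ‖LSeries (restr S (tw (hm i.2) c) ·) (σ + t * Complex.I)‖]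
  have hle' := hle
  rw [Finset.sum_add_distrib] at hle'
  have s0 : 0 ≤ (1 + C₂) * (Δ * (∑ n ∈ S, ‖a n‖ ^ 2 / n + ∑ n ∈ S, ‖c n‖ ^ 2 / n)) := by
    have : 0 ≤ ∑ n ∈ S, ‖a n‖ ^ 2 / n := Finset.sum_nonneg fun n _ ↦ by positivity
    have : 0 ≤ ∑ n ∈ S, ‖c n‖ ^ 2 / n := Finset.sum_nonneg fun n _ ↦ by positivity
    positivity
  have ht : 1 ≤ 1 + t ^ 2 := by nlinarith [sq_nonneg t]
  calc _ ≤ (1 + C₂) * (Δ * (∑ n ∈ S, ‖a n‖ ^ 2 / n + ∑ n ∈ S, ‖c n‖ ^ 2 / n)) := by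
        refine hle'.trans ?_
        linarith
    _ ≤ _ := le_mul_of_one_le_right s0 ht

lemma norm_restr_le (S : Finset ℕ) (a : ArithmeticFunction ℂ) (n : ℕ) :
    ‖restr S a n‖ ≤ ‖a n‖ := by
  rw [restr_apply]; split_ifs <;> simp

lemma norm_tw_le {g : ℕ →*₀ ℂ} (hg : ∀ n, ‖g n‖ ≤ 1) (a : ArithmeticFunction ℂ) (n : ℕ) :
    ‖tw g a n‖ ≤ ‖a n‖ := by
  rw [tw_apply, norm_mul]
  exact mul_le_of_le_one_left (norm_nonneg _) (hg n)

/-- Vaughan's identity for `pl`, on a range where only finitely many terms matter. -/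
lemma pl_eq_vaughan (g₁ g₂ : ℕ →*₀ ℂ) {u z n : ℕ} (hn : n ≠ 0) (hu : u < n) (hz : n ≤ z) :
    pl g₁ g₂ n = (lg (pf g₁ g₂) * restr (Finset.Icc 1 u) (pb g₁ g₂) +
      pf g₁ g₂ * (-restr (Finset.Icc 1 u) (pl g₁ g₂) * restr (Finset.Icc 1 u) (pb g₁ g₂)) +
      restr (Finset.Ioc u z) (pl g₁ g₂) * restr (Finset.Ioc u z)
        (1 - pf g₁ g₂ * restr (Finset.Icc 1 u) (pb g₁ g₂))) n := by
  set f := pf g₁ g₂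
  set B := restr (Finset.Icc 1 u) (pb g₁ g₂) with hB
  set P := pl g₁ g₂
  set P' := restr (Finset.Icc 1 u) P with hP'
  have e1 : (restr (Finset.Ioc u z) P * restr (Finset.Ioc u z) (1 - f * B)) n =
      ((P - P') * (1 - f * B)) n := by
    refine conv_congr fun d k hdk _ ↦ ?_
    have hd : d ≠ 0 := by rintro rfl; simp at hdk; exact hn hdk.symm
    have hk : k ≠ 0 := by rintro rfl; simp at hdk; exact hn hdk.symm
    have hdn : d ≤ n := by rw [← hdk]; exact Nat.le_mul_of_pos_right _ (by omega)
    have hkn : k ≤ n := by rw [← hdk]; exact Nat.le_mul_of_pos_left _ (by omega)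
    have hsub (a b : ArithmeticFunction ℂ) (m : ℕ) : (a - b) m = a m - b m := rfl
    congr 1
    · rw [hsub, hP', restr_apply, restr_apply]
      by_cases h : d ≤ u
      · rw [if_neg (by simp [h]), if_pos (by simp; omega), sub_self]
      · rw [if_pos (by simp; omega), if_neg (by simp; omega), sub_zero]
    · rw [restr_apply]
      split_ifs with h
      · rfl
      · have hku : k ≤ u := by
          rw [Finset.mem_Ioc] at h; omega
        have : (f * B) k = (f * pb g₁ g₂) k := by
          refine conv_congr fun a b hab _ ↦ ?_
          have hb : b ≠ 0 := by rintro rfl; simp at hab; exact hk hab.symm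
          have ha : a ≠ 0 := by rintro rfl; simp at hab; exact hk hab.symm
          have : b ≤ k := by rw [← hab]; exact Nat.le_mul_of_pos_left _ (by omega)
          rw [hB, restr_apply, if_pos (by simp; omega)]
        rw [hsub, this, pf_mul_pb, sub_self]
  have e2 : P' n = 0 := by rw [hP', restr_apply, if_neg (by simp; omega)]
  have e3 : P = P' + (lg f * B + f * (-P' * B) + (P - P') * (1 - f * B)) := by
    rw [lg_pf]; ring
  have e4 := congrArg (fun a : ArithmeticFunction ℂ ↦ a n) e3
  simp only [ArithmeticFunction.add_apply, e2, zero_add] at e4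
  rw [ArithmeticFunction.add_apply, ArithmeticFunction.add_apply, e1]
  exact e4

lemma sum_divisors_mul_le (n : ℕ) :
    (((ζ : ArithmeticFunction ℝ) * ζ) * ((ζ : ArithmeticFunction ℝ) * ζ)) n ≤
      (n.divisors.card : ℝ) ^ 3 := by
  rw [mul_apply]
  have : ∀ p ∈ n.divisorsAntidiagonal, ((ζ : ArithmeticFunction ℝ) * ζ) p.1 *
      ((ζ : ArithmeticFunction ℝ) * ζ) p.2 ≤ (n.divisors.card : ℝ) ^ 2 := by
    intro p hp
    rw [Nat.mem_divisorsAntidiagonal] at hp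
    rw [zeta_mul_zeta_apply, zeta_mul_zeta_apply, sq]
    gcongr
    · exact hp.2
    · exact hp.1 ▸ Dvd.intro _ rfl
    · exact hp.2
    · exact hp.1 ▸ Dvd.intro_left _ rfl
  refine (Finset.sum_le_card_nsmul _ _ _ this).trans (le_of_eq ?_)
  rw [nsmul_eq_mul, show n.divisorsAntidiagonal.card = n.divisors.card by
    rw [← Nat.map_div_right_divisors, Finset.card_map]]
  ring

lemma vonMangoldt_mul_le (n : ℕ) :
    ((Λ : ArithmeticFunction ℝ) * ((ζ : ArithmeticFunction ℝ) * ζ)) n ≤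
      Real.log n * n.divisors.card := by
  rw [← mul_assoc, vonMangoldt_mul_zeta, mul_comm log, coe_zeta_mul_apply]
  have : ∀ d ∈ n.divisors, log d ≤ Real.log n := by
    intro d hd
    rw [log_apply]
    have h1 := Nat.pos_of_mem_divisors hd
    have h2 := Nat.divisor_le hd
    gcongr
  refine (Finset.sum_le_card_nsmul _ _ _ this).trans (le_of_eq ?_)
  rw [nsmul_eq_mul, mul_comm]

set_option maxHeartbeats 1000000 in
/-- Large conductors: on average over primitive characters the prime sums lose only a fixed power
of the logarithm. -/
theorem sum_norm_ssum_pl_le {h : ℝ → ℂ} (h1 : ContDiff ℝ (⊤ : ℕ∞) h)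
    (hs : ∀ u, 1 < |u| → h u = 0) :
    ∃ C : ℝ, 0 < C ∧ ∀ (g₁ g₂ : ℕ →*₀ ℂ), (∀ n, ‖g₁ n‖ ≤ 1) → (∀ n, ‖g₂ n‖ ≤ 1) →
      ∀ (X : Finset (Σ r : ℕ, DirichletCharacter ℂ r)) (Q K x σ : ℝ), PrimChars X Q → 0 ≤ Q →
      (∀ i ∈ X, Controlled (pf (hm i.2 * g₁) (hm i.2 * g₂)) K) → 81 ≤ x → 1 < σ → σ ≤ 2 →
      Q ^ 4 ≤ x ^ (1 / 32 : ℝ) → Q ^ 2 * K ≤ x ^ (1 / 16 : ℝ) →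
      ∑ i ∈ X, ‖ssum h x σ (pl (hm i.2 * g₁) (hm i.2 * g₂))‖ ≤
        C * x ^ σ * (2 + Real.log x) ^ 65 := by
  obtain ⟨C₀, hC₀, ht0⟩ := type_one h1 hs 0
  obtain ⟨C₁, hC₁, ht1⟩ := type_one h1 hs 1
  obtain ⟨C₂, hC₂, ht2⟩ := type_two h1 hs
  refine ⟨(C₁ + C₀ * 2) * 9 + C₂ * 16, by positivity,
    fun g₁ g₂ n₁ n₂ X Q K x σ hX hQ hc hx σ1 σ2 hQ4 hQK ↦ ?_⟩
  have he := Real.exp_one_lt_d9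
  have he' := Real.exp_one_gt_d9
  have hx0 : 0 < x := by linarith
  set Z := Real.exp 1 * x with hZ
  set L := 2 + Real.log x with hL
  have hlx : 0 ≤ Real.log x := Real.log_nonneg (by linarith)
  have hL2 : 2 ≤ L := by linarith
  have hLZ : 1 + Real.log Z = L := by
    rw [hZ, Real.log_mul (by positivity) hx0.ne', Real.log_exp]; ring
  set U := x ^ (1 / 4 : ℝ) with hU
  have hU1 : 1 ≤ U := Real.one_le_rpow (by linarith) (by norm_num)
  have hU4 : U ^ 4 = x := by
    rw [hU, ← Real.rpow_natCast, ← Real.rpow_mul hx0.le]; norm_num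
  have hU3 : 3 ≤ U := by
    by_contra! hlt
    have : U ^ 4 < 3 ^ 4 := pow_lt_pow_left₀ hlt (by linarith) (by norm_num)
    rw [hU4] at this
    linarith
  have hU2x : 9 * U ^ 2 ≤ x := by rw [← hU4]; nlinarith [sq_nonneg U]
  have hUx : Real.exp 1 * U < x := by nlinarith
  have hUZ : U ≤ Z := by nlinarith
  set u := ⌊U⌋₊ with hu
  set z := ⌊Z⌋₊ with hz
  have hzL : 1 + Real.log z ≤ L := by
    rw [← hLZ]
    have h1 : (1 : ℝ) ≤ z := by
      exact_mod_cast Nat.le_floor (by exact_mod_cast hU1.trans hUZ)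
    gcongr
    exact Nat.floor_le (by linarith)
  have hdiv (j : ℕ) : ∑ n ∈ Finset.Icc 1 z, (n.divisors.card : ℝ) ^ j / n ≤ L ^ 2 ^ j := by
    refine (sum_divisors_pow_div_le j z).trans ?_
    have : 0 ≤ Real.log z := Real.log_natCast_nonneg z
    gcongr
  set f := pf g₁ g₂ with hf
  set B := restr (Finset.Icc 1 u) (pb g₁ g₂) with hB
  set P := pl g₁ g₂ with hP
  set P' := restr (Finset.Icc 1 u) P with hP'
  set c := 1 - f * B with hc'
  have bB : ∀ n, ‖B n‖ ≤ ((ζ : ArithmeticFunction ℝ) * ζ) n := fun n ↦ by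
    rw [zeta_mul_zeta_apply]
    exact (norm_restr_le _ _ _).trans (norm_pb_le n₁ n₂ n)
  have hdecomp : ∀ i ∈ X, ssum h x σ (pl (hm i.2 * g₁) (hm i.2 * g₂)) =
      ssum h x σ (lg^[1] (tw (hm i.2) f) * tw (hm i.2) B) +
      ssum h x σ (lg^[0] (tw (hm i.2) f) * tw (hm i.2) (-P' * B)) +
      ssum h x σ (restr (Finset.Ioc u z) (tw (hm i.2) P) *
        restr (Finset.Ioc u z) (tw (hm i.2) c)) := by
    intro i _
    rw [← ssum_add, ← ssum_add, Function.iterate_one, Function.iterate_zero, id, ← tw_lg,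
      ← tw_mul, ← tw_mul, ← tw_restr, ← tw_restr, ← tw_mul, ← tw_add, ← tw_add, pl_twist]
    refine ssum_congr hs hx0 fun n hn hn1 hn2 ↦ ?_
    rw [tw_apply, tw_apply]
    congr 1
    refine pl_eq_vaughan g₁ g₂ hn ?_ (Nat.le_floor hn1)
    rw [hu, Nat.floor_lt (by linarith)]
    nlinarith
  rw [Finset.sum_congr rfl fun i hi ↦ by rw [hdecomp i hi]]
  have hNb : (x / (9 * U ^ 2)) ^ (-(1 / 8) : ℝ) ≤ 9 * x ^ (-(1 / 16) : ℝ) := by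
    have e : x / (9 * U ^ 2) = x ^ (1 / 2 : ℝ) / 9 := by
      have e2 : x ^ (1 / 2 : ℝ) = U ^ 2 := by
        rw [hU, ← Real.rpow_natCast, ← Real.rpow_mul hx0.le]; norm_num
      rw [e2]
      field_simp
      linarith
    rw [e, Real.div_rpow (by positivity) (by norm_num), ← Real.rpow_mul hx0.le,
      Real.rpow_neg (by norm_num : (0 : ℝ) ≤ 9), div_inv_eq_mul, mul_comm]
    norm_num
    refine mul_le_mul_of_nonneg_right ?_ (by positivity)
    exact (Real.rpow_le_rpow_of_exponent_le (by norm_num) (by norm_num : (1 / 8 : ℝ) ≤ 1)).trans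
      (by norm_num)
  have hcard := hX.card_le hQ
  have type1 : ∀ (j : ℕ) (C : ℝ), 0 < C → (∀ (f a : ArithmeticFunction ℂ) (K D x σ : ℝ),
      Controlled f K → 1 ≤ D → (∀ n : ℕ, D < n → a n = 0) → 9 * D ≤ x → 1 < σ → σ ≤ 2 →
      ‖ssum h x σ (lg^[j] f * a)‖ ≤ C * x ^ σ *
        (K * (∑ n ∈ Finset.Icc 1 ⌊D⌋₊, ‖a n‖ / n) * (x / (9 * D)) ^ (-(1 / 8) : ℝ))) →
      ∀ (a : ArithmeticFunction ℂ) (A : ℝ), 0 ≤ A → (∀ n : ℕ, U ^ 2 < n → a n = 0) →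
      ∑ n ∈ Finset.Icc 1 z, ‖a n‖ / n ≤ A →
      ∑ i ∈ X, ‖ssum h x σ (lg^[j] (tw (hm i.2) f) * tw (hm i.2) a)‖ ≤
        C * x ^ σ * (A * 9) := by
    intro j C hC hT a A hA ha haA
    rcases X.eq_empty_or_nonempty with rfl | ⟨i₀, hi₀⟩
    · simp; positivity
    have hK := (hc i₀ hi₀).one_le
    have hone : ∀ i ∈ X, ‖ssum h x σ (lg^[j] (tw (hm i.2) f) * tw (hm i.2) a)‖ ≤
        C * x ^ σ * (K * A * (9 * x ^ (-(1 / 16) : ℝ))) := by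
      intro i hi
      have hci := hc i hi
      rw [pf_twist] at hci
      refine (hT (tw (hm i.2) f) (tw (hm i.2) a) K (U ^ 2) x σ hci (one_le_pow₀ hU1)
        (fun n hn ↦ by rw [tw_apply, ha n hn, mul_zero]) hU2x σ1 σ2).trans ?_
      have hsum : ∑ n ∈ Finset.Icc 1 ⌊U ^ 2⌋₊, ‖tw (hm i.2) a n‖ / n ≤ A := by
        refine le_trans (Finset.sum_le_sum fun n _ ↦ ?_) ((Finset.sum_le_sum_of_subset_of_nonneg
          (Finset.Icc_subset_Icc_right (Nat.floor_mono (by nlinarith)))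
          (fun n _ _ ↦ by positivity)).trans haA)
        have := norm_tw_le (norm_hm_le i.2) a n
        gcongr
      gcongr
    refine (Finset.sum_le_card_nsmul _ _ _ hone).trans ?_
    rw [nsmul_eq_mul]
    have hxx : x ^ (1 / 16 : ℝ) * x ^ (-(1 / 16) : ℝ) = 1 := by
      rw [← Real.rpow_add hx0]; norm_num
    calc (X.card : ℝ) * (C * x ^ σ * (K * A * (9 * x ^ (-(1 / 16) : ℝ))))
        ≤ Q ^ 2 * (C * x ^ σ * (K * A * (9 * x ^ (-(1 / 16) : ℝ)))) := by gcongr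
      _ = C * x ^ σ * (A * 9) * ((Q ^ 2 * K) * x ^ (-(1 / 16) : ℝ)) := by ring
      _ ≤ C * x ^ σ * (A * 9) * (x ^ (1 / 16 : ℝ) * x ^ (-(1 / 16) : ℝ)) := by gcongr
      _ = _ := by rw [hxx, mul_one]
  have hL3 : L ^ 3 ≤ L ^ 65 := pow_le_pow_right₀ (by linarith) (by norm_num)
  have hfu : (u : ℝ) ≤ U := Nat.floor_le (by linarith)
  have hBU : ∀ n : ℕ, U < n → B n = 0 := fun n hn ↦ by
    rw [hB, restr_apply, if_neg]
    rw [Finset.mem_Icc, not_and, not_le]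
    exact fun _ ↦ by exact_mod_cast hfu.trans_lt hn
  have s1 := type1 1 C₁ hC₁ ht1 B (L ^ 3) (by positivity)
    (fun n hn ↦ hBU n (lt_of_le_of_lt (by nlinarith) hn)) (by
      refine (Finset.sum_le_sum fun n _ ↦ ?_).trans ((hdiv 1).trans
        (pow_le_pow_right₀ (by linarith) (by norm_num)))
      have := bB n
      rw [zeta_mul_zeta_apply] at this
      rw [pow_one]
      gcongr)
  have hlogn : ∀ n ∈ Finset.Icc 1 z, Real.log n ≤ L := by
    intro n hn
    rw [Finset.mem_Icc] at hn
    have h1 : (0 : ℝ) < n := by exact_mod_cast hn.1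
    have : Real.log n ≤ Real.log z := Real.log_le_log h1 (by exact_mod_cast hn.2)
    linarith
  have s2 := type1 0 C₀ hC₀ ht0 (-P' * B) (2 * L ^ 3) (by positivity)
    (fun n hn ↦ by
      rw [mul_apply]
      refine Finset.sum_eq_zero fun p hp ↦ ?_
      rw [Nat.mem_divisorsAntidiagonal] at hp
      by_cases hp2 : U < p.2
      · rw [hBU _ hp2, mul_zero]
      · push Not at hp2
        have hp1 : U < p.1 := by
          by_contra! hcon
          have : (n : ℝ) = p.1 * p.2 := by rw [← hp.1]; push_cast; ring
          have h2 : (p.1 : ℝ) * p.2 ≤ U * U := by gcongr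
          nlinarith
        have : P' p.1 = 0 := by
          rw [hP', restr_apply, if_neg]
          rw [Finset.mem_Icc, not_and, not_le]
          exact fun _ ↦ by exact_mod_cast hfu.trans_lt hp1
        rw [show (-P') p.1 = -(P' p.1) from rfl, this, neg_zero, zero_mul]) (by
      have hb : ∀ n ∈ Finset.Icc 1 z, ‖(-P' * B) n‖ / n ≤
          2 * L * ((n.divisors.card : ℝ) ^ 1 / n) := by
        intro n hn
        have hpp : ∀ n, ‖(-P') n‖ ≤ ((Λ : ArithmeticFunction ℝ) + Λ) n := by
          intro n
          rw [show (-P') n = -(P' n) from rfl, norm_neg, ArithmeticFunction.add_apply, ← two_mul]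
          exact (norm_restr_le _ _ _).trans (norm_pl_le n₁ n₂ n)
        have h3 := norm_conv_le hpp bB n
        rw [add_mul, ArithmeticFunction.add_apply] at h3
        have h4 := vonMangoldt_mul_le n
        have h5 := hlogn n hn
        have h6 : ‖(-P' * B) n‖ ≤ 2 * L * n.divisors.card := by
          have : Real.log n * n.divisors.card ≤ L * n.divisors.card := by gcongr
          linarith
        rw [pow_one, ← mul_div_assoc]
        gcongr
      refine (Finset.sum_le_sum hb).trans ?_
      rw [← Finset.mul_sum]
      calc 2 * L * ∑ n ∈ Finset.Icc 1 z, (n.divisors.card : ℝ) ^ 1 / n ≤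
            2 * L * L ^ 2 ^ 1 := by gcongr; exact hdiv 1
        _ = _ := by ring)
  have s3 := ht2 X Q hX hQ x σ U Z hx0 σ1 σ2 hU1 hUZ P c
  have hIoc : Finset.Ioc u z ⊆ Finset.Icc 1 z := fun n hn ↦ by
    rw [Finset.mem_Ioc] at hn
    rw [Finset.mem_Icc]
    omega
  have hΔ : 1 + Real.log Z + Q ^ 4 * U ^ (-(1 / 8) : ℝ) ≤ 2 * L := by
    have e : U ^ (-(1 / 8) : ℝ) = x ^ (-(1 / 32) : ℝ) := by
      rw [hU, ← Real.rpow_mul hx0.le]; norm_num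
    have : Q ^ 4 * U ^ (-(1 / 8) : ℝ) ≤ 1 := by
      rw [e]
      calc _ ≤ x ^ (1 / 32 : ℝ) * x ^ (-(1 / 32) : ℝ) := by gcongr
        _ = 1 := by rw [← Real.rpow_add hx0]; norm_num
    linarith
  have hPs : ∑ n ∈ Finset.Ioc u z, ‖P n‖ ^ 2 / n ≤ 4 * L ^ 3 := by
    have hb : ∀ n ∈ Finset.Icc 1 z, ‖P n‖ ^ 2 / n ≤ 4 * L ^ 2 * ((n.divisors.card : ℝ) ^ 0 / n) := by
      intro n hn
      have h2 : ‖P n‖ ≤ 2 * L := by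
        have := norm_pl_le n₁ n₂ n
        have := vonMangoldt_le_log (n := n)
        have := hlogn n hn
        linarith
      rw [pow_zero, mul_one_div]
      gcongr
      nlinarith [norm_nonneg (P n)]
    refine (Finset.sum_le_sum_of_subset_of_nonneg hIoc fun n _ _ ↦ by positivity).trans
      ((Finset.sum_le_sum hb).trans ?_)
    rw [← Finset.mul_sum]
    calc _ ≤ 4 * L ^ 2 * L ^ 2 ^ 0 := by gcongr; exact hdiv 0
      _ = _ := by ring
  have hcs : ∑ n ∈ Finset.Ioc u z, ‖c n‖ ^ 2 / n ≤ 4 * L ^ 64 := by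
    have hb : ∀ n ∈ Finset.Icc 1 z, ‖c n‖ ^ 2 / n ≤ 4 * ((n.divisors.card : ℝ) ^ 6 / n) := by
      intro n hn
      rw [Finset.mem_Icc] at hn
      have hd1 : (1 : ℝ) ≤ n.divisors.card := by
        exact_mod_cast Finset.card_pos.2 ⟨1, by simp; omega⟩
      have hf1 : ∀ n, ‖f n‖ ≤ ((ζ : ArithmeticFunction ℝ) * ζ) n := fun n ↦ by
        rw [zeta_mul_zeta_apply]; exact norm_pf_le n₁ n₂ n
      have h3 := (norm_conv_le hf1 bB n).trans (sum_divisors_mul_le n)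
      have h4 : ‖(1 : ArithmeticFunction ℂ) n‖ ≤ 1 := by
        rw [one_apply]; split_ifs <;> simp
      have h5 : ‖c n‖ ≤ 2 * (n.divisors.card : ℝ) ^ 3 := by
        rw [hc', show (1 - f * B) n = (1 : ArithmeticFunction ℂ) n - (f * B) n from rfl]
        have := one_le_pow₀ hd1 (n := 3)
        exact (norm_sub_le _ _).trans (by linarith)
      rw [← mul_div_assoc]
      gcongr
      calc ‖c n‖ ^ 2 ≤ (2 * (n.divisors.card : ℝ) ^ 3) ^ 2 := by gcongr
        _ = _ := by ring
    refine (Finset.sum_le_sum_of_subset_of_nonneg hIoc fun n _ _ ↦ by positivity).trans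
      ((Finset.sum_le_sum hb).trans ?_)
    rw [← Finset.mul_sum]
    have := hdiv 6
    norm_num at this ⊢
    linarith
  have hL364 : L ^ 3 ≤ L ^ 64 := pow_le_pow_right₀ (by linarith) (by norm_num)
  have s3' : ∑ i ∈ X, ‖ssum h x σ (restr (Finset.Ioc u z) (tw (hm i.2) P) *
      restr (Finset.Ioc u z) (tw (hm i.2) c))‖ ≤ C₂ * x ^ σ * (16 * L ^ 65) := by
    refine s3.trans ?_
    calc _ ≤ C₂ * x ^ σ * (2 * L * (4 * L ^ 3 + 4 * L ^ 64)) := by gcongr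
      _ ≤ C₂ * x ^ σ * (2 * L * (4 * L ^ 64 + 4 * L ^ 64)) := by gcongr
      _ = _ := by ring
  refine (Finset.sum_le_sum fun i _ ↦ (norm_add_le _ _).trans
    (add_le_add_left (norm_add_le _ _) _)).trans ?_
  rw [Finset.sum_add_distrib, Finset.sum_add_distrib]
  have hxs : 0 ≤ x ^ σ := by positivity
  have hw : (C₁ + C₀ * 2) * 9 * x ^ σ * L ^ 3 ≤ (C₁ + C₀ * 2) * 9 * x ^ σ * L ^ 65 := by gcongr
  calc _ ≤ C₁ * x ^ σ * (L ^ 3 * 9) + C₀ * x ^ σ * (2 * L ^ 3 * 9) + C₂ * x ^ σ * (16 * L ^ 65) :=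
        add_le_add (add_le_add s1 s2) s3'
    _ = (C₁ + C₀ * 2) * 9 * x ^ σ * L ^ 3 + C₂ * 16 * x ^ σ * L ^ 65 := by ring
    _ ≤ _ := by linarith

lemma ssum_lg_iterate (h : ℝ → ℂ) {x : ℝ} (hx : 0 < x) (σ : ℝ) (J : ℕ)
    (a : ArithmeticFunction ℂ) :
    ssum h x σ (lg^[J] a) = ∑ i ∈ Finset.range (J + 1), (J.choose i : ℂ) *
      (Real.log x : ℂ) ^ (J - i) * ssum (fun u ↦ (u : ℂ) ^ i * h u) x σ a := by
  simp only [ssum, Finset.mul_sum]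
  rw [Finset.sum_comm]
  refine Finset.sum_congr rfl fun n hn ↦ ?_
  have hn0 : (n : ℝ) ≠ 0 := by
    rw [Finset.mem_Icc] at hn
    exact_mod_cast (by omega : n ≠ 0)
  have e : (Real.log n : ℂ) = (Real.log (n / x) : ℝ) + (Real.log x : ℝ) := by
    rw [Real.log_div hn0 hx.ne']; push_cast; ring
  rw [lg_iterate_apply, e, add_pow, Finset.sum_mul, Finset.sum_mul]
  refine Finset.sum_congr rfl fun i _ ↦ ?_
  simp only [wt]
  ring

/-- Pairs of completely multiplicative functions whose twists have the analytic properties needed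
for a Bombieri–Vinogradov estimate. If `e` holds, the twist by the trivial character is excluded. -/
structure Adm (β : ℝ) (g₁ g₂ : ℕ →*₀ ℂ) (e : Prop) (C₀ : ℝ) (c : ℕ) : Prop where
  norm₁ : ∀ n, ‖g₁ n‖ ≤ 1
  norm₂ : ∀ n, ‖g₂ n‖ ≤ 1
  one_le : 1 ≤ C₀
  ctrl : ∀ r : ℕ, r ≠ 0 → ∀ χ : DirichletCharacter ℂ r, (e → χ ≠ 1) →
    Controlled (pf (hm χ * g₁) (hm χ * g₂)) (C₀ * (r : ℝ) ^ c)
  low : ∃ b : ℝ, 0 < b ∧ ∀ Q : ℕ, Good β Q → ∀ r : ℕ, r ≠ 0 → r ≤ Q →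
    ∀ χ : DirichletCharacter ℂ r, χ.IsPrimitive → (e → χ ≠ 1) → ∀ σ t : ℝ, 1 < σ → σ ≤ 2 →
      b ≤ ‖LSeries (pf (hm χ * g₁) (hm χ * g₂) ·) (σ + t * Complex.I)‖ *
        ll (C₀ * (Q : ℝ) ^ c) t ^ 21

/-- Large conductors. -/
lemma sum_norm_ssum_lg_pl_le {h : ℝ → ℂ} (h1 : ContDiff ℝ (⊤ : ℕ∞) h)
    (hs : ∀ u, 1 < |u| → h u = 0) (J : ℕ) :
    ∃ C : ℝ, 0 < C ∧ ∀ (g₁ g₂ : ℕ →*₀ ℂ), (∀ n, ‖g₁ n‖ ≤ 1) → (∀ n, ‖g₂ n‖ ≤ 1) →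
      ∀ (X : Finset (Σ r : ℕ, DirichletCharacter ℂ r)) (Q K x σ : ℝ), PrimChars X Q → 0 ≤ Q →
      (∀ i ∈ X, Controlled (pf (hm i.2 * g₁) (hm i.2 * g₂)) K) → 81 ≤ x → 1 ≤ Real.log x →
      1 < σ → σ ≤ 2 → Q ^ 4 ≤ x ^ (1 / 32 : ℝ) → Q ^ 2 * K ≤ x ^ (1 / 16 : ℝ) →
      ∑ i ∈ X, ‖ssum h x σ (lg^[J] (pl (hm i.2 * g₁) (hm i.2 * g₂)))‖ ≤
        C * x ^ σ * Real.log x ^ (J + 65) := by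
  have hh (i : ℕ) := sum_norm_ssum_pl_le (h := fun u ↦ (u : ℂ) ^ i * h u)
    ((Complex.ofRealCLM.contDiff.pow i).mul h1) (fun u hu ↦ by rw [hs u hu, mul_zero])
  choose C hC hb using hh
  refine ⟨(∑ i ∈ Finset.range (J + 1), J.choose i * C i) * 3 ^ 65, ?_,
    fun g₁ g₂ n₁ n₂ X Q K x σ hX hQ hc hx hlx σ1 σ2 hQ4 hQK ↦ ?_⟩
  · refine mul_pos (Finset.sum_pos (fun i hi ↦ mul_pos ?_ (hC i)) ⟨0, by simp⟩) (by positivity)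
    exact_mod_cast Nat.choose_pos (by simpa [Nat.lt_succ_iff] using hi)
  · have hx0 : 0 < x := by linarith
    set ℓ := Real.log x with hl
    calc _ ≤ ∑ i ∈ X, ∑ j ∈ Finset.range (J + 1), J.choose j * ℓ ^ (J - j) *
          ‖ssum (fun u ↦ (u : ℂ) ^ j * h u) x σ (pl (hm i.2 * g₁) (hm i.2 * g₂))‖ := by
          refine Finset.sum_le_sum fun i _ ↦ ?_
          rw [ssum_lg_iterate h hx0]
          refine (norm_sum_le _ _).trans (Finset.sum_le_sum fun j _ ↦ ?_)
          rw [norm_mul, norm_mul, norm_pow, Complex.norm_real, Real.norm_of_nonneg (by linarith),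
            Complex.norm_natCast]
      _ = ∑ j ∈ Finset.range (J + 1), J.choose j * ℓ ^ (J - j) * ∑ i ∈ X,
          ‖ssum (fun u ↦ (u : ℂ) ^ j * h u) x σ (pl (hm i.2 * g₁) (hm i.2 * g₂))‖ := by
          rw [Finset.sum_comm]; simp only [Finset.mul_sum]
      _ ≤ ∑ j ∈ Finset.range (J + 1), J.choose j * ℓ ^ J * (C j * x ^ σ * (3 * ℓ) ^ 65) := by
          refine Finset.sum_le_sum fun j _ ↦ ?_
          have h3 := hb j g₁ g₂ n₁ n₂ X Q K x σ hX hQ hc hx σ1 σ2 hQ4 hQK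
          have h4 := (hC j).le
          refine mul_le_mul ?_ (h3.trans ?_) (Finset.sum_nonneg fun _ _ ↦ norm_nonneg _)
            (by positivity)
          · gcongr
            omega
          · gcongr
            linarith
      _ = _ := by
          rw [Finset.sum_mul, Finset.sum_mul, Finset.sum_mul]
          refine Finset.sum_congr rfl fun j _ ↦ ?_
          rw [mul_pow, pow_add]; ring

lemma rpow_one_add_inv_log {x : ℝ} (hx : 1 < x) : x ^ (1 + 1 / Real.log x) = Real.exp 1 * x := by
  have hx0 : 0 < x := by linarith
  have := (Real.log_pos hx).ne'
  rw [Real.rpow_add hx0, Real.rpow_one, Real.rpow_def_of_pos hx0, mul_one_div_cancel this, mul_comm]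

/-- A Bombieri–Vinogradov estimate with a small level of distribution at suitable scales. -/
theorem bombieri_vinogradov {h : ℝ → ℂ} (h1 : ContDiff ℝ (⊤ : ℕ∞) h)
    (hs : ∀ u, 1 < |u| → h u = 0) (A : ℕ) {β : ℝ} {g₁ g₂ : ℕ →*₀ ℂ} {e : Prop} {C₀ : ℝ} {c : ℕ}
    (hg : Adm β g₁ g₂ e C₀ c) :
    ∃ ℓ₀ : ℝ, ∀ (Q : ℕ) (ℓ : ℝ), ℓ₀ ≤ ℓ → Good β Q → (Q : ℝ) = ℓ ^ (2 * (A + 66)) →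
      ∀ X : Finset (Σ r : ℕ, DirichletCharacter ℂ r),
      PrimChars X (Real.exp ℓ ^ (1 / (32 * (c + 4)) : ℝ)) → (e → ∀ i ∈ X, i.2 ≠ 1) →
      ∑ i ∈ X, (i.1 : ℝ) ^ (-(1 / 2) : ℝ) * ‖ssum h (Real.exp ℓ) (1 + 1 / ℓ)
        (lg^[4 * (A + 66) + 2 + A] (pl (hm i.2 * g₁) (hm i.2 * g₂)))‖ ≤
        Real.exp ℓ * ℓ ^ (4 * (A + 66) + 2) := by
  classical
  set J := 4 * (A + 66) + 2 + A with hJ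
  obtain ⟨b, hb, hlow⟩ := hg.low
  obtain ⟨C₁, hC₁, hbig⟩ := sum_norm_ssum_lg_pl_le h1 hs J
  obtain ⟨C₂, hC₂, N, hsmall⟩ := norm_ssum_lg_pl_le h1 hs 21 J hb
  have hC0 := hg.one_le
  set D : ℝ := 8 ^ N * N.factorial * Real.exp 1 with hD
  have hD0 : 0 < D := by positivity
  have hlC : 0 ≤ Real.log C₀ := Real.log_nonneg hC0
  set E := 1 + Real.log C₀ + c * (2 * (A + 66)) with hE
  have hE0 : 0 < E := by positivity
  refine ⟨5 + 32 * Real.log C₀ + C₁ * 3 + C₂ * 3 * (E ^ N * D),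
    fun Q ℓ hl hQ hQl X hX heX ↦ ?_⟩
  have p1 : 0 < C₂ * 3 * (E ^ N * D) := by positivity
  have hl5 : 5 ≤ ℓ := by linarith
  have hl0 : 0 < ℓ := by linarith
  set x := Real.exp ℓ with hx
  have hlx : Real.log x = ℓ := Real.log_exp ℓ
  have hx0 : 0 < x := Real.exp_pos _
  have hx81 : 81 ≤ x := by
    rw [hx]
    calc (81 : ℝ) ≤ 2.7182 ^ 5 := by norm_num
      _ ≤ Real.exp 1 ^ 5 := by gcongr; linarith [Real.exp_one_gt_d9]
      _ = Real.exp 5 := by rw [← Real.exp_nat_mul]; norm_num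
      _ ≤ _ := Real.exp_le_exp.2 hl5
  set σ := 1 + 1 / ℓ with hσ
  have σ1 : 1 < σ := by rw [hσ]; linarith [one_div_pos.2 hl0]
  have σ2 : σ ≤ 2 := by
    rw [hσ]
    have : 1 / ℓ ≤ 1 := by rw [div_le_one hl0]; linarith
    linarith
  have hxσ : x ^ σ ≤ 3 * x := by
    rw [hσ, ← hlx, rpow_one_add_inv_log (by linarith)]
    gcongr
    linarith [Real.exp_one_lt_d9]
  set θ : ℝ := 1 / (32 * (c + 4)) with hθ
  set R := x ^ θ with hR
  have hR0 : 0 < R := by positivity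
  have hR1 : 1 ≤ R := Real.one_le_rpow (by linarith) (by positivity)
  have hRc : R ^ (c + 4) = x ^ (1 / 32 : ℝ) := by
    rw [hR, ← Real.rpow_natCast, ← Real.rpow_mul hx0.le, hθ]
    congr 1
    push_cast
    field_simp
  have hR4 : R ^ 4 ≤ x ^ (1 / 32 : ℝ) := by
    rw [← hRc]; exact pow_le_pow_right₀ hR1 (by omega)
  have hRK : R ^ 2 * (C₀ * R ^ c) ≤ x ^ (1 / 16 : ℝ) := by
    have e1 : C₀ ≤ x ^ (1 / 32 : ℝ) := by
      rw [hx, ← Real.exp_mul, ← Real.log_le_iff_le_exp (by linarith)]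
      nlinarith
    calc R ^ 2 * (C₀ * R ^ c) = C₀ * R ^ (c + 2) := by ring
      _ ≤ x ^ (1 / 32 : ℝ) * R ^ (c + 4) := by
          gcongr
          norm_num
      _ = x ^ (1 / 16 : ℝ) := by rw [hRc, ← Real.rpow_add hx0]; norm_num
  rw [← Finset.sum_filter_add_sum_filter_not X (fun i ↦ i.1 ≤ Q)]
  have hQ1 : (1 : ℝ) ≤ Q := by rw [hQl]; exact one_le_pow₀ (by linarith)
  have hbig' : ∑ i ∈ X with ¬ i.1 ≤ Q, (i.1 : ℝ) ^ (-(1 / 2) : ℝ) *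
      ‖ssum h x σ (lg^[J] (pl (hm i.2 * g₁) (hm i.2 * g₂)))‖ ≤
      C₁ * 3 * x * ℓ ^ (4 * (A + 66) + 1) := by
    have hX' : PrimChars (X.filter fun i ↦ ¬ i.1 ≤ Q) R :=
      ⟨fun i hi ↦ hX.ne i (Finset.mem_of_mem_filter i hi),
        fun i hi ↦ hX.le i (Finset.mem_of_mem_filter i hi),
        fun i hi ↦ hX.prim i (Finset.mem_of_mem_filter i hi)⟩
    have := hbig g₁ g₂ hg.norm₁ hg.norm₂ _ R (C₀ * R ^ c) x σ hX' hR0.le (fun i hi ↦ by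
      have hi' := Finset.mem_of_mem_filter i hi
      refine (hg.ctrl i.1 (hX.ne i hi') i.2 fun he ↦ heX he i hi').mono ?_
      have := hX.le i hi'
      gcongr) hx81 (by rw [hlx]; linarith) σ1 σ2 hR4 hRK
    calc _ ≤ ∑ i ∈ X with ¬ i.1 ≤ Q, (ℓ ^ (A + 66))⁻¹ *
          ‖ssum h x σ (lg^[J] (pl (hm i.2 * g₁) (hm i.2 * g₂)))‖ := by
          refine Finset.sum_le_sum fun i hi ↦ ?_
          have hi2 : (Q : ℝ) ≤ i.1 := by
            have := (Finset.mem_filter.1 hi).2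
            exact_mod_cast (by omega : Q ≤ i.1)
          gcongr
          rw [Real.rpow_neg (by positivity)]
          gcongr
          calc ℓ ^ (A + 66) = (Q : ℝ) ^ (1 / 2 : ℝ) := by
                rw [hQl, mul_comm 2, pow_mul, ← Real.sqrt_eq_rpow, Real.sqrt_sq (by positivity)]
            _ ≤ _ := by gcongr
      _ = (ℓ ^ (A + 66))⁻¹ * ∑ i ∈ X with ¬ i.1 ≤ Q,
          ‖ssum h x σ (lg^[J] (pl (hm i.2 * g₁) (hm i.2 * g₂)))‖ := by rw [Finset.mul_sum]
      _ ≤ (ℓ ^ (A + 66))⁻¹ * (C₁ * (3 * x) * ℓ ^ (J + 65)) := by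
          gcongr
          refine this.trans ?_
          rw [hlx]
          gcongr
      _ = C₁ * 3 * x * ℓ ^ (4 * (A + 66) + 1) := by
          rw [show J + 65 = (A + 66) + (4 * (A + 66) + 1) by omega, pow_add ℓ (A + 66)]
          field_simp
  have hsmall' : ∑ i ∈ X with i.1 ≤ Q, (i.1 : ℝ) ^ (-(1 / 2) : ℝ) *
      ‖ssum h x σ (lg^[J] (pl (hm i.2 * g₁) (hm i.2 * g₂)))‖ ≤
      C₂ * 3 * (E ^ N * D) * x * ℓ ^ (4 * (A + 66) + 1) := by
    have hX' : PrimChars (X.filter fun i ↦ i.1 ≤ Q) Q :=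
      ⟨fun i hi ↦ hX.ne i (Finset.mem_of_mem_filter i hi),
        fun i hi ↦ by exact_mod_cast (Finset.mem_filter.1 hi).2,
        fun i hi ↦ hX.prim i (Finset.mem_of_mem_filter i hi)⟩
    have hcard := hX'.card_le (by linarith)
    have hlogK : 1 + Real.log (C₀ * (Q : ℝ) ^ c) ≤ E * (1 + Real.log ℓ) := by
      have hll : 0 ≤ Real.log ℓ := Real.log_nonneg (by linarith)
      rw [Real.log_mul (by linarith) (by positivity), Real.log_pow, hQl, Real.log_pow, hE]
      push_cast
      have : 0 ≤ Real.log C₀ * Real.log ℓ := by positivity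
      have : 0 ≤ (c : ℝ) * (2 * (A + 66)) := by positivity
      nlinarith
    have hpow : (1 + Real.log (C₀ * (Q : ℝ) ^ c)) ^ N ≤ E ^ N * D * ℓ := by
      have h0 : 0 ≤ Real.log (C₀ * (Q : ℝ) ^ c) :=
        Real.log_nonneg (one_le_mul_of_one_le_of_one_le hC0 (one_le_pow₀ hQ1))
      calc _ ≤ (E * (1 + Real.log ℓ)) ^ N := by gcongr
        _ = E ^ N * (1 + Real.log ℓ) ^ N := mul_pow _ _ _
        _ ≤ E ^ N * (D * ℓ) := by
            gcongr
            refine (one_add_log_pow_le N (by linarith)).trans ?_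
            rw [← hD]
            gcongr
            calc ℓ ^ (1 / 8 : ℝ) ≤ ℓ ^ (1 : ℝ) :=
                  Real.rpow_le_rpow_of_exponent_le (by linarith) (by norm_num)
              _ = ℓ := Real.rpow_one _
        _ = _ := by ring
    have hone : ∀ i ∈ X.filter (fun i ↦ i.1 ≤ Q), (i.1 : ℝ) ^ (-(1 / 2) : ℝ) *
        ‖ssum h x σ (lg^[J] (pl (hm i.2 * g₁) (hm i.2 * g₂)))‖ ≤
        C₂ * (3 * x) * (E ^ N * D * ℓ) := by
      intro i hi
      have hi' := Finset.mem_of_mem_filter i hi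
      have hne := hX.ne i hi'
      have hi1 : (1 : ℝ) ≤ i.1 := by exact_mod_cast Nat.one_le_iff_ne_zero.2 hne
      have hle := hX'.le i hi
      have h5 := hsmall (hm i.2 * g₁) (hm i.2 * g₂) (C₀ * (Q : ℝ) ^ c)
        (norm_mul_le' (norm_hm_le _) hg.norm₁) (norm_mul_le' (norm_hm_le _) hg.norm₂)
        ((hg.ctrl i.1 hne i.2 fun he ↦ heX he i hi').mono (mul_le_mul_of_nonneg_left
          (pow_le_pow_left₀ (Nat.cast_nonneg _) hle c) (by linarith))) σ σ1 σ2
        (fun t ↦ hlow Q hQ i.1 hne (by exact_mod_cast hle) i.2 (hX.prim i hi')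
          (fun he ↦ heX he i hi') σ t σ1 σ2) x hx0
      have h6 : (i.1 : ℝ) ^ (-(1 / 2) : ℝ) ≤ 1 :=
        Real.rpow_le_one_of_one_le_of_nonpos hi1 (by norm_num)
      calc _ ≤ 1 * (C₂ * x ^ σ * (1 + Real.log (C₀ * (Q : ℝ) ^ c)) ^ N) := by
            gcongr
        _ ≤ 1 * (C₂ * (3 * x) * (E ^ N * D * ℓ)) := by
            have h7 : 0 ≤ 1 + Real.log (C₀ * (Q : ℝ) ^ c) := by
              have h8 : (1 : ℝ) ≤ Q := hi1.trans hle
              linarith [Real.log_nonneg (one_le_mul_of_one_le_of_one_le hC0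
                (one_le_pow₀ (n := c) h8))]
            gcongr
        _ = _ := one_mul _
    refine (Finset.sum_le_card_nsmul _ _ _ hone).trans ?_
    rw [nsmul_eq_mul]
    calc _ ≤ (Q : ℝ) ^ 2 * (C₂ * (3 * x) * (E ^ N * D * ℓ)) := by gcongr
      _ = _ := by
        rw [hQl, ← pow_mul, show 2 * (A + 66) * 2 = 4 * (A + 66) by ring, pow_succ]; ring
  have hfin : C₁ * 3 + C₂ * 3 * (E ^ N * D) ≤ ℓ := by linarith
  calc _ ≤ C₂ * 3 * (E ^ N * D) * x * ℓ ^ (4 * (A + 66) + 1) +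
        C₁ * 3 * x * ℓ ^ (4 * (A + 66) + 1) := add_le_add hsmall' hbig'
    _ = (C₁ * 3 + C₂ * 3 * (E ^ N * D)) * (x * ℓ ^ (4 * (A + 66) + 1)) := by ring
    _ ≤ ℓ * (x * ℓ ^ (4 * (A + 66) + 1)) := by gcongr
    _ = _ := by ring

/-- Total variation of a function on the Gaussian integers in direction `δ`. -/
def vari (f : GaussianInt → ℂ) (δ : GaussianInt) : ℝ := ∑' α, ‖f (α + δ) - f α‖

lemma finite_support_comp {f : GaussianInt → ℂ} (hf : f.support.Finite)
    {ι : Type*} {g : ι → GaussianInt} (hg : Function.Injective g) :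
    (fun a ↦ f (g a)).support.Finite :=
  hf.preimage (f := g) hg.injOn

lemma finite_support_diff {f : GaussianInt → ℂ} (hf : f.support.Finite) (δ : GaussianInt) :
    (fun α ↦ ‖f (α + δ) - f α‖).support.Finite := by
  refine ((finite_support_comp hf (add_left_injective δ)).union hf).subset fun α hα ↦ ?_
  by_contra h
  simp only [Set.mem_union, Function.mem_support, not_or, not_not] at h
  exact hα (by simp [h.1, h.2])

lemma summable_diff {f : GaussianInt → ℂ} (hf : f.support.Finite) (δ : GaussianInt) :
    Summable fun α ↦ ‖f (α + δ) - f α‖ :=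
  summable_of_hasFiniteSupport (finite_support_diff hf δ)

lemma vari_add_le {f : GaussianInt → ℂ} (hf : f.support.Finite) (δ δ' : GaussianInt) :
    vari f (δ + δ') ≤ vari f δ + vari f δ' := by
  have e : vari f δ' = ∑' α, ‖f (α + δ + δ') - f (α + δ)‖ :=
    ((Equiv.addRight δ).tsum_eq fun α ↦ ‖f (α + δ') - f α‖).symm
  have hs : Summable fun α ↦ ‖f (α + δ + δ') - f (α + δ)‖ :=
    (summable_diff hf δ').comp_injective (add_left_injective δ)
  rw [e, vari, vari, ← (summable_diff hf δ).tsum_add hs]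
  refine (summable_diff hf _).tsum_le_tsum (fun α ↦ ?_) ((summable_diff hf δ).add hs)
  rw [← add_assoc]
  refine (le_of_eq ?_).trans (norm_add_le _ _)
  congr 1
  ring

lemma vari_nsmul_le {f : GaussianInt → ℂ} (hf : f.support.Finite) (δ : GaussianInt) (n : ℕ) :
    vari f (n • δ) ≤ n * vari f δ := by
  induction n with
  | zero => simp [vari]
  | succ n ih =>
    rw [succ_nsmul]
    refine (vari_add_le hf _ _).trans ?_
    push_cast
    linarith

/-- The Gaussian integer with natural coordinates. -/
def gi (v : ℕ × ℕ) : GaussianInt := ⟨v.1, v.2⟩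

lemma vari_gi_le {f : GaussianInt → ℂ} (hf : f.support.Finite) {D : ℝ} (h1 : vari f 1 ≤ D)
    (hI : vari f ⟨0, 1⟩ ≤ D) {v : ℕ × ℕ} {M : ℕ} (hv : v.1 ≤ M) (hv' : v.2 ≤ M) :
    vari f (gi v) ≤ 2 * M * D := by
  have hD : 0 ≤ D := (tsum_nonneg fun _ ↦ norm_nonneg _).trans h1
  have e : gi v = v.1 • (1 : GaussianInt) + v.2 • (⟨0, 1⟩ : GaussianInt) := by
    ext <;> simp [gi]
  rw [e]
  have hv1 : (v.1 : ℝ) ≤ M := by exact_mod_cast hv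
  have hv2 : (v.2 : ℝ) ≤ M := by exact_mod_cast hv'
  calc _ ≤ v.1 * vari f 1 + v.2 * vari f ⟨0, 1⟩ :=
        (vari_add_le hf _ _).trans (add_le_add (vari_nsmul_le hf _ _) (vari_nsmul_le hf _ _))
    _ ≤ M * D + M * D := by gcongr <;> exact tsum_nonneg fun _ ↦ norm_nonneg _
    _ = _ := by ring

lemma tsum_fintype_prod {ι κ : Type*} [Fintype ι] (F : ι × κ → ℂ) (hF : Summable F) :
    ∑' v, F v = ∑ i, ∑' k, F (i, k) := by
  rw [hF.tsum_prod, tsum_fintype]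

lemma norm_tsum_sub_le {ι κ : Type*} {g : κ → ℝ} (hg : Summable g) {a b : ι → ℂ}
    (ha : Summable a) (hb : Summable b) {i : ι → κ} (hi : Function.Injective i)
    (h : ∀ j, g (i j) = ‖a j - b j‖ := by intros; rfl) (h0 : ∀ k, 0 ≤ g k := by
      intros; exact norm_nonneg _) : ‖∑' j, a j - ∑' j, b j‖ ≤ ∑' k, g k := by
  have h1 : Summable fun j ↦ ‖a j - b j‖ := by
    have := hg.comp_injective hi
    rwa [show g ∘ i = fun j ↦ ‖a j - b j‖ from funext h] at this
  rw [← ha.tsum_sub hb]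
  refine (norm_tsum_le_tsum_norm h1).trans ?_
  exact h1.tsum_le_tsum_of_inj i hi (fun k _ ↦ h0 k) (fun j ↦ (h j).ge) hg

/-- Equidistribution of the sum of `f` among the cosets of an ideal. -/
lemma norm_tsum_sub_coset_le {f : GaussianInt → ℂ} (hf : f.support.Finite) {D : ℝ}
    (h1 : vari f 1 ≤ D) (hI : vari f ⟨0, 1⟩ ≤ D) {ρ : GaussianInt} (hρ : ρ ≠ 0)
    {ι : Type*} [Fintype ι] (rep : ι → ℕ × ℕ) {M : ℕ} (hM : ∀ j, (rep j).1 ≤ M ∧ (rep j).2 ≤ M)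
    (hb : Function.Bijective fun v : ι × GaussianInt ↦ ρ * v.2 + gi (rep v.1)) (j : ι) :
    ‖∑' α, f α - Fintype.card ι * ∑' α, f (ρ * α + gi (rep j))‖ ≤
      Fintype.card ι * (4 * M * D) := by
  have hinj : Function.Injective fun α : GaussianInt ↦ ρ * α := mul_right_injective₀ hρ
  have hsum {γ : GaussianInt} : Summable fun α ↦ f (ρ * α + γ) :=
    summable_of_hasFiniteSupport (finite_support_comp hf ((add_left_injective γ).comp hinj))
  have hT (i : ι) : ‖∑' α, f (ρ * α + gi (rep i)) - ∑' α, f (ρ * α)‖ ≤ 2 * M * D := by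
    have h0 : Summable fun α ↦ f (ρ * α) := by simpa using hsum (γ := 0)
    refine (norm_tsum_sub_le (summable_diff hf (gi (rep i))) hsum h0 hinj).trans ?_
    exact vari_gi_le hf h1 hI (hM i).1 (hM i).2
  have e : ∑' α, f α = ∑ i, ∑' α, f (ρ * α + gi (rep i)) := by
    have hs : Summable fun v : ι × GaussianInt ↦ f (ρ * v.2 + gi (rep v.1)) :=
      summable_of_hasFiniteSupport (finite_support_comp hf hb.1)
    have e1 := (Equiv.ofBijective _ hb).tsum_eq f
    rw [← e1]
    exact tsum_fintype_prod _ hs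
  rw [e, ← nsmul_eq_mul, ← Finset.card_univ, ← Finset.sum_const, ← Finset.sum_sub_distrib]
  refine (norm_sum_le _ _).trans ((Finset.sum_le_card_nsmul _ _ (4 * M * D) fun i _ ↦ ?_).trans ?_)
  · calc _ = ‖(∑' α, f (ρ * α + gi (rep i)) - ∑' α, f (ρ * α)) -
          (∑' α, f (ρ * α + gi (rep j)) - ∑' α, f (ρ * α))‖ := by congr 1; ring
      _ ≤ 2 * M * D + 2 * M * D := (norm_sub_le _ _).trans (add_le_add (hT i) (hT j))
      _ = _ := by ring
  · rw [nsmul_eq_mul]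

lemma bijective_five : Function.Bijective fun v : Fin 25 × GaussianInt ↦
    (⟨3, 4⟩ : GaussianInt) * v.2 + gi ((v.1 : ℕ), 0) := by
  constructor
  · rintro ⟨i, a, b⟩ ⟨j, c, d⟩ h
    simp only [gi, Zsqrtd.ext_iff, Zsqrtd.re_add, Zsqrtd.re_mul, Zsqrtd.im_add, Zsqrtd.im_mul] at h
    obtain ⟨i, hi⟩ := i
    obtain ⟨j, hj⟩ := j
    simp only [Prod.mk.injEq, Zsqrtd.ext_iff, Fin.mk.injEq]
    simp only at h
    omega
  · rintro ⟨a, b⟩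
    refine ⟨⟨⟨((a - 7 * b) % 25).toNat, by omega⟩,
      ⟨(3 * (a - (a - 7 * b) % 25) + 4 * b) / 25, (3 * b - 4 * (a - (a - 7 * b) % 25)) / 25⟩⟩, ?_⟩
    simp only [gi, Zsqrtd.ext_iff, Zsqrtd.re_add, Zsqrtd.re_mul, Zsqrtd.im_add, Zsqrtd.im_mul]
    omega

lemma bijective_nat {r : ℕ} (hr : r ≠ 0) : Function.Bijective
    fun v : (Fin r × Fin r) × GaussianInt ↦
      (r : GaussianInt) * v.2 + gi ((v.1.1 : ℕ), (v.1.2 : ℕ)) := by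
  constructor
  · rintro ⟨⟨⟨i, hi⟩, ⟨i', hi'⟩⟩, a, b⟩ ⟨⟨⟨j, hj⟩, ⟨j', hj'⟩⟩, c, d⟩ h
    simp only [gi, Zsqrtd.ext_iff, Zsqrtd.re_add, Zsqrtd.re_mul, Zsqrtd.im_add, Zsqrtd.im_mul,
      Zsqrtd.re_natCast, Zsqrtd.im_natCast] at h
    have key {i j : ℕ} {a c : ℤ} (hi : i < r) (hj : j < r) (h : (r : ℤ) * a + i = r * c + j) :
        i = j ∧ a = c := by
      have h1 : (i : ℤ) = j := by
        have := congrArg (· % (r : ℤ)) h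
        simp only [Int.mul_add_emod_self_left] at this
        rwa [Int.emod_eq_of_lt (by omega) (by omega), Int.emod_eq_of_lt (by omega) (by omega)]
          at this
      refine ⟨by exact_mod_cast h1, ?_⟩
      rw [h1] at h
      have h2 : (r : ℤ) ≠ 0 := by exact_mod_cast hr
      exact mul_left_cancel₀ h2 (by linarith)
    obtain ⟨h1, h2⟩ := key (a := a) (c := c) hi hj (by linarith [h.1])
    obtain ⟨h3, h4⟩ := key (a := b) (c := d) hi' hj' (by linarith [h.2])
    subst h1 h2 h3 h4
    rfl
  · rintro ⟨a, b⟩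
    have h2 : (0 : ℤ) < r := by exact_mod_cast Nat.pos_of_ne_zero hr
    have h0 (a : ℤ) : (((a % r).toNat : ℕ) : ℤ) = a % r := Int.toNat_of_nonneg
      (Int.emod_nonneg _ h2.ne')
    have h3 (a : ℤ) : (a % r).toNat < r := by
      have := Int.emod_lt_of_pos a h2
      have := h0 a
      omega
    refine ⟨⟨⟨⟨(a % r).toNat, h3 a⟩, ⟨(b % r).toNat, h3 b⟩⟩, ⟨a / r, b / r⟩⟩, ?_⟩
    simp only [gi, Zsqrtd.ext_iff, Zsqrtd.re_add, Zsqrtd.re_mul, Zsqrtd.im_add, Zsqrtd.im_mul,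
      Zsqrtd.re_natCast, Zsqrtd.im_natCast, h0]
    exact ⟨by linarith [Int.mul_ediv_add_emod a r], by linarith [Int.mul_ediv_add_emod b r]⟩

/-- The fourth power of the direction of a Gaussian integer. -/
def ev (α : GaussianInt) : ℂ := ((α : ℂ) / ‖(α : ℂ)‖) ^ 4

lemma ev_zero : ev 0 = 0 := by simp [ev]

lemma ev_mul (α β : GaussianInt) : ev (α * β) = ev α * ev β := by
  rw [ev, ev, ev, GaussianInt.toComplex_mul, norm_mul, ← mul_pow, div_mul_div_comm]
  push_cast
  rfl

lemma norm_ev {α : GaussianInt} (h : α ≠ 0) : ‖ev α‖ = 1 := by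
  have : ‖(α : ℂ)‖ ≠ 0 := by simpa using h
  rw [ev, norm_pow, norm_div, Complex.norm_real, norm_norm, div_self this, one_pow]

lemma norm_ev_le (α : GaussianInt) : ‖ev α‖ ≤ 1 := by
  rcases eq_or_ne α 0 with rfl | h
  · simp [ev_zero]
  · exact (norm_ev h).le

lemma ev_natCast {n : ℕ} (hn : n ≠ 0) : ev n = 1 := by
  have : (n : ℂ) ≠ 0 := by exact_mod_cast hn
  simp [ev, this]

lemma ev_I : ev ⟨0, 1⟩ = 1 := by
  simp [ev, GaussianInt.toComplex_def]

lemma norm_pow_sub_pow_le' {x y : ℂ} (hx : ‖x‖ ≤ 1) (hy : ‖y‖ ≤ 1) (n : ℕ) :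
    ‖x ^ n - y ^ n‖ ≤ n * ‖x - y‖ := by
  induction n with
  | zero => simp
  | succ n ih =>
    rw [show x ^ (n + 1) - y ^ (n + 1) = x ^ n * (x - y) + (x ^ n - y ^ n) * y by ring]
    refine (norm_add_le _ _).trans ?_
    rw [norm_mul, norm_mul, norm_pow]
    have h1 : ‖x‖ ^ n * ‖x - y‖ ≤ 1 * ‖x - y‖ := by
      gcongr
      exact pow_le_one₀ (norm_nonneg _) hx
    have h2 : ‖x ^ n - y ^ n‖ * ‖y‖ ≤ ‖x ^ n - y ^ n‖ * 1 := by gcongr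
    push_cast
    linarith

lemma norm_direction_sub_le {x y : ℂ} (hx : x ≠ 0) (hy : y ≠ 0) :
    ‖x / ‖x‖ - y / ‖y‖‖ ≤ 2 * ‖x - y‖ / ‖y‖ := by
  have hx' : (‖x‖ : ℂ) ≠ 0 := by exact_mod_cast norm_ne_zero_iff.2 hx
  have hy' : (‖y‖ : ℂ) ≠ 0 := by exact_mod_cast norm_ne_zero_iff.2 hy
  have e : x / ‖x‖ - y / ‖y‖ = (x / ‖x‖ * ((‖y‖ : ℂ) - ‖x‖) + (x - y)) / ‖y‖ := by
    field_simp
    ring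
  rw [e, norm_div, Complex.norm_real, norm_norm]
  gcongr
  refine (norm_add_le _ _).trans ?_
  rw [norm_mul, norm_div, Complex.norm_real, norm_norm, div_self (norm_ne_zero_iff.2 hx), one_mul,
    ← Complex.ofReal_sub, Complex.norm_real, Real.norm_eq_abs, ← norm_neg (x - y), neg_sub]
  linarith [abs_norm_sub_norm_le y x]

lemma norm_ev_pow_sub_le (κ : ℕ) {α β : GaussianInt} (hα : α ≠ 0) (hβ : β ≠ 0) :
    ‖ev α ^ κ - ev β ^ κ‖ ≤ 8 * κ * (‖(α : ℂ) - β‖ / ‖(β : ℂ)‖) := by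
  have hα' : (α : ℂ) ≠ 0 := by simpa using hα
  have hβ' : (β : ℂ) ≠ 0 := by simpa using hβ
  have n1 {x : ℂ} : ‖x / ‖x‖‖ ≤ 1 := by
    rw [norm_div, Complex.norm_real, norm_norm]
    exact div_self_le_one _
  calc _ ≤ κ * ‖ev α - ev β‖ := norm_pow_sub_pow_le' (norm_ev_le _) (norm_ev_le _) κ
    _ ≤ κ * ((4 : ℕ) * (2 * ‖(α : ℂ) - β‖ / ‖(β : ℂ)‖)) := by
        gcongr
        refine (norm_pow_sub_pow_le' n1 n1 4).trans ?_
        gcongr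
        exact norm_direction_sub_le hα' hβ'
    _ = _ := by push_cast; ring

/-- The power of the Hecke character restricted to a disc. -/
def disc (κ N : ℕ) (α : GaussianInt) : ℂ := if α.norm ≤ N then ev α ^ κ else 0

lemma norm_eq (α : GaussianInt) : α.norm = α.re ^ 2 + α.im ^ 2 := by
  rw [Zsqrtd.norm_def]; ring

lemma norm_disc_le (κ N : ℕ) (α : GaussianInt) : ‖disc κ N α‖ ≤ 1 := by
  rw [disc]
  split_ifs
  · rw [norm_pow]; exact pow_le_one₀ (norm_nonneg _) (norm_ev_le α)
  · simp

lemma abs_le_sqrt {a b : ℤ} {N : ℕ} (h : a ^ 2 + b ^ 2 ≤ N) : |a| ≤ N.sqrt := by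
  have h1 : a.natAbs ≤ N.sqrt := by
    rw [Nat.le_sqrt]
    zify
    rw [← sq, sq_abs]
    nlinarith [sq_nonneg b]
  rw [Int.abs_eq_natAbs]
  exact_mod_cast h1

lemma finite_norm_le (N : ℕ) : {α : GaussianInt | α.norm ≤ N}.Finite := by
  have hi : Function.Injective fun α : GaussianInt ↦ (α.re, α.im) := by
    intro α β h
    simpa [Zsqrtd.ext_iff] using h
  refine Set.Finite.of_finite_image (f := fun α : GaussianInt ↦ (α.re, α.im)) ?_ hi.injOn
  refine ((Finset.Icc (-(N.sqrt : ℤ)) N.sqrt ×ˢ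
    Finset.Icc (-(N.sqrt : ℤ)) N.sqrt).finite_toSet).subset ?_
  rintro _ ⟨α, hα, rfl⟩
  simp only [Set.mem_ofPred_eq, norm_eq] at hα
  simp only [Finset.coe_product, Set.mem_prod, Finset.mem_coe, Finset.mem_Icc]
  exact ⟨abs_le.1 (abs_le_sqrt hα), abs_le.1 (abs_le_sqrt (by rwa [add_comm] at hα))⟩

lemma finite_support_disc (κ N : ℕ) : (disc κ N).support.Finite := by
  refine (finite_norm_le N).subset fun α hα ↦ ?_
  by_contra h
  exact hα (if_neg h)

lemma disc_mul (κ N : ℕ) {ρ : GaussianInt} (hρ : ρ ≠ 0) {M : ℕ} (hM : ρ.norm = M)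
    (α : GaussianInt) : disc κ (M * N) (ρ * α) = ev ρ ^ κ * disc κ N α := by
  have hM0 : (0 : ℤ) < M := by
    rw [← hM]
    exact (Zsqrtd.norm_nonneg (by norm_num) ρ).lt_of_ne' fun h ↦ hρ (by
      rwa [Zsqrtd.norm_eq_zero_iff (by norm_num)] at h)
  simp only [disc, Zsqrtd.norm_mul, hM, Nat.cast_mul, ev_mul, mul_pow, mul_ite, mul_zero]
  congr 1
  exact propext (mul_le_mul_iff_right₀ hM0)

lemma vari_disc_I (κ N : ℕ) : vari (disc κ N) ⟨0, 1⟩ = vari (disc κ N) 1 := by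
  let I : GaussianIntˣ := ⟨⟨0, 1⟩, ⟨0, -1⟩, by ext <;> simp, by ext <;> simp⟩
  have h (α : GaussianInt) : disc κ N (⟨0, 1⟩ * α) = disc κ N α := by
    have := disc_mul κ N (ρ := ⟨0, 1⟩) (M := 1) (by simp [Zsqrtd.ext_iff]) (by simp [norm_eq]) α
    rwa [ev_I, one_pow, one_mul, one_mul] at this
  rw [vari, ← (Units.mulLeft I).tsum_eq, vari]
  refine tsum_congr fun α ↦ ?_
  have e : ∀ α, Units.mulLeft I α = ⟨0, 1⟩ * α := fun α ↦ rfl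
  rw [e, h, show (⟨0, 1⟩ : GaussianInt) * α + ⟨0, 1⟩ = ⟨0, 1⟩ * (α + 1) by ring, h]

lemma row_bound {κ N : ℕ} (hκ : κ ≠ 0) {q : ℝ} (hq : 0 < q) {v : ℕ} (hv : q ≤ v + 1) (a b : ℤ) :
    ‖disc κ N ⟨a + 1, b⟩ - disc κ N ⟨a, b⟩‖ ≤
      (if a = (N - b.natAbs ^ 2).sqrt ∨ a = -(N - b.natAbs ^ 2).sqrt - 1 then 1 else 0) +
      ((if |b| ≤ v then 2 else 0) + 8 * κ / q) := by
  have c0 : 0 ≤ 8 * κ / q := by positivity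
  have hin (a : ℤ) : (⟨a, b⟩ : GaussianInt).norm ≤ N ↔
      b.natAbs ^ 2 ≤ N ∧ |a| ≤ (N - b.natAbs ^ 2).sqrt := by
    have e : |a| ≤ (N - b.natAbs ^ 2).sqrt ↔ a.natAbs ≤ (N - b.natAbs ^ 2).sqrt := by
      rw [Int.abs_eq_natAbs]; norm_cast
    rw [norm_eq, e, Nat.le_sqrt']
    change a ^ 2 + b ^ 2 ≤ _ ↔ _
    have e1 : (a.natAbs : ℤ) ^ 2 = a ^ 2 := Int.natAbs_sq a
    have e2 : (b.natAbs : ℤ) ^ 2 = b ^ 2 := Int.natAbs_sq b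
    rw [← e1, ← e2]
    norm_cast
    generalize b.natAbs ^ 2 = B
    generalize a.natAbs ^ 2 = A
    omega
  set t := (N - b.natAbs ^ 2).sqrt with ht
  have i1 : (0 : ℝ) ≤ if a = t ∨ a = -t - 1 then 1 else 0 := by split_ifs <;> norm_num
  have i2 : (0 : ℝ) ≤ if |b| ≤ v then 2 else 0 := by split_ifs <;> norm_num
  have d1 := norm_disc_le κ N ⟨a + 1, b⟩
  have d2 := norm_disc_le κ N ⟨a, b⟩
  by_cases p1 : (⟨a + 1, b⟩ : GaussianInt).norm ≤ N <;>
    by_cases p2 : (⟨a, b⟩ : GaussianInt).norm ≤ N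
  · by_cases hb : |b| ≤ v
    · rw [if_pos hb]
      linarith [norm_sub_le (disc κ N ⟨a + 1, b⟩) (disc κ N ⟨a, b⟩)]
    · have hb0 : b ≠ 0 := by rintro rfl; simp at hb
      rw [disc, if_pos p1, disc, if_pos p2, if_neg hb]
      refine (norm_ev_pow_sub_le κ (by simp [Zsqrtd.ext_iff, hb0])
        (by simp [Zsqrtd.ext_iff, hb0])).trans ?_
      have e1 : ‖((⟨a + 1, b⟩ : GaussianInt) : ℂ) - (⟨a, b⟩ : GaussianInt)‖ = 1 := by
        simp [GaussianInt.toComplex_def]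
      have e2 : q ≤ ‖((⟨a, b⟩ : GaussianInt) : ℂ)‖ := by
        have h1 := Complex.abs_im_le_norm ((⟨a, b⟩ : GaussianInt) : ℂ)
        rw [GaussianInt.im_toComplex] at h1
        have h2 : (v : ℝ) + 1 ≤ |((b : ℤ) : ℝ)| := by
          have : (v : ℤ) + 1 ≤ |b| := by omega
          exact_mod_cast this
        exact hv.trans (h2.trans h1)
      rw [e1, mul_one_div]
      have : 8 * (κ : ℝ) / ‖((⟨a, b⟩ : GaussianInt) : ℂ)‖ ≤ 8 * κ / q := by gcongr
      linarith
  · rw [show disc κ N ⟨a, b⟩ = 0 from if_neg p2, sub_zero]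
    rw [hin] at p1 p2
    rw [if_pos (by rw [abs_le] at p1 p2; omega)]
    linarith
  · rw [show disc κ N ⟨a + 1, b⟩ = 0 from if_neg p1, zero_sub, norm_neg]
    rw [hin] at p1 p2
    rw [if_pos (by rw [abs_le] at p1 p2; omega)]
    linarith
  · rw [show disc κ N ⟨a + 1, b⟩ = 0 from if_neg p1, show disc κ N ⟨a, b⟩ = 0 from if_neg p2,
      sub_zero, norm_zero]
    linarith

lemma vari_disc_le {κ N : ℕ} (hκ : κ ≠ 0) :
    vari (disc κ N) 1 ≤ 126 * κ * (N : ℝ) ^ (3 / 4 : ℝ) := by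
  rcases Nat.eq_zero_or_pos N with rfl | hN
  · have h0 (α : GaussianInt) : disc κ 0 α = 0 := by
      rw [disc]
      split_ifs with h
      · have : α = 0 := by
          rw [← Zsqrtd.norm_eq_zero_iff (d := -1) (by norm_num)]
          exact le_antisymm (by simpa using h) (Zsqrtd.norm_nonneg (by norm_num) α)
        rw [this, ev_zero, zero_pow hκ]
      · rfl
    simp [vari, h0]
  set s := N.sqrt with hs
  have hs1 : 1 ≤ s := by rw [hs, Nat.le_sqrt]; omega
  set q := √(s : ℝ) with hq
  have hs1' : (1 : ℝ) ≤ s := by exact_mod_cast hs1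
  have hq1 : 1 ≤ q := Real.one_le_sqrt.2 hs1'
  have hqq : q * q = s := Real.mul_self_sqrt (by linarith)
  set v := s.sqrt with hv
  have hvq : (v : ℝ) ≤ q := Real.nat_sqrt_le_real_sqrt
  have hqv : q ≤ v + 1 := Real.real_sqrt_le_nat_sqrt_succ
  have hκ1 : (1 : ℝ) ≤ κ := by exact_mod_cast Nat.one_le_iff_ne_zero.2 hκ
  let E : ℤ × ℤ ≃ GaussianInt :=
    ⟨fun v ↦ ⟨v.1, v.2⟩, fun α ↦ (α.re, α.im), fun _ ↦ rfl, fun _ ↦ rfl⟩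
  set A := Finset.Icc (-(s : ℤ) - 1) s with hA
  set B := Finset.Icc (-(s : ℤ)) s with hB
  have hAc : (A.card : ℝ) = 2 * s + 2 := by
    have : A.card = 2 * s + 2 := by rw [hA, Int.card_Icc]; omega
    rw [this]; push_cast; ring
  have hBc : (B.card : ℝ) = 2 * s + 1 := by
    have : B.card = 2 * s + 1 := by rw [hB, Int.card_Icc]; omega
    rw [this]; push_cast; ring
  have e : vari (disc κ N) 1 =
      ∑ w ∈ B ×ˢ A, ‖disc κ N ⟨w.2 + 1, w.1⟩ - disc κ N ⟨w.2, w.1⟩‖ := by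
    rw [vari, ← ((Equiv.prodComm ℤ ℤ).trans E).tsum_eq, tsum_eq_sum (s := B ×ˢ A)]
    · refine Finset.sum_congr rfl fun w _ ↦ ?_
      congr 3
      simp [E, Zsqrtd.ext_iff]
    · rintro ⟨b, a⟩ hw
      have h0 : ∀ c : ℤ, (c = a ∨ c = a + 1) → disc κ N ⟨c, b⟩ = 0 := by
        intro c hc
        refine if_neg fun h ↦ hw ?_
        rw [norm_eq] at h
        change c ^ 2 + b ^ 2 ≤ _ at h
        have h1 := abs_le_sqrt h
        have h2 := abs_le_sqrt (a := b) (b := c) (by rw [add_comm]; exact h)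
        simp only [hA, hB, Finset.mem_product, Finset.mem_Icc]
        rw [abs_le] at h1 h2
        omega
      have e2 : (⟨a, b⟩ : GaussianInt) + 1 = ⟨a + 1, b⟩ := by simp [Zsqrtd.ext_iff]
      change ‖disc κ N (⟨a, b⟩ + 1) - disc κ N ⟨a, b⟩‖ = 0
      rw [e2, h0 _ (Or.inl rfl), h0 _ (Or.inr rfl), sub_zero, norm_zero]
  rw [e, Finset.sum_product]
  have hrow (b : ℤ) : ∑ a ∈ A, ‖disc κ N ⟨a + 1, b⟩ - disc κ N ⟨a, b⟩‖ ≤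
      2 + (2 * s + 2) * ((if |b| ≤ v then 2 else 0) + 8 * κ / q) := by
    refine (Finset.sum_le_sum fun a _ ↦ row_bound hκ (by linarith) hqv a b).trans ?_
    rw [Finset.sum_add_distrib, Finset.sum_const, nsmul_eq_mul, hAc]
    gcongr
    rw [← Finset.sum_filter, Finset.sum_const, nsmul_eq_mul, mul_one]
    set t := (N - b.natAbs ^ 2).sqrt
    have : (A.filter fun a : ℤ ↦ a = t ∨ a = -t - 1).card ≤ 2 :=
      (Finset.card_le_card (t := {(t : ℤ), -(t : ℤ) - 1}) fun a ha ↦ by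
        simpa using (Finset.mem_filter.1 ha).2).trans Finset.card_le_two
    exact_mod_cast this
  refine (Finset.sum_le_sum fun b _ ↦ hrow b).trans ?_
  rw [Finset.sum_add_distrib, ← Finset.mul_sum, Finset.sum_add_distrib, Finset.sum_const,
    Finset.sum_const, nsmul_eq_mul, nsmul_eq_mul, hBc, ← Finset.sum_filter, Finset.sum_const,
    nsmul_eq_mul]
  have hc : ((B.filter fun b : ℤ ↦ |b| ≤ v).card : ℝ) ≤ 2 * v + 1 := by
    have : (B.filter fun b : ℤ ↦ |b| ≤ v).card ≤ 2 * v + 1 := by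
      refine (Finset.card_le_card (t := Finset.Icc (-(v : ℤ)) v) fun b hb ↦ ?_).trans ?_
      · rw [Finset.mem_Icc]; exact abs_le.1 (Finset.mem_filter.1 hb).2
      · rw [Int.card_Icc]; omega
    exact_mod_cast this
  have h34 : (s : ℝ) * q ≤ (N : ℝ) ^ (3 / 4 : ℝ) := by
    have h1 : (s : ℝ) ≤ (N : ℝ) ^ (1 / 2 : ℝ) := by
      rw [← Real.sqrt_eq_rpow]; exact Real.nat_sqrt_le_real_sqrt
    have h2 : q ≤ (N : ℝ) ^ (1 / 4 : ℝ) := by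
      rw [hq, Real.sqrt_eq_rpow]
      refine (Real.rpow_le_rpow (by positivity) h1 (by norm_num)).trans ?_
      rw [← Real.rpow_mul (by positivity)]
      norm_num
    have hN0 : (0 : ℝ) < N := by exact_mod_cast hN
    calc _ ≤ (N : ℝ) ^ (1 / 2 : ℝ) * (N : ℝ) ^ (1 / 4 : ℝ) := by gcongr
      _ = _ := by rw [← Real.rpow_add hN0]; norm_num
  have hsq : (s : ℝ) ≤ s * q := le_mul_of_one_le_right (by linarith) hq1
  have hf : (s : ℝ) / q = q := by rw [div_eq_iff (by positivity), hqq]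
  have e8 : (2 * s + 1 : ℝ) * (8 * κ / q) ≤ 24 * κ * q := by
    calc (2 * s + 1 : ℝ) * (8 * κ / q) ≤ (3 * s) * (8 * κ / q) := by gcongr; linarith
      _ = 24 * κ * (s / q) := by ring
      _ = _ := by rw [hf]
  have hvv : ((B.filter fun b : ℤ ↦ |b| ≤ v).card : ℝ) * 2 ≤ 6 * q := by linarith
  calc _ ≤ (3 * s : ℝ) * 2 + (4 * s) * (6 * q + 24 * κ * q) := by
        gcongr <;> linarith
    _ ≤ (s * q) * (30 + 96 * κ) := by nlinarith
    _ ≤ (s * q) * (126 * κ) := by gcongr; linarith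
    _ ≤ (N : ℝ) ^ (3 / 4 : ℝ) * (126 * κ) := by gcongr
    _ = _ := by ring

lemma im_pow_mod_five {κ : ℕ} (hκ : κ ≠ 0) :
    ((⟨3, 4⟩ : GaussianInt) ^ κ).re % 5 = 3 ∧ ((⟨3, 4⟩ : GaussianInt) ^ κ).im % 5 = 4 := by
  induction κ with
  | zero => exact absurd rfl hκ
  | succ n ih =>
    rcases Nat.eq_zero_or_pos n with rfl | hn
    · simp
    · obtain ⟨h1, h2⟩ := ih hn.ne'
      rw [pow_succ, Zsqrtd.re_mul, Zsqrtd.im_mul]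
      dsimp only
      omega

lemma ev_five_pow_ne_one {κ : ℕ} (hκ : κ ≠ 0) : ev ⟨3, 4⟩ ^ κ ≠ 1 := by
  intro h
  have n5 : ‖((⟨3, 4⟩ : GaussianInt) : ℂ)‖ = 5 := by
    have h1 : Complex.normSq ((⟨3, 4⟩ : GaussianInt) : ℂ) = 5 ^ 2 := by
      rw [← GaussianInt.intCast_real_norm, norm_eq]
      norm_num
    rw [Complex.normSq_eq_norm_sq] at h1
    exact (pow_left_inj₀ (norm_nonneg _) (by norm_num) two_ne_zero).1 h1
  rw [ev, n5, ← pow_mul, div_pow, div_eq_one_iff_eq (by norm_num)] at h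
  have h1 : ((⟨3, 4⟩ : GaussianInt) ^ (4 * κ)) = ((5 ^ (4 * κ) : ℕ) : GaussianInt) := by
    apply GaussianInt.toComplex_injective
    rw [map_pow, map_natCast]
    push_cast at h ⊢
    exact h
  have h2 := (im_pow_mod_five (κ := 4 * κ) (by omega)).2
  rw [h1, Zsqrtd.im_natCast] at h2
  norm_num at h2

lemma norm_tsum_disc_le {κ : ℕ} (hκ : κ ≠ 0) :
    ∃ C : ℝ, 0 < C ∧ ∀ N : ℕ, ‖∑' α, disc κ N α‖ ≤ C * (N : ℝ) ^ (3 / 4 : ℝ) := by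
  have hpos : 0 < ‖ev ⟨3, 4⟩ ^ κ - 1‖ := norm_pos_iff.2 (sub_ne_zero.2 (ev_five_pow_ne_one hκ))
  refine ⟨120 * (126 * κ * 25 ^ (3 / 4 : ℝ)) / ‖ev ⟨3, 4⟩ ^ κ - 1‖, ?_, fun N ↦ ?_⟩
  · have : (0 : ℝ) < κ := by exact_mod_cast Nat.pos_of_ne_zero hκ
    positivity
  set D := 126 * κ * ((25 * N : ℕ) : ℝ) ^ (3 / 4 : ℝ) with hD
  have hv : vari (disc κ (25 * N)) 1 ≤ D := vari_disc_le hκ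
  have hv' : vari (disc κ (25 * N)) ⟨0, 1⟩ ≤ D := (vari_disc_I _ _).le.trans hv
  have hf := finite_support_disc κ (25 * N)
  have a1 := norm_tsum_sub_coset_le hf hv hv' (ρ := ⟨3, 4⟩) (by simp [Zsqrtd.ext_iff])
    (fun j : Fin 25 ↦ ((j : ℕ), 0)) (M := 25) (fun j ↦ ⟨j.2.le, by norm_num⟩) bijective_five 0
  have a2 := norm_tsum_sub_coset_le hf hv hv' (ρ := ((5 : ℕ) : GaussianInt))
    (by exact_mod_cast (by norm_num : (5 : ℕ) ≠ 0))
    (fun j : Fin 5 × Fin 5 ↦ ((j.1 : ℕ), (j.2 : ℕ))) (M := 5) (fun j ↦ ⟨j.1.2.le, j.2.2.le⟩)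
    (bijective_nat (by norm_num)) 0
  have g0 : gi (0, 0) = 0 := by ext <;> simp [gi]
  simp only [Fin.val_zero, Prod.fst_zero, Prod.snd_zero, g0, add_zero] at a1 a2
  have e1 (α : GaussianInt) : disc κ (25 * N) (⟨3, 4⟩ * α) = ev ⟨3, 4⟩ ^ κ * disc κ N α :=
    disc_mul κ N (by simp [Zsqrtd.ext_iff]) (by simp [norm_eq]) α
  have e2 (α : GaussianInt) : disc κ (25 * N) (((5 : ℕ) : GaussianInt) * α) = disc κ N α := by
    rw [disc_mul κ N (M := 25) (by exact_mod_cast (by norm_num : (5 : ℕ) ≠ 0))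
      (by rw [norm_eq]; simp), ev_natCast (by norm_num), one_pow, one_mul]
  simp only [e1, e2, tsum_mul_left, Fintype.card_prod, Fintype.card_fin] at a1 a2
  set S := ∑' α, disc κ N α
  set T := ∑' α, disc κ (25 * N) α
  have h3 : ‖(25 : ℂ) * ((ev ⟨3, 4⟩ ^ κ - 1) * S)‖ ≤ 25 * (120 * D) := by
    calc _ = ‖(T - ((5 * 5 : ℕ) : ℂ) * S) - (T - ((25 : ℕ) : ℂ) * (ev ⟨3, 4⟩ ^ κ * S))‖ := by
          congr 1; push_cast; ring
      _ ≤ _ := (norm_sub_le _ _).trans (add_le_add a2 a1)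
      _ = _ := by push_cast; ring
  rw [norm_mul, norm_mul] at h3
  have h4 : ‖(25 : ℂ)‖ = 25 := by simp
  rw [h4] at h3
  have h5 : ‖ev ⟨3, 4⟩ ^ κ - 1‖ * ‖S‖ ≤ 120 * D := by linarith
  rw [div_mul_eq_mul_div, le_div_iff₀ hpos, mul_comm]
  refine h5.trans (le_of_eq ?_)
  rw [hD]
  push_cast
  rw [Real.mul_rpow (by norm_num) (by positivity)]
  ring

/-- The Fourier coefficients of the representations as a sum of two squares. -/
def hecke (κ n : ℕ) : ℂ := (1 / 4) * ∑' α : GaussianInt, if α.norm = n then ev α ^ κ else 0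

lemma norm_sum_hecke_le {κ : ℕ} (hκ : κ ≠ 0) : ∃ C : ℝ, 1 ≤ C ∧ ∀ (r : ℕ), r ≠ 0 →
    ∀ (χ : DirichletCharacter ℂ r) (N : ℕ),
    ‖∑ n ∈ Finset.Icc 0 N, χ n * hecke κ n‖ ≤ C * r ^ 3 * (N : ℝ) ^ (3 / 4 : ℝ) := by
  obtain ⟨C, hC, h⟩ := norm_tsum_disc_le hκ
  refine ⟨1 + C + 504 * κ, by nlinarith [(Nat.cast_nonneg κ : (0 : ℝ) ≤ κ)],
    fun r hr χ N ↦ ?_⟩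
  have hr1 : (1 : ℝ) ≤ r := by exact_mod_cast Nat.one_le_iff_ne_zero.2 hr
  set Y := (N : ℝ) ^ (3 / 4 : ℝ) with hY
  have hY0 : 0 ≤ Y := by positivity
  have hfin (n : ℕ) : (fun α : GaussianInt ↦
      χ n * if α.norm = n then ev α ^ κ else 0).support.Finite := by
    refine (finite_norm_le n).subset fun α hα ↦ ?_
    by_contra hn
    refine hα ?_
    have : ¬ α.norm = n := fun h ↦ hn h.le
    simp [this]
  have e1 : ∑ n ∈ Finset.Icc 0 N, χ n * hecke κ n =
      (1 / 4) * ∑' α, χ ((α.norm : ℤ) : ZMod r) * disc κ N α := by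
    simp only [hecke, mul_left_comm (χ _) (1 / 4 : ℂ)]
    rw [← Finset.mul_sum]
    congr 1
    simp only [← tsum_mul_left]
    rw [← Summable.tsum_finsetSum fun n _ ↦ summable_of_hasFiniteSupport (hfin n)]
    refine tsum_congr fun α ↦ ?_
    obtain ⟨m, hm⟩ := Int.eq_ofNat_of_zero_le (Zsqrtd.norm_nonneg (d := -1) (by norm_num) α)
    have hm' : α.norm = (m : ℤ) := hm
    rw [disc, hm']
    simp only [Nat.cast_inj, Nat.cast_le, mul_ite, mul_zero, Finset.sum_ite_eq, Finset.mem_Icc,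
      zero_le, true_and, Int.cast_natCast]
  have hfd := finite_support_disc κ N
  have hb := bijective_nat hr
  set D := 126 * κ * Y with hD
  have hv : vari (disc κ N) 1 ≤ D := vari_disc_le hκ
  have hT (j : Fin r × Fin r) :
      ‖∑' α, disc κ N ((r : GaussianInt) * α + gi ((j.1 : ℕ), (j.2 : ℕ)))‖ ≤
        (C + 504 * κ) * r * Y := by
    have a1 := norm_tsum_sub_coset_le hfd hv ((vari_disc_I _ _).le.trans hv)
      (ρ := (r : GaussianInt)) (by exact_mod_cast hr)
      (fun j : Fin r × Fin r ↦ ((j.1 : ℕ), (j.2 : ℕ))) (M := r) (fun j ↦ ⟨j.1.2.le, j.2.2.le⟩)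
      hb j
    simp only [Fintype.card_prod, Fintype.card_fin] at a1
    set T := ∑' α, disc κ N ((r : GaussianInt) * α + gi ((j.1 : ℕ), (j.2 : ℕ)))
    have a2 := norm_sub_norm_le (((r * r : ℕ) : ℂ) * T) (∑' α, disc κ N α)
    rw [norm_sub_rev, norm_mul, Complex.norm_natCast] at a2
    have a3 : ((r * r : ℕ) : ℝ) * ‖T‖ ≤ (r * r : ℕ) * ((C + 504 * κ) * r * Y) := by
      have a4 := h N
      have hrr : (1 : ℝ) ≤ ((r * r : ℕ) : ℝ) := by
        push_cast; exact one_le_mul_of_one_le_of_one_le hr1 hr1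
      have a5 : C * Y ≤ ((r * r : ℕ) : ℝ) * (C * r * Y) := by
        have : C * Y ≤ C * r * Y := by
          rw [mul_right_comm]; exact le_mul_of_one_le_right (by positivity) hr1
        exact this.trans (le_mul_of_one_le_left (by positivity) hrr)
      have a6 : ((r * r : ℕ) : ℝ) * ((C + 504 * κ) * r * Y) =
          ((r * r : ℕ) : ℝ) * (C * r * Y) + (r * r : ℕ) * (4 * r * D) := by rw [hD]; ring
      rw [a6]
      linarith
    exact le_of_mul_le_mul_left a3 (by push_cast; positivity)
  have e2 : ∑' α, χ ((α.norm : ℤ) : ZMod r) * disc κ N α = ∑ j : Fin r × Fin r,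
      χ (((gi ((j.1 : ℕ), (j.2 : ℕ))).norm : ℤ) : ZMod r) *
        ∑' α, disc κ N ((r : GaussianInt) * α + gi ((j.1 : ℕ), (j.2 : ℕ))) := by
    have hsf : (fun α : GaussianInt ↦ χ ((α.norm : ℤ) : ZMod r) * disc κ N α).support.Finite :=
      hfd.subset fun α hα h0 ↦ hα (by simp only [h0, mul_zero])
    rw [← (Equiv.ofBijective _ hb).tsum_eq]
    simp only [← tsum_mul_left]
    refine (tsum_fintype_prod _
      (summable_of_hasFiniteSupport (finite_support_comp hsf hb.1))).trans ?_
    refine Finset.sum_congr rfl fun j _ ↦ tsum_congr fun α ↦ ?_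
    simp only
    congr 2
    simp only [norm_eq, gi, Zsqrtd.re_add, Zsqrtd.im_add, Zsqrtd.re_mul, Zsqrtd.im_mul,
      Zsqrtd.re_natCast, Zsqrtd.im_natCast]
    push_cast
    simp
  rw [e1, e2, norm_mul]
  have h4 : ‖(1 / 4 : ℂ)‖ ≤ 1 := by norm_num
  calc _ ≤ 1 * ∑ j : Fin r × Fin r, (C + 504 * κ) * r * Y := by
        gcongr
        refine (norm_sum_le _ _).trans (Finset.sum_le_sum fun j _ ↦ ?_)
        rw [norm_mul]
        exact (mul_le_of_le_one_left (norm_nonneg _) (χ.norm_le_one _)).trans (hT j)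
    _ = (C + 504 * κ) * r ^ 3 * Y := by simp; ring
    _ ≤ _ := by gcongr; linarith

/-- The completely multiplicative function with prescribed values at the primes. -/
def ofPrimes (f : ℕ → ℂ) : ℕ →*₀ ℂ where
  toFun n := if n = 0 then 0 else n.factorization.prod fun p k ↦ f p ^ k
  map_zero' := by simp
  map_one' := by simp
  map_mul' m n := by
    by_cases hm : m = 0
    · simp [hm]
    by_cases hn : n = 0
    · simp [hn]
    rw [if_neg (mul_ne_zero hm hn), if_neg hm, if_neg hn, Nat.factorization_mul hm hn,
      Finsupp.prod_add_index']
    · simp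
    · intro a b c
      rw [pow_add]

lemma ofPrimes_prime (f : ℕ → ℂ) {p : ℕ} (hp : p.Prime) : ofPrimes f p = f p := by
  change (if p = 0 then 0 else p.factorization.prod fun p k ↦ f p ^ k) = _
  rw [if_neg hp.ne_zero, hp.factorization, Finsupp.prod_single_index (by simp), pow_one]

lemma norm_ofPrimes_le {f : ℕ → ℂ} (hf : ∀ p, ‖f p‖ ≤ 1) (n : ℕ) : ‖ofPrimes f n‖ ≤ 1 := by
  change ‖if n = 0 then 0 else n.factorization.prod fun p k ↦ f p ^ k‖ ≤ 1
  split_ifs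
  · simp
  · rw [Finsupp.prod, norm_prod]
    refine Finset.prod_le_one (fun _ _ ↦ norm_nonneg _) fun p _ ↦ ?_
    rw [norm_pow]
    exact pow_le_one₀ (norm_nonneg _) (hf p)

/-- The recurrence satisfied by the convolution of two completely multiplicative functions. -/
def Recur (F s t : ℕ → ℂ) : Prop :=
  ∀ p : ℕ, p.Prime → ∀ n : ℕ, n ≠ 0 →
    F (p * n) + t p * (if p ∣ n then F (n / p) else 0) = s p * F n

lemma Recur.eq {F G s t : ℕ → ℂ} (hF : Recur F s t) (hG : Recur G s t) (h1 : F 1 = G 1) :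
    ∀ n : ℕ, n ≠ 0 → F n = G n := by
  intro n
  induction n using Nat.strong_induction_on with
  | _ n ih =>
    intro hn
    by_cases hn1 : n = 1
    · rw [hn1, h1]
    obtain ⟨p, hp, m, rfl⟩ := Nat.exists_prime_and_dvd hn1
    have hm : m ≠ 0 := right_ne_zero_of_mul hn
    have hlt : m < p * m := lt_mul_of_one_lt_left (Nat.pos_of_ne_zero hm) hp.one_lt
    have a := hF p hp m hm
    have b := hG p hp m hm
    rw [ih m hlt hm, ← b] at a
    by_cases hd : p ∣ m
    · obtain ⟨l, rfl⟩ := hd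
      have hl : l ≠ 0 := right_ne_zero_of_mul hm
      have hll : l < p * l := lt_mul_of_one_lt_left (Nat.pos_of_ne_zero hl) hp.one_lt
      rw [if_pos (dvd_mul_right _ _), if_pos (dvd_mul_right _ _), Nat.mul_div_cancel_left _ hp.pos,
        ih l (hll.trans hlt) hl] at a
      exact add_right_cancel a
    · simpa [hd] using a

lemma sum_filter_dvd_fst {p n : ℕ} (hp : p.Prime) (hn : n ≠ 0) (F : ℕ × ℕ → ℂ) :
    ∑ x ∈ (p * n).divisorsAntidiagonal with p ∣ x.1, F x =
      ∑ x ∈ n.divisorsAntidiagonal, F (p * x.1, x.2) := by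
  symm
  refine Finset.sum_bij (fun x _ ↦ (p * x.1, x.2)) ?_ ?_ ?_ ?_
  · rintro ⟨a, b⟩ h
    simp only [Nat.mem_divisorsAntidiagonal] at h
    simp only [Finset.mem_filter, Nat.mem_divisorsAntidiagonal]
    exact ⟨⟨by rw [mul_assoc, h.1], mul_ne_zero hp.ne_zero hn⟩, dvd_mul_right _ _⟩
  · rintro ⟨a, b⟩ _ ⟨c, d⟩ _ h
    simp only [Prod.mk.injEq] at h
    rw [Nat.eq_of_mul_eq_mul_left hp.pos h.1, h.2]
  · rintro ⟨a, b⟩ h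
    simp only [Finset.mem_filter, Nat.mem_divisorsAntidiagonal] at h
    obtain ⟨⟨h1, -⟩, c, rfl⟩ := h
    rw [mul_assoc] at h1
    exact ⟨(c, b), by simp [Nat.eq_of_mul_eq_mul_left hp.pos h1, hn], rfl⟩
  · intro _ _
    rfl

lemma sum_filter_dvd_snd {p n : ℕ} (hp : p.Prime) (hn : n ≠ 0) (F : ℕ × ℕ → ℂ) :
    ∑ x ∈ (p * n).divisorsAntidiagonal with p ∣ x.2, F x =
      ∑ x ∈ n.divisorsAntidiagonal, F (x.1, p * x.2) := by
  have h := sum_filter_dvd_fst hp hn (fun x ↦ F x.swap)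
  rw [← Nat.map_swap_divisorsAntidiagonal, ← Nat.map_swap_divisorsAntidiagonal (n := n),
    Finset.sum_filter, Finset.sum_map, Finset.sum_map]
  rw [Finset.sum_filter] at h
  exact h

lemma recur_pf (g₁ g₂ : ℕ →*₀ ℂ) :
    Recur (pf g₁ g₂) (fun p ↦ g₁ p + g₂ p) (fun p ↦ g₁ p * g₂ p) := by
  intro p hp n hn
  have hpf (m : ℕ) : pf g₁ g₂ m = ∑ x ∈ m.divisorsAntidiagonal, g₁ x.1 * g₂ x.2 := by
    rw [pf, ArithmeticFunction.mul_apply]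
    simp only [tw_zeta_apply]
  set F : ℕ × ℕ → ℂ := fun x ↦ g₁ x.1 * g₂ x.2 with hF
  have e1 := sum_filter_dvd_fst hp hn F
  have e2 := sum_filter_dvd_snd hp hn F
  have e3 := Finset.sum_union_inter (s₁ := (p * n).divisorsAntidiagonal.filter (p ∣ ·.1))
    (s₂ := (p * n).divisorsAntidiagonal.filter (p ∣ ·.2)) (f := F)
  have e4 : (p * n).divisorsAntidiagonal.filter (p ∣ ·.1) ∪
      (p * n).divisorsAntidiagonal.filter (p ∣ ·.2) = (p * n).divisorsAntidiagonal := by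
    rw [← Finset.filter_or, Finset.filter_true_of_mem]
    intro x hx
    rw [Nat.mem_divisorsAntidiagonal] at hx
    exact (hp.dvd_mul).1 (hx.1 ▸ dvd_mul_right p n)
  have e5 : ∑ x ∈ (p * n).divisorsAntidiagonal.filter (p ∣ ·.1) ∩
      (p * n).divisorsAntidiagonal.filter (p ∣ ·.2), F x =
      g₁ p * g₂ p * if p ∣ n then pf g₁ g₂ (n / p) else 0 := by
    rw [← Finset.filter_and, ← Finset.filter_filter, Finset.sum_filter,
      sum_filter_dvd_fst hp hn (fun x ↦ if p ∣ x.2 then F x else 0)]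
    simp only
    rw [← Finset.sum_filter (p := fun x : ℕ × ℕ ↦ p ∣ x.2) (f := fun x ↦ F (p * x.1, x.2))]
    by_cases hd : p ∣ n
    · obtain ⟨m, rfl⟩ := hd
      have hm : m ≠ 0 := right_ne_zero_of_mul hn
      rw [if_pos (dvd_mul_right _ _), Nat.mul_div_cancel_left _ hp.pos,
        sum_filter_dvd_snd hp hm (fun x ↦ F (p * x.1, x.2)), hpf, Finset.mul_sum]
      refine Finset.sum_congr rfl fun x _ ↦ ?_
      simp only [hF, map_mul]
      ring
    · rw [if_neg hd, mul_zero, Finset.filter_false_of_mem, Finset.sum_empty]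
      intro x hx hpx
      rw [Nat.mem_divisorsAntidiagonal] at hx
      exact hd (hx.1 ▸ hpx.mul_left _)
  rw [e4, e5, e1, e2, ← hpf] at e3
  simp only [hF, map_mul] at e3
  rw [e3, hpf n, add_mul, Finset.mul_sum, Finset.mul_sum]
  congr 1 <;> refine Finset.sum_congr rfl fun x _ ↦ by ring

lemma prime_of_norm_eq {π : GaussianInt} {p : ℕ} (hp : p.Prime) (h : π.norm = p) : Prime π := by
  refine Irreducible.prime ⟨fun hu ↦ ?_, fun {a b} hab ↦ ?_⟩
  · rw [← Zsqrtd.norm_eq_one_iff, h] at hu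
    exact hp.one_lt.ne' (by simpa using hu)
  · have : a.norm.natAbs * b.norm.natAbs = p := by
      rw [← Int.natAbs_mul, ← Zsqrtd.norm_mul, ← hab, h, Int.natAbs_natCast]
    rw [← Zsqrtd.norm_eq_one_iff, ← Zsqrtd.norm_eq_one_iff]
    have hd : a.norm.natAbs ∣ p := ⟨_, this.symm⟩
    rcases (Nat.dvd_prime hp).1 hd with h1 | h1
    · exact Or.inl h1
    · right
      rw [h1] at this
      exact Nat.eq_of_mul_eq_mul_left hp.pos (by rw [this, mul_one])

lemma mul_star_eq {π : GaussianInt} {p : ℕ} (h : π.norm = p) : π * star π = (p : GaussianInt) := by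
  rw [← Zsqrtd.norm_eq_mul_conj, h]
  simp

lemma norm_star' (α : GaussianInt) : (star α).norm = α.norm := Zsqrtd.norm_conj α

lemma dvd_or_star_dvd {π α : GaussianInt} {p n : ℕ} (hp : p.Prime) (h : π.norm = p)
    (hα : α.norm = (p * n : ℕ)) : π ∣ α ∨ star π ∣ α := by
  have h1 : π ∣ α * star α := by
    rw [mul_star_eq hα, Nat.cast_mul, ← mul_star_eq h, mul_assoc]
    exact dvd_mul_right _ _
  rcases (prime_of_norm_eq hp h).2.2 _ _ h1 with h2 | h2
  · exact Or.inl h2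
  · right
    obtain ⟨c, hc⟩ := h2
    refine ⟨star c, ?_⟩
    rw [← star_star α, hc, star_mul, mul_comm]

lemma dvd_of_star_dvd_two {π α : GaussianInt} (h : π.norm = (2 : ℕ)) (hα : star π ∣ α) :
    π ∣ α := by
  obtain ⟨c, rfl⟩ := hα
  refine Dvd.dvd.mul_right ?_ _
  have h1 := h
  rw [norm_eq] at h1
  push_cast at h1
  have hre : π.re = 1 ∨ π.re = -1 := by
    have : -1 ≤ π.re := by nlinarith [sq_nonneg π.im]
    have : π.re ≤ 1 := by nlinarith [sq_nonneg π.im]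
    have : π.re ≠ 0 := by
      intro h0
      rw [h0] at h1
      have : -1 ≤ π.im := by nlinarith
      have : π.im ≤ 1 := by nlinarith
      interval_cases π.im <;> norm_num at h1
    omega
  have hd : π ∣ π + star π := by
    have : π + star π = (2 : ℕ) * (π.re : GaussianInt) := by
      ext
      · simp [two_mul]
      · simp
    rw [this, ← mul_star_eq h, mul_assoc]
    exact dvd_mul_right _ _
  exact (dvd_add_right (dvd_refl π)).1 hd

lemma natCast_dvd_of_dvd {π α : GaussianInt} {p : ℕ} (hp : p.Prime) (h2 : p ≠ 2) (h : π.norm = p)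
    (h₁ : π ∣ α) (h₃ : star π ∣ α) : (p : GaussianInt) ∣ α := by
  obtain ⟨β, rfl⟩ := h₁
  have hs : (star π).norm = p := by rw [norm_star', h]
  rcases (prime_of_norm_eq hp hs).2.2 _ _ h₃ with h4 | h4
  · exfalso
    have hd : star π ∣ π + star π := dvd_add h4 dvd_rfl
    have e : π + star π = ((2 * π.re : ℤ) : GaussianInt) := by
      ext
      · simp [two_mul]
      · simp
    rw [e] at hd
    obtain ⟨γ, hγ⟩ := hd
    have e2 := congrArg Zsqrtd.norm hγ
    rw [Zsqrtd.norm_mul, hs, Zsqrtd.norm_intCast] at e2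
    have hd2 : (p : ℤ) ∣ 2 * π.re := by
      have : (p : ℤ) ∣ 2 * π.re * (2 * π.re) := ⟨_, e2⟩
      rcases (Nat.prime_iff_prime_int.1 hp).2.2 _ _ this with h | h <;> exact h
    have hd3 : (p : ℤ) ∣ π.re := by
      rcases (Nat.prime_iff_prime_int.1 hp).2.2 _ _ hd2 with h | h
      · exfalso
        have : p ∣ 2 := by exact_mod_cast h
        exact h2 ((Nat.prime_dvd_prime_iff_eq hp Nat.prime_two).1 this)
      · exact h
    rw [norm_eq] at h
    have hd4 : (p : ℤ) ∣ π.im := by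
      have : (p : ℤ) ∣ π.im ^ 2 := by
        have h5 : π.im ^ 2 = p - π.re * π.re := by rw [← h]; ring
        rw [h5]
        exact dvd_sub dvd_rfl (hd3.mul_right _)
      exact (Nat.prime_iff_prime_int.1 hp).dvd_of_dvd_pow this
    obtain ⟨a, ha⟩ := hd3
    obtain ⟨b, hb⟩ := hd4
    have h6 : (p : ℤ) * (p * (a ^ 2 + b ^ 2)) = p * 1 := by
      rw [mul_one]; nth_rw 3 [← h]; rw [ha, hb]; ring
    have hp0 : (p : ℤ) ≠ 0 := by exact_mod_cast hp.ne_zero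
    have h7 := mul_left_cancel₀ hp0 h6
    have h8 : (p : ℤ) ∣ 1 := ⟨_, h7.symm⟩
    have : p ∣ 1 := by exact_mod_cast h8
    exact hp.one_lt.ne' (Nat.dvd_one.1 this)
  · obtain ⟨γ, rfl⟩ := h4
    rw [← mul_assoc, mul_star_eq h]
    exact dvd_mul_right _ _

open Classical in
lemma tsum_dvd {ρ : GaussianInt} (hρ : ρ ≠ 0) (F : GaussianInt → ℂ) :
    ∑' α, (if ρ ∣ α then F α else 0) = ∑' β, F (ρ * β) := by
  have hinj : Function.Injective fun β ↦ ρ * β := mul_right_injective₀ hρ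
  rw [← hinj.tsum_eq]
  · simp
  · intro α hα
    rw [Function.mem_support] at hα
    have : ρ ∣ α := by
      by_contra h
      exact hα (if_neg h)
    obtain ⟨c, rfl⟩ := this
    exact ⟨c, rfl⟩

/-- Four times the Hecke coefficient. -/
def term (κ n : ℕ) (α : GaussianInt) : ℂ := if α.norm = n then ev α ^ κ else 0

lemma hecke_eq (κ n : ℕ) : hecke κ n = (1 / 4) * ∑' α, term κ n α := rfl

lemma finite_support_term (κ n : ℕ) : (term κ n).support.Finite := by
  refine (finite_norm_le n).subset fun α hα ↦ ?_
  by_contra hn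
  refine hα ?_
  have : ¬ α.norm = n := fun h ↦ hn h.le
  simp [term, this]

open Classical in
lemma tsum_dvd_term {ρ : GaussianInt} {q : ℕ} (hq : q ≠ 0) (h : ρ.norm = q) (κ n : ℕ) :
    ∑' α, (if ρ ∣ α then term κ (q * n) α else 0) = ev ρ ^ κ * ∑' α, term κ n α := by
  have hρ : ρ ≠ 0 := by
    rintro rfl
    rw [Zsqrtd.norm_zero] at h
    exact hq (by exact_mod_cast h.symm)
  rw [tsum_dvd hρ, ← tsum_mul_left]
  refine tsum_congr fun β ↦ ?_
  have : (q : ℤ) ≠ 0 := by exact_mod_cast hq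
  simp only [term, Zsqrtd.norm_mul, h, Nat.cast_mul, mul_right_inj' this, ev_mul, mul_pow, mul_ite,
    mul_zero]

open Classical in
lemma tsum_natCast_dvd_term {p : ℕ} (hp : p.Prime) {κ : ℕ} (n : ℕ) :
    ∑' α, (if (p : GaussianInt) ∣ α then term κ (p * n) α else 0) =
      if p ∣ n then ∑' α, term κ (n / p) α else 0 := by
  split_ifs with hd
  · obtain ⟨m, rfl⟩ := hd
    rw [Nat.mul_div_cancel_left _ hp.pos, ← mul_assoc, tsum_dvd_term (mul_ne_zero hp.ne_zero
      hp.ne_zero) (by rw [Zsqrtd.norm_natCast, Nat.cast_mul]), ev_natCast hp.ne_zero, one_pow,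
      one_mul]
  · convert tsum_zero with α
    split_ifs with h
    · obtain ⟨β, rfl⟩ := h
      rw [term, if_neg]
      intro h
      rw [Zsqrtd.norm_mul, Zsqrtd.norm_natCast, mul_assoc, Nat.cast_mul] at h
      have h1 := mul_left_cancel₀ (by exact_mod_cast hp.ne_zero) h
      have : (p : ℤ) ∣ n := ⟨_, h1.symm⟩
      exact hd (by exact_mod_cast this)
    · rfl

open Classical in
/-- A Gaussian integer of norm `p`. -/
def gp (p : ℕ) : GaussianInt := if h : ∃ π : GaussianInt, π.norm = p then h.choose else 1

lemma norm_gp {p : ℕ} (hp : p.Prime) (h : p % 4 ≠ 3) : (gp p).norm = p := by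
  have : ∃ π : GaussianInt, π.norm = p := by
    have := Fact.mk hp
    obtain ⟨a, b, hab⟩ := Nat.Prime.sq_add_sq h
    exact ⟨⟨a, b⟩, by rw [norm_eq]; dsimp only; exact_mod_cast hab⟩
  rw [gp, dif_pos this]
  exact this.choose_spec

lemma gp_ne_zero (p : ℕ) : gp p ≠ 0 ∨ p = 0 := by
  by_cases h : ∃ π : GaussianInt, π.norm = p
  · by_cases hp : p = 0
    · exact Or.inr hp
    · left
      rw [gp, dif_pos h]
      intro h0
      have := h.choose_spec
      rw [h0, Zsqrtd.norm_zero] at this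
      exact hp (by exact_mod_cast this.symm)
  · left
    rw [gp, dif_neg h]
    exact one_ne_zero

/-- Local data of the Hecke characters. -/
def e₁ (κ p : ℕ) : ℂ := if p % 4 = 3 then 1 else ev (gp p) ^ κ

/-- Local data of the Hecke characters. -/
def e₂ (κ p : ℕ) : ℂ :=
  if p % 4 = 3 then -1 else if p = 2 then 0 else ev (star (gp p)) ^ κ

lemma ev_star_mul {α : GaussianInt} (h : α ≠ 0) : ev α * ev (star α) = 1 := by
  obtain ⟨n, hn⟩ := Int.eq_ofNat_of_zero_le (Zsqrtd.norm_nonneg (d := -1) (by norm_num) α)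
  have hn' : α.norm = (n : ℤ) := hn
  rw [← ev_mul, mul_star_eq hn', ev_natCast]
  rintro rfl
  rw [Nat.cast_zero, Zsqrtd.norm_eq_zero_iff (by norm_num)] at hn'
  exact h hn'

lemma recur_hecke (κ : ℕ) :
    Recur (hecke κ) (fun p ↦ e₁ κ p + e₂ κ p) (fun p ↦ e₁ κ p * e₂ κ p) := by
  classical
  intro p hp n hn
  have hf (m : ℕ) (P : GaussianInt → Prop) : Summable fun α ↦ if P α then term κ m α else 0 := by
    refine summable_of_hasFiniteSupport ((finite_support_term κ m).subset fun α hα h0 ↦ hα ?_)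
    simp [h0]
  have hmul (x : ℂ) : x * (if p ∣ n then hecke κ (n / p) else 0) =
      1 / 4 * (x * if p ∣ n then ∑' α, term κ (n / p) α else 0) := by
    split_ifs
    · rw [hecke_eq]; ring
    · simp
  dsimp only
  rw [hmul, ← tsum_natCast_dvd_term hp, hecke_eq, hecke_eq, ← mul_add, mul_left_comm]
  congr 1
  by_cases h3 : p % 4 = 3
  · have := Fact.mk hp
    have hpp := GaussianInt.prime_of_nat_prime_of_mod_four_eq_three p h3
    simp only [e₁, e₂, if_pos h3]
    have : ∑' α, term κ (p * n) α =
        ∑' α, if (p : GaussianInt) ∣ α then term κ (p * n) α else 0 := by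
      refine tsum_congr fun α ↦ ?_
      split_ifs with h
      · rfl
      · rw [term, if_neg]
        intro hα
        have h1 : (p : GaussianInt) ∣ α * star α := by
          rw [mul_star_eq hα, Nat.cast_mul]
          exact dvd_mul_right _ _
        rcases hpp.2.2 _ _ h1 with h2 | h2
        · exact h h2
        · refine h ?_
          obtain ⟨c, hc⟩ := h2
          refine ⟨star c, ?_⟩
          rw [← star_star α, hc, star_mul, mul_comm, star_natCast]
    rw [this]
    ring
  have hπ := norm_gp hp h3
  have hπ0 : gp p ≠ 0 := (gp_ne_zero p).resolve_right hp.ne_zero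
  by_cases h2 : p = 2
  · subst h2
    simp only [e₁, e₂, if_neg h3, if_true, add_zero, mul_zero, zero_mul]
    rw [← tsum_dvd_term hp.ne_zero hπ]
    refine tsum_congr fun α ↦ ?_
    split_ifs with h
    · rfl
    · rw [term, if_neg]
      intro hα
      rcases dvd_or_star_dvd hp hπ hα with h1 | h1
      · exact h h1
      · exact h (dvd_of_star_dvd_two hπ h1)
  · simp only [e₁, e₂, if_neg h3, if_neg h2]
    rw [← mul_pow, ev_star_mul hπ0, one_pow, one_mul, add_mul,
      ← tsum_dvd_term hp.ne_zero hπ, ← tsum_dvd_term hp.ne_zero (by rw [norm_star', hπ]),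
      ← (hf _ _).tsum_add (hf _ _)]
    have h4 : Summable (term κ (p * n)) := summable_of_hasFiniteSupport (finite_support_term _ _)
    rw [← h4.tsum_add (hf _ _)]
    refine tsum_congr fun α ↦ ?_
    by_cases hα : α.norm = (p * n : ℕ)
    · have hd : (p : GaussianInt) ∣ α ↔ gp p ∣ α ∧ star (gp p) ∣ α := by
        refine ⟨fun h ↦ ?_, fun h ↦ natCast_dvd_of_dvd hp h2 hπ h.1 h.2⟩
        rw [← mul_star_eq hπ] at h
        exact ⟨dvd_of_mul_right_dvd h, dvd_of_mul_left_dvd h⟩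
      have ho := dvd_or_star_dvd hp hπ hα
      by_cases a1 : gp p ∣ α <;> by_cases a2 : star (gp p) ∣ α <;> simp_all
    · have : term κ (p * n) α = 0 := if_neg hα
      simp [this]

lemma hecke_one (κ : ℕ) : hecke κ 1 = 1 := by
  classical
  have h1 : ev (-1) = 1 := by
    simp [ev, GaussianInt.toComplex_def]
    norm_num
  have h2 : ev ⟨0, -1⟩ = 1 := by
    simp only [ev, GaussianInt.toComplex_def]
    simp [Even.neg_pow (n := 4) (by decide)]
  have h0 : ev 1 = 1 := by simp [ev]
  rw [hecke_eq, tsum_eq_sum (s := {1, -1, ⟨0, 1⟩, ⟨0, -1⟩})]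
  · rw [Finset.sum_insert (by decide), Finset.sum_insert (by decide), Finset.sum_insert (by decide),
      Finset.sum_singleton]
    simp only [term, ev_I, h0, h1, h2, one_pow]
    rw [if_pos (by decide), if_pos (by decide), if_pos (by decide), if_pos (by decide)]
    norm_num
  · intro α hα
    rw [term, if_neg]
    intro h
    refine hα ?_
    rw [norm_eq] at h
    push_cast at h
    obtain ⟨a, b⟩ := α
    dsimp only at h
    have b1 : -1 ≤ a := by nlinarith
    have b2 : a ≤ 1 := by nlinarith
    have b3 : -1 ≤ b := by nlinarith
    have b4 : b ≤ 1 := by nlinarith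
    interval_cases a <;> interval_cases b <;> first | (exfalso; norm_num at h; done) | decide

/-- The Hecke characters restricted to primes. -/
def he₁ (κ : ℕ) : ℕ →*₀ ℂ := ofPrimes (e₁ κ)

/-- The Hecke characters restricted to primes. -/
def he₂ (κ : ℕ) : ℕ →*₀ ℂ := ofPrimes (e₂ κ)

lemma hecke_eq_pf (κ : ℕ) {n : ℕ} (hn : n ≠ 0) : hecke κ n = pf (he₁ κ) (he₂ κ) n := by
  refine (recur_hecke κ).eq (fun p hp n hn ↦ ?_) ?_ n hn
  · have := recur_pf (he₁ κ) (he₂ κ) p hp n hn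
    simpa only [he₁, he₂, ofPrimes_prime _ hp] using this
  · rw [hecke_one, pf, ArithmeticFunction.mul_apply]
    simp [tw_zeta_apply]

lemma norm_he₁_le (κ n : ℕ) : ‖he₁ κ n‖ ≤ 1 := by
  refine norm_ofPrimes_le (fun p ↦ ?_) n
  rw [e₁]
  split_ifs
  · simp
  · rw [norm_pow]
    exact pow_le_one₀ (norm_nonneg _) (norm_ev_le _)

lemma norm_he₂_le (κ n : ℕ) : ‖he₂ κ n‖ ≤ 1 := by
  refine norm_ofPrimes_le (fun p ↦ ?_) n
  rw [e₂]
  split_ifs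
  · simp
  · simp
  · rw [norm_pow]
    exact pow_le_one₀ (norm_nonneg _) (norm_ev_le _)

lemma heckePair (κ : ℕ) : HeckePair (he₁ κ) (he₂ κ) (he₁ (2 * κ)) (he₂ (2 * κ)) := by
  refine ⟨norm_he₁_le κ, norm_he₂_le κ, norm_he₁_le _, norm_he₂_le _, fun p hp ↦ ?_⟩
  have hπ0 : gp p ≠ 0 := (gp_ne_zero p).resolve_right hp.ne_zero
  have hπ1 : star (gp p) ≠ 0 := by simpa using hπ0
  have n1 := norm_ev hπ0
  have n2 := norm_ev hπ1
  rw [hm_apply _ hp.ne_zero]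
  simp only [he₁, he₂, ofPrimes_prime _ hp, e₁, e₂]
  have hx (v : ZMod 4) : x4 v = (ZMod.χ₄ v : ℂ) := by simp [x4]
  rw [hx]
  by_cases h3 : p % 4 = 3
  · right; left
    simp [h3, ZMod.χ₄_nat_three_mod_four h3]
  by_cases h2 : p = 2
  · right; right
    subst h2
    rw [show ZMod.χ₄ ((2 : ℕ) : ZMod 4) = 0 by decide]
    simp [n1, ← pow_mul, mul_comm κ]
  · left
    have h1 : p % 4 = 1 := by
      have := hp.eq_two_or_odd
      omega
    rw [ZMod.χ₄_nat_one_mod_four h1]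
    simp only [if_neg h3, if_neg h2, norm_pow, n1, n2, one_pow, ← pow_mul, mul_comm κ]
    simp

lemma controlled_hecke {κ : ℕ} (hκ : κ ≠ 0) : ∃ C : ℝ, 1 ≤ C ∧ ∀ r : ℕ, r ≠ 0 →
    ∀ χ : DirichletCharacter ℂ r,
    Controlled (pf (hm χ * he₁ κ) (hm χ * he₂ κ)) (C * (r : ℝ) ^ 3) := by
  obtain ⟨C, hC, h⟩ := norm_sum_hecke_le hκ
  refine ⟨C, hC, fun r hr χ ↦ ⟨?_, ?_, fun N ↦ ?_⟩⟩
  · have : (1 : ℝ) ≤ r := by exact_mod_cast Nat.one_le_iff_ne_zero.2 hr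
    exact one_le_mul_of_one_le_of_one_le hC (one_le_pow₀ this)
  · exact norm_pf_le (norm_mul_le' (norm_hm_le χ) (norm_he₁_le κ))
      (norm_mul_le' (norm_hm_le χ) (norm_he₂_le κ))
  · refine le_of_eq_of_le ?_ (h r hr χ N)
    congr 1
    refine Finset.sum_congr rfl fun n _ ↦ ?_
    rw [pf_twist, tw_apply]
    rcases eq_or_ne n 0 with rfl | hn
    · have : hecke κ 0 = 0 := by
        rw [hecke_eq]
        have (α : GaussianInt) : term κ 0 α = 0 := by
          rw [term]
          split_ifs with h
          · rw [Nat.cast_zero, Zsqrtd.norm_eq_zero_iff (by norm_num)] at h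
            rw [h, ev_zero, zero_pow hκ]
          · rfl
        simp [this]
      simp [this]
    · rw [hm_apply _ hn, hecke_eq_pf κ hn]

/-- The Hecke characters are admissible. -/
theorem adm_hecke (β : ℝ) {κ : ℕ} (hκ : κ ≠ 0) :
    ∃ C₀ : ℝ, Adm β (he₁ κ) (he₂ κ) False C₀ 3 := by
  obtain ⟨C₁, hC₁, h₁⟩ := controlled_hecke hκ
  obtain ⟨C₂, hC₂, h₂⟩ := controlled_hecke (κ := 2 * κ) (by simpa)
  obtain ⟨c, hc, hlow⟩ := hecke_lower
  refine ⟨max C₁ C₂, norm_he₁_le κ, norm_he₂_le κ, le_max_of_le_left hC₁,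
    fun r hr χ _ ↦ (h₁ r hr χ).mono (by gcongr; exact le_max_left _ _),
    c, hc, fun Q hQ r hr hrQ χ _ _ σ t h1 h2 ↦ ?_⟩
  have hrQ' : (r : ℝ) ≤ Q := by exact_mod_cast hrQ
  have hC : 0 ≤ max C₁ C₂ := le_max_of_le_left (by linarith)
  have a1 := (h₁ r hr χ).mono (K' := max C₁ C₂ * (Q : ℝ) ^ 3) (by
    gcongr; exact le_max_left _ _)
  have a2 := (h₂ r hr (χ * χ)).mono (K' := max C₁ C₂ * (Q : ℝ) ^ 3) (by
    gcongr; exact le_max_right _ _)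
  refine (hlow (heckePair κ) χ _ a1 a2 σ t h1 h2).trans ?_
  have := one_le_ll a1.one_le t
  gcongr
  norm_num

/-- The Dirichlet characters are admissible. -/
theorem adm_zt {β : ℝ} (hβ : 0 < β) : Adm β zt dl True 1 3 := by
  have hz {r : ℕ} (χ : DirichletCharacter ℂ r) : hm χ * zt = hm χ := by
    ext n
    rcases eq_or_ne n 0 with rfl | hn
    · simp
    · rw [mul_apply', zt_apply hn, mul_one]
  have hd {r : ℕ} (χ : DirichletCharacter ℂ r) : hm χ * dl = dl := by
    ext n
    rw [mul_apply', dl_apply]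
    split_ifs with h
    · rw [h]; simp
    · simp
  obtain ⟨c, hc, hlow⟩ := good_lower hβ
  refine ⟨norm_zt_le, norm_dl_le, le_rfl, fun r hr χ hχ ↦ ?_, c, hc,
    fun Q hQ r hr hrQ χ hp hχ σ t h1 h2 ↦ ?_⟩
  · rw [hz, hd]
    refine (controlled_char hr (hχ trivial)).mono ?_
    have : (1 : ℝ) ≤ r := by exact_mod_cast Nat.one_le_iff_ne_zero.2 hr
    rw [one_mul]
    exact le_self_pow₀ this (by norm_num)
  · rw [hz, hd, LSeries_pf_dl, one_mul]
    exact hlow Q hQ r hr hrQ χ hp (hχ trivial) σ t h1 h2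

/-- A fixed bump function supported on `[-1, 1]`. -/
def bump : ContDiffBump (0 : ℝ) := ⟨1 / 2, 1, by norm_num, by norm_num⟩

lemma bump_eq_zero {u : ℝ} (hu : 1 ≤ |u|) : bump u = 0 :=
  bump.zero_of_le_dist (by simpa [bump] using hu)

lemma contDiff_bump : ContDiff ℝ (⊤ : ℕ∞) fun u ↦ (bump u : ℂ) :=
  Complex.ofRealCLM.contDiff.comp bump.contDiff

/-- The smooth weight on primes near `exp ℓ`. -/
def pw (ℓ : ℝ) (J n : ℕ) : ℝ :=
  if n.Prime then Real.log n * (Real.log n / ℓ) ^ J *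
    ((n / Real.exp ℓ : ℝ) ^ (-(1 + 1 / ℓ)) * bump (Real.log (n / Real.exp ℓ))) else 0

lemma pw_nonneg {ℓ : ℝ} (hℓ : 1 ≤ ℓ) (J n : ℕ) : 0 ≤ pw ℓ J n := by
  rw [pw]
  split_ifs
  · have := bump.nonneg (x := Real.log (n / Real.exp ℓ))
    have := Real.log_natCast_nonneg n
    positivity
  · rfl

lemma abs_log_div_lt {ℓ : ℝ} {n : ℕ} (hn : n ≠ 0) (h : bump (Real.log (n / Real.exp ℓ)) ≠ 0) :
    |Real.log n - ℓ| < 1 := by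
  by_contra! h'
  refine h (bump_eq_zero ?_)
  rwa [Real.log_div (by exact_mod_cast hn) (Real.exp_ne_zero _), Real.log_exp]

lemma pw_support {ℓ : ℝ} {J n : ℕ} (h : pw ℓ J n ≠ 0) :
    n.Prime ∧ |Real.log n - ℓ| < 1 := by
  rw [pw] at h
  split_ifs at h with hp
  · exact ⟨hp, abs_log_div_lt hp.ne_zero fun h' ↦ h (by rw [h']; simp)⟩
  · exact absurd rfl h

lemma rpow_bump_le {ℓ : ℝ} (hℓ : 1 ≤ ℓ) {n : ℕ} (hn : n ≠ 0) :
    (n / Real.exp ℓ : ℝ) ^ (-(1 + 1 / ℓ)) * bump (Real.log (n / Real.exp ℓ)) ≤ Real.exp 2 := by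
  by_cases h : bump (Real.log (n / Real.exp ℓ)) = 0
  · rw [h, mul_zero]; positivity
  · have h1 := abs_log_div_lt hn h
    have h2 : (1 : ℝ) / ℓ ≤ 1 := by rw [div_le_one (by linarith)]; exact hℓ
    have h3 : 0 < 1 / ℓ := by positivity
    have hn0 : (0 : ℝ) < n := by positivity
    rw [abs_lt] at h1
    calc _ ≤ (n / Real.exp ℓ : ℝ) ^ (-(1 + 1 / ℓ)) * 1 := by
          gcongr; exact bump.le_one
      _ = Real.exp ((Real.log n - ℓ) * -(1 + 1 / ℓ)) := by
          rw [mul_one, Real.rpow_def_of_pos (by positivity),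
            Real.log_div hn0.ne' (Real.exp_ne_zero _), Real.log_exp]
      _ ≤ Real.exp 2 := by
          gcongr
          nlinarith

lemma log_div_pow_le {ℓ : ℝ} {J : ℕ} (hℓ : 1 ≤ ℓ) (hJ : J ≤ ℓ) {u : ℝ} (h0 : 0 ≤ u)
    (hu : u ≤ ℓ + 1) : (u / ℓ) ^ J ≤ Real.exp 1 := by
  have h0 : 0 < ℓ := by linarith
  calc (u / ℓ) ^ J ≤ (1 / ℓ + 1) ^ J := by
        gcongr
        rw [div_add_one h0.ne']
        gcongr; linarith
    _ ≤ (Real.exp (1 / ℓ)) ^ J := by gcongr; exact Real.add_one_le_exp _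
    _ = Real.exp (J * (1 / ℓ)) := by rw [← Real.exp_nat_mul]
    _ ≤ _ := by
        gcongr
        rw [mul_one_div, div_le_one h0]; exact hJ

lemma pw_le {ℓ : ℝ} {J : ℕ} (hℓ : 1 ≤ ℓ) (hJ : J ≤ ℓ) (n : ℕ) : pw ℓ J n ≤ 2 * Real.exp 3 * ℓ := by
  by_cases h : pw ℓ J n = 0
  · rw [h]; positivity
  · obtain ⟨hp, h1⟩ := pw_support h
    rw [pw, if_pos hp]
    rw [abs_lt] at h1
    have h0 := Real.log_natCast_nonneg n
    have := bump.nonneg (x := Real.log (n / Real.exp ℓ))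
    calc _ ≤ (ℓ + ℓ) * Real.exp 1 * Real.exp 2 := by
          gcongr
          · linarith
          · exact log_div_pow_le hℓ hJ h0 (by linarith)
          · exact rpow_bump_le hℓ hp.ne_zero
      _ = _ := by
          rw [show (3 : ℝ) = 1 + 2 by norm_num, Real.exp_add]; ring

/-- Prime powers contribute little. -/
lemma norm_ssum_sub_le {ℓ : ℝ} {J : ℕ} (hℓ : 1 ≤ ℓ) (hJ : J ≤ ℓ) {r : ℕ} (χ : DirichletCharacter ℂ r)
    {g₁ g₂ : ℕ →*₀ ℂ} (n₁ : ∀ n, ‖g₁ n‖ ≤ 1) (n₂ : ∀ n, ‖g₂ n‖ ≤ 1) :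
    ‖ssum (fun u ↦ (bump u : ℂ)) (Real.exp ℓ) (1 + 1 / ℓ) (lg^[J] (pl (hm χ * g₁) (hm χ * g₂))) -
      ℓ ^ J * ∑ n ∈ Finset.Icc 1 ⌊Real.exp 1 * Real.exp ℓ⌋₊, hm χ n * (g₁ n + g₂ n) * pw ℓ J n‖ ≤
      ℓ ^ J * (8 * Real.exp 4 * ℓ * Real.exp (ℓ / 2)) := by
  have hl0 : 0 < ℓ := by linarith
  set N := ⌊Real.exp 1 * Real.exp ℓ⌋₊ with hN
  have key : ∀ n ∈ Finset.Icc 1 N,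
      ‖(lg^[J] (pl (hm χ * g₁) (hm χ * g₂))) n *
        wt (fun u ↦ (bump u : ℂ)) (Real.exp ℓ) (1 + 1 / ℓ) n -
        ℓ ^ J * (hm χ n * (g₁ n + g₂ n) * pw ℓ J n)‖ ≤
      if ¬ n.Prime then 2 * Real.exp 3 * ℓ ^ J * Λ n else 0 := by
    intro n hn
    rw [Finset.mem_Icc] at hn
    have hn0 : n ≠ 0 := by omega
    have h0 := Real.log_natCast_nonneg n
    by_cases hp : n.Prime
    · rw [if_neg (by simpa), norm_le_zero_iff, sub_eq_zero, lg_iterate_apply, pw, if_pos hp, wt, pl,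
        ArithmeticFunction.add_apply, tw_apply, tw_apply, vm_apply, vonMangoldt_apply_prime hp,
        mul_apply', mul_apply']
      push_cast
      rw [div_pow]
      have : (ℓ : ℂ) ^ J ≠ 0 := pow_ne_zero _ (by exact_mod_cast hl0.ne')
      field_simp
    · rw [if_pos hp, pw, if_neg hp, lg_iterate_apply]
      simp only [Complex.ofReal_zero, mul_zero, sub_zero]
      rw [norm_mul, norm_mul, norm_pow, Complex.norm_real, Real.norm_of_nonneg h0]
      have hw : ‖wt (fun u ↦ (bump u : ℂ)) (Real.exp ℓ) (1 + 1 / ℓ) n‖ ≤ Real.exp 2 := by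
        rw [wt, ← Complex.ofReal_mul, Complex.norm_real, Real.norm_of_nonneg]
        · exact rpow_bump_le hℓ hn0
        · exact mul_nonneg (by positivity) bump.nonneg
      have hln : Real.log n ≤ ℓ + 1 := by
        have h2 : (n : ℝ) ≤ Real.exp 1 * Real.exp ℓ :=
          (Nat.le_floor_iff (by positivity)).1 hn.2
        have := Real.log_le_log (by positivity) h2
        rw [← Real.exp_add, Real.log_exp] at this
        linarith
      have h3 : Real.log n ^ J ≤ Real.exp 1 * ℓ ^ J := by
        have := log_div_pow_le hℓ hJ h0 hln
        rwa [div_pow, div_le_iff₀ (by positivity)] at this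
      have h4 := norm_pl_le (norm_mul_le' (norm_hm_le χ) n₁) (norm_mul_le' (norm_hm_le χ) n₂) n
      calc _ ≤ Real.exp 1 * ℓ ^ J * (2 * Λ n) * Real.exp 2 := by gcongr
        _ = _ := by
          rw [show (3 : ℝ) = 1 + 2 by norm_num, Real.exp_add]; ring
  rw [ssum, Finset.mul_sum, ← Finset.sum_sub_distrib]
  refine (norm_sum_le_of_le _ key).trans ?_
  rw [← Finset.sum_filter, ← Finset.mul_sum]
  have h5 := Chebyshev.psi_sub_theta_eq_sum_not_prime (Real.exp 1 * Real.exp ℓ)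
  have h6 := Chebyshev.psi_sub_theta_le (x := Real.exp 1 * Real.exp ℓ) (by
    rw [← Real.exp_add]; exact Real.one_le_exp (by linarith))
  rw [h5, ← hN, ← Real.exp_add, Real.log_exp] at h6
  have h7 : √(Real.exp (1 + ℓ)) = Real.exp (1 / 2) * Real.exp (ℓ / 2) := by
    rw [← Real.exp_add, Real.sqrt_eq_iff_mul_self_eq (by positivity) (by positivity),
      ← Real.exp_add]
    congr 1; ring
  have h8 : Real.exp (1 / 2) ≤ Real.exp 1 := by gcongr; norm_num
  rw [h7] at h6
  change 2 * Real.exp 3 * ℓ ^ J * ∑ n ∈ Finset.Ioc 0 N with ¬ n.Prime, Λ n ≤ _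
  calc _ ≤ 2 * Real.exp 3 * ℓ ^ J * (2 * (Real.exp 1 * Real.exp (ℓ / 2)) * (ℓ + ℓ)) := by
        gcongr
        refine h6.trans ?_
        gcongr
    _ = _ := by
        rw [show (4 : ℝ) = 1 + 3 by norm_num, Real.exp_add]; ring

lemma exists_mul_pow_le_exp (C : ℝ) (m : ℕ) {c : ℝ} (hc : 0 < c) :
    ∃ ℓ₀ : ℝ, ∀ ℓ : ℝ, ℓ₀ ≤ ℓ → C * ℓ ^ m ≤ Real.exp (c * ℓ) := by
  have h := (isLittleO_pow_exp_pos_mul_atTop m hc).def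
    (show (0 : ℝ) < 1 / (|C| + 1) by positivity)
  obtain ⟨ℓ₀, h₀⟩ := Filter.eventually_atTop.1 h
  refine ⟨max ℓ₀ 0, fun ℓ hℓ ↦ ?_⟩
  have h1 := h₀ ℓ (le_of_max_le_left hℓ)
  have hl : 0 ≤ ℓ := le_of_max_le_right hℓ
  rw [Real.norm_of_nonneg (by positivity), Real.norm_of_nonneg (by positivity), one_div,
    ← div_eq_inv_mul, le_div_iff₀ (by positivity)] at h1
  have : C ≤ |C| + 1 := by linarith [le_abs_self C]
  calc _ ≤ (|C| + 1) * ℓ ^ m := by gcongr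
    _ = _ := mul_comm _ _
    _ ≤ _ := h1

/-- Bombieri–Vinogradov over primes. -/
theorem sum_norm_pw_le (A : ℕ) {β : ℝ} {g₁ g₂ : ℕ →*₀ ℂ} {e : Prop} {C₀ : ℝ}
    (hg : Adm β g₁ g₂ e C₀ 3) :
    ∃ ℓ₀ : ℝ, ∀ (Q : ℕ) (ℓ : ℝ), ℓ₀ ≤ ℓ → Good β Q → (Q : ℝ) = ℓ ^ (2 * (A + 66)) →
      ∀ X, PrimChars X (Real.exp ℓ ^ (1 / 224 : ℝ)) → (e → ∀ i ∈ X, i.2 ≠ 1) →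
      ∑ i ∈ X, (i.1 : ℝ) ^ (-(1 / 2) : ℝ) * ‖∑ n ∈ Finset.Icc 1 ⌊Real.exp 1 * Real.exp ℓ⌋₊,
        hm i.2 n * (g₁ n + g₂ n) * pw ℓ (4 * (A + 66) + 2 + A) n‖ ≤
        2 * (Real.exp ℓ / ℓ ^ A) := by
  obtain ⟨ℓ₁, h₁⟩ := bombieri_vinogradov contDiff_bump
    (fun u hu ↦ by simp [bump_eq_zero hu.le]) A hg
  obtain ⟨ℓ₂, h₂⟩ := exists_mul_pow_le_exp (8 * Real.exp 4) (A + 1)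
    (show (0 : ℝ) < 1 / 4 by norm_num)
  set J := 4 * (A + 66) + 2 + A with hJ
  refine ⟨max (max ℓ₁ ℓ₂) (max 1 J), fun Q ℓ hℓ hQ hQℓ X hX he ↦ ?_⟩
  simp only [max_le_iff] at hℓ
  obtain ⟨⟨l1, l2⟩, l3, l4⟩ := hℓ
  have a1 := h₁ Q ℓ l1 hQ hQℓ X (by convert hX using 2; norm_num) he
  have a2 := h₂ ℓ l2
  have hl0 : 0 < ℓ := by linarith
  set T : (Σ r : ℕ, DirichletCharacter ℂ r) → ℂ := fun i ↦
    ∑ n ∈ Finset.Icc 1 ⌊Real.exp 1 * Real.exp ℓ⌋₊, hm i.2 n * (g₁ n + g₂ n) * pw ℓ J n with hT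
  set E := 8 * Real.exp 4 * ℓ * Real.exp (ℓ / 2) with hE
  have a3 : ∀ i ∈ X, (i.1 : ℝ) ^ (-(1 / 2) : ℝ) * ‖T i‖ ≤
      (i.1 : ℝ) ^ (-(1 / 2) : ℝ) * ‖ssum (fun u ↦ (bump u : ℂ)) (Real.exp ℓ) (1 + 1 / ℓ)
        (lg^[J] (pl (hm i.2 * g₁) (hm i.2 * g₂)))‖ / ℓ ^ J + E := by
    intro i hi
    have b1 := norm_ssum_sub_le l3 l4 i.2 hg.norm₁ hg.norm₂
    rw [norm_sub_rev] at b1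
    have b2 := norm_le_norm_add_norm_sub' ((ℓ : ℂ) ^ J * T i) (ssum (fun u ↦ (bump u : ℂ)) (Real.exp ℓ) (1 + 1 / ℓ)
        (lg^[J] (pl (hm i.2 * g₁) (hm i.2 * g₂))))
    have b3 := b2.trans (add_le_add le_rfl b1)
    rw [norm_mul, norm_pow, Complex.norm_real, Real.norm_of_nonneg hl0.le, mul_comm,
      ← le_div_iff₀ (by positivity), add_div, mul_div_cancel_left₀ _ (by positivity)] at b3
    have hr : (1 : ℝ) ≤ i.1 := by exact_mod_cast Nat.one_le_iff_ne_zero.2 (hX.ne i hi)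
    have b4 : (i.1 : ℝ) ^ (-(1 / 2) : ℝ) ≤ 1 := Real.rpow_le_one_of_one_le_of_nonpos hr (by norm_num)
    have b5 : 0 ≤ E := by positivity
    rw [mul_div_assoc]
    calc _ ≤ (i.1 : ℝ) ^ (-(1 / 2) : ℝ) * (_ + E) := by gcongr
      _ ≤ _ := by rw [mul_add]; gcongr; nlinarith
  have hc := hX.card_le (by positivity)
  have e1 : (Real.exp ℓ ^ (1 / 224 : ℝ)) ^ 2 = Real.exp (ℓ / 112) := by
    rw [← Real.exp_mul, ← Real.exp_nat_mul]; congr 1; push_cast; ring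
  calc _ ≤ _ := Finset.sum_le_sum a3
    _ = (∑ i ∈ X, (i.1 : ℝ) ^ (-(1 / 2) : ℝ) * ‖ssum (fun u ↦ (bump u : ℂ)) (Real.exp ℓ) (1 + 1 / ℓ)
        (lg^[J] (pl (hm i.2 * g₁) (hm i.2 * g₂)))‖) / ℓ ^ J + X.card * E := by
        rw [Finset.sum_add_distrib, ← Finset.sum_div, Finset.sum_const, nsmul_eq_mul]
    _ ≤ Real.exp ℓ * ℓ ^ (4 * (A + 66) + 2) / ℓ ^ J + Real.exp (ℓ / 112) * E := by
        rw [e1] at hc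
        gcongr
    _ ≤ Real.exp ℓ / ℓ ^ A + Real.exp ℓ / ℓ ^ A := by
        gcongr ?_ + ?_
        · rw [hJ, pow_add ℓ _ A]
          apply le_of_eq
          field_simp
        · rw [le_div_iff₀ (by positivity), hE]
          calc _ = Real.exp (ℓ / 112) * Real.exp (ℓ / 2) * (8 * Real.exp 4 * ℓ ^ (A + 1)) := by ring
            _ ≤ Real.exp (ℓ / 112) * Real.exp (ℓ / 2) * Real.exp (1 / 4 * ℓ) := by gcongr
            _ = Real.exp (ℓ / 112 + ℓ / 2 + 1 / 4 * ℓ) := by rw [Real.exp_add, Real.exp_add]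
            _ ≤ _ := by gcongr; linarith
    _ = _ := by ring

lemma log_le_pw {ℓ : ℝ} {J : ℕ} (l2 : 2 ≤ ℓ) (l3 : J ≤ ℓ) {n : ℕ} (hp : n.Prime)
    (h1 : Real.exp (ℓ - 1 / 2) ≤ n) (h2 : n ≤ Real.exp (ℓ + 1 / 2)) :
    1 / 8 * Real.log n ≤ pw ℓ J n := by
  have hl0 : 0 < ℓ := by linarith
  have hn0 : (0 : ℝ) < n := by exact_mod_cast hp.pos
  have n1 : Real.log n ≤ ℓ + 1 / 2 := by
    rw [Real.log_le_iff_le_exp hn0]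
    exact h2
  have n2 : ℓ - 1 / 2 ≤ Real.log n := by
    rw [Real.le_log_iff_exp_le hn0]
    exact h1
  have e1 : bump (Real.log (n / Real.exp ℓ)) = 1 := by
    apply bump.one_of_mem_closedBall
    rw [Real.log_div hn0.ne' (Real.exp_ne_zero _), Real.log_exp, mem_closedBall_zero_iff,
      Real.norm_eq_abs, abs_le]
    constructor <;> simp only [bump] <;> linarith
  have e2 : 1 / 4 ≤ (n / Real.exp ℓ : ℝ) ^ (-(1 + 1 / ℓ)) := by
    rw [Real.rpow_def_of_pos (by positivity), Real.log_div hn0.ne' (Real.exp_ne_zero _),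
      Real.log_exp]
    have : 1 / ℓ ≤ 1 / 2 := by gcongr
    have h3 : 0 < 1 / ℓ := by positivity
    refine le_trans ?_ (Real.add_one_le_exp _)
    nlinarith
  have e3 : 1 / 2 ≤ (Real.log n / ℓ) ^ J := by
    have q1 : 1 + (-(1 / (2 * ℓ))) ≤ Real.log n / ℓ := by
      rw [le_div_iff₀ hl0]
      field_simp
      linarith
    have q2 : 1 / (2 * ℓ) ≤ 1 := by rw [div_le_one (by positivity)]; linarith
    have q3 := one_add_mul_le_pow (show -2 ≤ -(1 / (2 * ℓ)) by linarith) J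
    have q4 : (J : ℝ) * (1 / (2 * ℓ)) ≤ 1 / 2 := by
      rw [mul_one_div, div_le_iff₀ (by positivity)]; linarith
    calc (1 : ℝ) / 2 ≤ (1 + (-(1 / (2 * ℓ)))) ^ J := by linarith
      _ ≤ _ := by gcongr; linarith
  have := Real.log_natCast_nonneg n
  rw [pw, if_pos hp, e1, mul_one]
  calc _ = Real.log n * (1 / 2) * (1 / 4) := by ring
    _ ≤ _ := by gcongr

lemma theta_sub_theta_ge : ∃ ℓ₀ : ℝ, ∀ ℓ : ℝ, ℓ₀ ≤ ℓ → Real.exp ℓ / 12 ≤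
    Chebyshev.theta (Real.exp (ℓ + 1 / 2)) - Chebyshev.theta (Real.exp (ℓ - 1 / 2)) := by
  obtain ⟨ℓ₁, h₁⟩ := exists_mul_pow_le_exp 1000 1 (show (0 : ℝ) < 1 / 4 by norm_num)
  refine ⟨max ℓ₁ 2, fun ℓ hℓ ↦ ?_⟩
  simp only [max_le_iff] at hℓ
  obtain ⟨l1, l2⟩ := hℓ
  have a1 := h₁ ℓ l1
  have hl0 : 0 < ℓ := by linarith
  set a := Real.exp (ℓ + 1 / 2) with ha
  set b := Real.exp (ℓ - 1 / 2) with hb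
  have he1 := Real.exp_one_gt_d9
  have he2 := Real.exp_one_lt_d9
  set x := Real.exp ℓ with hx
  have hx0 : 0 < x := Real.exp_pos _
  set u := Real.exp (1 / 2) with hu
  have hu0 : 0 < u := Real.exp_pos _
  have huu : u * u = Real.exp 1 := by rw [← Real.exp_add]; norm_num
  have hu1 : 1.64 ≤ u := by nlinarith
  have hu2 : u ≤ 1.65 := by nlinarith
  have e1 : a = u * x := by rw [ha, Real.exp_add, mul_comm]
  have e2 : b * u = x := by rw [hb, hu, ← Real.exp_add, hx]; congr 1; ring
  have e2' : b ≤ 0.61 * x := by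
    have : 0 < b := Real.exp_pos _
    nlinarith
  have c1 := Chebyshev.theta_ge' (x := a) (Real.one_le_exp (by linarith))
  have c2 := Chebyshev.theta_le_log4_mul_x (x := b) (Real.exp_pos _).le
  rw [show (4 : ℝ) = 2 ^ 2 by norm_num, Real.log_pow] at c2
  push_cast at c2
  have e3 : Real.log a = ℓ + 1 / 2 := Real.log_exp _
  set y := Real.exp (ℓ / 2) with hy
  have hy1 : 1 ≤ y := Real.one_le_exp (by positivity)
  have e4 : √a ≤ 2 * y := by
    rw [Real.sqrt_le_iff, mul_pow, hy, ← Real.exp_nat_mul, e1, hx]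
    refine ⟨by positivity, ?_⟩
    rw [show ((2 : ℕ) : ℝ) * (ℓ / 2) = ℓ by push_cast; ring]
    nlinarith
  have e5 : Real.log (a + 2) ≤ ℓ + 3 / 2 := by
    have : 2 ≤ a := by
      have := Real.add_one_le_exp (ℓ + 1 / 2); linarith
    calc _ ≤ Real.log (2 * a) := by gcongr; linarith
      _ = Real.log 2 + (ℓ + 1 / 2) := by rw [Real.log_mul (by norm_num) (by positivity), e3]
      _ ≤ _ := by linarith [Real.log_two_lt_d9]
  have e6 : 12 * ℓ * y ≤ 0.012 * x := by
    rw [pow_one] at a1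
    have : x = Real.exp (1 / 2 * ℓ) * Real.exp (1 / 2 * ℓ) := by
      rw [← Real.exp_add, hx]; congr 1; ring
    have h3 : Real.exp (1 / 4 * ℓ) ≤ Real.exp (1 / 2 * ℓ) := by gcongr; norm_num
    rw [hy, this, show ℓ / 2 = 1 / 2 * ℓ by ring]
    nlinarith [Real.exp_pos (1 / 2 * ℓ)]
  rw [e3] at c1
  have e7 : 2 * √a * (ℓ + 1 / 2) ≤ 8 * ℓ * y := by
    calc _ ≤ 2 * (2 * y) * (ℓ + ℓ) := by gcongr; linarith
      _ = _ := by ring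
  have l1 := Real.log_two_gt_d9
  have l3 := Real.log_two_lt_d9
  have e8 : ℓ ≤ ℓ * y := le_mul_of_one_le_right hl0.le hy1
  have e9 : 1.64 * x ≤ a := by rw [e1]; gcongr
  have f1 : (1.64 * x - 1) * Real.log 2 ≤ (a - 1) * Real.log 2 := by gcongr
  have f2 : 2 * Real.log 2 * b ≤ 2 * Real.log 2 * (0.61 * x) := by gcongr
  have f3 : 0.69 * (0.42 * x) ≤ Real.log 2 * (0.42 * x) := by gcongr; linarith
  linarith

/-- The main term, from Chebyshev's estimates. -/
theorem le_sum_pw (J : ℕ) : ∃ ℓ₀ : ℝ, ∀ ℓ : ℝ, ℓ₀ ≤ ℓ →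
    Real.exp ℓ / 100 ≤ ∑ n ∈ Finset.Icc 1 ⌊Real.exp 1 * Real.exp ℓ⌋₊, pw ℓ J n := by
  obtain ⟨ℓ₁, h₁⟩ := theta_sub_theta_ge
  refine ⟨max ℓ₁ (max 2 J), fun ℓ hℓ ↦ ?_⟩
  simp only [max_le_iff] at hℓ
  obtain ⟨l1, l2, l3⟩ := hℓ
  have a1 := h₁ ℓ l1
  have hl0 : 0 < ℓ := by linarith
  set a := Real.exp (ℓ + 1 / 2) with ha
  set b := Real.exp (ℓ - 1 / 2) with hb
  have hab : b ≤ a := by rw [ha, hb]; gcongr; linarith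
  have hae : a ≤ Real.exp 1 * Real.exp ℓ := by
    rw [← Real.exp_add, ha, add_comm]; gcongr; norm_num
  have t2 : Chebyshev.theta a - Chebyshev.theta b =
      ∑ n ∈ Finset.Ioc ⌊b⌋₊ ⌊a⌋₊ with n.Prime, Real.log n := by
    rw [Chebyshev.theta, Chebyshev.theta, sub_eq_iff_eq_add, add_comm, ← Finset.sum_union]
    · rw [← Finset.filter_union, Finset.Ioc_union_Ioc_eq_Ioc (Nat.zero_le _) (Nat.floor_mono hab)]
    · exact Finset.disjoint_filter_filter (Finset.Ioc_disjoint_Ioc_of_le le_rfl)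
  have t3 : 1 / 8 * (Chebyshev.theta a - Chebyshev.theta b) ≤
      ∑ n ∈ Finset.Icc 1 ⌊Real.exp 1 * Real.exp ℓ⌋₊, pw ℓ J n := by
    rw [t2, Finset.mul_sum]
    calc _ ≤ ∑ n ∈ Finset.Ioc ⌊b⌋₊ ⌊a⌋₊ with n.Prime, pw ℓ J n := by
          refine Finset.sum_le_sum fun n hn ↦ ?_
          rw [Finset.mem_filter] at hn
          rw [Finset.mem_Ioc] at hn
          exact log_le_pw l2 l3 hn.2 (Nat.lt_of_floor_lt hn.1.1).le
            ((Nat.le_floor_iff (by positivity)).1 hn.1.2)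
      _ ≤ _ := by
          refine Finset.sum_le_sum_of_subset_of_nonneg (fun n hn ↦ ?_)
            fun n _ _ ↦ pw_nonneg (by linarith) J n
          rw [Finset.mem_filter, Finset.mem_Ioc] at hn
          rw [Finset.mem_Icc]
          exact ⟨hn.2.one_lt.le, hn.1.2.trans (Nat.floor_mono hae)⟩
  linarith [Real.exp_pos ℓ]

lemma two_add_pow {u w : ℂ} (h : u * w = 1) (n : ℕ) :
    (2 + u + w) ^ n = (2 * n).choose n + ∑ κ ∈ Finset.range n,
      ((2 * n).choose (n - 1 - κ) : ℂ) * (u ^ (κ + 1) + w ^ (κ + 1)) := by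
  have e : 2 + u + w = w * (u + 1) ^ 2 := by linear_combination (-2 - u) * h
  have hpow (i : ℕ) : w ^ i * u ^ i = 1 := by rw [← mul_pow, mul_comm, h, one_pow]
  rw [e, mul_pow, ← pow_mul, add_pow, show 2 * n + 1 = (n + 1) + n by ring,
    Finset.sum_range_add, Finset.sum_range_succ, ← Finset.sum_range_reflect, mul_add, mul_add,
    Finset.mul_sum, Finset.mul_sum, add_right_comm, ← Finset.sum_add_distrib, add_comm]
  congr 1
  · rw [one_pow, mul_one, ← mul_assoc, hpow, one_mul]
  · refine Finset.sum_congr rfl fun κ hκ ↦ ?_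
    rw [Finset.mem_range] at hκ
    have h1 : (2 * n).choose (n + 1 + κ) = (2 * n).choose (n - 1 - κ) := by
      rw [← Nat.choose_symm (by omega)]; congr 1; omega
    have h2 : w ^ n * u ^ (n - 1 - κ) = w ^ (κ + 1) := by
      conv_lhs => rw [show n = (n - 1 - κ) + (κ + 1) by omega, pow_add]
      rw [show n - 1 - κ + (κ + 1) - 1 - κ = n - 1 - κ by omega]
      linear_combination w ^ (κ + 1) * hpow (n - 1 - κ)
    have h3 : w ^ n * u ^ (n + 1 + κ) = u ^ (κ + 1) := by
      rw [show n + 1 + κ = n + (κ + 1) by ring, pow_add]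
      linear_combination u ^ (κ + 1) * hpow n
    rw [h1, one_pow, one_pow, ← h2, ← h3]
    ring

/-- A trigonometric minorant of a short arc, with positive mean. -/
lemma exists_minorant {δ : ℝ} (hδ : 0 < δ) (hδ1 : δ ≤ 1) :
    ∃ (K : ℕ) (c₀ : ℝ) (c : ℕ → ℝ), 0 < c₀ ∧ ∀ u w : ℂ, ‖u‖ = 1 → u * w = 1 → ∃ t : ℝ,
      (t : ℂ) = c₀ + ∑ κ ∈ Finset.range K, c κ * (u ^ (κ + 1) + w ^ (κ + 1)) ∧ |t| ≤ 2 ∧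
      (0 < t → 1 - δ < u.re) := by
  obtain ⟨n, hn⟩ := exists_nat_gt (1 / δ)
  have hn1 : 1 / ((n : ℝ) + 1) < δ := by
    rw [div_lt_comm₀ (by positivity) hδ]; linarith
  refine ⟨n + 1, ((2 * n).choose n : ℝ) / 4 ^ n * (δ - 1 / (n + 1)),
    fun κ ↦ 2 * ((2 * (n + 1)).choose (n + 1 - 1 - κ) : ℝ) / 4 ^ (n + 1) -
      if κ < n then (2 - δ) * ((2 * n).choose (n - 1 - κ) : ℝ) / 4 ^ n else 0,
    mul_pos (div_pos (by exact_mod_cast Nat.choose_pos (by omega)) (by positivity)) (by linarith),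
    fun u w hu huw ↦ ?_⟩
  have hw : w = (starRingEnd ℂ) u := by
    have : u * (starRingEnd ℂ) u = 1 := by
      rw [Complex.mul_conj, Complex.normSq_eq_norm_sq, hu]; norm_num
    have hu0 : u ≠ 0 := by rintro rfl; simp at hu
    exact mul_left_cancel₀ hu0 (huw.trans this.symm)
  have hv : 2 + u + w = ((2 + 2 * u.re : ℝ) : ℂ) := by
    rw [hw, add_assoc, Complex.add_conj]; push_cast; ring
  have hre := abs_le.1 (Complex.abs_re_le_norm u)
  rw [hu] at hre
  refine ⟨((1 + u.re) / 2) ^ n * (u.re - 1 + δ), ?_, ?_, fun h ↦ ?_⟩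
  · have e1 := two_add_pow huw n
    have e2 := two_add_pow huw (n + 1)
    have e3 : ((2 * (n + 1)).choose (n + 1) : ℂ) * (n + 1) = 2 * (2 * n + 1) * (2 * n).choose n := by
      have := Nat.succ_mul_centralBinom_succ n
      rw [Nat.centralBinom, Nat.centralBinom] at this
      rw [mul_comm]
      exact_mod_cast this
    have e4 : ∑ κ ∈ Finset.range (n + 1), (((2 * ((2 * (n + 1)).choose (n + 1 - 1 - κ) : ℝ) / 4 ^ (n + 1) -
      if κ < n then (2 - δ) * ((2 * n).choose (n - 1 - κ) : ℝ) / 4 ^ n else 0 : ℝ) : ℂ)) *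
        (u ^ (κ + 1) + w ^ (κ + 1)) = 2 / 4 ^ (n + 1) * ((2 + u + w) ^ (n + 1) - (2 * (n + 1)).choose (n + 1)) -
          (2 - δ) / 4 ^ n * ((2 + u + w) ^ n - (2 * n).choose n) := by
      rw [e1, e2, add_sub_cancel_left, add_sub_cancel_left, Finset.mul_sum, Finset.mul_sum]
      have : ∑ i ∈ Finset.range n, (2 - (δ : ℂ)) / 4 ^ n *
          (((2 * n).choose (n - 1 - i) : ℂ) * (u ^ (i + 1) + w ^ (i + 1))) =
          ∑ i ∈ Finset.range (n + 1), if i < n then (2 - (δ : ℂ)) / 4 ^ n *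
          (((2 * n).choose (n - 1 - i) : ℂ) * (u ^ (i + 1) + w ^ (i + 1))) else 0 := by
        rw [Finset.sum_range_succ, if_neg (lt_irrefl n), add_zero]
        exact Finset.sum_congr rfl fun i hi ↦ by rw [if_pos (Finset.mem_range.1 hi)]
      rw [this, ← Finset.sum_sub_distrib]
      refine Finset.sum_congr rfl fun κ _ ↦ ?_
      split_ifs <;> push_cast <;> ring
    rw [e4, hv]
    have h4 : (4 : ℂ) ^ n ≠ 0 := pow_ne_zero _ (by norm_num)
    have hn0 : (n : ℂ) + 1 ≠ 0 := by exact_mod_cast n.succ_ne_zero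
    have e5 : ((2 * (n + 1)).choose (n + 1) : ℂ) = 2 * (2 * n + 1) * (2 * n).choose n / (n + 1) := by
      rw [eq_div_iff hn0]; exact e3
    have e6 : ((1 + (u.re : ℂ)) / 2) ^ n = (2 + 2 * (u.re : ℂ)) ^ n / 4 ^ n := by
      rw [← div_pow]; congr 1; ring
    rw [e5]
    push_cast
    rw [e6]
    rw [pow_succ (4 : ℂ), pow_succ (2 + 2 * (u.re : ℂ))]
    field_simp
    ring
  · rw [abs_mul, abs_pow]
    have h1 : |(1 + u.re) / 2| ≤ 1 := by rw [abs_le]; constructor <;> linarith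
    have h2 : |u.re - 1 + δ| ≤ 2 := by rw [abs_le]; constructor <;> linarith
    calc _ ≤ (1 : ℝ) ^ n * 2 := by gcongr
      _ = 2 := by simp
  · have : 0 ≤ ((1 + u.re) / 2) ^ n := pow_nonneg (by linarith) n
    linarith [pos_of_mul_pos_right h this]

lemma ev_eq {π : GaussianInt} {p : ℕ} (hp : p ≠ 0) (h : π.norm = p) :
    (ev π).re = 1 - 8 * (π.re : ℝ) ^ 2 * (π.im : ℝ) ^ 2 / (p : ℝ) ^ 2 := by
  have h1 : (‖(π : ℂ)‖ : ℝ) ^ 2 = p := by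
    rw [← Complex.normSq_eq_norm_sq, Complex.normSq_apply, GaussianInt.toComplex_def]
    simp only [Complex.add_re, Complex.intCast_re, Complex.mul_re, Complex.I_re, mul_zero,
      Complex.intCast_im, Complex.I_im, sub_zero, add_zero, Complex.add_im,
      Complex.mul_im, mul_one, zero_add]
    rw [norm_eq] at h
    have : ((π.re ^ 2 + π.im ^ 2 : ℤ) : ℝ) = ((p : ℤ) : ℝ) := by rw [h]
    push_cast at this
    linarith
  have h2 : (‖(π : ℂ)‖ : ℂ) ^ 4 = ((p : ℝ) ^ 2 : ℝ) := by
    rw [← h1]; push_cast; ring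
  rw [ev, div_pow, h2, Complex.div_ofReal_re, eq_sub_iff_add_eq, ← add_div, div_eq_one_iff_eq
    (by positivity)]
  have h3 : (π : ℂ) = (π.re : ℝ) + (π.im : ℝ) * Complex.I := by
    rw [GaussianInt.toComplex_def]; push_cast; ring
  have h4 : (π : ℂ) ^ 4 = (((π.re : ℝ) ^ 4 - 6 * (π.re : ℝ) ^ 2 * (π.im : ℝ) ^ 2 + (π.im : ℝ) ^ 4 : ℝ) : ℂ) +
      ((4 * (π.re : ℝ) ^ 3 * π.im - 4 * π.re * (π.im : ℝ) ^ 3 : ℝ) : ℂ) * Complex.I := by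
    rw [h3]
    push_cast
    linear_combination ((π.im : ℂ) ^ 4 * (Complex.I ^ 2 - 1) + 6 * (π.re : ℂ) ^ 2 * (π.im : ℂ) ^ 2 +
      4 * (π.re : ℂ) * (π.im : ℂ) ^ 3 * Complex.I) * Complex.I_sq
  rw [h4, Complex.add_re, Complex.ofReal_re, Complex.re_ofReal_mul, Complex.I_re]
  rw [norm_eq] at h
  have : ((π.re ^ 2 + π.im ^ 2 : ℤ) : ℝ) = ((p : ℤ) : ℝ) := by rw [h]
  push_cast at this
  rw [← this]
  ring

lemma mem_Peps {ε : ℝ} (hε : 0 < ε) {p : ℕ} (hp : p.Prime) {π : GaussianInt} (h : π.norm = p)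
    (h' : 1 - 4 * ε ^ 2 < (ev π).re) : p ∈ Peps ε := by
  rw [ev_eq hp.ne_zero h] at h'
  rw [norm_eq] at h
  have hp0 : (0 : ℝ) < p := by exact_mod_cast hp.pos
  have key (a b : ℤ) (hab : a ^ 2 + b ^ 2 = p) (hle : a ^ 2 ≤ b ^ 2)
      (h : 8 * (a : ℝ) ^ 2 * (b : ℝ) ^ 2 < 4 * ε ^ 2 * p ^ 2) : p ∈ Peps ε := by
    refine ⟨hp, a, b, hab.symm, ?_⟩
    have h1 : (a : ℝ) ^ 2 + b ^ 2 = p := by exact_mod_cast hab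
    have h2 : (a : ℝ) ^ 2 ≤ b ^ 2 := by exact_mod_cast hle
    have h3 : (a : ℝ) ^ 2 ≤ ε ^ 2 * p := by
      by_contra! hc
      have : (p : ℝ) / 2 ≤ b ^ 2 := by linarith
      have := mul_le_mul hc.le this (by positivity) (by positivity)
      nlinarith
    have h4 : (a : ℝ) ^ 2 ≤ (ε * √p) ^ 2 := by rwa [mul_pow, Real.sq_sqrt hp0.le]
    exact abs_le_of_sq_le_sq h4 (by positivity)
  have h2 : 8 * (π.re : ℝ) ^ 2 * (π.im : ℝ) ^ 2 < 4 * ε ^ 2 * p ^ 2 := by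
    rw [← div_lt_iff₀ (by positivity)]; linarith
  rcases le_total (π.re ^ 2) (π.im ^ 2) with hle | hle
  · exact key _ _ h hle h2
  · exact key _ _ (by rw [add_comm]; exact h) hle (by linarith)

set_option maxHeartbeats 1000000 in
/-- Smooth weights on primes near `x`, positive only at primes of `Peps ε` or primes that are not
`1` modulo `4`, with positive mean and a level of distribution. -/
theorem exists_weights {ε : ℝ} (hε : 0 < ε) (hε' : ε < 1 / 2) :
    ∃ c₁ : ℝ, 0 < c₁ ∧ ∀ (A : ℕ) (x₀ : ℝ), ∃ x : ℝ, x₀ ≤ x ∧ ∃ (S : Finset ℕ) (τ : ℕ → ℝ),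
      (∀ n ∈ S, n.Prime ∧ x ≤ 3 * n ∧ n ≤ 3 * x ∧ |τ n| ≤ Real.log x ∧
        (0 < τ n → n % 4 = 1 → n ∈ Peps ε)) ∧
      c₁ * x ≤ ∑ n ∈ S, τ n ∧
      ∀ X, PrimChars X (x ^ (1 / 224 : ℝ)) → (∀ i ∈ X, i.2 ≠ 1) →
        ∑ i ∈ X, (i.1 : ℝ) ^ (-(1 / 2) : ℝ) * ‖∑ n ∈ S, i.2 n * (τ n : ℂ)‖ ≤
          x / Real.log x ^ A := by
  obtain ⟨K, c₀, c, hc₀, hmin⟩ := exists_minorant (δ := 4 * ε ^ 2) (by positivity) (by nlinarith)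
  obtain ⟨β, hβ, hgood⟩ := exists_good
  set D : ℝ := (2 + c₀) * (2 * Real.exp 3) with hD
  have hD0 : 0 < D := by positivity
  set B : ℝ := ∑ κ ∈ Finset.range K, |c κ| with hB
  have hB0 : 0 ≤ B := Finset.sum_nonneg fun _ _ ↦ abs_nonneg _
  refine ⟨c₀ / (200 * D), by positivity, fun A x₀ ↦ ?_⟩
  set J := 4 * (A + 1 + 66) + 2 + (A + 1) with hJ
  obtain ⟨ℓ₁, h₁⟩ := sum_norm_pw_le (A + 1) (adm_zt hβ)
  have h₂ (κ : ℕ) := sum_norm_pw_le (A + 1) (adm_hecke β (κ := κ + 1) (by omega)).choose_spec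
  choose ℓ₂ h₂ using h₂
  obtain ⟨ℓ₃, h₃⟩ := le_sum_pw J
  set L : ℝ := max (max ℓ₁ (∑ κ ∈ Finset.range K, |ℓ₂ κ|)) (max (max ℓ₃ J)
    (max (max 1 (2 * (c₀ + B) / D)) (max (400 * B / c₀) (Real.log (max x₀ 1))))) with hL
  obtain ⟨Q, hQ, hQg⟩ := hgood (⌈(max L 1) ^ (2 * (A + 1 + 66))⌉₊)
  set ℓ : ℝ := (Q : ℝ) ^ (1 / ((2 * (A + 1 + 66) : ℕ) : ℝ)) with hℓ
  have hQℓ : (Q : ℝ) = ℓ ^ (2 * (A + 1 + 66)) := by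
    rw [hℓ, one_div, Real.rpow_inv_natCast_pow (by positivity) (by omega)]
  have hLℓ : L ≤ ℓ := by
    have h1 : (max L 1) ^ (2 * (A + 1 + 66)) ≤ ℓ ^ (2 * (A + 1 + 66)) := by
      rw [← hQℓ]; exact (Nat.le_ceil _).trans (by exact_mod_cast hQ)
    exact (le_max_left _ _).trans (le_of_pow_le_pow_left₀ (by omega) (by positivity) h1)
  rw [hL] at hLℓ
  simp only [max_le_iff] at hLℓ
  obtain ⟨⟨l1, l2⟩, ⟨l3, l4⟩, ⟨l5, l6⟩, l7, l8⟩ := hLℓ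
  have hl0 : 0 < ℓ := by linarith
  set x := Real.exp ℓ with hx
  have hx0 : 0 < x := Real.exp_pos _
  have hlx : Real.log x = ℓ := Real.log_exp _
  set I := Finset.Icc 1 ⌊Real.exp 1 * Real.exp ℓ⌋₊ with hI
  set F : ℕ → ℕ → ℂ := fun κ n ↦ he₁ (κ + 1) n + he₂ (κ + 1) n with hF
  have hT (p : ℕ) (hp : p.Prime) (h2 : p ≠ 2) : ∃ t : ℝ,
      (t : ℂ) = c₀ + ∑ κ ∈ Finset.range K, c κ * F κ p ∧ |t| ≤ 2 + c₀ ∧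
        (0 < t → p % 4 = 1 → p ∈ Peps ε) := by
    simp only [hF, he₁, he₂, ofPrimes_prime _ hp, e₁, e₂]
    by_cases h3 : p % 4 = 3
    · refine ⟨c₀, by simp [h3], by rw [abs_of_pos hc₀]; linarith, fun _ h ↦ by omega⟩
    · have hg := norm_gp hp h3
      have hg0 := (gp_ne_zero p).resolve_right hp.ne_zero
      obtain ⟨t, e1, e2, e3⟩ := hmin _ _ (norm_ev hg0) (ev_star_mul hg0)
      exact ⟨t, by simpa [h3, h2] using e1, by linarith, fun h _ ↦ mem_Peps hε hp hg (e3 h)⟩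
  set S := I.filter fun n : ℕ ↦ n.Prime ∧ |Real.log n - ℓ| < 1 with hS
  have hS1 : ∀ n ∈ S, n.Prime ∧ n ≠ 2 ∧ x ≤ 3 * n ∧ n ≤ 3 * x := by
    intro n hn
    rw [hS, Finset.mem_filter, abs_lt] at hn
    obtain ⟨-, hp, n1, n2⟩ := hn
    have hn0 : (0 : ℝ) < n := by exact_mod_cast hp.pos
    have he := Real.exp_one_lt_three
    have n3 : x ≤ Real.exp 1 * n := by
      have : ℓ ≤ 1 + Real.log n := by linarith
      have := Real.exp_le_exp.2 this
      rwa [Real.exp_add, Real.exp_log hn0] at this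
    have n4 : n ≤ Real.exp 1 * x := by
      have : Real.log n ≤ 1 + ℓ := by linarith
      have := Real.exp_le_exp.2 this
      rwa [Real.exp_add, Real.exp_log hn0] at this
    refine ⟨hp, ?_, by nlinarith, by nlinarith⟩
    rintro rfl
    have h6 : (200 : ℝ) ≤ J := by exact_mod_cast (by omega : 200 ≤ J)
    have := Real.log_two_lt_d9
    push_cast at n1
    linarith
  have l2' : ∀ κ ∈ Finset.range K, ℓ₂ κ ≤ ℓ := fun κ hκ ↦
    (le_abs_self _).trans ((Finset.single_le_sum (f := fun κ ↦ |ℓ₂ κ|)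
      (fun _ _ ↦ abs_nonneg _) hκ).trans l2)
  choose! t ht1 ht2 ht3 using hT
  set T0 : (Σ r : ℕ, DirichletCharacter ℂ r) → ℂ := fun i ↦
    ∑ n ∈ I, hm i.2 n * (zt n + dl n) * pw ℓ J n with hT0
  set T : ℕ → (Σ r : ℕ, DirichletCharacter ℂ r) → ℂ := fun κ i ↦
    ∑ n ∈ I, hm i.2 n * (he₁ (κ + 1) n + he₂ (κ + 1) n) * pw ℓ J n with hT
  have key (i : Σ r : ℕ, DirichletCharacter ℂ r) :
      ∑ n ∈ S, i.2 n * ((t n * pw ℓ J n / D : ℝ) : ℂ) =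
        (c₀ * T0 i + ∑ κ ∈ Finset.range K, c κ * T κ i) / D := by
    simp only [hT0, hT]
    rw [Finset.mul_sum]
    simp only [Finset.mul_sum]
    rw [Finset.sum_comm, ← Finset.sum_add_distrib, Finset.sum_div, hS, Finset.sum_filter]
    refine Finset.sum_congr rfl fun n hn ↦ ?_
    split_ifs with hc
    · have h2 := (hS1 n (Finset.mem_filter.2 ⟨hn, hc⟩)).2.1
      push_cast
      rw [ht1 n hc.1 h2, hm_apply _ hc.1.ne_zero, zt_apply hc.1.ne_zero, dl_apply,
        if_neg hc.1.one_lt.ne', add_zero, mul_one, add_mul, ← mul_div_assoc, mul_add,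
        Finset.sum_mul, Finset.mul_sum]
      congr 2
      · ring
      · exact Finset.sum_congr rfl fun κ _ ↦ by simp only [hF]; ring
    · have : pw ℓ J n = 0 := by
        by_contra h
        exact hc (pw_support h)
      simp [this]
  refine ⟨x, ?_, S, fun n ↦ t n * pw ℓ J n / D, fun n hn ↦ ?_, ?_, fun X hX hX1 ↦ ?_⟩
  · exact (le_max_left _ _).trans ((Real.log_le_iff_le_exp (by positivity)).1 l8)
  · obtain ⟨hp, h2, h3, h4⟩ := hS1 n hn
    have hpw := pw_nonneg l5 J n
    refine ⟨hp, h3, h4, ?_, fun h ↦ ht3 n hp h2 ?_⟩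
    · rw [hlx, abs_div, abs_mul, abs_of_nonneg hpw, abs_of_pos hD0, div_le_iff₀ hD0, hD]
      calc _ ≤ (2 + c₀) * (2 * Real.exp 3 * ℓ) := by
            gcongr
            · exact ht2 n hp h2
            · exact pw_le l5 l4 n
        _ = _ := by ring
    · by_contra! h'
      exact absurd h (not_lt.2 (div_nonpos_of_nonpos_of_nonneg (mul_nonpos_of_nonpos_of_nonneg h' hpw) hD0.le))
  · have h6 := h₃ ℓ l3
    have h7 := key ⟨1, (1 : DirichletCharacter ℂ 1)⟩
    have h8 : ∀ n ∈ I, hm (1 : DirichletCharacter ℂ 1) n = 1 := fun n hn ↦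
      zt_apply (by rw [hI, Finset.mem_Icc] at hn; omega)
    have h9 : ∑ n ∈ S, (1 : DirichletCharacter ℂ 1) n * ((t n * pw ℓ J n / D : ℝ) : ℂ) =
        ((∑ n ∈ S, t n * pw ℓ J n / D : ℝ) : ℂ) := by
      push_cast
      refine Finset.sum_congr rfl fun n hn ↦ ?_
      rw [MulChar.one_apply (isUnit_of_subsingleton _), one_mul]
    have h10 : T0 ⟨1, (1 : DirichletCharacter ℂ 1)⟩ = ((∑ n ∈ I, pw ℓ J n : ℝ) : ℂ) := by
      push_cast
      refine Finset.sum_congr rfl fun n hn ↦ ?_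
      by_cases hp : pw ℓ J n = 0
      · simp [hp]
      · have hp := (pw_support hp).1
        rw [h8 n hn, zt_apply hp.ne_zero, dl_apply, if_neg hp.one_lt.ne']
        ring
    have hX1 : PrimChars {⟨1, (1 : DirichletCharacter ℂ 1)⟩} (Real.exp ℓ ^ (1 / 224 : ℝ)) := by
      constructor
      · simp
      · simp only [Finset.mem_singleton, forall_eq, Nat.cast_one]
        exact Real.one_le_rpow (Real.one_le_exp hl0.le) (by norm_num)
      · simp only [Finset.mem_singleton, forall_eq]
        exact DirichletCharacter.isPrimitive_one_level_one
    have h11 : ∀ κ ∈ Finset.range K, ‖T κ ⟨1, (1 : DirichletCharacter ℂ 1)⟩‖ ≤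
        2 * (x / ℓ ^ (A + 1)) := fun κ hκ ↦ by
      simpa only [Finset.sum_singleton, Nat.cast_one, Real.one_rpow, one_mul] using h₂ κ Q ℓ (l2' κ hκ) hQg hQℓ _ hX1 (by simp)
    rw [h9, h10, eq_div_iff (by exact_mod_cast hD0.ne')] at h7
    have h12 : ‖(((∑ n ∈ S, t n * pw ℓ J n / D) * D - c₀ * ∑ n ∈ I, pw ℓ J n : ℝ) : ℂ)‖ ≤ B * (2 * (x / ℓ ^ (A + 1))) := by
      push_cast at h7 ⊢
      rw [h7, add_sub_cancel_left, hB, Finset.sum_mul]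
      refine norm_sum_le_of_le _ fun κ hκ ↦ ?_
      rw [norm_mul, Complex.norm_real, Real.norm_eq_abs]
      gcongr
      exact h11 κ hκ
    rw [Complex.norm_real, Real.norm_eq_abs, abs_le] at h12
    have h13 : B * (2 * (x / ℓ ^ (A + 1))) ≤ c₀ * x / 200 := by
      have q1 : ℓ ≤ ℓ ^ (A + 1) := le_self_pow₀ l5 (by omega)
      rw [div_le_iff₀ hc₀] at l7
      calc B * (2 * (x / ℓ ^ (A + 1))) ≤ B * (2 * (x / ℓ)) := by gcongr
        _ = 2 * B * x / ℓ := by ring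
        _ ≤ _ := by
          rw [div_le_div_iff₀ hl0 (by norm_num)]
          nlinarith
    have h14 := mul_le_mul_of_nonneg_left h6 hc₀.le
    rw [div_mul_eq_mul_div, div_le_iff₀ (by positivity)]
    linarith
  · have hXn (i) (hi : i ∈ X) : i.1 ≠ 0 := hX.ne i hi
    have h6 := h₁ Q ℓ l1 hQg hQℓ X hX fun _ ↦ hX1
    have h7 := fun κ hκ ↦ h₂ κ Q ℓ (l2' κ hκ) hQg hQℓ X hX False.elim
    rw [hlx]
    calc _ ≤ ∑ i ∈ X, (1 / D) * (c₀ * ((i.1 : ℝ) ^ (-(1 / 2) : ℝ) * ‖T0 i‖) +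
          ∑ κ ∈ Finset.range K, |c κ| * ((i.1 : ℝ) ^ (-(1 / 2) : ℝ) * ‖T κ i‖)) := by
          refine Finset.sum_le_sum fun i hi ↦ ?_
          rw [key i, norm_div, Complex.norm_real, Real.norm_of_nonneg hD0.le]
          have : ‖c₀ * T0 i + ∑ κ ∈ Finset.range K, c κ * T κ i‖ ≤ c₀ * ‖T0 i‖ +
              ∑ κ ∈ Finset.range K, |c κ| * ‖T κ i‖ := by
            refine (norm_add_le _ _).trans (add_le_add ?_ (norm_sum_le_of_le _ fun κ _ ↦ ?_))
            · rw [norm_mul, Complex.norm_real, Real.norm_of_nonneg hc₀.le]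
            · rw [norm_mul, Complex.norm_real, Real.norm_eq_abs]
          calc _ ≤ (i.1 : ℝ) ^ (-(1 / 2) : ℝ) * ((c₀ * ‖T0 i‖ +
              ∑ κ ∈ Finset.range K, |c κ| * ‖T κ i‖) / D) := by gcongr
            _ = _ := by
              rw [mul_add (1 / D), Finset.mul_sum, add_div, mul_add, Finset.sum_div, Finset.mul_sum]
              congr 1
              · ring
              · exact Finset.sum_congr rfl fun _ _ ↦ by ring
      _ = (1 / D) * (c₀ * ∑ i ∈ X, (i.1 : ℝ) ^ (-(1 / 2) : ℝ) * ‖T0 i‖ +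
          ∑ κ ∈ Finset.range K, |c κ| * ∑ i ∈ X, (i.1 : ℝ) ^ (-(1 / 2) : ℝ) * ‖T κ i‖) := by
          rw [← Finset.mul_sum, Finset.sum_add_distrib, ← Finset.mul_sum, Finset.sum_comm]
          simp only [Finset.mul_sum]
      _ ≤ (1 / D) * (c₀ * (2 * (x / ℓ ^ (A + 1))) +
          ∑ κ ∈ Finset.range K, |c κ| * (2 * (x / ℓ ^ (A + 1)))) := by
          gcongr with κ hκ
          exact h7 κ hκ
      _ = (2 * (c₀ + B) / D) * (x / ℓ ^ (A + 1)) := by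
          rw [← Finset.sum_mul, ← hB]; ring
      _ ≤ ℓ * (x / ℓ ^ (A + 1)) := by gcongr
      _ = _ := by rw [pow_succ]; field_simp

/-! ### Arithmetic progressions -/

lemma exists_primChars (Y : ℝ) (hY : 0 ≤ Y) : ∃ X, PrimChars X Y ∧ (∀ i ∈ X, i.2 ≠ 1) ∧
    ∀ i : Σ r : ℕ, DirichletCharacter ℂ r, i.1 ≠ 0 → (i.1 : ℝ) ≤ Y → i.2.IsPrimitive → i.2 ≠ 1 →
      i ∈ X := by
  classical
  set X : Finset (Σ r : ℕ, DirichletCharacter ℂ r) := (Finset.Icc 1 ⌊Y⌋₊).sigma fun r ↦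
    if h : r = 0 then ∅ else
      haveI : NeZero r := ⟨h⟩
      Finset.univ.filter fun χ : DirichletCharacter ℂ r ↦ χ.IsPrimitive ∧ χ ≠ 1 with hX
  have key (i) : i ∈ X ↔ i.1 ≠ 0 ∧ (i.1 : ℝ) ≤ Y ∧ i.2.IsPrimitive ∧ i.2 ≠ 1 := by
    rw [hX, Finset.mem_sigma, Finset.mem_Icc, Nat.le_floor_iff hY]
    by_cases h : i.1 = 0
    · simp [h]
    · simp [h, Nat.one_le_iff_ne_zero]
  exact ⟨X, ⟨fun i hi ↦ ((key i).1 hi).1, fun i hi ↦ ((key i).1 hi).2.1,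
    fun i hi ↦ ((key i).1 hi).2.2.1⟩, fun i hi ↦ ((key i).1 hi).2.2.2,
    fun i h1 h2 h3 h4 ↦ (key i).2 ⟨h1, h2, h3, h4⟩⟩

theorem abs_sum_modEq_sub_le (S : Finset ℕ) (τ : ℕ → ℝ) {Q a : ℕ} (hQ : Q ≠ 0)
    (ha : a.Coprime Q) (hS : ∀ N ∈ S, N.Coprime Q)
    {X : Finset (Σ r : ℕ, DirichletCharacter ℂ r)}
    (hX : ∀ i : Σ r : ℕ, DirichletCharacter ℂ r, i.1 ≠ 0 → i.1 ∣ Q → i.2.IsPrimitive → i.2 ≠ 1 →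
      i ∈ X) :
    |∑ N ∈ S with N ≡ a [MOD Q], τ N - (∑ N ∈ S, τ N) / Q.totient| ≤
      (1 / Q.totient) * ∑ i ∈ X, if i.1 ∣ Q then ‖∑ N ∈ S, i.2 N * (τ N : ℂ)‖ else 0 := by
  classical
  have : NeZero Q := ⟨hQ⟩
  have hφ : (Q.totient : ℂ) ≠ 0 := by
    exact_mod_cast (Nat.totient_pos.2 (Nat.pos_of_ne_zero hQ)).ne'
  have hau : IsUnit (a : ZMod Q) := (ZMod.isUnit_iff_coprime _ _).2 ha
  have h1 : (Q.totient : ℂ) * ((∑ N ∈ S with N ≡ a [MOD Q], τ N : ℝ) : ℂ) =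
      ∑ χ : DirichletCharacter ℂ Q, χ (a : ZMod Q)⁻¹ * ∑ N ∈ S, χ N * (τ N : ℂ) := by
    simp only [Finset.mul_sum]
    rw [Finset.sum_comm]
    push_cast
    rw [Finset.sum_filter, Finset.mul_sum]
    refine Finset.sum_congr rfl fun N _ ↦ ?_
    simp only [← mul_assoc]
    rw [← Finset.sum_mul, DirichletCharacter.sum_char_inv_mul_char_eq ℂ hau]
    simp [eq_comm (a := (a : ZMod Q)), ZMod.natCast_eq_natCast_iff]
  have h2 : (1 : DirichletCharacter ℂ Q) (a : ZMod Q)⁻¹ *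
      ∑ N ∈ S, (1 : DirichletCharacter ℂ Q) N * (τ N : ℂ) = ((∑ N ∈ S, τ N : ℝ) : ℂ) := by
    have : IsUnit (a : ZMod Q)⁻¹ := by
      obtain ⟨u, hu⟩ := hau
      exact hu ▸ (ZMod.inv_coe_unit u).symm ▸ Units.isUnit _
    rw [MulChar.one_apply this, one_mul]
    push_cast
    refine Finset.sum_congr rfl fun N hN ↦ ?_
    rw [MulChar.one_apply ((ZMod.isUnit_iff_coprime _ _).2 (hS N hN)), one_mul]
  set f : DirichletCharacter ℂ Q → Σ r : ℕ, DirichletCharacter ℂ r :=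
    fun χ ↦ ⟨χ.conductor, χ.primitiveCharacter⟩ with hf
  have hinj : Function.Injective f := fun χ ψ h ↦ by
    have key : ∀ i : Σ r : ℕ, DirichletCharacter ℂ r, ∀ h : i.1 ∣ Q, i = f χ →
        DirichletCharacter.changeLevel h i.2 = χ := by
      rintro _ h rfl
      exact χ.changeLevel_primitiveCharacter
    rw [← key (f ψ) ψ.conductor_dvd_level h.symm]
    exact ψ.changeLevel_primitiveCharacter
  have h3 : ∀ χ : DirichletCharacter ℂ Q, ∑ N ∈ S, χ N * (τ N : ℂ) =
      ∑ N ∈ S, (f χ).2 N * (τ N : ℂ) := fun χ ↦ Finset.sum_congr rfl fun N hN ↦ by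
    have := χ.primitiveCharacter_apply_of_isCoprime (a := N) (Nat.isCoprime_iff_coprime.2 (hS N hN))
    push_cast at this
    rw [← this]
  have h4 : ‖(Q.totient : ℂ) * (((∑ N ∈ S with N ≡ a [MOD Q], τ N) -
      (∑ N ∈ S, τ N) / Q.totient : ℝ) : ℂ)‖ ≤
      ∑ i ∈ X, if i.1 ∣ Q then ‖∑ N ∈ S, i.2 N * (τ N : ℂ)‖ else 0 := by
    have : (Q.totient : ℂ) * (((∑ N ∈ S with N ≡ a [MOD Q], τ N) -
        (∑ N ∈ S, τ N) / Q.totient : ℝ) : ℂ) =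
        ∑ χ ∈ (Finset.univ : Finset (DirichletCharacter ℂ Q)).erase 1,
          χ (a : ZMod Q)⁻¹ * ∑ N ∈ S, χ N * (τ N : ℂ) := by
      rw [← Finset.add_sum_erase _ _ (Finset.mem_univ 1), h2] at h1
      rw [Complex.ofReal_sub, mul_sub, h1, Complex.ofReal_div, Complex.ofReal_natCast, mul_div_cancel₀ _ hφ]
      ring
    rw [this, ← Finset.sum_filter]
    calc _ ≤ ∑ χ ∈ (Finset.univ : Finset (DirichletCharacter ℂ Q)).erase 1,
          ‖∑ N ∈ S, (f χ).2 N * (τ N : ℂ)‖ := by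
          refine norm_sum_le_of_le _ fun χ _ ↦ ?_
          rw [norm_mul, h3]
          exact mul_le_of_le_one_left (norm_nonneg _) (χ.norm_le_one _)
      _ = ∑ i ∈ ((Finset.univ : Finset (DirichletCharacter ℂ Q)).erase 1).image f,
          ‖∑ N ∈ S, i.2 N * (τ N : ℂ)‖ := by
          rw [Finset.sum_image hinj.injOn]
      _ ≤ _ := by
          refine Finset.sum_le_sum_of_subset_of_nonneg (fun i hi ↦ ?_) fun _ _ _ ↦ norm_nonneg _
          obtain ⟨χ, hχ, rfl⟩ := Finset.mem_image.1 hi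
          have hd : (f χ).1 ∣ Q := χ.conductor_dvd_level
          refine Finset.mem_filter.2 ⟨hX _ (fun h ↦ hQ (by rw [h] at hd; exact zero_dvd_iff.1 hd)) hd χ.primitiveCharacter_isPrimitive
            fun h ↦ (Finset.mem_erase.1 hχ).1 ?_, hd⟩
          have := χ.changeLevel_primitiveCharacter
          rw [← this, show χ.primitiveCharacter = 1 from h, DirichletCharacter.changeLevel_one]
  rw [norm_mul, Complex.norm_real, Complex.norm_natCast, Real.norm_eq_abs] at h4
  rw [one_div_mul_eq_div, le_div_iff₀' (by exact_mod_cast Nat.totient_pos.2 (Nat.pos_of_ne_zero hQ))]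
  exact h4

/-! ### Tensor products of quadratic inequalities -/

lemma sum_cons {α : Type*} [Fintype α] {n : ℕ} (f : (Fin (n + 1) → α) → ℝ) :
    ∑ c, f c = ∑ s, ∑ c' : Fin n → α, f (Fin.cons s c') := by
  rw [← (Fin.consEquiv fun _ ↦ α).sum_comp, Fintype.sum_prod_type]
  rfl

theorem tensor_mono {σ ω τ : Type*} [Fintype σ] [Fintype ω] [Fintype τ] : ∀ {n : ℕ}
    {p : Fin n → ω → ℝ} {e : Fin n → σ → ω → ℝ} {N : Fin n → τ → ℝ} {L : Fin n → σ → τ → ℝ},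
    (∀ j o, 0 ≤ p j o) → (∀ j t, 0 ≤ N j t) →
    (∀ j, ∀ b : σ → ℝ, ∑ o, p j o * (∑ s, b s * e j s o) ^ 2 ≤
      ∑ t, N j t * (∑ s, b s * L j s t) ^ 2) → ∀ a : (Fin n → σ) → ℝ,
    ∑ o : Fin n → ω, (∏ j, p j (o j)) * (∑ c, a c * ∏ j, e j (c j) (o j)) ^ 2 ≤
      ∑ t : Fin n → τ, (∏ j, N j (t j)) * (∑ c, a c * ∏ j, L j (c j) (t j)) ^ 2 := by
  intro n
  induction n with
  | zero => intro p e N L _ _ _ a; simp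
  | succ n ih =>
    intro p e N L hp hN h a
    simp only [sum_cons, Fin.prod_univ_succ, Fin.cons_zero, Fin.cons_succ]
    calc _ = ∑ o, p 0 o * ∑ o' : Fin n → ω, (∏ j, p j.succ (o' j)) *
          (∑ c', (∑ s, a (Fin.cons s c') * e 0 s o) * ∏ j, e j.succ (c' j) (o' j)) ^ 2 := by
          refine Finset.sum_congr rfl fun o _ ↦ ?_
          rw [Finset.mul_sum]
          refine Finset.sum_congr rfl fun o' _ ↦ ?_
          rw [mul_assoc, Finset.sum_comm]
          simp only [Finset.sum_mul, mul_assoc]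
      _ ≤ ∑ o, p 0 o * ∑ t : Fin n → τ, (∏ j, N j.succ (t j)) *
          (∑ c', (∑ s, a (Fin.cons s c') * e 0 s o) * ∏ j, L j.succ (c' j) (t j)) ^ 2 := by
          gcongr with o
          · exact hp 0 o
          · exact ih (fun j ↦ hp j.succ) (fun j ↦ hN j.succ) (fun j ↦ h j.succ) _
      _ = ∑ t : Fin n → τ, (∏ j, N j.succ (t j)) * ∑ o, p 0 o *
          (∑ s, (∑ c', a (Fin.cons s c') * ∏ j, L j.succ (c' j) (t j)) * e 0 s o) ^ 2 := by
          simp only [Finset.mul_sum]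
          rw [Finset.sum_comm]
          refine Finset.sum_congr rfl fun t _ ↦ Finset.sum_congr rfl fun o _ ↦ ?_
          rw [mul_left_comm]
          simp only [Finset.sum_mul]
          rw [Finset.sum_comm]
          simp only [mul_right_comm]
      _ ≤ ∑ t' : Fin n → τ, (∏ j, N j.succ (t' j)) * ∑ t, N 0 t *
          (∑ s, (∑ c', a (Fin.cons s c') * ∏ j, L j.succ (c' j) (t' j)) * L 0 s t) ^ 2 := by
          gcongr with t
          · exact Finset.prod_nonneg fun j _ ↦ hN _ _
          · exact h 0 _
      _ = _ := by
          simp only [Finset.mul_sum]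
          rw [Finset.sum_comm]
          refine Finset.sum_congr rfl fun t _ ↦ Finset.sum_congr rfl fun t' _ ↦ ?_
          rw [mul_left_comm, mul_assoc]
          simp only [Finset.sum_mul]
          congr 4 with s
          exact Finset.sum_congr rfl fun c _ ↦ by ring

section Local

variable {K : Type*} [DecidableEq K]

/-- `inc s o = 1` when the condition `s` holds for the residue pattern `o`. -/
def inc (s o : Option K) : ℝ := if s = none ∨ s = o then 1 else 0

/-- The coefficients of the sieve basis functions in terms of `inc`. -/
def mc (p : ℝ) : Option K → Option K → ℝ
  | none, none => 1
  | none, some _ => 0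
  | some _, none => 1
  | some i, some j => if i = j then -p else 0

/-- The sieve basis functions. -/
def eb (p : ℝ) : Option K → Option K → ℝ
  | none, _ => 1
  | some _, none => 1
  | some i, some j => if i = j then 1 - p else 1

variable [Fintype K]

lemma sum_mc_mul_inc (p : ℝ) (s o : Option K) : ∑ d, mc p s d * inc d o = eb p s o := by
  cases s <;> cases o <;> simp [Fintype.sum_option, mc, inc, eb]
  split_ifs <;> ring

/-- The probabilities of the residue patterns of integers at the prime `p`. -/
def pr (p : ℝ) : Option K → ℝ
  | none => 1 - Fintype.card K / p
  | some _ => 1 / p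

/-- The probabilities of the residue patterns of shifted primes at the prime `p`. -/
def pr' (p : ℝ) (m : K) : Option K → ℝ
  | none => 1 - (Fintype.card K - 1) / (p - 1)
  | some i => if i = m then 0 else 1 / (p - 1)

/-- The projection adapted to `pr'`. -/
def lb (m : K) : Option K → Option K → ℝ
  | s, none => if s = none ∨ s = some m then 1 else 0
  | s, some i => if s = some i then 1 else 0

/-- The weights adapted to `pr'`. -/
def nb (p : ℝ) (m : K) : Option K → ℝ
  | none => 1 - Fintype.card K / (p - 1) ^ 2
  | some i => if i = m then 0 else p - 2 * Fintype.card K - 1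

lemma sum_mul_eb (p : ℝ) (b : Option K → ℝ) (o : Option K) :
    ∑ s, b s * eb p s o = (b none + ∑ i, b (some i)) - p * (o.elim 0 fun i ↦ b (some i)) := by
  cases o with
  | none => simp [Fintype.sum_option, eb]
  | some j =>
    have h (i : K) : b (some i) * (if i = j then 1 - p else 1) =
        b (some i) - if i = j then p * b (some i) else 0 := by split_ifs <;> ring
    simp [Fintype.sum_option, eb, h, -mul_ite, Finset.sum_sub_distrib]
    ring

lemma local_upper {p : ℝ} (hp : 0 < p) (b : Option K → ℝ) :
    ∑ o, pr p o * (∑ s, b s * eb p s o) ^ 2 ≤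
      ∑ t : Option K, (t.elim 1 fun _ ↦ p) * (∑ s, b s * if s = t then 1 else 0) ^ 2 := by
  simp only [sum_mul_eb, mul_ite, mul_one, mul_zero, Finset.sum_ite_eq', Finset.mem_univ, if_true]
  simp only [Fintype.sum_option, pr, Option.elim_none, Option.elim_some]
  set B := b none + ∑ i, b (some i) with hB
  have h (i : K) : 1 / p * (B - p * b (some i)) ^ 2 =
      B ^ 2 / p - 2 * B * b (some i) + p * b (some i) ^ 2 := by field_simp; ring
  simp only [h, Finset.sum_add_distrib, Finset.sum_sub_distrib, Finset.sum_const, Finset.card_univ,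
    nsmul_eq_mul, ← Finset.mul_sum]
  have : ∑ i, b (some i) = B - b none := by rw [hB]; ring
  rw [this]
  have : (1 - Fintype.card K / p) * (B - p * 0) ^ 2 + Fintype.card K * (B ^ 2 / p) = B ^ 2 := by ring
  nlinarith [sq_nonneg (B - b none)]

lemma local_lower {p : ℝ} (hp : 3 ≤ p) (m : K) (b : Option K → ℝ) :
    ∑ t, nb p m t * (∑ s, b s * lb m s t) ^ 2 ≤ ∑ o, pr' p m o * (∑ s, b s * eb p s o) ^ 2 := by
  have hk : (1 : ℝ) ≤ Fintype.card K := by exact_mod_cast Fintype.card_pos_iff.2 ⟨m⟩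
  set k : ℝ := (Fintype.card K : ℝ) with hkd
  set d : ℝ := 1 / (p - 1) with hd
  have hd0 : 0 < d := by rw [hd]; exact one_div_pos.2 (by linarith)
  have hdp : d * (p - 1) = 1 := by rw [hd]; exact one_div_mul_cancel (by linarith)
  have hd1 : d ≤ 1 / 2 := by nlinarith
  set b' : K → ℝ := fun i ↦ if i = m then 0 else b (some i) with hb'
  have e1 : ∑ s, b s * lb m s none = b none + b (some m) := by
    simp [Fintype.sum_option, lb]
  have e2 : ∑ i, b (some i) = ∑ i, b' i + b (some m) := by
    rw [← Finset.add_sum_erase _ _ (Finset.mem_univ m), ← Finset.add_sum_erase _ b' (Finset.mem_univ m), add_comm]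
    congr 1
    simp only [hb', if_true, zero_add]
    exact Finset.sum_congr rfl fun i hi ↦ (if_neg (Finset.ne_of_mem_erase hi)).symm
  simp only [sum_mul_eb, e2]
  rw [Fintype.sum_option (f := fun t ↦ nb p m t * _),
    Fintype.sum_option (f := fun o ↦ pr' p m o * _), e1]
  simp only [Option.elim_none, Option.elim_some]
  set c := b none + b (some m) with hc
  set s := ∑ i, b' i with hs
  set q := ∑ i, b' i ^ 2 with hq
  have hB : b none + (s + b (some m)) = c + s := by rw [hc]; ring
  have e3 : ∑ i, nb p m (some i) * (∑ s, b s * lb m s (some i)) ^ 2 = (p - 2 * k - 1) * q := by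
    rw [hq, Finset.mul_sum]
    refine Finset.sum_congr rfl fun i _ ↦ ?_
    simp only [nb, lb, hb', mul_ite, mul_one, mul_zero, Finset.sum_ite_eq', Finset.mem_univ, if_true]
    split_ifs <;> simp [hkd]
  have e4 : ∑ i, pr' p m (some i) * (c + s - p * b (some i)) ^ 2 =
      d * (k * (c + s) ^ 2 - 2 * p * (c + s) * s + p ^ 2 * q) - d * (c + s) ^ 2 := by
    have (i : K) : pr' p m (some i) * (c + s - p * b (some i)) ^ 2 =
        d * ((c + s) ^ 2 - 2 * p * (c + s) * b' i + p ^ 2 * b' i ^ 2) -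
          if i = m then d * (c + s) ^ 2 else 0 := by
      simp only [pr', hb']
      split_ifs <;> ring
    simp only [this, Finset.sum_sub_distrib, ← Finset.mul_sum, Finset.sum_add_distrib,
      Finset.sum_const, Finset.card_univ, nsmul_eq_mul, Finset.sum_ite_eq', Finset.mem_univ, if_true]
    rfl
  rw [hB, e3, e4]
  have e5 : s ^ 2 ≤ (k - 1) * q := by
    have h1 : s = ∑ i ∈ Finset.univ.erase m, b' i := by
      rw [hs, ← Finset.add_sum_erase _ _ (Finset.mem_univ m)]
      simp [hb']
    have h2 : ∑ i ∈ Finset.univ.erase m, b' i ^ 2 ≤ q :=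
      Finset.sum_le_sum_of_subset_of_nonneg (Finset.erase_subset _ _) fun _ _ _ ↦ sq_nonneg _
    have h3 : ((Finset.univ.erase m).card : ℝ) = k - 1 := by
      rw [Finset.card_erase_of_mem (Finset.mem_univ m), Finset.card_univ, Nat.cast_sub (Fintype.card_pos_iff.2 ⟨m⟩), hkd]
      simp
    rw [h1]
    refine sq_sum_le_card_mul_sum_sq.trans ?_
    rw [h3]
    gcongr
  have hq0 : 0 ≤ q := Finset.sum_nonneg fun _ _ ↦ sq_nonneg _
  have hdk : 1 - k / (p - 1) ^ 2 = 1 - k * d ^ 2 := by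
    rw [hd, div_pow, one_pow, mul_one_div]
  have hdk' : 1 - (k - 1) / (p - 1) = 1 - (k - 1) * d := by rw [hd]; ring
  simp only [nb, pr', ← hkd, hdk, hdk']
  have hdp' : d * p = 1 + d := by linarith
  have e6 : 2 * d * c * s ≤ k * d ^ 2 * c ^ 2 + q := by
    have : s ^ 2 ≤ k * q := e5.trans (by gcongr; linarith)
    have h5 : k * (2 * d * c * s) ≤ k * (k * d ^ 2 * c ^ 2 + q) := by
      nlinarith [sq_nonneg (k * d * c - s)]
    exact le_of_mul_le_mul_left h5 (by linarith)
  have e7 : d * (k * (c + s) ^ 2 - 2 * p * (c + s) * s + p ^ 2 * q) = d * k * (c + s) ^ 2 -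
      2 * (1 + d) * (c + s) * s + (1 + d) * p * q := by
    rw [← hdp']; ring
  have e8 : (1 + d) * p = p + 1 + d := by linarith
  have e9 : 2 * d * s ^ 2 ≤ s ^ 2 := by nlinarith [sq_nonneg s]
  rw [e7, e8]
  linarith [mul_nonneg hd0.le hq0, mul_nonneg (by linarith : 0 ≤ k) hq0]

end Local

/-! ### The sieve weights -/

section Weights

variable {K : Type*} [DecidableEq K] [Fintype K] {n : ℕ}

/-- The size of a local component. -/
def sz (p : ℕ) (s : Option K) : ℕ := s.elim 1 fun _ ↦ p

/-- The modulus attached to a pattern. -/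
def size (P : Fin n → ℕ) (c : Fin n → Option K) : ℕ := ∏ j, sz (P j) (c j)

/-- The sieve function with coefficients `a`. -/
def sieve (P : Fin n → ℕ) (a : (Fin n → Option K) → ℝ) (o : Fin n → Option K) : ℝ :=
  ∑ c, a c * ∏ j, eb (P j) (c j) (o j)

/-- The coefficients of `sieve` with respect to divisibility conditions. -/
def lam (P : Fin n → ℕ) (a : (Fin n → Option K) → ℝ) (d : Fin n → Option K) : ℝ :=
  ∑ c, a c * ∏ j, mc (P j) (c j) (d j)

lemma sieve_eq (P : Fin n → ℕ) (a : (Fin n → Option K) → ℝ) (o : Fin n → Option K) :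
    sieve P a o = ∑ d, lam P a d * ∏ j, inc (d j) (o j) := by
  simp only [sieve, lam, Finset.sum_mul]
  rw [Finset.sum_comm]
  refine Finset.sum_congr rfl fun c _ ↦ ?_
  simp only [← sum_mc_mul_inc, Fintype.prod_sum, Finset.mul_sum, mul_assoc, Finset.prod_mul_distrib]

lemma inc_mul_inc (s s' o : Option K) :
    inc s o * inc s' o = (if s = none ∨ s' = none ∨ s = s' then 1 else 0) * inc (s.or s') o := by
  rcases s with _ | s <;> rcases s' with _ | s' <;> rcases o with _ | o <;> simp [inc]
  by_cases h : s = o <;> by_cases h' : s' = o <;> simp_all [eq_comm]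

theorem abs_sum_sieve_sq_sub_le {N : Type*} (P : Fin n → ℕ) (a : (Fin n → Option K) → ℝ)
    (T : Finset N) (v : N → ℝ) (ω : N → Fin n → Option K) (V : ℝ) (π : Fin n → Option K → ℝ) :
    |∑ t ∈ T, v t * sieve P a (ω t) ^ 2 - V * ∑ o : Fin n → Option K, (∏ j, π j (o j)) * sieve P a o ^ 2| ≤
      ∑ d, ∑ d', |lam P a d| * |lam P a d'| *
        |∑ t ∈ T, v t * ∏ j, inc ((d j).or (d' j)) (ω t j) -
          V * ∏ j, ∑ o, π j o * inc ((d j).or (d' j)) o| := by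
  set χ : (Fin n → Option K) → (Fin n → Option K) → ℝ := fun d d' ↦
    ∏ j, if d j = none ∨ d' j = none ∨ d j = d' j then 1 else 0 with hχ
  have h1 (o : Fin n → Option K) : sieve P a o ^ 2 = ∑ d, ∑ d', lam P a d * lam P a d' * χ d d' *
      ∏ j, inc ((d j).or (d' j)) (o j) := by
    rw [sieve_eq, sq, Finset.sum_mul_sum]
    refine Finset.sum_congr rfl fun d _ ↦ Finset.sum_congr rfl fun d' _ ↦ ?_
    rw [mul_mul_mul_comm, ← Finset.prod_mul_distrib, mul_assoc _ (χ d d'), hχ, ← Finset.prod_mul_distrib]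
    simp only [inc_mul_inc]
  have h2 : ∑ t ∈ T, v t * sieve P a (ω t) ^ 2 - V * ∑ o : Fin n → Option K, (∏ j, π j (o j)) * sieve P a o ^ 2 =
      ∑ d, ∑ d', lam P a d * lam P a d' * χ d d' *
        (∑ t ∈ T, v t * ∏ j, inc ((d j).or (d' j)) (ω t j) -
          V * ∏ j, ∑ o, π j o * inc ((d j).or (d' j)) o) := by
    simp only [h1, Fintype.prod_sum, Finset.prod_mul_distrib, mul_sub, Finset.mul_sum,
      Finset.sum_sub_distrib]
    congr 1
    · rw [Finset.sum_comm]
      refine Finset.sum_congr rfl fun d _ ↦ ?_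
      rw [Finset.sum_comm]
      exact Finset.sum_congr rfl fun d' _ ↦ Finset.sum_congr rfl fun t _ ↦ by ring
    · rw [Finset.sum_comm]
      refine Finset.sum_congr rfl fun d _ ↦ ?_
      rw [Finset.sum_comm]
      exact Finset.sum_congr rfl fun d' _ ↦ Finset.sum_congr rfl fun t _ ↦ by ring
  rw [h2]
  refine (Finset.abs_sum_le_sum_abs _ _).trans (Finset.sum_le_sum fun d _ ↦
    (Finset.abs_sum_le_sum_abs _ _).trans (Finset.sum_le_sum fun d' _ ↦ ?_))
  rw [abs_mul, abs_mul, abs_mul]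
  refine mul_le_mul_of_nonneg_right (mul_le_of_le_one_right (by positivity) ?_) (abs_nonneg _)
  rw [hχ, Finset.abs_prod]
  exact Finset.prod_le_one (fun _ _ ↦ abs_nonneg _) fun j _ ↦ by split_ifs <;> simp

omit [DecidableEq K] [Fintype K] in
lemma size_pos {P : Fin n → ℕ} (hP : ∀ j, 0 < P j) (c : Fin n → Option K) : 0 < size P c :=
  Finset.prod_pos fun j _ ↦ by cases c j <;> simp [sz, hP]

lemma lam_eq_zero {P : Fin n → ℕ} (hP : ∀ j, 0 < P j) {a : (Fin n → Option K) → ℝ} {R : ℝ}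
    (ha : ∀ c, R < size P c → a c = 0) {d : Fin n → Option K} (hd : R < size P d) :
    lam P a d = 0 := by
  refine Finset.sum_eq_zero fun c _ ↦ mul_eq_zero.2 ?_
  by_cases h : ∃ j, d j ≠ none ∧ c j ≠ d j
  · obtain ⟨j, h1, h2⟩ := h
    refine Or.inr (Finset.prod_eq_zero (Finset.mem_univ j) ?_)
    obtain ⟨i, hi⟩ := Option.ne_none_iff_exists'.1 h1
    rw [hi] at h2 ⊢
    rcases hc : c j with _ | i' <;> rw [hc] at h2 <;> simp_all [mc]
  · push Not at h
    refine Or.inl (ha c (hd.trans_le ?_))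
    rw [Nat.cast_le]
    refine Finset.prod_le_prod' fun j _ ↦ ?_
    rcases hj : d j with _ | i
    · cases c j <;> simp [sz]
      exact hP j
    · rw [h j (by simp [hj]), hj]

lemma abs_lam_le {P : Fin n → ℕ} (hP : ∀ j, 0 < P j) {a : (Fin n → Option K) → ℝ} {A : ℝ}
    (hA : 0 ≤ A) (ha : ∀ c, |a c| ≤ A / size P c) (d : Fin n → Option K) :
    |lam P a d| ≤ A * ∏ j, (1 + Fintype.card K / (P j : ℝ)) := by
  have h (j : Fin n) : (0 : ℝ) < P j := by exact_mod_cast hP j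
  calc |lam P a d| ≤ ∑ c : Fin n → Option K, A / size P c * ∏ j, |mc (P j : ℝ) (c j) (d j)| := by
        refine (Finset.abs_sum_le_sum_abs _ _).trans (Finset.sum_le_sum fun c _ ↦ ?_)
        rw [abs_mul, Finset.abs_prod]
        exact mul_le_mul_of_nonneg_right (ha c) (Finset.prod_nonneg fun _ _ ↦ abs_nonneg _)
    _ = A * ∏ j, ∑ s, |mc (P j : ℝ) s (d j)| / sz (P j) s := by
        rw [Fintype.prod_sum, Finset.mul_sum]
        refine Finset.sum_congr rfl fun c _ ↦ ?_
        rw [size, Nat.cast_prod, Finset.prod_div_distrib]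
        ring
    _ ≤ _ := by
        refine mul_le_mul_of_nonneg_left (Finset.prod_le_prod (fun j _ ↦ by positivity) fun j _ ↦ ?_) hA
        rcases d j with _ | i
        · simp [Fintype.sum_option, mc, sz, div_eq_mul_inv]
        · simp only [Fintype.sum_option, mc, sz, apply_ite abs, ite_div, abs_zero, zero_div, abs_neg, Nat.abs_cast, Option.elim_some,
            Finset.sum_ite_eq', Finset.mem_univ, if_true, div_self (h j).ne', zero_add]
          have := (h j).le
          exact le_add_of_nonneg_right (by positivity)

end Weights

/-! ### The sum of the sieve weights -/

section Patterns

variable {K : Type*} {n : ℕ}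

/-- The residue pattern of `N`. -/
def pat (P : Fin n → ℕ) (h : K → ℤ) (N : ℕ) (j : Fin n) : Option K :=
  open scoped Classical in if H : ∃ i, (P j : ℤ) ∣ N + h i then some H.choose else none

/-- The divisibility condition encoded by a component of a pattern. -/
def Cond (p : ℕ) (h : K → ℤ) (s : Option K) (N : ℕ) : Prop := ∀ i ∈ s, (p : ℤ) ∣ N + h i

open scoped Classical in
lemma prod_inc_pat {P : Fin n → ℕ} {h : K → ℤ} (hh : ∀ j i i', i ≠ i' → ¬ (P j : ℤ) ∣ h i - h i')
    (u : Fin n → Option K) (N : ℕ) :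
    ∏ j, inc (u j) (pat P h N j) = if ∀ j, Cond (P j) h (u j) N then 1 else 0 := by
  have key (j) : inc (u j) (pat P h N j) = if Cond (P j) h (u j) N then 1 else 0 := by
    rcases u j with _ | i
    · simp [inc, Cond]
    · simp only [inc, Cond, pat, Option.mem_def, Option.some.injEq, forall_eq', reduceCtorEq, false_or]
      congr 1
      rw [eq_iff_iff]
      split_ifs with H
      · rw [Option.some.injEq]
        refine ⟨fun e ↦ e ▸ H.choose_spec, fun e ↦ ?_⟩
        by_contra hne
        exact hh j _ _ hne (by simpa using dvd_sub e H.choose_spec)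
      · simpa using fun e ↦ H ⟨i, e⟩
  simp only [key, Finset.prod_ite_zero, Finset.mem_univ, true_imp_iff, Finset.prod_const_one]

lemma coprime_size {P : Fin n → ℕ} (hP : ∀ j, (P j).Prime) {W : ℕ} (hW : ∀ j, ¬ P j ∣ W)
    (u : Fin n → Option K) : W.Coprime (size P u) :=
  Nat.Coprime.prod_right fun j _ ↦ by
    cases u j
    · simp [sz]
    · exact (Nat.Coprime.symm ((hP j).coprime_iff_not_dvd.2 (hW j)))

lemma exists_modEq {P : Fin n → ℕ} (hP : ∀ j, (P j).Prime) (hinj : Function.Injective P) {W : ℕ}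
    (hW : ∀ j, ¬ P j ∣ W) (h : K → ℤ) (u : Fin n → Option K) :
    ∃ a : ℕ, ∀ N : ℕ, N ≡ a [MOD W * size P u] ↔
      N ≡ 1 [MOD W] ∧ ∀ j, Cond (P j) h (u j) N := by
  suffices H : ∀ J : Finset (Fin n), ∃ a : ℕ, ∀ N : ℕ, N ≡ a [MOD W * ∏ j ∈ J, sz (P j) (u j)] ↔
      N ≡ 1 [MOD W] ∧ ∀ j ∈ J, Cond (P j) h (u j) N by
    obtain ⟨a, ha⟩ := H Finset.univ
    exact ⟨a, fun N ↦ by simpa [size] using ha N⟩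
  intro J
  induction J using Finset.induction_on with
  | empty => exact ⟨1, by simp⟩
  | insert j J hj ih =>
    obtain ⟨a, ha⟩ := ih
    simp only [Finset.forall_mem_insert, Finset.prod_insert hj]
    rcases hu : u j with _ | i
    · exact ⟨a, fun N ↦ by simpa [sz, Cond] using ha N⟩
    · have hco : Nat.Coprime (W * ∏ j ∈ J, sz (P j) (u j)) (P j) := by
        refine Nat.Coprime.mul_left ((hP j).coprime_iff_not_dvd.2 (hW j)).symm
          (Nat.Coprime.prod_left fun j' hj' ↦ ?_)
        cases u j'
        · simp [sz]
        · exact (Nat.coprime_primes (hP _) (hP _)).2 fun e ↦ hj (hinj e ▸ hj')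
      have hp0 : (P j : ℤ) ≠ 0 := by exact_mod_cast (hP j).ne_zero
      obtain ⟨b, hb1, hb2⟩ := Nat.chineseRemainder hco a ((-h i) % P j).toNat
      refine ⟨b, fun N ↦ ?_⟩
      rw [show W * (sz (P j) (some i) * ∏ j ∈ J, sz (P j) (u j)) =
        (W * ∏ j ∈ J, sz (P j) (u j)) * P j by simp only [sz, Option.elim_some]; ring,
        ← Nat.modEq_and_modEq_iff_modEq_mul hco, and_left_comm, and_comm (a := Cond _ _ _ _), ← ha N]
      refine and_congr ⟨fun e ↦ e.trans hb1, fun e ↦ e.trans hb1.symm⟩ ?_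
      have e1 : N ≡ b [MOD P j] ↔ (N : ℤ) ≡ -h i [ZMOD P j] := by
        have : (b : ℤ) ≡ -h i [ZMOD P j] := by
          have := (Int.natCast_modEq_iff).2 hb2
          rw [Int.toNat_of_nonneg (Int.emod_nonneg _ hp0)] at this
          exact this.trans (Int.mod_modEq _ _)
        rw [← Int.natCast_modEq_iff]
        exact ⟨fun e ↦ e.trans this, fun e ↦ e.trans this.symm⟩
      rw [e1, Int.modEq_comm, Int.modEq_iff_dvd]
      simp [Cond]

lemma abs_card_modEq_sub_le (M a : ℕ) {Q : ℕ} (hQ : 0 < Q) :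
    |(((Finset.Icc 1 M).filter fun N ↦ N ≡ a [MOD Q]).card : ℝ) - M / Q| ≤ 1 := by
  have h := Nat.Ioc_filter_modEq_card 0 M hQ a
  have hs : Finset.Ioc 0 M = Finset.Icc 1 M := by ext; simp [Nat.succ_le_iff]
  rw [hs] at h
  have hQ' : (0 : ℝ) < Q := by exact_mod_cast hQ
  have hQ'' : (0 : ℚ) < Q := by exact_mod_cast hQ
  have h1 := Int.floor_le (((M : ℕ) - (a : ℕ) : ℚ) / Q)
  have h2 := Int.lt_floor_add_one (((M : ℕ) - (a : ℕ) : ℚ) / Q)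
  have h3 := Int.floor_le (((0 : ℕ) - (a : ℕ) : ℚ) / Q)
  have h4 := Int.lt_floor_add_one (((0 : ℕ) - (a : ℕ) : ℚ) / Q)
  rw [max_eq_left] at h
  swap
  · rw [sub_nonneg]
    exact Int.floor_mono (by gcongr; exact Nat.zero_le M)
  set c := ((Finset.Icc 1 M).filter fun N ↦ N ≡ a [MOD Q]).card
  have h' : (c : ℚ) = (⌊((M : ℕ) - (a : ℕ) : ℚ) / Q⌋ : ℚ) - ⌊((0 : ℕ) - (a : ℕ) : ℚ) / Q⌋ := by
    exact_mod_cast h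
  have h5 : ((M : ℕ) - (a : ℕ) : ℚ) / Q - ((0 : ℕ) - (a : ℕ) : ℚ) / Q = M / Q := by
    rw [← sub_div]; simp
  have h6 : |(c : ℚ) - M / Q| ≤ 1 := abs_le.2 ⟨by linarith, by linarith⟩
  have h7 : |((c : ℚ) : ℝ) - ((M : ℚ) : ℝ) / ((Q : ℚ) : ℝ)| ≤ 1 := by exact_mod_cast h6
  simpa using h7

variable [DecidableEq K] [Fintype K]

omit [DecidableEq K] in
lemma sum_inv_size (P : Fin n → ℕ) :
    ∑ d : Fin n → Option K, 1 / (size P d : ℝ) = ∏ j, (1 + Fintype.card K / (P j : ℝ)) := by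
  have (d : Fin n → Option K) : 1 / (size P d : ℝ) = ∏ j, 1 / (sz (P j) (d j) : ℝ) := by
    rw [size, Nat.cast_prod, Finset.prod_div_distrib, Finset.prod_const_one]
  simp only [this]
  rw [← Fintype.prod_sum fun j s ↦ 1 / (sz (P j) s : ℝ)]
  simp [Fintype.sum_option, sz, div_eq_mul_inv]

theorem sum_sieve_sq_le {P : Fin n → ℕ} (hP : ∀ j, (P j).Prime) (hinj : Function.Injective P) {W : ℕ}
    (hW0 : 0 < W) (hW : ∀ j, ¬ P j ∣ W) {h : K → ℤ}
    (hh : ∀ j i i', i ≠ i' → ¬ (P j : ℤ) ∣ h i - h i') (hk : ∀ j, Fintype.card K ≤ P j)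
    {a : (Fin n → Option K) → ℝ} {A R : ℝ} (hA : 0 ≤ A) (hR : 0 ≤ R)
    (ha : ∀ c, |a c| ≤ A / size P c) (haR : ∀ c, R < size P c → a c = 0) (M : ℕ) :
    ∑ N ∈ Finset.Icc 1 M with N ≡ 1 [MOD W], sieve P a (pat P h N) ^ 2 ≤
      M / W * ∑ c, size P c * a c ^ 2 +
        (A * R * (∏ j, (1 + Fintype.card K / (P j : ℝ))) ^ 2) ^ 2 := by
  classical
  have hP0 (j) : 0 < P j := (hP j).pos
  have hP0' (j) : (0 : ℝ) < P j := by exact_mod_cast hP0 j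
  set 𝓔 : ℝ := ∏ j, (1 + Fintype.card K / (P j : ℝ)) with h𝓔
  have h𝓔0 : 0 ≤ 𝓔 := Finset.prod_nonneg fun j _ ↦ by have := (hP0' j).le; positivity
  have h1 := abs_sum_sieve_sq_sub_le P a ((Finset.Icc 1 M).filter (· ≡ 1 [MOD W])) (fun _ ↦ 1)
    (pat P h) (M / W) fun j ↦ pr (P j)
  simp only [one_mul] at h1
  have h2 := tensor_mono (p := fun j ↦ pr (P j : ℝ)) (e := fun j ↦ eb (P j : ℝ))
    (N := fun j (t : Option K) ↦ t.elim 1 fun _ ↦ (P j : ℝ))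
    (L := fun j s t ↦ if s = t then 1 else 0) (fun j o ↦ by
      cases o
      · simp only [pr, sub_nonneg]
        exact (div_le_one (hP0' j)).2 (by exact_mod_cast hk j)
      · exact (one_div_pos.2 (hP0' j)).le) (fun j t ↦ by
      cases t
      · simp
      · exact (hP0' j).le) (fun j b ↦ local_upper (hP0' j) b) a
  have h3 : ∑ t : Fin n → Option K, (∏ j, (t j).elim 1 fun _ ↦ (P j : ℝ)) *
      (∑ c, a c * ∏ j, if c j = t j then 1 else 0) ^ 2 = ∑ c, size P c * a c ^ 2 := by
    refine Finset.sum_congr rfl fun t _ ↦ ?_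
    congr 1
    · rw [size, Nat.cast_prod]
      refine Finset.prod_congr rfl fun j _ ↦ ?_
      cases t j <;> simp [sz]
    · have e (c : Fin n → Option K) : (∀ j, c j = t j) ↔ c = t := funext_iff.symm
      simp only [Finset.prod_ite_zero, Finset.mem_univ, true_imp_iff, Finset.prod_const_one,
        e, mul_ite, mul_one, mul_zero, Finset.sum_ite_eq', if_true]
  have h4 (u : Fin n → Option K) : |∑ N ∈ Finset.Icc 1 M with N ≡ 1 [MOD W],
      ∏ j, inc (u j) (pat P h N j) - M / W * ∏ j, ∑ o, pr (P j : ℝ) o * inc (u j) o| ≤ 1 := by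
    obtain ⟨b, hb⟩ := exists_modEq hP hinj hW h u
    have e1 : ∏ j, ∑ o, pr (P j : ℝ) o * inc (u j) o = 1 / size P u := by
      rw [size, Nat.cast_prod, ← Finset.prod_const_one, ← Finset.prod_div_distrib]
      refine Finset.prod_congr rfl fun j _ ↦ ?_
      have := (hP0' j).ne'
      rcases u j with _ | i
      · simp [Fintype.sum_option, pr, inc, sz, div_eq_mul_inv]
      · simp [pr, inc, sz]
    rw [e1]
    rw [Finset.sum_congr rfl fun N _ ↦ (show _ = _ by convert prod_inc_pat hh u N)]
    rw [← Finset.sum_filter, Finset.filter_filter, Finset.sum_const, nsmul_one]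
    simp only [← hb]
    rw [div_mul_div_comm, mul_one, ← Nat.cast_mul]
    exact abs_card_modEq_sub_le _ _ (Nat.mul_pos hW0 (size_pos hP0 u))
  have h5 : ∑ d, |lam P a d| ≤ A * R * 𝓔 ^ 2 := by
    calc _ ≤ ∑ d : Fin n → Option K, A * 𝓔 * R * (1 / size P d) := by
          refine Finset.sum_le_sum fun d _ ↦ ?_
          have hs : (0 : ℝ) < size P d := by exact_mod_cast size_pos hP0 d
          by_cases hd : R < size P d
          · rw [lam_eq_zero hP0 haR hd, abs_zero]
            positivity
          · refine (abs_lam_le hP0 hA ha d).trans ?_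
            rw [mul_assoc _ R, mul_one_div]
            exact le_mul_of_one_le_right (by positivity) ((one_le_div hs).2 (not_lt.1 hd))
      _ = _ := by rw [← Finset.mul_sum, sum_inv_size]; ring
  have h6 : ∑ d, ∑ d', |lam P a d| * |lam P a d'| *
      |∑ N ∈ Finset.Icc 1 M with N ≡ 1 [MOD W], ∏ j, inc ((d j).or (d' j)) (pat P h N j) -
        M / W * ∏ j, ∑ o, pr (P j : ℝ) o * inc ((d j).or (d' j)) o| ≤ (A * R * 𝓔 ^ 2) ^ 2 := by
    calc _ ≤ ∑ d, ∑ d', |lam P a d| * |lam P a d'| := by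
          refine Finset.sum_le_sum fun d _ ↦ Finset.sum_le_sum fun d' _ ↦
            mul_le_of_le_one_right (by positivity) (h4 fun j ↦ (d j).or (d' j))
      _ = (∑ d, |lam P a d|) ^ 2 := by rw [sq, Finset.sum_mul_sum]
      _ ≤ _ := by gcongr
  rw [h3] at h2
  have h7 := (abs_le.1 (h1.trans h6)).2
  have h8 : (M / W : ℝ) * ∑ o : Fin n → Option K, (∏ j, pr (P j : ℝ) (o j)) * sieve P a o ^ 2 ≤
    M / W * ∑ c, size P c * a c ^ 2 := mul_le_mul_of_nonneg_left h2 (by positivity)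
  linarith

end Patterns

/-! ### Sieve weights over primes -/

section Primes

variable {K : Type*} {n : ℕ}

lemma dvd_sz_or {P : Fin n → ℕ} {u : Fin n → Option K} {p : ℕ} (hp : p.Prime) (h : p ∣ size P u) :
    ∃ j, u j ≠ none ∧ p ∣ P j := by
  obtain ⟨j, -, hj⟩ := (hp.prime.dvd_finsetProd_iff _).1 h
  refine ⟨j, ?_⟩
  rcases hu : u j with _ | i
  · rw [hu] at hj
    exact absurd (Nat.dvd_one.1 hj) hp.ne_one
  · rw [hu] at hj
    exact ⟨by simp, hj⟩

lemma totient_size {P : Fin n → ℕ} (hP : ∀ j, (P j).Prime) (hinj : Function.Injective P)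
    (u : Fin n → Option K) : (size P u).totient = ∏ j, (sz (P j) (u j)).totient := by
  suffices H : ∀ J : Finset (Fin n), (∏ j ∈ J, sz (P j) (u j)).totient =
      ∏ j ∈ J, (sz (P j) (u j)).totient from H Finset.univ
  intro J
  induction J using Finset.induction_on with
  | empty => simp
  | insert j J hj ih =>
    rw [Finset.prod_insert hj, Finset.prod_insert hj, Nat.totient_mul, ih]
    refine Nat.Coprime.prod_right fun j' hj' ↦ ?_
    cases u j <;> cases u j' <;> simp only [sz, Option.elim_none, Option.elim_some,
      Nat.coprime_one_left_iff, Nat.coprime_one_right_iff]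
    exact (Nat.coprime_primes (hP _) (hP _)).2 fun e ↦ hj (hinj e ▸ hj')

open scoped Classical in
/-- The local factors in the bound for the contribution of a character modulo `r`. -/
def gw (p r : ℕ) (s : Option K) : ℝ :=
  if s = none ∧ p ∣ r then 0 else √(r.gcd (sz p s)) / (sz p s).totient

lemma gw_nonneg (p r : ℕ) (s : Option K) : 0 ≤ gw p r s := by
  rw [gw]; split_ifs <;> positivity

lemma ite_dvd_div_totient_le {P : Fin n → ℕ} (hP : ∀ j, (P j).Prime) (hinj : Function.Injective P)
    {W : ℕ} (hW0 : 0 < W) (hW : ∀ j, ¬ P j ∣ W) (u : Fin n → Option K) {r : ℕ}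
    (hr : r ∣ W * size P u) :
    1 / ((W * size P u).totient : ℝ) ≤
      √W / W.totient * ((r : ℝ) ^ (-(1 / 2) : ℝ) * ∏ j, gw (P j) r (u j)) := by
  classical
  have hs := size_pos (fun j ↦ (hP j).pos) u
  have hr0 : 0 < r := Nat.pos_of_dvd_of_pos hr (Nat.mul_pos hW0 hs)
  have h1 (j) : gw (P j) r (u j) = √(r.gcd (sz (P j) (u j))) / (sz (P j) (u j)).totient := by
    refine if_neg fun ⟨h, h'⟩ ↦ ?_
    obtain ⟨j', h1, h2⟩ := dvd_sz_or (hP j) (((hP j).dvd_mul.1 (h'.trans hr)).resolve_left (hW j))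
    exact h1 (hinj ((Nat.prime_dvd_prime_iff_eq (hP _) (hP _)).1 h2) ▸ h)
  have h2 : r ≤ W * ∏ j, r.gcd (sz (P j) (u j)) := by
    have key : ∀ J : Finset (Fin n), r.gcd (∏ j ∈ J, sz (P j) (u j)) ∣
        ∏ j ∈ J, r.gcd (sz (P j) (u j)) := by
      intro J
      induction J using Finset.induction_on with
      | empty => simp
      | insert j J hj ih =>
        rw [Finset.prod_insert hj, Finset.prod_insert hj]
        exact (Nat.gcd_mul_right_dvd_mul_gcd _ _ _).trans (mul_dvd_mul_left _ ih)
    refine Nat.le_of_dvd (Nat.mul_pos hW0 (Finset.prod_pos fun j _ ↦ Nat.gcd_pos_of_pos_left _ hr0)) ?_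
    calc r = r.gcd (W * size P u) := (Nat.gcd_eq_left hr).symm
      _ ∣ r.gcd W * r.gcd (size P u) := Nat.gcd_mul_right_dvd_mul_gcd _ _ _
      _ ∣ _ := mul_dvd_mul (Nat.gcd_dvd_right _ _) (key Finset.univ)
  have hr' : (0 : ℝ) < r := by exact_mod_cast hr0
  have h3 : √(r : ℝ) ≤ √W * ∏ j, √(r.gcd (sz (P j) (u j))) := by
    rw [← Real.sqrt_prod _ fun j _ ↦ Nat.cast_nonneg _, ← Real.sqrt_mul (Nat.cast_nonneg _)]
    exact Real.sqrt_le_sqrt (by exact_mod_cast h2)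
  have h4 : (r : ℝ) ^ (-(1 / 2) : ℝ) = 1 / √r := by
    rw [Real.rpow_neg hr'.le, Real.sqrt_eq_rpow, one_div, one_div]
  have hφ : (0 : ℝ) < W.totient * ∏ j, ((sz (P j) (u j)).totient : ℝ) := by
    rw [← Nat.cast_prod, ← totient_size hP hinj]
    have := Nat.totient_pos.2 hW0
    have := Nat.totient_pos.2 hs
    positivity
  rw [Nat.totient_mul (coprime_size hP hW u), Nat.cast_mul, totient_size hP hinj, Nat.cast_prod, h4,
    Finset.prod_congr rfl fun j _ ↦ h1 j, Finset.prod_div_distrib]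
  have hr'' := Real.sqrt_pos.2 hr'
  calc _ = √(r : ℝ) / (√r * (W.totient * ∏ j, ((sz (P j) (u j)).totient : ℝ))) := by
        rw [← div_div √(r : ℝ), div_self hr''.ne']
    _ ≤ (√W * ∏ j, √(r.gcd (sz (P j) (u j)))) /
        (√r * (W.totient * ∏ j, ((sz (P j) (u j)).totient : ℝ))) := by gcongr
    _ = _ := by ring

variable [Fintype K]

lemma sum_sum_or (g : Option K → ℝ) {c : ℝ} (hc : ∀ i, g (some i) = c) :
    ∑ s : Option K, ∑ s', g (s.or s') = g none + ((Fintype.card K + 1) ^ 2 - 1) * c := by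
  simp [Fintype.sum_option, hc]
  ring

lemma sum_sum_gw_le {p : ℕ} (hp : p.Prime) (hk : 4 * (Fintype.card K + 1) ^ 4 ≤ p) (r : ℕ) :
    ∑ s : Option K, ∑ s', gw p r (s.or s') ≤ 1 + 2 * (Fintype.card K + 1) ^ 2 / p := by
  set k : ℝ := (Fintype.card K : ℝ) with hkd
  have hk0 : 0 ≤ k := Nat.cast_nonneg _
  have hp2 : (2 : ℝ) ≤ p := by exact_mod_cast hp.two_le
  have hkp : 4 * (k + 1) ^ 4 ≤ p := by rw [hkd]; exact_mod_cast hk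
  have hφ : (p.totient : ℝ) = p - 1 := by
    rw [Nat.totient_prime hp, Nat.cast_sub hp.one_le, Nat.cast_one]
  have hK : (0 : ℝ) ≤ (k + 1) ^ 2 - 1 := by nlinarith
  by_cases hpr : p ∣ r
  · have hg : r.gcd p = p := Nat.gcd_eq_right hpr
    rw [sum_sum_or _ (c := √p / (p - 1)) fun i ↦ by simp [gw, sz, hg, hφ]]
    have h1 : gw p r (none : Option K) = 0 := by simp [gw, hpr]
    rw [h1, zero_add, ← hkd]
    have h2 : 2 * (k + 1) ^ 2 ≤ √p := Real.le_sqrt_of_sq_le (by nlinarith)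
    have h3 : √(p : ℝ) ^ 2 = p := Real.sq_sqrt (by positivity)
    have : ((k + 1) ^ 2 - 1) * (√p / (p - 1)) ≤ 1 := by
      rw [mul_div_assoc', div_le_one (by linarith)]
      nlinarith [Real.sqrt_nonneg p]
    have : 0 ≤ 2 * (k + 1) ^ 2 / p := by positivity
    linarith
  · have hg : r.gcd p = 1 := (Nat.Coprime.symm ((hp.coprime_iff_not_dvd).2 hpr))
    rw [sum_sum_or _ (c := 1 / (p - 1)) fun i ↦ by simp [gw, sz, hg, hφ]]
    have h1 : gw p r (none : Option K) = 1 := by simp [gw, hpr, sz]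
    rw [h1, ← hkd, mul_one_div]
    gcongr 1 + ?_
    rw [div_le_div_iff₀ (by linarith) (by linarith)]
    nlinarith [mul_nonneg hK (sub_nonneg.2 hp2)]

lemma sum_sum_prod_or (g : Fin n → Option K → ℝ) :
    ∑ d : Fin n → Option K, ∑ d' : Fin n → Option K, ∏ j, g j ((d j).or (d' j)) =
      ∏ j, ∑ s : Option K, ∑ s', g j (s.or s') := by
  rw [Fintype.prod_sum fun (j : Fin n) (s : Option K) ↦ ∑ s' : Option K, g j (s.or s')]
  exact Finset.sum_congr rfl fun d _ ↦ (Fintype.prod_sum fun j s' ↦ g j ((d j).or s')).symm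

variable [DecidableEq K]

lemma sum_pr'_mul_inc {p : ℝ} (hp : 3 ≤ p) (m : K) (s : Option K) :
    ∑ o, pr' p m o * inc s o = s.elim 1 fun i ↦ if i = m then 0 else 1 / (p - 1) := by
  have : p - 1 ≠ 0 := by linarith
  rcases s with _ | i
  · have h (i : K) : (if i = m then (0 : ℝ) else 1 / (p - 1)) =
        1 / (p - 1) - if i = m then 1 / (p - 1) else 0 := by split_ifs <;> simp
    simp [Fintype.sum_option, pr', inc, h, -one_div, Finset.sum_sub_distrib]
    field_simp
    ring
  · simp [pr', inc]

lemma abs_sum_prod_inc_sub_le {P : Fin n → ℕ} (hP : ∀ j, (P j).Prime)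
    (hinj : Function.Injective P) {W : ℕ} (hW0 : 0 < W) (hW : ∀ j, ¬ P j ∣ W) {h : K → ℤ}
    (hh : ∀ j i i', i ≠ i' → ¬ (P j : ℤ) ∣ h i - h i') (hP3 : ∀ j, 3 ≤ P j) {m : K} (hm : h m = 0)
    {S : Finset ℕ} {τ : ℕ → ℝ} (hSW : ∀ N ∈ S, N.Coprime W) (hSP : ∀ N ∈ S, ∀ j, N.Coprime (P j))
    {X : Finset (Σ r : ℕ, DirichletCharacter ℂ r)} {Y : ℝ}
    (hX : ∀ i : Σ r : ℕ, DirichletCharacter ℂ r, i.1 ≠ 0 → (i.1 : ℝ) ≤ Y → i.2.IsPrimitive →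
      i.2 ≠ 1 → i ∈ X) (u : Fin n → Option K) (hu : (W * size P u : ℝ) ≤ Y) :
    |∑ N ∈ S with N ≡ 1 [MOD W], τ N * ∏ j, inc (u j) (pat P h N j) -
      (∑ N ∈ S, τ N) / W.totient * ∏ j, ∑ o, pr' (P j : ℝ) m o * inc (u j) o| ≤
    √W / W.totient * ∑ i ∈ X, (i.1 : ℝ) ^ (-(1 / 2) : ℝ) * ‖∑ N ∈ S, i.2 N * (τ N : ℂ)‖ *
      ∏ j, gw (P j) i.1 (u j) := by
  classical
  have hs := size_pos (fun j ↦ (hP j).pos) u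
  have hR : 0 ≤ √W / W.totient * ∑ i ∈ X, (i.1 : ℝ) ^ (-(1 / 2) : ℝ) *
      ‖∑ N ∈ S, i.2 N * (τ N : ℂ)‖ * ∏ j, gw (P j) i.1 (u j) :=
    mul_nonneg (by positivity) (Finset.sum_nonneg fun i _ ↦ mul_nonneg (by positivity)
      (Finset.prod_nonneg fun j _ ↦ gw_nonneg _ _ _))
  have hP3' (j) : (3 : ℝ) ≤ P j := by exact_mod_cast hP3 j
  simp only [fun j s ↦ sum_pr'_mul_inc (hP3' j) m s]
  by_cases hum : ∃ j, u j = some m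
  · obtain ⟨j, hj⟩ := hum
    rw [Finset.prod_eq_zero (Finset.mem_univ j) (by simp [hj]), mul_zero, sub_zero,
      Finset.sum_eq_zero, abs_zero]
    · exact hR
    intro N hN
    have e : ∏ j, inc (u j) (pat P h N j) = if ∀ j, Cond (P j) h (u j) N then 1 else 0 := by
      convert prod_inc_pat hh u N
    rw [e, if_neg, mul_zero]
    intro H
    have := H j m hj
    rw [hm, add_zero, Int.natCast_dvd_natCast] at this
    exact (hP j).one_lt.ne' (Nat.dvd_one.1 (hSP N (Finset.mem_filter.1 hN).1 j ▸ Nat.dvd_gcd this dvd_rfl))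
  push Not at hum
  obtain ⟨a, ha⟩ := exists_modEq hP hinj hW h u
  obtain ⟨ha1, ha2⟩ := (ha a).1 rfl
  have hQ : W * size P u ≠ 0 := (Nat.mul_pos hW0 hs).ne'
  have haW : a.Coprime W := by
    rw [Nat.Coprime, ha1.gcd_eq, Nat.gcd_one_left]
  have haQ : a.Coprime (W * size P u) := by
    refine Nat.Coprime.mul_right haW (Nat.Coprime.prod_right fun j _ ↦ ?_)
    rcases huj : u j with _ | i
    · simp [sz]
    · refine Nat.Coprime.symm ((hP j).coprime_iff_not_dvd.2 fun H ↦ hh j i m ?_ ?_)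
      · rintro rfl
        exact hum j huj
      · have := dvd_sub (ha2 j i huj) (Int.natCast_dvd_natCast.2 H)
        simpa [hm] using this
  have hSQ : ∀ N ∈ S, N.Coprime (W * size P u) := fun N hN ↦
    Nat.Coprime.mul_right (hSW N hN) (Nat.Coprime.prod_right fun j _ ↦ by
      cases u j
      · simp [sz]
      · exact hSP N hN j)
  have key := abs_sum_modEq_sub_le S τ hQ haQ hSQ (X := X) fun i h0 h1 h2 h3 ↦ hX i h0 (by
    refine le_trans ?_ hu
    exact_mod_cast Nat.le_of_dvd (Nat.mul_pos hW0 hs) h1) h2 h3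
  have e1 : ∑ N ∈ S with N ≡ 1 [MOD W], τ N * ∏ j, inc (u j) (pat P h N j) =
      ∑ N ∈ S with N ≡ a [MOD W * size P u], τ N := by
    have e (N : ℕ) : ∏ j, inc (u j) (pat P h N j) = if ∀ j, Cond (P j) h (u j) N then 1 else 0 := by
      convert prod_inc_pat hh u N
    simp only [e, mul_ite, mul_one, mul_zero]
    rw [← Finset.sum_filter, Finset.filter_filter]
    simp only [ha]
  have e2 : (∑ N ∈ S, τ N) / W.totient *
      ∏ j, (u j).elim 1 (fun i ↦ if i = m then (0 : ℝ) else 1 / (P j - 1)) =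
      (∑ N ∈ S, τ N) / (W * size P u).totient := by
    rw [Nat.totient_mul (coprime_size hP hW u), Nat.cast_mul, totient_size hP hinj, Nat.cast_prod,
      ← div_div, div_eq_mul_inv _ (∏ j, _), ← Finset.prod_inv_distrib]
    congr 1
    refine Finset.prod_congr rfl fun j _ ↦ ?_
    rcases huj : u j with _ | i
    · simp [sz]
    · have : i ≠ m := by
        rintro rfl
        exact hum j huj
      simp [this, sz, Nat.totient_prime (hP j), Nat.cast_sub (hP j).one_le]
  rw [e1, e2]
  refine key.trans ?_
  rw [Finset.mul_sum, Finset.mul_sum]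
  refine Finset.sum_le_sum fun i _ ↦ ?_
  split_ifs with hd
  · calc _ ≤ √W / W.totient * ((i.1 : ℝ) ^ (-(1 / 2) : ℝ) * ∏ j, gw (P j) i.1 (u j)) *
          ‖∑ N ∈ S, i.2 N * (τ N : ℂ)‖ :=
          mul_le_mul_of_nonneg_right (ite_dvd_div_totient_le hP hinj hW0 hW u hd) (norm_nonneg _)
      _ = _ := by ring
  · rw [mul_zero]
    exact mul_nonneg (by positivity) (mul_nonneg (by positivity)
      (Finset.prod_nonneg fun j _ ↦ gw_nonneg _ _ _))

theorem le_sum_sieve_sq {P : Fin n → ℕ} (hP : ∀ j, (P j).Prime)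
    (hinj : Function.Injective P) {W : ℕ} (hW0 : 0 < W) (hW : ∀ j, ¬ P j ∣ W) {h : K → ℤ}
    (hh : ∀ j i i', i ≠ i' → ¬ (P j : ℤ) ∣ h i - h i')
    (hk : ∀ j, 4 * (Fintype.card K + 1) ^ 4 ≤ P j) {m : K} (hm : h m = 0)
    {S : Finset ℕ} {τ : ℕ → ℝ} (hSW : ∀ N ∈ S, N.Coprime W) (hSP : ∀ N ∈ S, ∀ j, N.Coprime (P j))
    (hτ : 0 ≤ ∑ N ∈ S, τ N)
    {X : Finset (Σ r : ℕ, DirichletCharacter ℂ r)} {Y : ℝ}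
    (hX : ∀ i : Σ r : ℕ, DirichletCharacter ℂ r, i.1 ≠ 0 → (i.1 : ℝ) ≤ Y → i.2.IsPrimitive →
      i.2 ≠ 1 → i ∈ X) {E : ℝ}
    (hE : ∑ i ∈ X, (i.1 : ℝ) ^ (-(1 / 2) : ℝ) * ‖∑ N ∈ S, i.2 N * (τ N : ℂ)‖ ≤ E)
    {a : (Fin n → Option K) → ℝ} {A R : ℝ} (hA : 0 ≤ A) (hR : 0 ≤ R)
    (ha : ∀ c, |a c| ≤ A / size P c) (haR : ∀ c, R < size P c → a c = 0) (hY : W * R ^ 2 ≤ Y) :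
    (∑ N ∈ S, τ N) / W.totient * ∑ t : Fin n → Option K, (∏ j, nb (P j : ℝ) m (t j)) *
        (∑ c, a c * ∏ j, lb m (c j) (t j)) ^ 2 -
      (A * ∏ j, (1 + Fintype.card K / (P j : ℝ))) ^ 2 * (√W * E *
        ∏ j, (1 + 2 * (Fintype.card K + 1) ^ 2 / (P j : ℝ))) ≤
    ∑ N ∈ S with N ≡ 1 [MOD W], τ N * sieve P a (pat P h N) ^ 2 := by
  classical
  have hk1 : 1 ≤ Fintype.card K := Fintype.card_pos_iff.2 ⟨m⟩
  have hkP (j) : 4 * ((Fintype.card K : ℝ) + 1) ^ 4 ≤ P j := by exact_mod_cast hk j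
  have hk1' : (1 : ℝ) ≤ Fintype.card K := by exact_mod_cast hk1
  set k : ℝ := (Fintype.card K : ℝ) with hkd
  have hkP' (j) : 4 * (k + 1) ≤ P j :=
    le_trans (mul_le_mul_of_nonneg_left (le_self_pow₀ (by linarith) (by norm_num)) (by norm_num)) (hkP j)
  have hP3 (j) : 3 ≤ P j := by
    have : (3 : ℝ) ≤ P j := by linarith [hkP' j]
    exact_mod_cast this
  have hP3' (j) : (3 : ℝ) ≤ P j := by exact_mod_cast hP3 j
  have hP0 (j) : 0 < P j := (hP j).pos
  set 𝓔 : ℝ := ∏ j, (1 + k / (P j : ℝ)) with h𝓔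
  have h𝓔0 : 0 ≤ 𝓔 := Finset.prod_nonneg fun j _ ↦ by positivity
  have h1 := abs_sum_sieve_sq_sub_le P a (S.filter (· ≡ 1 [MOD W])) τ
    (pat P h) ((∑ N ∈ S, τ N) / W.totient) fun j ↦ pr' (P j) m
  have h2 := tensor_mono (p := fun j ↦ nb (P j : ℝ) m) (e := fun _ ↦ lb m)
    (N := fun j ↦ pr' (P j : ℝ) m) (L := fun j ↦ eb (P j : ℝ)) (fun j o ↦ by
      have := hkP' j
      cases o
      · simp only [nb, ← hkd, sub_nonneg]
        rw [div_le_one (by nlinarith)]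
        nlinarith
      · simp only [nb, ← hkd]
        split_ifs <;> linarith) (fun j t ↦ by
      have := hkP' j
      cases t
      · simp only [pr', ← hkd, sub_nonneg]
        exact div_le_one_of_le₀ (by linarith) (by linarith)
      · simp only [pr']
        split_ifs
        · exact le_rfl
        · exact one_div_nonneg.2 (by linarith)) (fun j b ↦ local_lower (hP3' j) m b) a
  have h3 (d d' : Fin n → Option K) : |lam P a d| * |lam P a d'| *
      |∑ N ∈ S with N ≡ 1 [MOD W], τ N * ∏ j, inc ((d j).or (d' j)) (pat P h N j) -
        (∑ N ∈ S, τ N) / W.totient * ∏ j, ∑ o, pr' (P j : ℝ) m o * inc ((d j).or (d' j)) o| ≤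
      (A * 𝓔) ^ 2 * (√W / W.totient * ∑ i ∈ X, (i.1 : ℝ) ^ (-(1 / 2) : ℝ) *
        ‖∑ N ∈ S, i.2 N * (τ N : ℂ)‖ * ∏ j, gw (P j) i.1 ((d j).or (d' j))) := by
    have hR' : 0 ≤ (A * 𝓔) ^ 2 * (√W / W.totient * ∑ i ∈ X, (i.1 : ℝ) ^ (-(1 / 2) : ℝ) *
        ‖∑ N ∈ S, i.2 N * (τ N : ℂ)‖ * ∏ j, gw (P j) i.1 ((d j).or (d' j))) :=
      mul_nonneg (by positivity) (mul_nonneg (by positivity)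
        (Finset.sum_nonneg fun i _ ↦ mul_nonneg (by positivity)
          (Finset.prod_nonneg fun j _ ↦ gw_nonneg _ _ _)))
    by_cases hd : R < size P d
    · rw [lam_eq_zero hP0 haR hd, abs_zero, zero_mul, zero_mul]
      exact hR'
    by_cases hd' : R < size P d'
    · rw [lam_eq_zero hP0 haR hd', abs_zero, mul_zero, zero_mul]
      exact hR'
    have hsz : (size P (fun j ↦ (d j).or (d' j)) : ℝ) ≤ R ^ 2 := by
      calc _ ≤ (size P d * size P d' : ℝ) := by
            rw [← Nat.cast_mul, Nat.cast_le, size, size, size, ← Finset.prod_mul_distrib]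
            refine Finset.prod_le_prod' fun j _ ↦ ?_
            have := hP0 j
            cases d j <;> cases d' j <;> simp [sz]
            exact Nat.le_mul_self _
        _ ≤ R * R := mul_le_mul (not_lt.1 hd) (not_lt.1 hd') (Nat.cast_nonneg _) hR
        _ = _ := (sq R).symm
    refine mul_le_mul ?_ (abs_sum_prod_inc_sub_le hP hinj hW0 hW hh hP3 hm hSW hSP hX _
      ((mul_le_mul_of_nonneg_left hsz (Nat.cast_nonneg _)).trans hY)) (abs_nonneg _) (by positivity)
    rw [sq]
    exact mul_le_mul (abs_lam_le hP0 hA ha d) (abs_lam_le hP0 hA ha d') (abs_nonneg _) (by positivity)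
  have h4 : ∑ d, ∑ d', |lam P a d| * |lam P a d'| *
      |∑ N ∈ S with N ≡ 1 [MOD W], τ N * ∏ j, inc ((d j).or (d' j)) (pat P h N j) -
        (∑ N ∈ S, τ N) / W.totient * ∏ j, ∑ o, pr' (P j : ℝ) m o * inc ((d j).or (d' j)) o| ≤
      (A * 𝓔) ^ 2 * (√W * E * ∏ j, (1 + 2 * (k + 1) ^ 2 / (P j : ℝ))) := by
    calc _ ≤ _ := Finset.sum_le_sum fun d _ ↦ Finset.sum_le_sum fun d' _ ↦ h3 d d'
      _ = (A * 𝓔) ^ 2 * (√W / W.totient * ∑ i ∈ X, (i.1 : ℝ) ^ (-(1 / 2) : ℝ) *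
          ‖∑ N ∈ S, i.2 N * (τ N : ℂ)‖ * ∏ j, ∑ s : Option K, ∑ s', gw (P j) i.1 (s.or s')) := by
          simp only [← Finset.mul_sum]
          congr 2
          rw [Finset.sum_congr rfl fun d _ ↦ Finset.sum_comm, Finset.sum_comm]
          refine Finset.sum_congr rfl fun i _ ↦ ?_
          simp only [← Finset.mul_sum]
          rw [sum_sum_prod_or fun j ↦ gw (P j) i.1]
      _ ≤ (A * 𝓔) ^ 2 * (√W / 1 * ∑ i ∈ X, (i.1 : ℝ) ^ (-(1 / 2) : ℝ) *
          ‖∑ N ∈ S, i.2 N * (τ N : ℂ)‖ * ∏ j, (1 + 2 * (k + 1) ^ 2 / (P j : ℝ))) := by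
          have h5 : (1 : ℝ) ≤ W.totient := by exact_mod_cast Nat.totient_pos.2 hW0
          gcongr with i _ j _
          · exact Finset.sum_nonneg fun i _ ↦ mul_nonneg (by positivity)
              (Finset.prod_nonneg fun j _ ↦ Finset.sum_nonneg fun _ _ ↦
                Finset.sum_nonneg fun _ _ ↦ gw_nonneg _ _ _)
          · exact fun j _ ↦ Finset.sum_nonneg fun _ _ ↦ Finset.sum_nonneg fun _ _ ↦ gw_nonneg _ _ _
          · exact sum_sum_gw_le (hP j) (hk j) _
      _ ≤ _ := by
          rw [← Finset.sum_mul, div_one, mul_assoc √(W : ℝ)]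
          have : 0 ≤ ∏ j, (1 + 2 * (k + 1) ^ 2 / (P j : ℝ)) :=
            Finset.prod_nonneg fun j _ ↦ by positivity
          gcongr
  have h7 := (abs_le.1 (h1.trans h4)).1
  have h8 := mul_le_mul_of_nonneg_left h2
    (show 0 ≤ (∑ N ∈ S, τ N) / (W.totient : ℝ) by positivity)
  have h9 : ∑ o : Fin n → Option K, (∏ j, pr' (P j : ℝ) m (o j)) * sieve P a o ^ 2 =
    ∑ t : Fin n → Option K, (∏ j, pr' (P j : ℝ) m (t j)) *
      (∑ c, a c * ∏ j, eb (P j : ℝ) (c j) (t j)) ^ 2 := rfl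
  rw [h9] at h7
  linarith

end Primes

/-! ### One-dimensional smooth weights -/

/-- The one-dimensional sieve weight. -/
def G : ℕ → ℝ → ℝ → ℝ
  | 0, _, _ => 0
  | J + 1, z, r => (if r ≤ z then 1 else 0) + G J (z ^ 2) r / 2

lemma G_nonneg (J : ℕ) (z r : ℝ) : 0 ≤ G J z r := by
  induction J generalizing z with
  | zero => exact le_rfl
  | succ J ih =>
    have := ih (z ^ 2)
    simp only [G]
    split_ifs <;> linarith

lemma G_le_two (J : ℕ) (z r : ℝ) : G J z r ≤ 2 := by
  induction J generalizing z with
  | zero => simp [G]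
  | succ J ih =>
    have := ih (z ^ 2)
    simp only [G]
    split_ifs <;> linarith

lemma G_anti (J : ℕ) (z : ℝ) {r r' : ℝ} (h : r ≤ r') : G J z r' ≤ G J z r := by
  induction J generalizing z with
  | zero => exact le_rfl
  | succ J ih =>
    have := ih (z ^ 2)
    simp only [G]
    split_ifs <;> linarith

lemma G_eq_zero (J : ℕ) {z r : ℝ} (hz : 1 ≤ z) (h : z ^ 2 ^ J < r) : G J z r = 0 := by
  induction J generalizing z with
  | zero => rfl
  | succ J ih =>
    have h1 : z < r := (le_self_pow₀ hz (by positivity)).trans_lt h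
    rw [G, if_neg h1.not_ge, ih (one_le_pow₀ hz) (by rwa [← pow_mul, ← pow_succ'])]
    simp

lemma G_mul_log_le (J : ℕ) {z r : ℝ} (hz : 1 ≤ z) (hr : 1 ≤ r) :
    G J z r * Real.log r ≤ 2 * Real.log z := by
  induction J generalizing z with
  | zero => simpa [G] using Real.log_nonneg hz
  | succ J ih =>
    by_cases h : r ≤ z
    · exact mul_le_mul (G_le_two _ _ _) (Real.log_le_log (by linarith) h) (Real.log_nonneg hr)
        (by norm_num)
    · have := ih (z := z ^ 2) (one_le_pow₀ hz)
      rw [Real.log_pow] at this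
      rw [G, if_neg h]
      push_cast at this
      linarith

lemma G_succ_sq_le (J : ℕ) (z r : ℝ) :
    G (J + 1) z r ^ 2 ≤ (if r ≤ z then 4 else 0) + G J (z ^ 2) r ^ 2 / 4 := by
  by_cases h : r ≤ z
  · rw [if_pos h]
    nlinarith [G_le_two (J + 1) z r, G_nonneg (J + 1) z r, sq_nonneg (G J (z ^ 2) r)]
  · rw [G, if_neg h, if_neg h]
    linarith

theorem sum_mul_G_bounds {ι : Type*} (I : Finset ι) (w r : ι → ℝ) (hw : ∀ i ∈ I, 0 ≤ w i) {κ : ℝ}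
    (J : ℕ) {z : ℝ} (hz : 1 ≤ z)
    (hU : ∀ y, z ≤ y → y ≤ z ^ 2 ^ J → κ * Real.log y / 4 ≤ ∑ i ∈ I with r i ≤ y, w i ∧
      ∑ i ∈ I with r i ≤ y, w i ≤ 2 * κ * Real.log y) :
    J * κ * Real.log z / 4 ≤ ∑ i ∈ I, w i * G J z (r i) ∧
    ∑ i ∈ I, w i * G J z (r i) ≤ 2 * J * κ * Real.log z ∧
    (0 < J → κ * Real.log z / 4 ≤ ∑ i ∈ I, w i * G J z (r i) ^ 2) ∧
    ∑ i ∈ I, w i * G J z (r i) ^ 2 ≤ 16 * κ * Real.log z := by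
  have h0 := hU z le_rfl (le_self_pow₀ hz (by positivity))
  have hκ : 0 ≤ κ * Real.log z := by
    have : 0 ≤ ∑ i ∈ I with r i ≤ z, w i :=
      Finset.sum_nonneg fun i hi ↦ hw i (Finset.mem_filter.1 hi).1
    linarith [h0.2]
  induction J generalizing z with
  | zero => simpa [G, mul_assoc] using hκ
  | succ J ih =>
    have hz2 : z ≤ z ^ 2 := le_self_pow₀ hz (by norm_num)
    have e : (z ^ 2) ^ 2 ^ J = z ^ 2 ^ (J + 1) := by rw [← pow_mul, ← pow_succ']
    have h1 : Real.log (z ^ 2) = 2 * Real.log z := by rw [Real.log_pow]; norm_num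
    have h2 := ih (z := z ^ 2) (one_le_pow₀ hz)
      (fun y hy hy' ↦ hU y (hz2.trans hy) (by rwa [← e]))
      (hU _ hz2 (by rw [← e]; exact le_self_pow₀ (one_le_pow₀ hz) (by positivity)))
      (by rw [h1]; linarith)
    rw [h1] at h2
    obtain ⟨h3, h4, -, h6⟩ := h2
    have e1 : ∑ i ∈ I, w i * G (J + 1) z (r i) =
        ∑ i ∈ I with r i ≤ z, w i + (∑ i ∈ I, w i * G J (z ^ 2) (r i)) / 2 := by
      rw [Finset.sum_filter, Finset.sum_div, ← Finset.sum_add_distrib]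
      refine Finset.sum_congr rfl fun i _ ↦ ?_
      rw [G]
      split_ifs <;> ring
    have e2 : ∑ i ∈ I, w i * G (J + 1) z (r i) ^ 2 ≤
        4 * ∑ i ∈ I with r i ≤ z, w i + (∑ i ∈ I, w i * G J (z ^ 2) (r i) ^ 2) / 4 := by
      rw [Finset.sum_filter, Finset.sum_div, Finset.mul_sum, ← Finset.sum_add_distrib]
      refine Finset.sum_le_sum fun i hi ↦
        (mul_le_mul_of_nonneg_left (G_succ_sq_le J z (r i)) (hw i hi)).trans_eq ?_
      split_ifs <;> ring
    push_cast
    refine ⟨by rw [e1]; linarith, by rw [e1]; linarith, fun _ ↦ ?_, by linarith⟩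
    refine h0.1.trans ?_
    rw [Finset.sum_filter]
    refine Finset.sum_le_sum fun i hi ↦ ?_
    split_ifs with h
    · refine le_mul_of_one_le_right (hw i hi) (one_le_pow₀ ?_)
      rw [G, if_pos h]
      linarith [G_nonneg J (z ^ 2) (r i)]
    · exact mul_nonneg (hw i hi) (sq_nonneg _)

/-! ### Squarefree products of sieving primes -/

/-- The product of the primes indexed by `M`. -/
def rr {n : ℕ} (P : Fin n → ℕ) (M : Finset (Fin n)) : ℕ := ∏ j ∈ M, P j

section Products

variable {n : ℕ} {P : Fin n → ℕ}

lemma rr_pos (hP : ∀ j, (P j).Prime) (M : Finset (Fin n)) : 0 < rr P M :=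
  Finset.prod_pos fun j _ ↦ (hP j).pos

lemma dvd_rr (hP : ∀ j, (P j).Prime) (hinj : Function.Injective P) (M : Finset (Fin n)) (j : Fin n) :
    P j ∣ rr P M ↔ j ∈ M := by
  refine ⟨fun h ↦ ?_, fun h ↦ Finset.dvd_prod_of_mem P h⟩
  obtain ⟨j', hj', h'⟩ := ((hP j).prime.dvd_finsetProd_iff _).1 h
  exact hinj ((Nat.prime_dvd_prime_iff_eq (hP _) (hP _)).1 h') ▸ hj'

lemma rr_injective (hP : ∀ j, (P j).Prime) (hinj : Function.Injective P) :
    Function.Injective (rr P) := fun M M' h ↦ by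
  ext j
  rw [← dvd_rr hP hinj, h, dvd_rr hP hinj]

lemma exists_rr_eq (hP : ∀ j, (P j).Prime) (hinj : Function.Injective P) {t : ℕ}
    (ht : Squarefree t) (h : ∀ p, p.Prime → p ∣ t → ∃ j, P j = p) : ∃ M, rr P M = t := by
  classical
  refine ⟨Finset.univ.filter (P · ∣ t), ?_⟩
  rw [rr, ← Nat.prod_primeFactors_of_squarefree ht, ← Finset.prod_image (f := fun p ↦ p)
    fun j _ j' _ e ↦ hinj e]
  refine Finset.prod_congr ?_ fun _ _ ↦ rfl
  ext p
  simp only [Finset.mem_image, Finset.mem_filter, Finset.mem_univ, true_and, Nat.mem_primeFactors,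
    Nat.prod_primeFactors_of_squarefree ht]
  constructor
  · rintro ⟨j, hj, rfl⟩
    exact ⟨hP j, hj, ht.ne_zero⟩
  · rintro ⟨hp, hd, -⟩
    obtain ⟨j, rfl⟩ := h p hp hd
    exact ⟨j, hd, rfl⟩

lemma sum_inv_sq_le (N : ℕ) : ∑ s ∈ Finset.Icc 1 N, 1 / (s : ℝ) ^ 2 ≤ 2 := by
  have h := sum_Ioo_inv_sq_le (α := ℝ) 0 (N + 1)
  rw [show Finset.Ioo 0 (N + 1) = Finset.Icc 1 N by ext; simp; omega] at h
  simpa using h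

lemma coprime_block_bounds {W : ℕ} (hW : 0 < W) (L : ℕ) :
    (W.totient / W : ℝ) * harmonic L ≤ ∑ N ∈ Finset.Ico 1 (L * W + 1) with W.Coprime N, 1 / (N : ℝ) ∧
    ∑ N ∈ Finset.Ico 1 ((L + 1) * W + 1) with W.Coprime N, 1 / (N : ℝ) ≤
      W.totient / W * harmonic L + W := by
  have hW' : (0 : ℝ) < W := by exact_mod_cast hW
  have hsplit (L : ℕ) : ∑ N ∈ Finset.Ico 1 ((L + 1) * W + 1) with W.Coprime N, 1 / (N : ℝ) =
      ∑ N ∈ Finset.Ico 1 (L * W + 1) with W.Coprime N, 1 / (N : ℝ) +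
      ∑ N ∈ Finset.Ico (L * W + 1) (L * W + 1 + W) with W.Coprime N, 1 / (N : ℝ) := by
    simp only [Finset.sum_filter]
    rw [Finset.sum_Ico_consecutive _ (by omega) (by omega), show (L + 1) * W + 1 = L * W + 1 + W by ring]
  have hlow (L : ℕ) : (W.totient / W : ℝ) * (1 / (L + 1)) ≤
      ∑ N ∈ Finset.Ico (L * W + 1) (L * W + 1 + W) with W.Coprime N, 1 / (N : ℝ) := by
    have := Finset.card_nsmul_le_sum (Finset.filter W.Coprime (Finset.Ico (L * W + 1) (L * W + 1 + W)))
      (fun N ↦ 1 / (N : ℝ)) (1 / ((L + 1) * W)) fun N hN ↦ by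
        obtain ⟨h1, h2⟩ := Finset.mem_Ico.1 (Finset.mem_filter.1 hN).1
        refine one_div_le_one_div_of_le (by exact_mod_cast (by omega : 0 < N)) ?_
        have : N ≤ (L + 1) * W := by rw [add_mul]; omega
        exact_mod_cast this
    rw [Nat.filter_coprime_Ico_eq_totient, nsmul_eq_mul] at this
    refine le_trans (le_of_eq ?_) this
    field_simp
  have hupp (L : ℕ) : ∑ N ∈ Finset.Ico ((L + 1) * W + 1) ((L + 1) * W + 1 + W) with W.Coprime N,
      1 / (N : ℝ) ≤ (W.totient / W : ℝ) * (1 / (L + 1)) := by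
    have := Finset.sum_le_card_nsmul
      (Finset.filter W.Coprime (Finset.Ico ((L + 1) * W + 1) ((L + 1) * W + 1 + W)))
      (fun N ↦ 1 / (N : ℝ)) (1 / ((L + 1) * W)) fun N hN ↦ by
        obtain ⟨h1, h2⟩ := Finset.mem_Ico.1 (Finset.mem_filter.1 hN).1
        refine one_div_le_one_div_of_le (by positivity) ?_
        exact_mod_cast (by omega : (L + 1) * W ≤ N)
    rw [Nat.filter_coprime_Ico_eq_totient, nsmul_eq_mul] at this
    refine this.trans (le_of_eq ?_)
    field_simp
  constructor
  · induction L with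
    | zero => simp
    | succ L ih =>
      rw [harmonic_succ, hsplit]
      push_cast
      have := hlow L
      rw [one_div] at this
      linarith
  · induction L with
    | zero =>
      rw [harmonic_zero, Rat.cast_zero, mul_zero, zero_add, Finset.sum_filter]
      refine (Finset.sum_le_card_nsmul _ _ 1 fun N hN ↦ ?_).trans (by simp)
      split_ifs
      · exact div_le_one_of_le₀ (by exact_mod_cast (Finset.mem_Ico.1 hN).1) (Nat.cast_nonneg _)
      · norm_num
    | succ L ih =>
      rw [harmonic_succ, hsplit]
      push_cast
      have := hupp L
      rw [one_div] at this
      linarith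

lemma coprime_sum_bounds {W : ℕ} (hW : 0 < W) {y : ℝ} (hy : 1 ≤ y) :
    (W.totient / W : ℝ) * (Real.log y - Real.log W) ≤
      ∑ N ∈ Finset.Icc 1 ⌊y⌋₊ with W.Coprime N, 1 / (N : ℝ) ∧
    ∑ N ∈ Finset.Icc 1 ⌊y⌋₊ with W.Coprime N, 1 / (N : ℝ) ≤
      W.totient / W * (1 + Real.log y) + W := by
  have hW' : (0 : ℝ) < W := by exact_mod_cast hW
  set L := ⌊y⌋₊ / W with hL
  obtain ⟨h1, h2⟩ := coprime_block_bounds hW L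
  have h3 : L * W ≤ ⌊y⌋₊ := Nat.div_mul_le_self _ _
  have h4 : ⌊y⌋₊ < (L + 1) * W := by rw [add_mul, one_mul]; exact Nat.lt_div_mul_add hW
  constructor
  · calc _ ≤ (W.totient / W : ℝ) * harmonic L := by
          refine mul_le_mul_of_nonneg_left (le_trans ?_ (log_add_one_le_harmonic L)) (by positivity)
          rw [← Real.log_div (by linarith) hW'.ne']
          refine Real.log_le_log (by positivity) ?_
          rw [div_le_iff₀ hW']
          refine (Nat.lt_floor_add_one y).le.trans ?_
          exact_mod_cast h4
      _ ≤ _ := h1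
      _ ≤ _ := Finset.sum_le_sum_of_subset_of_nonneg (Finset.filter_subset_filter _ fun N hN ↦ by
          simp only [Finset.mem_Ico, Finset.mem_Icc] at hN ⊢; omega) fun _ _ _ ↦ by positivity
  · calc _ ≤ _ := Finset.sum_le_sum_of_subset_of_nonneg (Finset.filter_subset_filter _ fun N hN ↦ by
          simp only [Finset.mem_Ico, Finset.mem_Icc] at hN ⊢; omega) fun _ _ _ ↦ by positivity
      _ ≤ _ := h2
      _ ≤ _ := by
          gcongr
          refine (harmonic_le_one_add_log L).trans ?_
          gcongr 1 + ?_
          rcases Nat.eq_zero_or_pos L with h | h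
          · rw [h, Nat.cast_zero, Real.log_zero]
            exact Real.log_nonneg hy
          · refine Real.log_le_log (by exact_mod_cast h) ?_
            refine le_trans ?_ (Nat.floor_le (by linarith : 0 ≤ y))
            exact_mod_cast Nat.div_le_self _ _

theorem sum_inv_rr_bounds (hP : ∀ j, (P j).Prime) (hinj : Function.Injective P) {W : ℕ}
    (hW0 : 0 < W) (hW : ∀ j, ¬ P j ∣ W) {y : ℝ} (hy : 1 ≤ y)
    (hall : ∀ p, p.Prime → ¬ p ∣ W → (p : ℝ) ≤ y → ∃ j, P j = p)
    (hy1 : 2 * Real.log W ≤ Real.log y) (hy2 : 1 + (W : ℝ) ^ 2 ≤ Real.log y) :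
    (W.totient / W : ℝ) * Real.log y / 4 ≤ ∑ M with (rr P M : ℝ) ≤ y, 1 / (rr P M : ℝ) ∧
    ∑ M with (rr P M : ℝ) ≤ y, 1 / (rr P M : ℝ) ≤ 2 * (W.totient / W : ℝ) * Real.log y := by
  classical
  obtain ⟨h1, h2⟩ := coprime_sum_bounds hW0 hy
  have hW' : (0 : ℝ) < W := by exact_mod_cast hW0
  have hκ : (0 : ℝ) ≤ W.totient / W := by positivity
  constructor
  · have h3 : ∑ N ∈ Finset.Icc 1 ⌊y⌋₊ with W.Coprime N, 1 / (N : ℝ) ≤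
        ∑ q ∈ Finset.Icc 1 ⌊y⌋₊ ×ˢ (Finset.univ.filter fun M ↦ (rr P M : ℝ) ≤ y),
          1 / (q.1 : ℝ) ^ 2 * (1 / (rr P q.2 : ℝ)) := by
      have key : ∀ N ∈ (Finset.Icc 1 ⌊y⌋₊).filter W.Coprime,
          ∃ q ∈ Finset.Icc 1 ⌊y⌋₊ ×ˢ (Finset.univ.filter fun M ↦ (rr P M : ℝ) ≤ y),
            q.1 ^ 2 * rr P q.2 = N := by
        intro N hN
        obtain ⟨hN1, hN2⟩ := Finset.mem_filter.1 hN
        obtain ⟨hN3, hN4⟩ := Finset.mem_Icc.1 hN1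
        obtain ⟨t, s, hst, hsq⟩ := Nat.sq_mul_squarefree N
        have htN : t ∣ N := ⟨s ^ 2, by rw [← hst, mul_comm]⟩
        have hle (d : ℕ) (hd : d ∣ N) : (d : ℝ) ≤ y :=
          (Nat.le_floor_iff (by linarith)).1 ((Nat.le_of_dvd hN3 hd).trans hN4)
        obtain ⟨M, hM⟩ := exists_rr_eq hP hinj hsq fun p hp hpt ↦ hall p hp
          (fun h ↦ hp.one_lt.ne' (Nat.dvd_one.1 (hN2 ▸ Nat.dvd_gcd h (hpt.trans htN))))
          (hle p (hpt.trans htN))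
        have hs : s ∣ N := ⟨s * t, by rw [← hst]; ring⟩
        refine ⟨(s, M), ?_, by rw [hM, hst]⟩
        simp only [Finset.mem_product, Finset.mem_Icc, Finset.mem_filter, Finset.mem_univ, true_and, hM]
        exact ⟨⟨Nat.pos_of_dvd_of_pos hs hN3, (Nat.le_of_dvd hN3 hs).trans hN4⟩, hle t htN⟩
      choose! f hf hf' using key
      rw [← Finset.sum_congr rfl fun N hN ↦ show 1 / ((f N).1 : ℝ) ^ 2 * (1 / (rr P (f N).2 : ℝ)) =
        1 / (N : ℝ) by rw [one_div_mul_one_div]; exact_mod_cast congrArg (fun N : ℕ ↦ 1 / (N : ℝ)) (hf' N hN)]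
      rw [← Finset.sum_image (s := (Finset.Icc 1 ⌊y⌋₊).filter W.Coprime) (g := f)
        (f := fun q ↦ 1 / (q.1 : ℝ) ^ 2 * (1 / (rr P q.2 : ℝ)))
        fun N hN N' hN' e ↦ by rw [← hf' N hN, ← hf' N' hN', e]]
      exact Finset.sum_le_sum_of_subset_of_nonneg (Finset.image_subset_iff.2 hf)
        fun _ _ _ ↦ by positivity
    rw [Finset.sum_product] at h3
    dsimp only at h3
    rw [← Finset.sum_mul_sum] at h3
    have h4 := sum_inv_sq_le ⌊y⌋₊
    have h5 : 0 ≤ ∑ M with (rr P M : ℝ) ≤ y, 1 / (rr P M : ℝ) :=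
      Finset.sum_nonneg fun _ _ ↦ by positivity
    have h6 := mul_le_mul_of_nonneg_right h4 h5
    have h7 : (W.totient / W : ℝ) * (Real.log y / 2) ≤
      W.totient / W * (Real.log y - Real.log W) := mul_le_mul_of_nonneg_left (by linarith) hκ
    linarith
  · have h3 : ∑ M with (rr P M : ℝ) ≤ y, 1 / (rr P M : ℝ) ≤
        ∑ N ∈ Finset.Icc 1 ⌊y⌋₊ with W.Coprime N, 1 / (N : ℝ) := by
      rw [← Finset.sum_image (g := rr P) (f := fun N : ℕ ↦ 1 / (N : ℝ))
        fun M _ M' _ e ↦ rr_injective hP hinj e]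
      refine Finset.sum_le_sum_of_subset_of_nonneg (Finset.image_subset_iff.2 fun M hM ↦ ?_)
        fun _ _ _ ↦ by positivity
      rw [Finset.mem_filter, Finset.mem_Icc, Nat.le_floor_iff (by linarith)]
      exact ⟨⟨rr_pos hP M, (Finset.mem_filter.1 hM).2⟩,
        Nat.Coprime.prod_right fun j _ ↦ (Nat.Coprime.symm ((hP j).coprime_iff_not_dvd.2 (hW j)))⟩
    have h4 : (1 : ℝ) / W ≤ W.totient / W := by
      gcongr
      exact_mod_cast Nat.totient_pos.2 hW0
    have h5 : (1 : ℝ) / W * (W ^ 2) ≤ W.totient / W * (Real.log y - 1) :=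
      mul_le_mul h4 (by linarith) (by positivity) hκ
    have h6 : (1 : ℝ) / W * (W ^ 2) = W := by field_simp
    linarith

end Products

/-! ### The sieve coefficients and the upper bound for the main term -/

section Coefficients

variable {K : Type*} [DecidableEq K] {n : ℕ}

/-- The set of indices at which the pattern `t` takes the value `i`. -/
def cl (t : Fin n → Option K) (i : K) : Finset (Fin n) := Finset.univ.filter (t · = some i)

lemma mem_cl {t : Fin n → Option K} {i : K} {j : Fin n} : j ∈ cl t i ↔ t j = some i := by simp [cl]

lemma cl_injective : Function.Injective (cl : (Fin n → Option K) → K → Finset (Fin n)) := by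
  intro t t' h
  funext j
  refine Option.ext fun i ↦ ?_
  exact mem_cl.symm.trans ((h ▸ Iff.rfl : j ∈ cl t i ↔ j ∈ cl t' i).trans mem_cl)

lemma exists_cl_eq {f : K → Finset (Fin n)} (h : ∀ i i', i ≠ i' → ∀ j, j ∈ f i → j ∉ f i') :
    ∃ t, cl t = f := by
  classical
  refine ⟨fun j ↦ if H : ∃ i, j ∈ f i then some H.choose else none, ?_⟩
  funext i
  ext j
  rw [mem_cl]
  split_ifs with H
  · rw [Option.some.injEq]
    refine ⟨fun e ↦ e ▸ H.choose_spec, fun e ↦ ?_⟩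
    by_contra hne
    exact h _ _ hne j H.choose_spec e
  · simpa using fun e ↦ H ⟨i, e⟩

variable [Fintype K]

lemma size_eq_prod_cl (P : Fin n → ℕ) (t : Fin n → Option K) : size P t = ∏ i, rr P (cl t i) := by
  simp only [size, rr, cl, Finset.prod_filter]
  rw [Finset.prod_comm]
  refine Finset.prod_congr rfl fun j _ ↦ ?_
  rcases t j with _ | i <;> simp [sz]

/-- The coefficients of the sieve weights. -/
def coef (P : Fin n → ℕ) (J : ℕ) (z R : ℝ) (c : Fin n → Option K) : ℝ :=
  if (size P c : ℝ) ≤ R then ∏ i, G J z (rr P (cl c i)) / rr P (cl c i) else 0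

lemma coef_nonneg (P : Fin n → ℕ) (J : ℕ) (z R : ℝ) (c : Fin n → Option K) :
    0 ≤ coef P J z R c := by
  rw [coef]
  split_ifs
  · exact Finset.prod_nonneg fun i _ ↦ div_nonneg (G_nonneg _ _ _) (Nat.cast_nonneg _)
  · exact le_rfl

lemma coef_eq_zero (P : Fin n → ℕ) (J : ℕ) (z : ℝ) {R : ℝ} {c : Fin n → Option K}
    (h : R < size P c) : coef P J z R c = 0 := if_neg h.not_ge

lemma abs_coef_le (P : Fin n → ℕ) (J : ℕ) (z R : ℝ) (c : Fin n → Option K) :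
    |coef P J z R c| ≤ 2 ^ Fintype.card K / size P c := by
  rw [abs_of_nonneg (coef_nonneg _ _ _ _ _), coef]
  split_ifs
  · rw [Finset.prod_div_distrib, size_eq_prod_cl, Nat.cast_prod]
    gcongr
    exact (Finset.prod_le_prod (fun i _ ↦ G_nonneg _ _ _) fun i _ ↦ G_le_two _ _ _).trans_eq (by simp)
  · positivity

theorem sum_size_mul_coef_sq_le {P : Fin n → ℕ} (hP : ∀ j, (P j).Prime) (J : ℕ) (z R : ℝ) :
    ∑ c : Fin n → Option K, size P c * coef P J z R c ^ 2 ≤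
      (∑ M, 1 / (rr P M : ℝ) * G J z (rr P M) ^ 2) ^ Fintype.card K := by
  have h (c : Fin n → Option K) : size P c * coef P J z R c ^ 2 ≤
      ∏ i, 1 / (rr P (cl c i) : ℝ) * G J z (rr P (cl c i)) ^ 2 := by
    rw [coef]
    split_ifs
    · rw [size_eq_prod_cl, Nat.cast_prod, ← Finset.prod_pow, ← Finset.prod_mul_distrib]
      refine (Finset.prod_congr rfl fun i _ ↦ ?_).le
      have : (rr P (cl c i) : ℝ) ≠ 0 := by exact_mod_cast (rr_pos hP _).ne'
      field_simp
    · simpa using Finset.prod_nonneg fun i _ ↦ by positivity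
  calc _ ≤ ∑ c : Fin n → Option K, ∏ i, 1 / (rr P (cl c i) : ℝ) * G J z (rr P (cl c i)) ^ 2 :=
        Finset.sum_le_sum fun c _ ↦ h c
    _ = ∑ f ∈ Finset.univ.image (cl : (Fin n → Option K) → K → Finset (Fin n)),
        ∏ i, 1 / (rr P (f i) : ℝ) * G J z (rr P (f i)) ^ 2 :=
        by rw [Finset.sum_image fun c _ c' _ e ↦ cl_injective e]
    _ ≤ ∑ f : K → Finset (Fin n), ∏ i, 1 / (rr P (f i) : ℝ) * G J z (rr P (f i)) ^ 2 :=
        Finset.sum_le_sum_of_subset_of_nonneg (Finset.subset_univ _) fun f _ _ ↦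
          Finset.prod_nonneg fun i _ ↦ by positivity
    _ = _ := by
        rw [← Fintype.prod_sum fun (_ : K) M ↦ 1 / (rr P M : ℝ) * G J z (rr P M) ^ 2]
        simp

end Coefficients

/-! ### Random tuples of sets -/

section Tuples

variable {K ι : Type*} [DecidableEq K] [Fintype K] [Fintype ι]

lemma sum_prod_mul_prod_le {w φ : K → ι → ℝ} {c : K → ℝ} (hw : ∀ i M, 0 ≤ w i M)
    (hφ : ∀ i M, 0 ≤ φ i M) (h : ∀ i, ∑ M, w i M * φ i M ≤ c i * ∑ M, w i M) :
    ∑ f : K → ι, (∏ i, w i (f i)) * ∏ i, φ i (f i) ≤ (∏ i, c i) * ∏ i, ∑ M, w i M := by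
  simp only [← Finset.prod_mul_distrib]
  rw [← Fintype.prod_sum fun i M ↦ w i M * φ i M]
  exact Finset.prod_le_prod (fun i _ ↦ Finset.sum_nonneg fun M _ ↦ mul_nonneg (hw i M) (hφ i M))
    fun i _ ↦ h i

lemma sum_prod_mul_le {w : K → ι → ℝ} {φ : ι → ℝ} {q : ℝ} (hw : ∀ i M, 0 ≤ w i M)
    (hφ : ∀ M, 0 ≤ φ M) (i₀ : K) (h : ∑ M, w i₀ M * φ M ≤ q * ∑ M, w i₀ M) :
    ∑ f : K → ι, (∏ i, w i (f i)) * φ (f i₀) ≤ q * ∏ i, ∑ M, w i M := by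
  have := sum_prod_mul_prod_le (w := w) (φ := fun i M ↦ if i = i₀ then φ M else 1)
    (c := fun i ↦ if i = i₀ then q else 1) hw (fun i M ↦ by split_ifs <;> simp [hφ])
    fun i ↦ by
      by_cases hi : i = i₀
      · simpa [hi] using h
      · simp [hi]
  simpa [Finset.prod_ite_eq'] using this

lemma sum_prod_mul_mul_le {w : K → ι → ℝ} {φ : ι → ℝ} {q : ℝ} (hw : ∀ i M, 0 ≤ w i M)
    (hφ : ∀ M, 0 ≤ φ M) {i₀ i₁ : K} (hi : i₀ ≠ i₁) (h : ∀ i, ∑ M, w i M * φ M ≤ q * ∑ M, w i M) :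
    ∑ f : K → ι, (∏ i, w i (f i)) * (φ (f i₀) * φ (f i₁)) ≤ q ^ 2 * ∏ i, ∑ M, w i M := by
  have e (x : K → ℝ) : ∏ i, (if i = i₀ ∨ i = i₁ then x i else 1) = x i₀ * x i₁ := by
    rw [← Finset.prod_filter, ← Finset.prod_pair hi]
    congr 1
    ext i
    simp
  have := sum_prod_mul_prod_le (w := w) (φ := fun i M ↦ if i = i₀ ∨ i = i₁ then φ M else 1)
    (c := fun i ↦ if i = i₀ ∨ i = i₁ then q else 1) hw (fun i M ↦ by split_ifs <;> simp [hφ])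
    fun i ↦ by
      by_cases hi : i = i₀ ∨ i = i₁
      · simpa [hi] using h i
      · simp [hi]
  rw [e fun _ ↦ q] at this
  rw [sq]
  refine le_of_eq_of_le (Finset.sum_congr rfl fun f _ ↦ ?_) this
  rw [e fun i ↦ φ (f i)]

variable {n : ℕ}

lemma sum_mem_le {P : Fin n → ℕ} (hP : ∀ j, (P j).Prime) {F : ℝ → ℝ} (hF0 : ∀ x, 0 ≤ F x)
    (hF : ∀ x y, x ≤ y → F y ≤ F x) (j : Fin n) :
    ∑ M, 1 / (rr P M : ℝ) * F (rr P M) * (if j ∈ M then 1 else 0) ≤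
      1 / P j * ∑ M, 1 / (rr P M : ℝ) * F (rr P M) := by
  have hPj : (0 : ℝ) < P j := by exact_mod_cast (hP j).pos
  simp only [mul_ite, mul_one, mul_zero]
  rw [← Finset.sum_filter]
  calc ∑ M : Finset (Fin n) with j ∈ M, 1 / (rr P M : ℝ) * F (rr P M) ≤
        ∑ M : Finset (Fin n) with j ∈ M, 1 / P j * (1 / (rr P (M.erase j) : ℝ) * F (rr P (M.erase j))) := by
        refine Finset.sum_le_sum fun M hM ↦ ?_
        have e : rr P M = P j * rr P (M.erase j) :=
          (Finset.mul_prod_erase M P (Finset.mem_filter.1 hM).2).symm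
        rw [← mul_assoc, one_div_mul_one_div, ← Nat.cast_mul, ← e]
        refine mul_le_mul_of_nonneg_left (hF _ _ ?_) (by positivity)
        rw [Nat.cast_le, e]
        exact Nat.le_mul_of_pos_left _ (hP j).pos
    _ = 1 / P j * ∑ M ∈ (Finset.univ.filter fun M : Finset (Fin n) ↦ j ∈ M).image (·.erase j),
        1 / (rr P M : ℝ) * F (rr P M) := by
        rw [Finset.sum_image, Finset.mul_sum]
        intro M hM M' hM' e
        rw [← Finset.insert_erase (Finset.mem_filter.1 hM).2,
          ← Finset.insert_erase (Finset.mem_filter.1 hM').2]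
        exact congrArg _ e
    _ ≤ _ := by
        refine mul_le_mul_of_nonneg_left (Finset.sum_le_sum_of_subset_of_nonneg
          (Finset.subset_univ _) fun M _ _ ↦ mul_nonneg (by positivity) (hF0 _)) (by positivity)

end Tuples

section Tuples

variable {K : Type*} [DecidableEq K] [Fintype K] {n : ℕ}

/-- By Markov's inequality, most tuples of sets are disjoint and small. -/
theorem half_le_sum_good (P : Fin n → ℕ) {w : K → Finset (Fin n) → ℝ} (hw : ∀ i M, 0 ≤ w i M)
    (h₁ : ∀ i j, ∑ M, w i M * (if j ∈ M then 1 else 0) ≤ 1 / (P j : ℝ) * ∑ M, w i M) {q L : ℝ}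
    (h₂ : ∀ i, ∑ M, w i M * Real.log (rr P M) ≤ q * ∑ M, w i M)
    (hP : 52 * (Fintype.card K : ℝ) ^ 2 * ∑ j, 1 / (P j : ℝ) ^ 2 ≤ 1) (hL : 0 < L)
    (hq : 4 * Fintype.card K * q ≤ L) :
    (1 / 2) * ∏ i, ∑ M, w i M ≤ ∑ f : K → Finset (Fin n) with
      (∀ i i', i ≠ i' → ∀ j, j ∈ f i → j ∉ f i') ∧ ∑ i, Real.log (rr P (f i)) ≤ L ∧
      ∑ i, ∑ j ∈ f i, (2 * Fintype.card K + 1) / (P j : ℝ) ≤ 1 / 4, ∏ i, w i (f i) := by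
  classical
  set k : ℝ := (Fintype.card K : ℝ) with hk
  set Z := ∏ i, ∑ M, w i M
  have hZ : 0 ≤ Z := Finset.prod_nonneg fun i _ ↦ Finset.sum_nonneg fun M _ ↦ hw i M
  set s := ∑ j, 1 / (P j : ℝ) ^ 2 with hs
  have hs0 : 0 ≤ s := Finset.sum_nonneg fun j _ ↦ by positivity
  let δ (j : Fin n) (M : Finset (Fin n)) : ℝ := if j ∈ M then 1 else 0
  have hδ (j M) : 0 ≤ δ j M := by dsimp only [δ]; split_ifs <;> norm_num
  let X₁ (f : K → Finset (Fin n)) := ∑ i, ∑ i' ∈ Finset.univ.erase i, ∑ j, δ j (f i) * δ j (f i')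
  let X₂ (f : K → Finset (Fin n)) := ∑ i, Real.log (rr P (f i))
  let X₃ (f : K → Finset (Fin n)) := ∑ i, ∑ j, (2 * k + 1) / (P j : ℝ) * δ j (f i)
  have hX₁ (f) : 0 ≤ X₁ f := Finset.sum_nonneg fun i _ ↦ Finset.sum_nonneg fun i' _ ↦
    Finset.sum_nonneg fun j _ ↦ mul_nonneg (hδ _ _) (hδ _ _)
  have hX₂ (f) : 0 ≤ X₂ f := Finset.sum_nonneg fun i _ ↦ Real.log_natCast_nonneg _
  have hX₃ (f) : 0 ≤ X₃ f := Finset.sum_nonneg fun i _ ↦ Finset.sum_nonneg fun j _ ↦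
    mul_nonneg (by positivity) (hδ _ _)
  have e₁ : ∑ f : K → Finset (Fin n), (∏ i, w i (f i)) * X₁ f ≤ k ^ 2 * s * Z := by
    calc ∑ f : K → Finset (Fin n), (∏ i, w i (f i)) * X₁ f = ∑ i, ∑ i' ∈ Finset.univ.erase i, ∑ j,
          ∑ f : K → Finset (Fin n), (∏ i, w i (f i)) * (δ j (f i) * δ j (f i')) := by
          simp only [X₁, Finset.mul_sum]
          rw [Finset.sum_comm]
          refine Finset.sum_congr rfl fun i _ ↦ ?_
          rw [Finset.sum_comm]
          exact Finset.sum_congr rfl fun i' _ ↦ Finset.sum_comm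
      _ ≤ ∑ i : K, ∑ i' ∈ Finset.univ.erase i, s * Z := by
          refine Finset.sum_le_sum fun i _ ↦ Finset.sum_le_sum fun i' hi' ↦ ?_
          rw [hs, Finset.sum_mul]
          refine Finset.sum_le_sum fun j _ ↦ ?_
          rw [← one_div_pow]
          exact sum_prod_mul_mul_le hw (hδ j) (Finset.ne_of_mem_erase hi').symm fun i ↦ h₁ i j
      _ ≤ ∑ i : K, ∑ i' : K, s * Z := Finset.sum_le_sum fun i _ ↦
          Finset.sum_le_sum_of_subset_of_nonneg (Finset.erase_subset _ _) fun _ _ _ ↦ by positivity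
      _ = k ^ 2 * s * Z := by
          simp only [Finset.sum_const, Finset.card_univ, nsmul_eq_mul, ← hk]
          ring
  have e₂ : ∑ f : K → Finset (Fin n), (∏ i, w i (f i)) * X₂ f ≤ k * q * Z := by
    simp only [X₂, Finset.mul_sum]
    rw [Finset.sum_comm]
    refine (Finset.sum_le_card_nsmul _ _ (q * Z) fun i _ ↦
      sum_prod_mul_le hw (fun M ↦ Real.log_natCast_nonneg _) i (h₂ i)).trans_eq ?_
    rw [Finset.card_univ, nsmul_eq_mul, hk, mul_assoc]
  have e₃ : ∑ f : K → Finset (Fin n), (∏ i, w i (f i)) * X₃ f ≤ k * ((2 * k + 1) * s * Z) := by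
    simp only [X₃, Finset.mul_sum]
    rw [Finset.sum_comm]
    refine (Finset.sum_le_card_nsmul _ _ ((2 * k + 1) * s * Z) fun i _ ↦ ?_).trans_eq ?_
    · rw [Finset.sum_comm, hs, Finset.mul_sum, Finset.sum_mul]
      refine Finset.sum_le_sum fun j _ ↦ ?_
      have := mul_le_mul_of_nonneg_left (sum_prod_mul_le hw (hδ j) i (h₁ i j))
        (by positivity : 0 ≤ (2 * k + 1) / (P j : ℝ))
      rw [Finset.mul_sum] at this
      refine le_of_le_of_eq (le_of_eq_of_le (Finset.sum_congr rfl fun f _ ↦ ?_) this) ?_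
      · ring
      · ring
    · rw [Finset.card_univ, nsmul_eq_mul]
  have hmain : ∑ f : K → Finset (Fin n), (∏ i, w i (f i)) * (1 - X₁ f - X₂ f / L - 4 * X₃ f) ≤
      ∑ f : K → Finset (Fin n) with
      (∀ i i', i ≠ i' → ∀ j, j ∈ f i → j ∉ f i') ∧ ∑ i, Real.log (rr P (f i)) ≤ L ∧
      ∑ i, ∑ j ∈ f i, (2 * k + 1) / (P j : ℝ) ≤ 1 / 4, ∏ i, w i (f i) := by
    rw [Finset.sum_filter]
    refine Finset.sum_le_sum fun f _ ↦ ?_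
    have hW : 0 ≤ ∏ i, w i (f i) := Finset.prod_nonneg fun i _ ↦ hw _ _
    have h2 : 0 ≤ X₂ f / L := div_nonneg (hX₂ f) hL.le
    split_ifs with hg
    · refine mul_le_of_le_one_right hW ?_
      linarith [hX₁ f, hX₃ f]
    · refine mul_nonpos_of_nonneg_of_nonpos hW ?_
      rw [not_and_or, not_and_or] at hg
      rcases hg with hg | hg | hg
      · push Not at hg
        obtain ⟨i, i', hi, j, hj, hj'⟩ := hg
        have : 1 ≤ X₁ f := by
          have e : δ j (f i) * δ j (f i') = 1 := by simp [δ, hj, hj']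
          rw [← e]
          refine (Finset.single_le_sum (f := fun j ↦ δ j (f i) * δ j (f i')) (fun j _ ↦
            mul_nonneg (hδ _ _) (hδ _ _)) (Finset.mem_univ j)).trans ?_
          refine (Finset.single_le_sum (f := fun i' ↦ ∑ j, δ j (f i) * δ j (f i')) (fun i' _ ↦
            Finset.sum_nonneg fun j _ ↦ mul_nonneg (hδ _ _) (hδ _ _))
            (Finset.mem_erase.2 ⟨hi.symm, Finset.mem_univ i'⟩)).trans ?_
          exact Finset.single_le_sum
            (f := fun i ↦ ∑ i' ∈ Finset.univ.erase i, ∑ j, δ j (f i) * δ j (f i'))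
            (fun i _ ↦ Finset.sum_nonneg fun i' _ ↦ Finset.sum_nonneg fun j _ ↦
            mul_nonneg (hδ _ _) (hδ _ _)) (Finset.mem_univ i)
        linarith [hX₃ f]
      · have : 1 ≤ X₂ f / L := (one_le_div hL).2 (not_le.1 hg).le
        linarith [hX₁ f, hX₃ f]
      · have : X₃ f = ∑ i, ∑ j ∈ f i, (2 * k + 1) / (P j : ℝ) := by simp [X₃, δ]
        linarith [hX₁ f]
  refine le_trans ?_ hmain
  have e : ∑ f : K → Finset (Fin n), (∏ i, w i (f i)) * (1 - X₁ f - X₂ f / L - 4 * X₃ f) =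
      Z - ∑ f : K → Finset (Fin n), (∏ i, w i (f i)) * X₁ f -
      (∑ f : K → Finset (Fin n), (∏ i, w i (f i)) * X₂ f) / L -
      4 * ∑ f : K → Finset (Fin n), (∏ i, w i (f i)) * X₃ f := by
    simp only [Z]
    rw [Fintype.prod_sum, Finset.sum_div, Finset.mul_sum, ← Finset.sum_sub_distrib,
      ← Finset.sum_sub_distrib, ← Finset.sum_sub_distrib]
    exact Finset.sum_congr rfl fun f _ ↦ by ring
  rw [e]
  have h2 : (∑ f : K → Finset (Fin n), (∏ i, w i (f i)) * X₂ f) / L ≤ Z / 4 := by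
    rw [div_le_iff₀ hL]
    nlinarith [mul_le_mul_of_nonneg_right hq hZ]
  have hk1 : k ≤ k ^ 2 := by
    rw [hk]
    exact_mod_cast Nat.le_self_pow two_ne_zero _
  have h3 : (k ^ 2 * s + 4 * (k * ((2 * k + 1) * s))) * Z ≤ 1 / 4 * Z := by
    refine mul_le_mul_of_nonneg_right ?_ hZ
    nlinarith [mul_le_mul_of_nonneg_right hk1 hs0]
  linarith

end Tuples

section Patterns

variable {K : Type*} [DecidableEq K] [Fintype K] {n : ℕ} {P : Fin n → ℕ}

lemma one_sub_sum_le_prod {ι : Type*} (s : Finset ι) {δ : ι → ℝ} (h₀ : ∀ i ∈ s, 0 ≤ δ i)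
    (h₁ : ∀ i ∈ s, δ i ≤ 1) : 1 - ∑ i ∈ s, δ i ≤ ∏ i ∈ s, (1 - δ i) := by
  classical
  induction s using Finset.induction_on with
  | empty => simp
  | insert i s hi ih =>
    rw [Finset.sum_insert hi, Finset.prod_insert hi]
    have h := ih (fun i hi ↦ h₀ i (Finset.mem_insert_of_mem hi))
      fun i hi ↦ h₁ i (Finset.mem_insert_of_mem hi)
    have hs : 0 ≤ ∑ i ∈ s, δ i := Finset.sum_nonneg fun i hi ↦ h₀ i (Finset.mem_insert_of_mem hi)
    have := mul_le_mul_of_nonneg_left h (sub_nonneg.2 (h₁ i (Finset.mem_insert_self _ _)))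
    nlinarith [mul_nonneg (h₀ i (Finset.mem_insert_self _ _)) hs]

lemma sum_cl (t : Fin n → Option K) (x : Fin n → ℝ) :
    ∑ i, ∑ j ∈ cl t i, x j = ∑ j with t j ≠ none, x j := by
  simp only [cl, Finset.sum_filter]
  rw [Finset.sum_comm]
  refine Finset.sum_congr rfl fun j _ ↦ ?_
  rcases t j with _ | i <;> simp

lemma four_mul_le {p : ℕ} (hp : 4 * (Fintype.card K + 1) ^ 4 ≤ p) :
    4 * ((Fintype.card K : ℝ) + 1) ≤ p := by
  have h := Nat.le_self_pow four_ne_zero (Fintype.card K + 1)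
  exact_mod_cast (by lia : 4 * (Fintype.card K + 1) ≤ p)

lemma nb_nonneg {p : ℕ} (hp : 4 * (Fintype.card K + 1) ^ 4 ≤ p) (m : K) (s : Option K) :
    0 ≤ nb (p : ℝ) m s := by
  have h := four_mul_le hp
  have hk : (0 : ℝ) ≤ Fintype.card K := Nat.cast_nonneg _
  rcases s with _ | i
  · exact sub_nonneg.2 ((div_le_one (by nlinarith)).2 (by nlinarith))
  · rw [nb]
    split_ifs <;> linarith

lemma half_size_le_prod_nb (hP : ∀ j, 4 * (Fintype.card K + 1) ^ 4 ≤ P j)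
    (hs : 16 * (Fintype.card K : ℝ) * ∑ j, 1 / (P j : ℝ) ^ 2 ≤ 1) {m : K} {t : Fin n → Option K}
    (hm : ∀ j, t j ≠ some m)
    (ht : ∑ i, ∑ j ∈ cl t i, (2 * (Fintype.card K : ℝ) + 1) / (P j : ℝ) ≤ 1 / 4) :
    (size P t : ℝ) / 2 ≤ ∏ j, nb (P j : ℝ) m (t j) := by
  set k : ℝ := (Fintype.card K : ℝ) with hk
  have hk0 : 0 ≤ k := Nat.cast_nonneg _
  have hP' (j) : 4 * (k + 1) ≤ P j := four_mul_le (hP j)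
  let δ (j : Fin n) : ℝ := if t j ≠ none then (2 * k + 1) / P j else k / (P j - 1) ^ 2
  have e : ∏ j, nb (P j : ℝ) m (t j) = size P t * ∏ j, (1 - δ j) := by
    rw [size, Nat.cast_prod, ← Finset.prod_mul_distrib]
    refine Finset.prod_congr rfl fun j _ ↦ ?_
    have h0 : (P j : ℝ) ≠ 0 := by linarith [hP' j]
    have := hm j
    dsimp only [δ]
    rcases h : t j with _ | i
    · simp [nb, sz, hk]
    · have hi : i ≠ m := fun hi ↦ this (by rw [h, hi])
      simp only [nb, sz, if_neg hi, Option.elim_some, ← hk, ne_eq, reduceCtorEq, not_false_eq_true,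
        if_true]
      field_simp
      ring
  have hδ (j) : 0 ≤ δ j ∧ δ j ≤ 1 ∧ δ j ≤ (if t j ≠ none then (2 * k + 1) / (P j : ℝ) else 0) +
      4 * k * (1 / (P j : ℝ) ^ 2) := by
    have h1 := hP' j
    have h2 : (P j : ℝ) / 2 ≤ P j - 1 := by linarith
    have h3 : k / ((P j : ℝ) - 1) ^ 2 ≤ 4 * k * (1 / (P j : ℝ) ^ 2) := by
      calc k / ((P j : ℝ) - 1) ^ 2 ≤ k / ((P j : ℝ) / 2) ^ 2 :=
            div_le_div_of_nonneg_left hk0 (by nlinarith) (by gcongr)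
        _ = _ := by
            have : (P j : ℝ) ≠ 0 := by linarith
            field_simp
            norm_num
    dsimp only [δ]
    split_ifs
    · refine ⟨by positivity, (div_le_one (by linarith)).2 (by linarith), ?_⟩
      exact le_add_of_nonneg_right (by positivity)
    · refine ⟨by positivity, (div_le_one (by nlinarith)).2 (by nlinarith), by linarith⟩
  rw [sum_cl] at ht
  have h := one_sub_sum_le_prod Finset.univ (fun j _ ↦ (hδ j).1) fun j _ ↦ (hδ j).2.1
  have h' : ∑ j, δ j ≤ 1 / 2 := by
    refine (Finset.sum_le_sum fun j _ ↦ (hδ j).2.2).trans ?_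
    rw [Finset.sum_add_distrib, ← Finset.mul_sum, ← Finset.sum_filter]
    linarith
  rw [e, div_eq_mul_one_div]
  exact mul_le_mul_of_nonneg_left (by linarith) (Nat.cast_nonneg _)

lemma le_sum_coef_mul_prod_lb (hP : ∀ j, (P j).Prime) {m : K} {t : Fin n → Option K}
    (hm : ∀ j, t j ≠ some m) {J : ℕ} {z R : ℝ} (hz : 1 ≤ z) (hR : size P t * z ^ 2 ^ J ≤ R)
    (ht : ∑ j with t j ≠ none, 1 / (P j : ℝ) ≤ 1 / 4) :
    3 / 4 * (∑ M, 1 / (rr P M : ℝ) * G J z (rr P M)) *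
      ∏ i ∈ Finset.univ.erase m, G J z (rr P (cl t i)) / rr P (cl t i) ≤
      ∑ c, coef P J z R c * ∏ j, lb m (c j) (t j) := by
  set g : Finset (Fin n) → ℝ := fun M ↦ 1 / (rr P M : ℝ) * G J z (rr P M) with hg
  have hg0 (M) : 0 ≤ g M := mul_nonneg (by positivity) (G_nonneg _ _ _)
  set Q := ∏ i ∈ Finset.univ.erase m, G J z (rr P (cl t i)) / rr P (cl t i)
  have hQ : 0 ≤ Q := Finset.prod_nonneg fun i _ ↦ div_nonneg (G_nonneg _ _ _) (Nat.cast_nonneg _)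
  let c (M : Finset (Fin n)) (j : Fin n) : Option K := if j ∈ M then some m else t j
  let S : Finset (Finset (Fin n)) := Finset.univ.filter fun M ↦ ∀ j ∈ M, t j = none
  have hclm (M) : cl (c M) m = M := by
    ext j
    rw [mem_cl]
    by_cases hj : j ∈ M
    · simp [c, hj]
    · simp [c, hj, hm j]
  have hcl {M} (hM : M ∈ S) {i} (hi : i ≠ m) : cl (c M) i = cl t i := by
    ext j
    rw [mem_cl, mem_cl]
    by_cases hj : j ∈ M
    · simp [c, hj, (Finset.mem_filter.1 hM).2 j hj, hi.symm]
    · simp [c, hj]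
  have hclt : rr P (cl t m) = 1 := by
    rw [rr, Finset.prod_eq_one]
    exact fun j hj ↦ absurd (mem_cl.1 hj) (hm j)
  have hterm {M} (hM : M ∈ S) : g M * Q ≤ coef P J z R (c M) * ∏ j, lb m (c M j) (t j) := by
    have h1 : ∏ j, lb m (c M j) (t j) = 1 := by
      refine Finset.prod_eq_one fun j _ ↦ ?_
      by_cases hj : j ∈ M
      · simp [c, hj, (Finset.mem_filter.1 hM).2 j hj, lb]
      · rcases h : t j with _ | i <;> simp [c, hj, h, lb]
    rw [h1, mul_one]
    by_cases hz' : z ^ 2 ^ J < rr P M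
    · have : g M = 0 := by rw [hg]; simp [G_eq_zero J hz hz']
      rw [this, zero_mul]
      exact coef_nonneg _ _ _ _ _
    have hsz : (size P (c M) : ℝ) ≤ R := by
      have : size P (c M) = rr P M * size P t := by
        rw [size_eq_prod_cl, size_eq_prod_cl, ← Finset.mul_prod_erase _ _ (Finset.mem_univ m),
          ← Finset.mul_prod_erase _ (fun i ↦ rr P (cl t i)) (Finset.mem_univ m), hclt, one_mul, hclm]
        congr 1
        exact Finset.prod_congr rfl fun i hi ↦ by rw [hcl hM (Finset.ne_of_mem_erase hi)]
      rw [this, Nat.cast_mul]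
      refine le_trans ?_ hR
      rw [mul_comm]
      exact mul_le_mul_of_nonneg_left (not_lt.1 hz') (Nat.cast_nonneg _)
    rw [coef, if_pos hsz, ← Finset.mul_prod_erase _ _ (Finset.mem_univ m), hclm]
    refine (congrArg₂ _ (by rw [hg]; ring) (Finset.prod_congr rfl fun i hi ↦ ?_)).le
    rw [hcl hM (Finset.ne_of_mem_erase hi)]
  have hS : 3 / 4 * ∑ M, g M ≤ ∑ M ∈ S, g M := by
    have h1 : ∑ M, g M ≤ ∑ M ∈ S, g M +
        ∑ j with t j ≠ none, ∑ M, g M * (if j ∈ M then 1 else 0) := by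
      rw [Finset.sum_comm, Finset.sum_filter, ← Finset.sum_add_distrib]
      refine Finset.sum_le_sum fun M _ ↦ ?_
      have h0 (j) : 0 ≤ g M * (if j ∈ M then 1 else 0) := by
        have := hg0 M
        split_ifs <;> simp [this]
      split_ifs with hM
      · exact le_add_of_nonneg_right (Finset.sum_nonneg fun j _ ↦ h0 j)
      · push Not at hM
        obtain ⟨j, hj, hj'⟩ := hM
        rw [zero_add]
        refine le_trans (by simp [hj]) (Finset.single_le_sum (fun j _ ↦ h0 j)
          (Finset.mem_filter.2 ⟨Finset.mem_univ j, hj'⟩))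
    have h2 : ∑ j with t j ≠ none, ∑ M, g M * (if j ∈ M then 1 else 0) ≤
        (∑ j with t j ≠ none, 1 / (P j : ℝ)) * ∑ M, g M := by
      rw [Finset.sum_mul]
      exact Finset.sum_le_sum fun j _ ↦
        sum_mem_le hP (fun x ↦ G_nonneg J z x) (fun x y ↦ G_anti J z) j
    have := mul_le_mul_of_nonneg_right ht (Finset.sum_nonneg fun M _ ↦ hg0 M : 0 ≤ ∑ M, g M)
    linarith
  have hinj : Function.Injective c := fun M M' h ↦ by rw [← hclm M, h, hclm]
  calc 3 / 4 * (∑ M, g M) * Q ≤ ∑ M ∈ S, g M * Q := by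
        rw [← Finset.sum_mul]
        exact mul_le_mul_of_nonneg_right hS hQ
    _ ≤ ∑ M ∈ S, coef P J z R (c M) * ∏ j, lb m (c M j) (t j) :=
        Finset.sum_le_sum fun M hM ↦ hterm hM
    _ = ∑ d ∈ S.image c, coef P J z R d * ∏ j, lb m (d j) (t j) :=
        by rw [Finset.sum_image fun M _ M' _ h ↦ hinj h]
    _ ≤ _ := Finset.sum_le_sum_of_subset_of_nonneg (Finset.subset_univ _) fun d _ _ ↦
        mul_nonneg (coef_nonneg _ _ _ _ _) (Finset.prod_nonneg fun j _ ↦ by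
          rcases t j with _ | i
          all_goals
            rw [lb]
            split_ifs <;> norm_num)

theorem le_sum_prod_nb_mul_sq (hP : ∀ j, (P j).Prime)
    (hPk : ∀ j, 4 * (Fintype.card K + 1) ^ 4 ≤ P j)
    (hs : 52 * (Fintype.card K : ℝ) ^ 2 * ∑ j, 1 / (P j : ℝ) ^ 2 ≤ 1) (m : K) {J : ℕ} {z R q : ℝ}
    (hz : 1 ≤ z) (hq0 : 0 ≤ q) (hR0 : 0 < R)
    (hR : 0 < Real.log R - Real.log (z ^ 2 ^ J))
    (hq : 4 * Fintype.card K * q ≤ Real.log R - Real.log (z ^ 2 ^ J))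
    (hlog : ∑ M, 1 / (rr P M : ℝ) * G J z (rr P M) ^ 2 * Real.log (rr P M) ≤
      q * ∑ M, 1 / (rr P M : ℝ) * G J z (rr P M) ^ 2) :
    (∑ M, 1 / (rr P M : ℝ) * G J z (rr P M)) ^ 2 / 8 *
      (∑ M, 1 / (rr P M : ℝ) * G J z (rr P M) ^ 2) ^ (Fintype.card K - 1) ≤
      ∑ t : Fin n → Option K, (∏ j, nb (P j : ℝ) m (t j)) *
        (∑ c, coef P J z R c * ∏ j, lb m (c j) (t j)) ^ 2 := by
  classical
  set b := ∑ M, 1 / (rr P M : ℝ) * G J z (rr P M) with hb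
  set a := ∑ M, 1 / (rr P M : ℝ) * G J z (rr P M) ^ 2 with ha
  have hb0 : 0 ≤ b := Finset.sum_nonneg fun M _ ↦ mul_nonneg (by positivity) (G_nonneg _ _ _)
  let w (i : K) (M : Finset (Fin n)) : ℝ :=
    if i = m then (if M = ∅ then 1 else 0) else 1 / (rr P M : ℝ) * G J z (rr P M) ^ 2
  have hw (i M) : 0 ≤ w i M := by
    dsimp only [w]
    split_ifs <;> positivity
  have hsum : ∏ i, ∑ M, w i M = a ^ (Fintype.card K - 1) := by
    rw [← Finset.mul_prod_erase _ _ (Finset.mem_univ m), Finset.prod_congr rfl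
      (g := fun _ ↦ a) fun i hi ↦ by simp [w, Finset.ne_of_mem_erase hi, ha]]
    simp [w, Finset.card_erase_of_mem]
  have hgood := half_le_sum_good P hw (q := q) (L := Real.log R - Real.log (z ^ 2 ^ J))
    (fun i j ↦ by
      by_cases hi : i = m
      · refine (Finset.sum_nonpos fun M _ ↦ ?_).trans
          (mul_nonneg (by positivity) (Finset.sum_nonneg fun M _ ↦ hw i M))
        rcases eq_or_ne M ∅ with rfl | hM <;> simp [w, *]
      · simpa [w, hi] using sum_mem_le hP (fun x ↦ sq_nonneg (G J z x))
          (fun x y h ↦ pow_le_pow_left₀ (G_nonneg _ _ _) (G_anti J z h) 2) j)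
    (fun i ↦ by
      by_cases hi : i = m
      · simp [w, hi, rr, hq0]
      · simpa only [w, if_neg hi] using hlog) hs hR hq
  rw [hsum] at hgood
  let D : Finset (Fin n → Option K) := Finset.univ.filter fun t ↦
    ∑ i, Real.log (rr P (cl t i)) ≤ Real.log R - Real.log (z ^ 2 ^ J) ∧
    ∑ i, ∑ j ∈ cl t i, (2 * (Fintype.card K : ℝ) + 1) / (P j : ℝ) ≤ 1 / 4
  have hnb (t : Fin n → Option K) : 0 ≤ ∏ j, nb (P j : ℝ) m (t j) :=
    Finset.prod_nonneg fun j _ ↦ nb_nonneg (hPk j) m _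
  have hterm {t} (ht : t ∈ D) : b ^ 2 / 4 * ∏ i, w i (cl t i) ≤ (∏ j, nb (P j : ℝ) m (t j)) *
        (∑ c, coef P J z R c * ∏ j, lb m (c j) (t j)) ^ 2 := by
    obtain ⟨-, ht₁, ht₂⟩ := Finset.mem_filter.1 ht
    by_cases htm : cl t m = ∅
    · have hm (j) : t j ≠ some m := fun h ↦ by simpa [htm] using mem_cl.2 h
      have h₁ := half_size_le_prod_nb hPk (by
        refine le_trans ?_ hs
        have : (Fintype.card K : ℝ) ≤ (Fintype.card K : ℝ) ^ 2 := by
          exact_mod_cast Nat.le_self_pow two_ne_zero _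
        refine mul_le_mul_of_nonneg_right (by nlinarith) (Finset.sum_nonneg fun j _ ↦ by positivity))
        hm ht₂
      have h₂ := le_sum_coef_mul_prod_lb hP hm (J := J) (R := R) hz (by
        have h0 (i) : (rr P (cl t i) : ℝ) ≠ 0 := by exact_mod_cast (rr_pos hP _).ne'
        rw [← Real.log_prod fun i _ ↦ h0 i, ← Nat.cast_prod, ← size_eq_prod_cl] at ht₁
        have hsz : (0 : ℝ) < size P t := by
          rw [size_eq_prod_cl]
          exact_mod_cast Finset.prod_pos fun i _ ↦ rr_pos hP _
        have hz0 : 0 < z ^ 2 ^ J := by positivity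
        rw [← Real.log_le_log_iff (by positivity) hR0, Real.log_mul hsz.ne' hz0.ne']
        linarith) (by
        refine le_trans (Finset.sum_le_sum fun j _ ↦ ?_) ((sum_cl t _).symm.trans_le ht₂)
        gcongr
        linarith [(Nat.cast_nonneg (Fintype.card K) : (0 : ℝ) ≤ _)])
      set Q := ∏ i ∈ Finset.univ.erase m, G J z (rr P (cl t i)) / rr P (cl t i)
      have hQ : 0 ≤ Q :=
        Finset.prod_nonneg fun i _ ↦ div_nonneg (G_nonneg _ _ _) (Nat.cast_nonneg _)
      have e : ∏ i, w i (cl t i) = size P t * Q ^ 2 := by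
        rw [size_eq_prod_cl, ← Finset.mul_prod_erase _ _ (Finset.mem_univ m),
          ← Finset.mul_prod_erase _ (fun i ↦ rr P (cl t i)) (Finset.mem_univ m), htm]
        have h1 : rr P ∅ = 1 := Finset.prod_empty
        simp only [w, if_true, one_mul, h1]
        rw [Nat.cast_prod, ← Finset.prod_pow, ← Finset.prod_mul_distrib]
        refine Finset.prod_congr rfl fun i hi ↦ ?_
        rw [if_neg (Finset.ne_of_mem_erase hi)]
        have h0 : (rr P (cl t i) : ℝ) ≠ 0 := by exact_mod_cast (rr_pos hP _).ne'
        field_simp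
      rw [e]
      calc b ^ 2 / 4 * (size P t * Q ^ 2) ≤ size P t / 2 * (3 / 4 * b * Q) ^ 2 := by
            have : 0 ≤ (size P t : ℝ) * (b * Q) ^ 2 := by positivity
            nlinarith
        _ ≤ _ := mul_le_mul h₁ (pow_le_pow_left₀ (by positivity) h₂ 2) (by positivity)
            (hnb t)
    · rw [Finset.prod_eq_zero (Finset.mem_univ m) (by simp [w, htm]), mul_zero]
      exact mul_nonneg (hnb t) (sq_nonneg _)
  calc b ^ 2 / 8 * a ^ (Fintype.card K - 1) = b ^ 2 / 4 * (1 / 2 * a ^ (Fintype.card K - 1)) := by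
        ring
    _ ≤ b ^ 2 / 4 * ∑ f ∈ D.image cl, ∏ i, w i (f i) := by
        refine mul_le_mul_of_nonneg_left (hgood.trans ?_) (by positivity)
        refine Finset.sum_le_sum_of_subset_of_nonneg (fun f hf ↦ ?_) fun f _ _ ↦
          Finset.prod_nonneg fun i _ ↦ hw _ _
        obtain ⟨-, h₁, h₂, h₃⟩ := Finset.mem_filter.1 hf
        obtain ⟨t, rfl⟩ := exists_cl_eq h₁
        exact Finset.mem_image_of_mem _ (Finset.mem_filter.2 ⟨Finset.mem_univ _, h₂, h₃⟩)
    _ = ∑ t ∈ D, b ^ 2 / 4 * ∏ i, w i (cl t i) := by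
        rw [Finset.sum_image fun c _ c' _ e ↦ cl_injective e, Finset.mul_sum]
    _ ≤ ∑ t ∈ D, (∏ j, nb (P j : ℝ) m (t j)) *
        (∑ c, coef P J z R c * ∏ j, lb m (c j) (t j)) ^ 2 := Finset.sum_le_sum fun t ↦ hterm
    _ ≤ _ := Finset.sum_le_sum_of_subset_of_nonneg (Finset.subset_univ _) fun t _ _ ↦
        mul_nonneg (hnb t) (sq_nonneg _)

end Patterns

/-! ### Sieving primes and the size of the main terms -/

lemma exists_enum (D : ℕ) (R : ℝ) : ∃ (n : ℕ) (P : Fin n → ℕ), (∀ j, (P j).Prime) ∧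
    Function.Injective P ∧ (∀ j, D < P j ∧ (P j : ℝ) ≤ R) ∧
    ∀ p : ℕ, p.Prime → D < p → (p : ℝ) ≤ R → ∃ j, P j = p := by
  let s : Finset ℕ := (Finset.Ioc D ⌊R⌋₊).filter Nat.Prime
  have h (j : Fin s.card) := Finset.mem_filter.1 (s.orderEmbOfFin_mem rfl j)
  refine ⟨s.card, s.orderEmbOfFin rfl, fun j ↦ (h j).2, (s.orderEmbOfFin rfl).injective,
    fun j ↦ ?_, fun p hp hD hR ↦ ?_⟩
  · obtain ⟨h₁, h₂⟩ := Finset.mem_Ioc.1 (h j).1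
    exact ⟨h₁, (Nat.le_floor_iff' (h j).2.ne_zero).1 h₂⟩
  · have hp' : p ∈ s := Finset.mem_filter.2 ⟨Finset.mem_Ioc.2 ⟨hD, Nat.le_floor hR⟩, hp⟩
    rw [← Finset.mem_coe, ← s.range_orderEmbOfFin rfl] at hp'
    exact hp'

lemma sum_one_div_sq_le {n : ℕ} {P : Fin n → ℕ} (hinj : Function.Injective P) {D : ℕ}
    (hD : ∀ j, D < P j) : ∑ j, 1 / (P j : ℝ) ^ 2 ≤ 2 / ((D : ℝ) + 1) := by
  calc ∑ j, 1 / (P j : ℝ) ^ 2 = ∑ p ∈ Finset.univ.image P, ((p : ℝ) ^ 2)⁻¹ := by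
        rw [Finset.sum_image fun j _ j' _ e ↦ hinj e]
        simp
    _ ≤ ∑ p ∈ Finset.Ioo D ((∑ j, P j) + 1), ((p : ℝ) ^ 2)⁻¹ := by
        refine Finset.sum_le_sum_of_subset_of_nonneg (fun p hp ↦ ?_) fun _ _ _ ↦ by positivity
        obtain ⟨j, -, rfl⟩ := Finset.mem_image.1 hp
        exact Finset.mem_Ioo.2 ⟨hD j, Nat.lt_succ_of_le
          (Finset.single_le_sum (f := P) (fun _ _ ↦ Nat.zero_le _) (Finset.mem_univ j))⟩
    _ ≤ _ := sum_Ioo_inv_sq_le _ _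

lemma prod_one_add_div_le {n : ℕ} {P : Fin n → ℕ} (hP : ∀ j, (P j).Prime)
    (hinj : Function.Injective P) {R : ℝ} (hR : ∀ j, (P j : ℝ) ≤ R) (h1 : 1 ≤ Real.log R) (k : ℕ) :
    ∏ j, (1 + k / (P j : ℝ)) ≤ (8 * Real.log R) ^ (3 * k) := by
  set σ : ℝ := 1 + 1 / Real.log R with hσ
  have hσ1 : 1 < σ := by rw [hσ]; linarith [one_div_pos.2 (by linarith : 0 < Real.log R)]
  have hσ2 : σ ≤ 2 := by rw [hσ]; linarith [(div_le_one (by linarith : 0 < Real.log R)).2 h1]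
  have hP0 (j) : (0 : ℝ) < P j := by exact_mod_cast (hP j).pos
  have hone (j) : 1 + k / (P j : ℝ) ≤ ((1 + (P j : ℝ) ^ (-σ)) ^ 3) ^ k := by
    have h2 : 1 / (P j : ℝ) ≤ 3 * (P j : ℝ) ^ (-σ) := by
      have h3 : (P j : ℝ) ^ (-σ) = 1 / P j * Real.exp (-(Real.log (P j) / Real.log R)) := by
        rw [hσ, neg_add, Real.rpow_add (hP0 j), Real.rpow_neg_one, Real.rpow_def_of_pos (hP0 j),
          one_div, one_div, mul_neg, ← div_eq_mul_inv]
      have h4 : Real.exp (-1) ≤ Real.exp (-(Real.log (P j) / Real.log R)) := by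
        rw [Real.exp_le_exp, neg_le_neg_iff, div_le_one (by linarith)]
        exact Real.log_le_log (hP0 j) (hR j)
      have h5 : 1 ≤ 3 * Real.exp (-1) := by
        rw [Real.exp_neg, ← div_eq_mul_inv, one_le_div (Real.exp_pos _)]
        linarith [Real.exp_one_lt_d9]
      rw [h3]
      nlinarith [one_div_pos.2 (hP0 j)]
    calc 1 + k / (P j : ℝ) = 1 + k * (1 / P j) := by ring
      _ ≤ (1 + 1 / (P j : ℝ)) ^ k :=
          one_add_mul_le_pow (by linarith [one_div_pos.2 (hP0 j)]) k
      _ ≤ _ := by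
          refine pow_le_pow_left₀ (by positivity) (le_trans ?_ (one_add_mul_le_pow
            (by linarith [Real.rpow_nonneg (hP0 j).le (-σ)]) 3)) k
          push_cast
          linarith
  have hsum : ∏ j, (1 + (P j : ℝ) ^ (-σ)) ≤ 8 * Real.log R := by
    calc ∏ j, (1 + (P j : ℝ) ^ (-σ)) = ∑ M, (rr P M : ℝ) ^ (-σ) := by
          rw [Finset.prod_one_add, Finset.powerset_univ]
          refine Finset.sum_congr rfl fun M _ ↦ ?_
          rw [rr, Nat.cast_prod, Real.finsetProd_rpow _ _ fun j _ ↦ (hP0 j).le]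
      _ = ∑ N ∈ Finset.univ.image (rr P), (N : ℝ) ^ (-σ) := by
          rw [Finset.sum_image fun M _ M' _ e ↦ rr_injective hP hinj e]
      _ ≤ ∑' N : ℕ, (N : ℝ) ^ (-σ) := (Real.summable_nat_rpow.2 (by linarith)).sum_le_tsum _
          fun N _ ↦ by positivity
      _ ≤ ‖LSeries (zt ·) σ‖ := by
          have e (N : ℕ) : LSeries.term (zt ·) σ N = ((N : ℝ) ^ (-σ) : ℝ) := by
            rcases eq_or_ne N 0 with rfl | hN
            · rw [LSeries.term_zero, Nat.cast_zero, Real.zero_rpow (by linarith), Complex.ofReal_zero]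
            · rw [LSeries.term_of_ne_zero hN, zt_apply hN, Complex.ofReal_cpow (Nat.cast_nonneg _),
                Complex.ofReal_neg, Complex.cpow_neg, one_div, Complex.ofReal_natCast]
          rw [LSeries, tsum_congr e, ← Complex.ofReal_tsum, Complex.norm_real]
          exact le_abs_self _
      _ ≤ 8 / (σ - 1) := norm_LSeries_zt_real_le hσ1 hσ2
      _ = 8 * Real.log R := by rw [hσ, add_sub_cancel_left, div_div_eq_mul_div, div_one]
  calc _ ≤ ∏ j, ((1 + (P j : ℝ) ^ (-σ)) ^ 3) ^ k :=
        Finset.prod_le_prod (fun j _ ↦ by positivity) fun j _ ↦ hone j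
    _ = (∏ j, (1 + (P j : ℝ) ^ (-σ))) ^ (3 * k) := by
        rw [← Finset.prod_pow]
        exact Finset.prod_congr rfl fun j _ ↦ (pow_mul _ _ _).symm
    _ ≤ _ := pow_le_pow_left₀ (Finset.prod_nonneg fun j _ ↦ by positivity) hsum _

theorem exists_main_term {K : Type*} [DecidableEq K] [Fintype K] {n : ℕ} {P : Fin n → ℕ}
    (hP : ∀ j, (P j).Prime) (hinj : Function.Injective P) {W : ℕ} (hW0 : 0 < W)
    (hW : ∀ j, ¬ P j ∣ W) (hPk : ∀ j, 4 * (Fintype.card K + 1) ^ 4 ≤ P j)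
    (hs : 52 * (Fintype.card K : ℝ) ^ 2 * ∑ j, 1 / (P j : ℝ) ^ 2 ≤ 1) {J : ℕ} (hJ : 0 < J)
    (hJK : 2 ^ J = Fintype.card K) {z R : ℝ} (hz : 1 ≤ z) (hzW : 1 + (W : ℝ) ^ 2 ≤ Real.log z)
    (hR0 : 0 < R) (hall : ∀ p, p.Prime → ¬ p ∣ W → (p : ℝ) ≤ R → ∃ j, P j = p)
    (hR : Real.log R = 65 * Fintype.card K * J * Real.log z) :
    ∃ a : ℝ, (W.totient / W : ℝ) * Real.log z / 4 ≤ a ∧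
      ∑ c : Fin n → Option K, size P c * coef P J z R c ^ 2 ≤ a ^ Fintype.card K ∧
      ∀ m : K, (J : ℝ) ^ 2 * ((W.totient / W : ℝ) * Real.log z) / 2048 * a ^ Fintype.card K ≤
        ∑ t : Fin n → Option K, (∏ j, nb (P j : ℝ) m (t j)) *
        (∑ c, coef P J z R c * ∏ j, lb m (c j) (t j)) ^ 2 := by
  set κ : ℝ := (W.totient / W : ℝ) with hκ
  have hW1 : (1 : ℝ) ≤ W := by exact_mod_cast hW0
  have hL : 0 < Real.log z := by nlinarith
  have hκ0 : 0 < κ := by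
    have := Nat.totient_pos.2 hW0
    positivity
  have hk1 : (1 : ℝ) ≤ Fintype.card K := by
    rw [← hJK]
    exact_mod_cast Nat.one_le_two_pow
  have hJ1 : (1 : ℝ) ≤ J := by exact_mod_cast hJ
  have hzJ : Real.log (z ^ 2 ^ J) = Fintype.card K * Real.log z := by
    rw [Real.log_pow, ← hJK]
  have hkJ : (Fintype.card K : ℝ) * Real.log z ≤ Fintype.card K * J * Real.log z := by
    refine mul_le_mul_of_nonneg_right (le_mul_of_one_le_right (by linarith) hJ1) hL.le
  have hkL : 0 < (Fintype.card K : ℝ) * Real.log z := by positivity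
  have hzR : z ^ 2 ^ J ≤ R := by
    rw [← Real.log_le_log_iff (by positivity) hR0, hzJ, hR]
    linarith
  have hlW : Real.log W ≤ W := Real.log_le_self (by linarith)
  obtain ⟨hb, hb', ha, ha'⟩ := sum_mul_G_bounds Finset.univ (fun M ↦ 1 / (rr P M : ℝ))
    (fun M ↦ (rr P M : ℝ)) (fun _ _ ↦ by positivity) (κ := κ) J hz fun y hy hy' ↦ by
      have h := Real.log_le_log (by linarith) hy
      exact sum_inv_rr_bounds hP hinj hW0 hW (hz.trans hy)
        (fun p hp hpW hpy ↦ hall p hp hpW (hpy.trans (hy'.trans hzR))) (by nlinarith) (hzW.trans h)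
  have ha := ha hJ
  set b := ∑ M, 1 / (rr P M : ℝ) * G J z (rr P M)
  set a := ∑ M, 1 / (rr P M : ℝ) * G J z (rr P M) ^ 2
  have hκL : 0 < κ * Real.log z := by positivity
  have ha0 : 0 < a := by linarith
  refine ⟨a, ha, sum_size_mul_coef_sq_le hP J z R, fun m ↦ ?_⟩
  have hlog : ∑ M, 1 / (rr P M : ℝ) * G J z (rr P M) ^ 2 * Real.log (rr P M) ≤
      16 * J * Real.log z * a := by
    calc ∑ M, 1 / (rr P M : ℝ) * G J z (rr P M) ^ 2 * Real.log (rr P M) ≤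
          ∑ M, 2 * Real.log z * (1 / (rr P M : ℝ) * G J z (rr P M)) := by
          refine Finset.sum_le_sum fun M _ ↦ ?_
          have h₁ := G_mul_log_le J hz (r := rr P M) (by exact_mod_cast rr_pos hP M)
          have h₂ : 0 ≤ 1 / (rr P M : ℝ) * G J z (rr P M) :=
            mul_nonneg (by positivity) (G_nonneg _ _ _)
          have := mul_le_mul_of_nonneg_left h₁ h₂
          linarith
      _ = 2 * Real.log z * b := by rw [← Finset.mul_sum]
      _ ≤ 2 * Real.log z * (8 * J * a) := by
          refine mul_le_mul_of_nonneg_left (hb'.trans ?_) (by linarith)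
          nlinarith
      _ = _ := by ring
  refine le_trans ?_ (le_sum_prod_nb_mul_sq hP hPk hs m hz (by positivity) hR0
    (by rw [hR, hzJ]; linarith) (by rw [hR, hzJ]; linarith) hlog)
  obtain ⟨d, hd⟩ : ∃ d, Fintype.card K = d + 1 := Nat.exists_eq_succ_of_ne_zero (by
    rw [← hJK]; positivity)
  change _ ≤ b ^ 2 / 8 * a ^ (Fintype.card K - 1)
  rw [hd, Nat.add_sub_cancel, pow_succ a, mul_comm (a ^ d), ← mul_assoc]
  refine mul_le_mul_of_nonneg_right ?_ (by positivity)
  have h₁ : (J * κ * Real.log z / 4) ^ 2 ≤ b ^ 2 := pow_le_pow_left₀ (by positivity) hb 2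
  have h₂ := mul_le_mul_of_nonneg_left ha' (by positivity : 0 ≤ (J : ℝ) ^ 2 * (κ * Real.log z))
  linarith

/-! ### Proof of the main theorem -/

lemma exists_lt_card {k W r M : ℕ} {S : Finset ℕ} {τ w : ℕ → ℝ} {l : ℝ} (hl : 0 ≤ l)
    (hτ : ∀ N ∈ S, τ N ≤ l)
    (hw : ∀ N, 0 ≤ w N) (hS : ∀ N ∈ S, k * W < N ∧ N ≤ M)
    (h : r * l * ∑ N ∈ Finset.Icc 1 M with N ≡ 1 [MOD W], w N <
      ∑ i : Fin k, ∑ N ∈ S with N ≡ 1 [MOD W], τ N * w (N - i * W)) :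
    ∃ N, r < (Finset.univ.filter fun i : Fin k ↦
      N + i * W ∈ S ∧ N + i * W ≡ 1 [MOD W] ∧ 0 < τ (N + i * W)).card := by
  by_contra! hc
  refine h.not_ge ?_
  have key (i : Fin k) : ∑ N ∈ S with N ≡ 1 [MOD W], τ N * w (N - i * W) ≤
      ∑ N ∈ Finset.Icc 1 M with N ≡ 1 [MOD W],
        if N + i * W ∈ S ∧ N + i * W ≡ 1 [MOD W] ∧ 0 < τ (N + i * W) then l * w N else 0 := by
    have hiW {N} (hN : N ∈ S) : i * W < N :=
      (Nat.mul_le_mul_right W i.2.le).trans_lt (hS N hN).1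
    calc ∑ N ∈ S with N ≡ 1 [MOD W], τ N * w (N - i * W) ≤
          ∑ N ∈ S with N ≡ 1 [MOD W] ∧ 0 < τ N, l * w (N - i * W) := by
          rw [Finset.sum_filter, Finset.sum_filter]
          refine Finset.sum_le_sum fun N hN ↦ ?_
          by_cases h₁ : N ≡ 1 [MOD W]
          · by_cases h₂ : 0 < τ N
            · rw [if_pos h₁, if_pos ⟨h₁, h₂⟩]
              exact mul_le_mul_of_nonneg_right (hτ N hN) (hw _)
            · rw [if_pos h₁, if_neg fun h ↦ h₂ h.2]
              exact mul_nonpos_of_nonpos_of_nonneg (not_lt.1 h₂) (hw _)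
          · rw [if_neg h₁, if_neg fun h ↦ h₁ h.1]
      _ = ∑ N ∈ (S.filter fun N ↦ N ≡ 1 [MOD W] ∧ 0 < τ N).image (· - i * W), l * w N := by
          rw [Finset.sum_image]
          intro N hN N' hN' e
          have h₁ := hiW (Finset.mem_filter.1 hN).1
          have h₂ := hiW (Finset.mem_filter.1 hN').1
          dsimp only at e
          omega
      _ ≤ _ := by
          rw [← Finset.sum_filter]
          refine Finset.sum_le_sum_of_subset_of_nonneg (fun N' hN' ↦ ?_) fun N hN _ ↦ ?_
          · obtain ⟨N, hN, rfl⟩ := Finset.mem_image.1 hN'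
            obtain ⟨h₁, h₂, h₃⟩ := Finset.mem_filter.1 hN
            have h₄ := hiW h₁
            have h₅ : N - i * W + i * W = N := Nat.sub_add_cancel h₄.le
            have h₆ : N - i * W ≡ 1 [MOD W] := by
              refine Nat.ModEq.add_right_cancel' (i * W) ?_
              rw [h₅]
              exact h₂.trans (by simp [Nat.ModEq])
            simp only [Finset.mem_filter, Finset.mem_Icc]
            rw [h₅]
            exact ⟨⟨⟨by omega, (Nat.sub_le _ _).trans (hS N h₁).2⟩, h₆⟩, h₁, h₂, h₃⟩
          · exact mul_nonneg hl (hw _)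
  refine (Finset.sum_le_sum fun i _ ↦ key i).trans ?_
  rw [Finset.sum_comm, Finset.mul_sum]
  refine Finset.sum_le_sum fun N _ ↦ ?_
  rw [← Finset.sum_filter, Finset.sum_const, nsmul_eq_mul, mul_assoc]
  exact mul_le_mul_of_nonneg_right (by exact_mod_cast hc N) (mul_nonneg hl (hw _))

lemma not_dvd_sub_shift {k W p : ℕ} (hp : p.Prime) (hk : k ≤ p) (hW : ¬ p ∣ W) (c : ℤ)
    {i i' : Fin k} (hi : i ≠ i') :
    ¬ (p : ℤ) ∣ (((i : ℕ) : ℤ) - c) * W - (((i' : ℕ) : ℤ) - c) * W := by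
  rw [← sub_mul, sub_sub_sub_cancel_right, (Nat.prime_iff_prime_int.1 hp).dvd_mul,
    Int.natCast_dvd_natCast, not_or]
  refine ⟨fun h ↦ hi ?_, hW⟩
  have := Int.eq_zero_of_abs_lt_dvd h (by rw [abs_lt]; omega)
  omega

lemma mul_lt_sum_of_bounds {k J W φ m : ℕ} (hk : 0 < k) (hJ : 0 < J) (hφ : 0 < φ) (hW : 4 ≤ W)
    {c₁ x l a L M Q Θ S₁ E₁ E₂ : ℝ} (hJm : 3 * m + 3 ≤ c₁ * J / 66560000) (hc₁ : 0 < c₁) (hx : 0 < x)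
    (hl : 0 < l) (hL : L = l / (32500 * k * J)) (hWL : 1 + (W : ℝ) ^ 2 ≤ L)
    (ha : (φ / W : ℝ) * L / 4 ≤ a) (hM : M ≤ 3 * x) (hS₁ : S₁ ≤ M / W * a ^ k + E₁)
    (hE₁ : m * E₁ * W ≤ x) (hΘ : c₁ * x ≤ Θ) (hQ : (J : ℝ) ^ 2 * ((φ / W : ℝ) * L) / 2048 * a ^ k ≤ Q)
    (hE₂ : k * E₂ * W ≤ x * l) {S₂ : Fin k → ℝ} (hS₂ : ∀ i, Θ / φ * Q - E₂ ≤ S₂ i) :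
    m * l * S₁ < ∑ i, S₂ i := by
  have hW' : (4 : ℝ) ≤ W := by exact_mod_cast hW
  have hφ' : (1 : ℝ) ≤ φ := by exact_mod_cast hφ
  have hk' : (0 : ℝ) < k := by exact_mod_cast hk
  have hJ' : (0 : ℝ) < J := by exact_mod_cast hJ
  have hW0 : (0 : ℝ) < W := by linarith
  have ha1 : 1 ≤ a := by
    refine le_trans ?_ ha
    rw [le_div_iff₀ (by norm_num), div_mul_eq_mul_div, le_div_iff₀ hW0]
    nlinarith
  have hak : 1 ≤ a ^ k := one_le_pow₀ ha1
  have h₁ : m * l * S₁ * W ≤ 3 * m * x * l * a ^ k + x * l := by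
    calc m * l * S₁ * W ≤ m * l * (3 * x / W * a ^ k + E₁) * W := by
          gcongr
          exact hS₁.trans (by gcongr)
      _ = 3 * m * x * l * a ^ k + m * E₁ * W * l := by field_simp
      _ ≤ _ := by gcongr
  have h₂ : k * (Θ / φ * Q - E₂) ≤ ∑ i, S₂ i := by
    calc _ = ∑ _i : Fin k, (Θ / φ * Q - E₂) := by
          rw [Finset.sum_const, Finset.card_univ, Fintype.card_fin, nsmul_eq_mul]
      _ ≤ _ := Finset.sum_le_sum fun i _ ↦ hS₂ i
  have h₃ : (3 * m + 3) * x * l * a ^ k ≤ k * (Θ / φ * Q) * W := by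
    calc (3 * m + 3) * x * l * a ^ k ≤ c₁ * J / 66560000 * x * l * a ^ k := by gcongr
      _ = k * (c₁ * x / φ * ((J : ℝ) ^ 2 * ((φ / W : ℝ) * L) / 2048 * a ^ k)) * W := by
        rw [hL]
        field_simp
        norm_num
      _ ≤ _ := by
        have : 0 ≤ L := by nlinarith
        have : 0 ≤ Θ := le_trans (by positivity) hΘ
        gcongr
  refine lt_of_lt_of_le ?_ h₂
  refine lt_of_mul_lt_mul_right ?_ hW0.le
  have : 0 < x * l := mul_pos hx hl
  nlinarith [mul_le_mul_of_nonneg_left hak this.le]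

lemma pat_congr {K : Type*} {n : ℕ} (P : Fin n → ℕ) {h h' : K → ℤ} {N N' : ℕ}
    (H : ∀ i, (N : ℤ) + h i = N' + h' i) : pat P h N = pat P h' N' := by
  open scoped Classical in
  exact funext fun j ↦ congrArg (fun q : K → Prop ↦ if H : ∃ i, q i then some H.choose else none)
    (funext fun i ↦ by rw [H])

set_option maxHeartbeats 1000000 in
theorem exists_lt_card_of_weights {c₁ : ℝ} (hc₁ : 0 < c₁) {m J k W D A : ℕ} (hJ : 0 < J)
    (hk : k = 2 ^ J) (hJm : 3 * m + 3 ≤ c₁ * J / 66560000) (hD : D = 104 * (k + 1) ^ 4)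
    (hW : W = 4 * D.factorial) (hA : A = 6 * k + 6 * (k + 1) ^ 2) {x l : ℝ} (hx : x = Real.exp l)
    (h₁ : 1 + (W : ℝ) ^ 2 ≤ l / (32500 * k * J)) (h₂ : W * Real.exp (l / 500) ^ 2 ≤ x ^ (1 / 224 : ℝ))
    (h₃ : k * 4 ^ k * (W : ℝ) ^ 2 ≤ l) (h₄ : m * 4 ^ k * W * l ^ (12 * k) * Real.exp (l / 500) ^ 2 ≤ x)
    (h₅ : (k : ℝ) * W < x / 3) {S : Finset ℕ} {τ : ℕ → ℝ}
    (hS : ∀ n ∈ S, n.Prime ∧ x ≤ 3 * n ∧ n ≤ 3 * x ∧ |τ n| ≤ l) (hΘ : c₁ * x ≤ ∑ n ∈ S, τ n)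
    (hE : ∀ X, PrimChars X (x ^ (1 / 224 : ℝ)) → (∀ i ∈ X, i.2 ≠ 1) →
      ∑ i ∈ X, (i.1 : ℝ) ^ (-(1 / 2) : ℝ) * ‖∑ n ∈ S, i.2 n * (τ n : ℂ)‖ ≤ x / l ^ A) :
    ∃ N, m < (Finset.univ.filter fun i : Fin k ↦
      N + i * W ∈ S ∧ N + i * W ≡ 1 [MOD W] ∧ 0 < τ (N + i * W)).card := by
  have hx0 : 0 < x := hx ▸ Real.exp_pos l
  have hk1 : (1 : ℝ) ≤ k := by rw [hk]; exact_mod_cast Nat.one_le_two_pow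
  have hJ1 : (1 : ℝ) ≤ J := by exact_mod_cast hJ
  have hW0 : 0 < W := by rw [hW]; positivity
  have hW4 : (4 : ℝ) ≤ W := by
    rw [hW]
    exact_mod_cast Nat.le_mul_of_pos_right 4 D.factorial_pos
  have hkJ : (1 : ℝ) ≤ k * J := one_le_mul_of_one_le_of_one_le hk1 hJ1
  have hl : 32500 * (k * J) * (1 + (W : ℝ) ^ 2) ≤ l := by
    rw [le_div_iff₀ (by positivity)] at h₁
    linarith
  have hl500 : 500 ≤ l := by nlinarith
  set R := Real.exp (l / 500) with hRdef
  set z := Real.exp (l / (32500 * k * J)) with hzdef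
  have hlogR : Real.log R = l / 500 := Real.log_exp _
  have hlogz : Real.log z = l / (32500 * k * J) := Real.log_exp _
  have hR3 : 3 * R < x := by
    have : R * Real.exp (l * (499 / 500)) = x := by
      rw [hx, hRdef, ← Real.exp_add]
      congr 1
      ring
    have h := Real.add_one_le_exp (l * (499 / 500))
    rw [← this, mul_comm]
    exact mul_lt_mul_of_pos_left (by linarith) (Real.exp_pos _)
  obtain ⟨n, P, hP, hinj, hPR, hall⟩ := exists_enum D R
  have hPW (j) : ¬ P j ∣ W := by
    intro h
    rw [hW, (hP j).dvd_mul, (hP j).dvd_factorial] at h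
    rcases h with h | h
    · have h' := Nat.le_of_dvd (by norm_num) h
      have h4 : 1 ≤ (k + 1) ^ 4 := Nat.one_le_pow _ _ (by omega)
      have := (hPR j).1
      omega
    · exact absurd (hPR j).1 h.not_gt
  have hPk (j) : 4 * (Fintype.card (Fin k) + 1) ^ 4 ≤ P j := by
    rw [Fintype.card_fin]
    have := (hPR j).1
    omega
  have hkP (j) : k ≤ P j := by
    have h := hPk j
    rw [Fintype.card_fin] at h
    have := Nat.le_self_pow four_ne_zero (k + 1)
    omega
  have hsq : 52 * (Fintype.card (Fin k) : ℝ) ^ 2 * ∑ j, 1 / (P j : ℝ) ^ 2 ≤ 1 := by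
    have h := sum_one_div_sq_le hinj fun j ↦ (hPR j).1
    rw [Fintype.card_fin]
    refine (mul_le_mul_of_nonneg_left h (by positivity)).trans ?_
    rw [← mul_div_assoc, div_le_one (by positivity), hD]
    push_cast
    have : (k : ℝ) ^ 2 ≤ ((k : ℝ) + 1) ^ 4 := by
      calc (k : ℝ) ^ 2 ≤ ((k : ℝ) + 1) ^ 2 := by gcongr; linarith
        _ ≤ ((k : ℝ) + 1) ^ 4 := pow_le_pow_right₀ (by linarith) (by norm_num)
    linarith
  obtain ⟨a, ha, ha₁, ha₂⟩ := exists_main_term hP hinj hW0 hPW hPk hsq hJ (by simp [hk]) (z := z)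
    (R := R) (Real.one_le_exp (by positivity)) (by rwa [hlogz]) (Real.exp_pos _)
    (fun p hp hpW hpR ↦ hall p hp (by
      by_contra! h
      exact hpW (hW ▸ dvd_mul_of_dvd_right ((hp.dvd_factorial).2 h) 4)) hpR)
    (by rw [hlogR, hlogz, Fintype.card_fin]; field_simp; norm_num)
  simp only [Fintype.card_fin] at ha₁ ha₂ hPk hsq
  have hR1 : 1 ≤ Real.log R := by linarith
  have hl0 : 0 < l := by linarith
  have hprod (q : ℕ) : ∏ j, (1 + q / (P j : ℝ)) ≤ l ^ (3 * q) :=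
    (prod_one_add_div_le hP hinj (fun j ↦ (hPR j).2) hR1 q).trans
      (pow_le_pow_left₀ (by linarith) (by linarith) _)
  have hprod0 (q : ℕ) : 0 ≤ ∏ j, (1 + q / (P j : ℝ)) :=
    Finset.prod_nonneg fun j _ ↦ by positivity
  have hcoef (c : Fin n → Option (Fin k)) := abs_coef_le P J z R c
  have hcoef0 (c : Fin n → Option (Fin k)) (h : R < size P c) := coef_eq_zero P J z h
  have hΘ0 : 0 ≤ ∑ N ∈ S, τ N := le_trans (by positivity) hΘ
  obtain ⟨X, hX, hX1, hXall⟩ := exists_primChars (x ^ (1 / 224 : ℝ)) (by positivity)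
  set a' := coef (K := Fin k) P J z R with ha'
  have hS₁ := sum_sieve_sq_le hP hinj hW0 hPW (K := Fin k) (h := fun i ↦ (((i : ℕ) : ℤ) - (0 : ℤ)) * W)
    (fun j i i' hi ↦ not_dvd_sub_shift (hP j) (hkP j) (hPW j) 0 hi) (by simpa using hkP)
    (a := a') (by positivity) (Real.exp_pos _).le hcoef hcoef0 ⌊3 * x⌋₊
  have hNW {N} (hN : N ∈ S) : W < N := by
    have : (W : ℝ) < N := by nlinarith [(hS N hN).2.1]
    exact_mod_cast this
  have hkN {N} (hN : N ∈ S) : k * W < N := by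
    have : (k : ℝ) * W < N := by linarith [(hS N hN).2.1]
    exact_mod_cast this
  have hS₂ (i : Fin k) := le_sum_sieve_sq hP hinj hW0 hPW (K := Fin k)
    (h := fun i' ↦ (((i' : ℕ) : ℤ) - (i : ℕ)) * W)
    (fun j i₁ i₂ hi ↦ not_dvd_sub_shift (hP j) (hkP j) (hPW j) _ hi) (by simpa using hPk)
    (m := i) (by simp) (S := S) (τ := τ)
    (fun N hN ↦ Nat.coprime_of_lt_prime hW0.ne' (hNW hN) (hS N hN).1)
    (fun N hN j ↦ (Nat.coprime_primes (hS N hN).1 (hP j)).2 fun h ↦ by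
      have h₁ := (hPR j).2
      have h₂ := (hS N hN).2.1
      rw [← h] at h₁
      linarith)
    hΘ0 hXall (hE X hX hX1) (a := a') (by positivity) (Real.exp_pos _).le hcoef hcoef0 h₂
  simp only [Fintype.card_fin] at hS₁ hS₂
  refine exists_lt_card hl0.le (fun N hN ↦ (le_abs_self _).trans (hS N hN).2.2.2)
    (w := fun N ↦ sieve P a' (pat P (fun i : Fin k ↦ (((i : ℕ) : ℤ) - (0 : ℤ)) * W) N) ^ 2)
    (fun N ↦ sq_nonneg _) (fun N hN ↦ ⟨hkN hN, Nat.le_floor (hS N hN).2.2.1⟩) ?_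
  have h𝓔 := hprod k
  have h𝓔' : ∏ j, (1 + 2 * ((k : ℝ) + 1) ^ 2 / (P j : ℝ)) ≤ l ^ (3 * (2 * (k + 1) ^ 2)) := by
    exact_mod_cast hprod (2 * (k + 1) ^ 2)
  have h𝓔0 := hprod0 k
  have h𝓔0' : 0 ≤ ∏ j, (1 + 2 * ((k : ℝ) + 1) ^ 2 / (P j : ℝ)) := by
    exact_mod_cast hprod0 (2 * (k + 1) ^ 2)
  have h4 : ((2 : ℝ) ^ k) ^ 2 = 4 ^ k := by rw [← pow_mul, mul_comm, pow_mul]; norm_num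
  set 𝓔 := ∏ j, (1 + (k : ℝ) / (P j : ℝ))
  set 𝓔' := ∏ j, (1 + 2 * ((k : ℝ) + 1) ^ 2 / (P j : ℝ))
  refine mul_lt_sum_of_bounds (by exact_mod_cast hk1) hJ (Nat.totient_pos.2 hW0)
    (by exact_mod_cast hW4) hJm hc₁ hx0 hl0 rfl h₁ (by rwa [hlogz] at ha)
    (Nat.floor_le (by positivity : 0 ≤ 3 * x))
    (hS₁.trans (add_le_add_left (mul_le_mul_of_nonneg_left ha₁ (by positivity)) _)) ?_ hΘ le_rfl
    (E₂ := (2 ^ k * 𝓔) ^ 2 * (√W * (x / l ^ A) * 𝓔')) ?_ fun i ↦ ?_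
  · calc m * (2 ^ k * R * 𝓔 ^ 2) ^ 2 * W ≤ m * (2 ^ k * R * (l ^ (3 * k)) ^ 2) ^ 2 * W := by
          have : 0 ≤ R := (Real.exp_pos _).le
          gcongr
      _ = m * 4 ^ k * W * l ^ (12 * k) * R ^ 2 := by
        rw [← h4, ← pow_mul, mul_pow, mul_pow, ← pow_mul l]
        ring_nf
      _ ≤ x := h₄
  · have hsqrt : √W ≤ W := Real.sqrt_le_iff.2 ⟨by linarith, by nlinarith⟩
    calc k * ((2 ^ k * 𝓔) ^ 2 * (√W * (x / l ^ A) * 𝓔')) * W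
        ≤ k * ((2 ^ k * l ^ (3 * k)) ^ 2 * (W * (x / l ^ A) * l ^ (3 * (2 * (k + 1) ^ 2)))) * W := by
          gcongr
      _ = k * 4 ^ k * (W : ℝ) ^ 2 * x := by
        have : l ^ A = (l ^ (3 * k)) ^ 2 * l ^ (3 * (2 * (k + 1) ^ 2)) := by
          rw [← pow_mul, ← pow_add, hA]
          ring_nf
        rw [this, mul_pow, h4]
        field_simp
      _ ≤ x * l := by
        rw [mul_comm x]
        gcongr
  · have h := hS₂ i
    have h' := ha₂ i
    rw [hlogz] at h'
    refine le_trans (sub_le_sub_right (mul_le_mul_of_nonneg_left h' (by positivity)) _) (h.trans_eq ?_)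
    refine Finset.sum_congr rfl fun N hN ↦ ?_
    rw [pat_congr P (h' := fun i : Fin k ↦ (((i : ℕ) : ℤ) - (0 : ℤ)) * W) fun i' ↦ ?_]
    have : i * W ≤ N := (Nat.mul_le_mul_right W i.2.le).trans (hkN (Finset.mem_filter.1 hN).1).le
    push_cast [this]
    ring

end

end SectorPrimes

open SectorPrimes in
theorem many_primes_in_bounded_intervals_sum_two_squares_small_a
    (ε : ℝ) (hε : 0 < ε) (hε' : ε < 1 / 2) (m : ℕ) (hm : 1 ≤ m) :
    ∃ B : ℕ, 0 < B ∧ ∀ N₀ : ℕ, ∃ n : ℕ, N₀ < n ∧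
      m ≤ Nat.card {p : ℕ | n ≤ p ∧ p ≤ n + B ∧ p ∈ Peps ε} := by
  obtain ⟨c₁, hc₁, hw⟩ := exists_weights hε hε'
  obtain ⟨J, hJ⟩ := exists_nat_gt ((3 * m + 3) * 66560000 / c₁)
  have hJ0 : 0 < J := by
    have : (0 : ℝ) < J := lt_trans (by positivity) hJ
    exact_mod_cast this
  have hJm : 3 * m + 3 ≤ c₁ * J / 66560000 := by
    rw [div_lt_iff₀ hc₁] at hJ
    linarith
  set k := 2 ^ J with hk
  set D := 104 * (k + 1) ^ 4 with hD
  set W := 4 * D.factorial with hW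
  set A := 6 * k + 6 * (k + 1) ^ 2 with hA
  have hk0 : 0 < k := by positivity
  have hW0 : 0 < W := by positivity
  clear_value A W D k
  refine ⟨k * W, by positivity, fun N₀ ↦ ?_⟩
  obtain ⟨ℓ₁, h₁⟩ := exists_mul_pow_le_exp (W : ℝ) 0 (by norm_num : (0 : ℝ) < 1 / 224 - 1 / 250)
  obtain ⟨ℓ₂, h₂⟩ := exists_mul_pow_le_exp (m * 4 ^ k * W : ℝ) (12 * k)
    (by norm_num : (0 : ℝ) < 249 / 250)
  set ℓ₀ : ℝ := |ℓ₁| + |ℓ₂| + 32500 * k * J * (1 + (W : ℝ) ^ 2) + k * 4 ^ k * (W : ℝ) ^ 2 +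
    3 * (k * W + N₀) with hℓ₀
  obtain ⟨x, hx, S, τ, hS, hΘ, hE⟩ := hw A (Real.exp ℓ₀)
  have hx0 : 0 < x := (Real.exp_pos _).trans_le hx
  set l := Real.log x with hl
  have hxl : x = Real.exp l := (Real.exp_log hx0).symm
  have hℓl : ℓ₀ ≤ l := (Real.le_log_iff_exp_le hx0).2 hx
  have p₁ := abs_nonneg ℓ₁
  have p₂ := abs_nonneg ℓ₂
  have p₃ : 0 ≤ 32500 * k * J * (1 + (W : ℝ) ^ 2) := by positivity
  have p₄ : 0 ≤ k * 4 ^ k * (W : ℝ) ^ 2 := by positivity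
  have p₅ : (0 : ℝ) ≤ 3 * (k * W + N₀) := by positivity
  have hxN : 3 * (k * W + N₀) < x := by
    have := Real.add_one_le_exp l
    rw [← hxl] at this
    linarith
  obtain ⟨N, hN⟩ := exists_lt_card_of_weights hc₁ hJ0 hk hJm hD hW hA hxl
    (by
      rw [le_div_iff₀ (by positivity)]
      linarith)
    (by
      have h := h₁ l (by linarith [le_abs_self ℓ₁])
      rw [pow_zero, mul_one] at h
      calc W * Real.exp (l / 500) ^ 2
          ≤ Real.exp ((1 / 224 - 1 / 250) * l) * Real.exp (l / 500) ^ 2 := by gcongr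
        _ = x ^ (1 / 224 : ℝ) := by
          rw [hxl, ← Real.exp_mul, ← Real.exp_nat_mul, ← Real.exp_add]
          congr 1
          push_cast
          ring)
    (by linarith)
    (by
      have h := h₂ l (by linarith [le_abs_self ℓ₂])
      calc m * 4 ^ k * W * l ^ (12 * k) * Real.exp (l / 500) ^ 2
          ≤ Real.exp (249 / 250 * l) * Real.exp (l / 500) ^ 2 := by gcongr
        _ = x := by
          rw [hxl, ← Real.exp_nat_mul, ← Real.exp_add]
          congr 1
          push_cast
          ring)
    (by linarith [(Nat.cast_nonneg N₀ : (0 : ℝ) ≤ N₀)])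
    (fun n hn ↦ ⟨(hS n hn).1, (hS n hn).2.1, (hS n hn).2.2.1, (hS n hn).2.2.2.1⟩) hΘ hE
  have hmem {i : Fin k} (hi : N + i * W ∈ S) : N₀ < N := by
    have h := (hS _ hi).2.1
    have hik : (i : ℝ) * W ≤ k * W := by gcongr; exact i.2.le
    have : (N₀ : ℝ) < N := by
      push_cast at h
      linarith
    exact_mod_cast this
  refine ⟨N, ?_, ?_⟩
  · obtain ⟨i, hi⟩ := Finset.card_pos.1 (m.zero_le.trans_lt hN)
    exact hmem (Finset.mem_filter.1 hi).2.1
  · refine hN.le.trans ?_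
    have hfin : {p : ℕ | N ≤ p ∧ p ≤ N + k * W ∧ p ∈ Peps ε}.Finite :=
      (Set.finite_Icc N (N + k * W)).subset fun p hp ↦ ⟨hp.1, hp.2.1⟩
    rw [Nat.card_coe_set_eq, ← Set.ncard_coe_finset]
    refine Set.ncard_le_ncard_of_injOn (fun i : Fin k ↦ N + i * W) (fun i hi ↦ ?_) (fun i _ i' _ h ↦ ?_) hfin
    · obtain ⟨-, hiS, hi1, hi0⟩ := Finset.mem_filter.1 hi
      refine ⟨Nat.le_add_right _ _, Nat.add_le_add_left (Nat.mul_le_mul_right W i.2.le) _,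
        (hS _ hiS).2.2.2.2 hi0 ?_⟩
      rw [hW] at hi1 ⊢
      exact hi1.of_mul_right _
    · simpa [hW0.ne', Fin.ext_iff] using h
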